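/- Let ℓ be a prime and let K be a number field containing all ℓ-th roots of unity. For an ideal class 𝒞 in Cl(K)^{(ℓ−1)/2}, the subgroup of (ℓ−1)/2-th powers in the ideal class group of K, one has lim_{X→∞} #{L/K : Gal(L/K) ≅ ℤ/ℓℤ, N(Δ_{L/K}) ≤ X, St(𝒪_L) = 𝒞} / #{L/K : Gal(L/K) ≅ ℤ/ℓℤ, N(Δ_{L/K}) ≤ X} = 1/#(Cl(K)^{(ℓ−1)/2}). In particular, Steinitz classes of degree-ℓ cyclic extensions of K are equidistributed among the classes in Cl(K)^{(ℓ−1)/2}. -/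

import Mathlib

open NumberField Filter
open scoped nonZeroDivisors

noncomputable section

/-- The relative discriminant ideal of `L/K`: the ideal of `𝓞 K` generated by the
discriminants of all `K`-bases of `L` consisting of elements integral over `ℤ`. -/
def relDisc (K L : Type*) [Field K] [NumberField K] [Field L] [Algebra K L] :
    Ideal (𝓞 K) :=
  Ideal.span {d : 𝓞 K | ∃ b : Module.Basis (Fin (Module.finrank K L)) K L,
    (∀ i, IsIntegral ℤ (b i)) ∧ algebraMap (𝓞 K) K d = Algebra.discr K ⇑b}

/-- `c` is the Steinitz class of `L/K`: `𝓞 L ≅ 𝓞 K^(n-1) ⊕ I` as `𝓞 K`-modules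
with `[I] = c`. -/
def IsSteinitzClass (K : Type*) [Field K] [NumberField K] (L : Type*) [Field L]
    [Algebra K L] (c : ClassGroup (𝓞 K)) : Prop :=
  ∃ I : (Ideal (𝓞 K))⁰, ClassGroup.mk0 I = c ∧
    Nonempty ((𝓞 L) ≃ₗ[𝓞 K] ((Fin (Module.finrank K L - 1) → 𝓞 K) × (I : Ideal (𝓞 K))))

/-- `L/K` is Galois with Galois group `ℤ/ℓℤ`. -/
def IsCyclicExt (ℓ : ℕ) (K L : Type*) [Field K] [Field L] [Algebra K L] : Prop :=
  IsGalois K L ∧ Nonempty ((L ≃ₐ[K] L) ≃* Multiplicative (ZMod ℓ))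

/-- The subgroup `Cl(K)^m` of `m`-th powers of the class group. -/
def powClassGroup (K : Type*) [Field K] [NumberField K] (m : ℕ) :
    Subgroup (ClassGroup (𝓞 K)) :=
  (powMonoidHom m : ClassGroup (𝓞 K) →* ClassGroup (𝓞 K)).range

section CosetCount

open MeasureTheory Bornology Module Topology
open scoped Pointwise

/-- A monotone function whose values along `n ^ d`, for `n ≡ 1` modulo `q`, grow like `lam * n ^ d`
is asymptotic to `lam * c`. -/
theorem tendsto_div_of_tendsto_div_pow_arith {g : ℝ → ℝ} {lam : ℝ} {d q : ℕ} (hd : d ≠ 0)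
    (hq : 0 < q) (hmono : ∀ x y, 0 < x → x ≤ y → g x ≤ g y) (hnonneg : ∀ x, 0 ≤ g x)
    (h : Tendsto (fun j : ℕ ↦ g (((q * j + 1 : ℕ) : ℝ) ^ d) / ((q * j + 1 : ℕ) : ℝ) ^ d)
      atTop (𝓝 lam)) :
    Tendsto (fun c : ℝ ↦ g c / c) atTop (𝓝 lam) := by
  set n : ℕ → ℝ := fun j ↦ ((q * j + 1 : ℕ) : ℝ) with hn
  have hnpos : ∀ j, 0 < n j := fun j ↦ by simp only [hn]; positivity
  have hq' : (0 : ℝ) < q := by exact_mod_cast hq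
  have hnn : Tendsto n atTop atTop := by
    refine tendsto_natCast_atTop_atTop.comp (tendsto_atTop_mono (fun j ↦ ?_) tendsto_id)
    simp only [id]; nlinarith
  have hratio : Tendsto (fun j ↦ (n (j + 1) / n j) ^ d) atTop (𝓝 1) := by
    have h1 : Tendsto (fun j ↦ n (j + 1) / n j) atTop (𝓝 1) := by
      have : (fun j ↦ n (j + 1) / n j) = fun j ↦ 1 + q / n j := by
        ext j
        have := (hnpos j).ne'
        field_simp
        simp only [hn]; push_cast; ring
      rw [this]
      simpa using tendsto_const_nhds.add (hnn.const_div_atTop (q : ℝ))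
    simpa using h1.pow d
  have hratio' : Tendsto (fun j ↦ (n j / n (j + 1)) ^ d) atTop (𝓝 1) := by
    have := hratio.inv₀ one_ne_zero
    simpa [← inv_pow, inv_div] using this
  let J : ℝ → ℕ := fun c ↦ ⌊(c ^ (1 / (d : ℝ)) - 1) / q⌋₊
  have hd' : (0 : ℝ) < 1 / d := by positivity
  have hJ : Tendsto J atTop atTop := by
    refine tendsto_nat_floor_atTop.comp ?_
    exact ((tendsto_atTop_add_const_right _ (-1) (tendsto_rpow_atTop hd'))).atTop_div_const hq'
  have hlow : ∀ c : ℝ, 1 ≤ c → n (J c) ^ d ≤ c ∧ c ≤ n (J c + 1) ^ d := by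
    intro c hc
    have hc0 : 0 ≤ c := by linarith
    have hr : 1 ≤ c ^ (1 / (d : ℝ)) := Real.one_le_rpow hc hd'.le
    have hcd : (c ^ (1 / (d : ℝ))) ^ d = c := by
      rw [one_div]; exact Real.rpow_inv_natCast_pow hc0 hd
    have h1 : n (J c) ≤ c ^ (1 / (d : ℝ)) := by
      have := Nat.floor_le (a := (c ^ (1 / (d : ℝ)) - 1) / q) (by apply div_nonneg <;> linarith)
      rw [le_div_iff₀ hq'] at this
      simp only [hn, J]; push_cast; linarith
    have h2 : c ^ (1 / (d : ℝ)) ≤ n (J c + 1) := by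
      have := (Nat.lt_floor_add_one ((c ^ (1 / (d : ℝ)) - 1) / q)).le
      rw [div_le_iff₀ hq'] at this
      simp only [hn, J]; push_cast; linarith
    constructor
    · calc n (J c) ^ d ≤ (c ^ (1 / (d : ℝ))) ^ d := pow_le_pow_left₀ (hnpos _).le h1 d
        _ = c := hcd
    · calc c = (c ^ (1 / (d : ℝ))) ^ d := hcd.symm
        _ ≤ _ := pow_le_pow_left₀ (by linarith) h2 d
  have hl := (h.mul hratio').comp hJ
  have hu := ((h.comp (tendsto_add_atTop_nat 1)).mul hratio).comp hJ
  rw [mul_one] at hl hu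
  refine tendsto_of_tendsto_of_tendsto_of_le_of_le' hl hu ?_ ?_
  · filter_upwards [eventually_ge_atTop 1] with c hc
    obtain ⟨h1, h2⟩ := hlow c hc
    simp only [Function.comp]
    have hp := pow_pos (hnpos (J c)) d
    have hp' := pow_pos (hnpos (J c + 1)) d
    calc g (n (J c) ^ d) / n (J c) ^ d * (n (J c) / n (J c + 1)) ^ d
        = g (n (J c) ^ d) / n (J c + 1) ^ d := by rw [div_pow]; field_simp
      _ ≤ g c / c := by
        gcongr
        · exact hnonneg _
        · exact hmono _ _ hp h1
  · filter_upwards [eventually_ge_atTop 1] with c hc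
    obtain ⟨h1, h2⟩ := hlow c hc
    simp only [Function.comp]
    have hp := pow_pos (hnpos (J c)) d
    have hp' := pow_pos (hnpos (J c + 1)) d
    calc g c / c ≤ g (n (J c + 1) ^ d) / n (J c) ^ d := by
          gcongr
          · exact hnonneg _
          · exact hmono _ _ (by linarith) h2
      _ = g (n (J c + 1) ^ d) / n (J c + 1) ^ d * (n (J c + 1) / n (J c)) ^ d := by
          rw [div_pow]; field_simp

/-- Counting the points of a coset `v + L` of a lattice, with `v` of finite order modulo `L`, in
the dilates of a bounded piece of a cone. -/
theorem tendsto_card_coset_le_div {E : Type*} [NormedAddCommGroup E] [InnerProductSpace ℝ E]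
    [FiniteDimensional ℝ E] [MeasurableSpace E] [BorelSpace E] [Nontrivial E]
    (L : Submodule ℤ E) [DiscreteTopology L] [IsZLattice ℝ L] (v : E) {q : ℕ} (hq : 0 < q)
    (hv : q • v ∈ L) {X : Set E} {F : E → ℝ}
    (hX : ∀ ⦃x⦄ ⦃r : ℝ⦄, x ∈ X → 0 < r → r • x ∈ X)
    (h₁ : ∀ x ⦃r : ℝ⦄, 0 ≤ r → F (r • x) = r ^ finrank ℝ E * (F x))
    (h₂ : IsBounded {x ∈ X | F x ≤ 1}) (h₃ : MeasurableSet {x ∈ X | F x ≤ 1})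
    (h₄ : volume (frontier {x ∈ X | F x ≤ 1}) = 0) :
    Tendsto (fun c : ℝ ↦ (Nat.card {x : E // (x ∈ X ∧ F x ≤ c) ∧ x - v ∈ L} : ℝ) / c)
      atTop (𝓝 (volume.real {x ∈ X | F x ≤ 1} / ZLattice.covolume L)) := by
  set D := {x ∈ X | F x ≤ 1} with hD
  have hscale : ∀ (n : ℝ), 0 < n → ∀ x, x ∈ D ↔ (n • x ∈ X ∧ F (n • x) ≤ n ^ finrank ℝ E) := by
    intro n hn x
    simp only [hD, Set.mem_ofPred_eq]
    rw [h₁ _ hn.le]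
    have hp : 0 < n ^ finrank ℝ E := by positivity
    constructor
    · rintro ⟨hx, hF⟩
      exact ⟨hX hx hn, by nlinarith⟩
    · rintro ⟨hx, hF⟩
      refine ⟨?_, ?_⟩
      · have := hX hx (inv_pos.mpr hn)
        rwa [inv_smul_smul₀ hn.ne'] at this
      · by_contra hc
        push Not at hc
        nlinarith
  have hfr : 0 < finrank ℝ E := finrank_pos
  have hfin : ∀ c : ℝ, Finite {x : E // (x ∈ X ∧ F x ≤ c) ∧ x - v ∈ L} := by
    intro c
    set n : ℝ := max 1 c
    have hn : 0 < n := by positivity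
    have hcn : c ≤ n ^ finrank ℝ E :=
      (le_max_right _ _).trans (le_self_pow₀ (le_max_left _ _) hfr.ne')
    have hb : IsBounded ((fun x ↦ n • x - v) '' D) := by
      refine ((h₂.smul₀ n).sub (isBounded_singleton (x := v))).subset ?_
      rintro _ ⟨x, hx, rfl⟩
      exact Set.sub_mem_sub (Set.smul_mem_smul_set hx) rfl
    have hf := Metric.finite_isBounded_inter_isClosed (s := (L : Set E)) ⟨‹_›⟩ hb
      (by have := AddSubgroup.isClosed_of_discrete (H := L.toAddSubgroup); exact this)
    have : Set.Finite {x : E | (x ∈ X ∧ F x ≤ c) ∧ x - v ∈ L} := by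
      refine (hf.image (fun y ↦ y + v)).subset ?_
      rintro x ⟨⟨hx, hF⟩, hxL⟩
      refine ⟨x - v, ⟨⟨n⁻¹ • x, ?_, ?_⟩, hxL⟩, by simp⟩
      · rw [hscale n hn, smul_inv_smul₀ hn.ne']
        exact ⟨hx, hF.trans hcn⟩
      · simp [smul_inv_smul₀ hn.ne']
    exact this
  refine tendsto_div_of_tendsto_div_pow_arith (d := finrank ℝ E) hfr.ne' hq ?_
    (fun _ ↦ by positivity) ?_
  · intro x y _ hxy
    have := hfin y
    exact_mod_cast Nat.card_le_card_of_injective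
      (fun z : {z : E // (z ∈ X ∧ F z ≤ x) ∧ z - v ∈ L} ↦
        (⟨z.1, ⟨z.2.1.1, z.2.1.2.trans hxy⟩, z.2.2⟩ : {z : E // (z ∈ X ∧ F z ≤ y) ∧ z - v ∈ L}))
      (fun a b h ↦ by simpa [Subtype.ext_iff] using h)
  · have hsub : (fun x : E ↦ x - v) '' D = (fun x ↦ x + v) ⁻¹' D := by
      ext x; constructor
      · rintro ⟨y, hy, rfl⟩; simpa using hy
      · intro hx; exact ⟨x + v, hx, by simp⟩
    have key := ZLattice.covolume.tendsto_card_div_pow' L (s := (fun x ↦ x + v) ⁻¹' D)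
      (by
        rw [← hsub]
        refine (h₂.sub (isBounded_singleton (x := v))).subset ?_
        rintro _ ⟨x, hx, rfl⟩
        exact Set.sub_mem_sub hx rfl)
      (measurable_add_const v h₃)
      (by
        have := (Homeomorph.addRight v).preimage_frontier D
        simp only [Homeomorph.coe_addRight] at this
        rw [← this, measure_preimage_add_right, h₄])
    have hvol : volume.real ((fun x ↦ x + v) ⁻¹' D) = volume.real D := by
      simp [measureReal_def, measure_preimage_add_right]
    rw [hvol] at key
    refine (key.comp (tendsto_atTop_mono (f := id) (g := fun j : ℕ ↦ q * j + 1) (fun j ↦ ?_)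
      tendsto_id)).congr ?_
    · simp only [id]; nlinarith
    intro j
    simp only [Function.comp]
    congr 2
    set n : ℕ := q * j + 1 with hn
    have hn0 : (0 : ℝ) < n := by positivity
    refine Nat.card_congr ((Equiv.ofBijective (fun x : E ↦ (n : ℝ) • (x + v)) ?_).subtypeEquiv
      fun x ↦ ?_)
    · constructor
      · intro x y h
        simpa [hn0.ne'] using congrArg ((n : ℝ)⁻¹ • ·) h
      · intro y
        exact ⟨(n : ℝ)⁻¹ • y - v, by simp [smul_inv_smul₀ hn0.ne']⟩
    · simp only [Set.mem_inter_iff, Set.mem_preimage]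
      rw [hscale n hn0, Set.mem_inv_smul_set_iff₀ hn0.ne']
      refine and_congr Iff.rfl ?_
      have : (n : ℝ) • (x + v) - v = (n : ℝ) • x + (j : ℤ) • (q • v) := by
        simp only [hn]
        rw [← Int.cast_smul_eq_zsmul ℝ, ← Nat.cast_smul_eq_nsmul ℝ]
        push_cast
        module
      change (n : ℝ) • x ∈ L ↔ (n : ℝ) • (x + v) - v ∈ L
      rw [this]
      exact (Submodule.add_mem_iff_left _ (L.smul_mem _ hv)).symm

end CosetCount

section RayCount

open Ideal NumberField.InfinitePlace NumberField.mixedEmbedding NumberField.mixedEmbedding.euclidean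
  NumberField.mixedEmbedding.fundamentalCone NumberField.Units MeasureTheory Topology

variable (K : Type*) [Field K] [NumberField K]

open scoped Classical in
/-- Counting integers in the fundamental cone satisfying a congruence. -/
theorem exists_tendsto_card_cone_congr :
    ∃ lam : ℝ, 0 < lam ∧ ∀ (b M : (Ideal (𝓞 K))⁰), IsCoprime (b : Ideal (𝓞 K)) M → ∀ h : 𝓞 K,
      Tendsto (fun c : ℝ ↦ (Nat.card {γ : 𝓞 K // (mixedEmbedding K γ ∈ fundamentalCone K ∧
        mixedEmbedding.norm (mixedEmbedding K γ) ≤ c) ∧ γ ∈ (b : Ideal (𝓞 K)) ∧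
        γ - h ∈ (M : Ideal (𝓞 K))} : ℝ) / c) atTop
        (𝓝 (lam / (absNorm (b : Ideal (𝓞 K)) * absNorm (M : Ideal (𝓞 K))))) := by
  have h₁ : ∀ s : ℝ,
    {x | x ∈ toMixed K ⁻¹' fundamentalCone K ∧ mixedEmbedding.norm (toMixed K x) ≤ s} =
      toMixed K ⁻¹' {x | x ∈ fundamentalCone K ∧ mixedEmbedding.norm x ≤ s} := fun _ ↦ rfl
  have h₂ : {x | x ∈ fundamentalCone K ∧ mixedEmbedding.norm x ≤ 1} = normLeOne K := by ext; simp
  refine ⟨volume.real (normLeOne K) / ((2⁻¹ : ℝ) ^ nrComplexPlaces K * Real.sqrt |discr K|),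
    ?_, ?_⟩
  · apply div_pos
    · rw [measureReal_def, volume_normLeOne]
      have := regulator_pos K
      simp only [ENNReal.toReal_mul, ENNReal.toReal_pow, ENNReal.toReal_ofNat,
        ENNReal.toReal_ofReal this.le, ENNReal.coe_toReal, NNReal.coe_real_pi]
      positivity
    · have : (0 : ℝ) < |(discr K : ℝ)| := by
        have := discr_ne_zero K
        positivity
      positivity
  intro b M hbM h
  obtain ⟨v0, hv0b, hv0M⟩ : ∃ v0 ∈ (b : Ideal (𝓞 K)), v0 - h ∈ (M : Ideal (𝓞 K)) := by
    obtain ⟨i, hi, j, hj, hij⟩ := Ideal.isCoprime_iff_exists.mp hbM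
    refine ⟨h * i, Ideal.mul_mem_left _ _ hi, ?_⟩
    have : h * i - h = - (h * j) := by linear_combination h * hij
    rw [this]
    exact neg_mem (Ideal.mul_mem_left _ _ hj)
  have hmem : ∀ γ : 𝓞 K, (γ ∈ (b : Ideal (𝓞 K)) ∧ γ - h ∈ (M : Ideal (𝓞 K))) ↔
      γ - v0 ∈ ((b * M : (Ideal (𝓞 K))⁰) : Ideal (𝓞 K)) := by
    intro γ
    rw [Submonoid.coe_mul, Ideal.mul_eq_inf_of_isCoprime hbM, Ideal.mem_inf]
    refine and_congr ?_ ?_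
    · exact (Submodule.sub_mem_iff_left _ hv0b).symm
    · rw [← sub_sub_sub_cancel_right γ v0 h]
      exact (Submodule.sub_mem_iff_left _ hv0M).symm
  set L := ZLattice.comap ℝ (mixedEmbedding.idealLattice K (FractionalIdeal.mk0 K (b * M)))
    (toMixed K).toLinearMap with hL
  have hLmem : ∀ γ : 𝓞 K, (toMixed K).symm (mixedEmbedding K γ) ∈ L ↔
      γ ∈ ((b * M : (Ideal (𝓞 K))⁰) : Ideal (𝓞 K)) := by
    intro γ
    rw [hL, ← SetLike.mem_coe, ZLattice.coe_comap]
    simp only [Set.mem_preimage, SetLike.mem_coe, mem_idealLattice, FractionalIdeal.coe_mk0]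
    constructor
    · rintro ⟨x, hx, hxe⟩
      obtain ⟨y, hy, rfl⟩ := (FractionalIdeal.mem_coeIdeal _).mp hx
      have := mixedEmbedding_injective K (hxe.trans ((toMixed K).apply_symm_apply _))
      rwa [← RingOfIntegers.coe_injective this]
    · intro hγ
      exact ⟨γ, (FractionalIdeal.mem_coeIdeal _).mpr ⟨γ, hγ, rfl⟩,
        ((toMixed K).apply_symm_apply _).symm⟩
  have hLrange : ∀ x ∈ L, ∃ γ : 𝓞 K, x = (toMixed K).symm (mixedEmbedding K γ) := by
    intro x hx
    rw [hL, ← SetLike.mem_coe, ZLattice.coe_comap] at hx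
    simp only [Set.mem_preimage, SetLike.mem_coe, mem_idealLattice, FractionalIdeal.coe_mk0] at hx
    obtain ⟨y, hy, hye⟩ := hx
    obtain ⟨γ, -, rfl⟩ := (FractionalIdeal.mem_coeIdeal _).mp hy
    refine ⟨γ, ?_⟩
    rw [hye]
    exact ((toMixed K).symm_apply_apply _).symm
  set v := (toMixed K).symm (mixedEmbedding K v0) with hv
  have key := tendsto_card_coset_le_div L v (q := absNorm ((b * M : (Ideal (𝓞 K))⁰) : Ideal (𝓞 K)))
    (absNorm_pos_of_nonZeroDivisors _) (by
      have : absNorm ((b * M : (Ideal (𝓞 K))⁰) : Ideal (𝓞 K)) • v = (toMixed K).symm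
          (mixedEmbedding K ((absNorm ((b * M : (Ideal (𝓞 K))⁰) : Ideal (𝓞 K)) * v0 : 𝓞 K))) := by
        rw [hv, ← map_nsmul, ← map_nsmul]; simp
      rw [this, hLmem]
      exact Ideal.mul_mem_right _ _ (absNorm_mem _))
    (F := fun x ↦ mixedEmbedding.norm (toMixed K x)) (X := (toMixed K) ⁻¹' (fundamentalCone K))
    (fun _ _ _ h ↦ by rwa [Set.mem_preimage, map_smul, smul_mem_iff_mem h.ne'])
    (fun _ _ h ↦ by rw [map_smul, mixedEmbedding.norm_smul, euclidean.finrank, abs_of_nonneg h])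
    ((toMixed K).antilipschitz.isBounded_preimage (isBounded_normLeOne K))
    ((toMixed K).continuous.measurable (measurableSet_normLeOne K))
    (by
      rw [h₁, ← (toMixed K).coe_toHomeomorph, ← Homeomorph.preimage_frontier,
        (toMixed K).coe_toHomeomorph, (volumePreserving_toMixed K).measure_preimage
        measurableSet_frontier.nullMeasurableSet, h₂, volume_frontier_normLeOne])
  have hlim : volume.real {x | x ∈ toMixed K ⁻¹' fundamentalCone K ∧
      mixedEmbedding.norm (toMixed K x) ≤ 1} / ZLattice.covolume L =
      volume.real (normLeOne K) / ((2⁻¹ : ℝ) ^ nrComplexPlaces K * Real.sqrt |discr K|) /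
        (absNorm (b : Ideal (𝓞 K)) * absNorm (M : Ideal (𝓞 K))) := by
    rw [h₁, h₂, measureReal_def, (volumePreserving_toMixed K).measure_preimage
      (measurableSet_normLeOne K).nullMeasurableSet, hL, ZLattice.covolume_comap
      _ _ _ (volumePreserving_toMixed K), covolume_idealLattice,
      FractionalIdeal.coe_mk0, FractionalIdeal.coeIdeal_absNorm, Submonoid.coe_mul, map_mul,
      measureReal_def, div_div]
    push_cast
    ring_nf
  rw [hlim] at key
  refine key.congr fun c ↦ ?_
  congr 2
  symm
  refine Nat.card_congr (Equiv.ofBijective (fun γ ↦ ⟨(toMixed K).symm (mixedEmbedding K γ.1), ?_⟩)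
    ⟨?_, ?_⟩)
  · obtain ⟨γ, ⟨hγ1, hγ2⟩, hγ3⟩ := γ
    refine ⟨⟨?_, ?_⟩, ?_⟩
    · simpa using hγ1
    · simpa using hγ2
    · rw [hmem] at hγ3
      have := (hLmem _).mpr hγ3
      rwa [show ((γ - v0 : 𝓞 K) : K) = (γ : K) - v0 from rfl, map_sub, map_sub] at this
  · rintro ⟨γ, hγ⟩ ⟨γ', hγ'⟩ heq
    simp only [Subtype.mk.injEq, EmbeddingLike.apply_eq_iff_eq] at heq
    exact Subtype.ext (RingOfIntegers.coe_injective (mixedEmbedding_injective K heq))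
  · rintro ⟨x, ⟨hx1, hx2⟩, hx3⟩
    obtain ⟨γ, hγ⟩ := hLrange _ hx3
    have hx : x = (toMixed K).symm (mixedEmbedding K ((γ + v0 : 𝓞 K) : K)) := by
      rw [show ((γ + v0 : 𝓞 K) : K) = (γ : K) + v0 from rfl, map_add, map_add, ← hγ, ← hv]; abel
    refine ⟨⟨γ + v0, ⟨?_, ?_⟩, ?_⟩, Subtype.ext hx.symm⟩
    · rw [hx] at hx1; simpa using hx1
    · rw [hx] at hx2; simpa using hx2
    · rw [hmem, add_sub_cancel_right, ← hLmem, ← hγ]; exact hx3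

end RayCount

section RayClass

variable {R : Type*} [CommRing R] [IsDedekindDomain R]

/-- The monoid of nonzero ideals coprime to `M`. -/
def copIdeals (M : Ideal R) : Submonoid (Ideal R) where
  carrier := {a | a ≠ ⊥ ∧ IsCoprime a M}
  one_mem' := ⟨by simp, isCoprime_one_left⟩
  mul_mem' := fun ha hb ↦ ⟨mul_ne_zero ha.1 hb.1, ha.2.mul_left hb.2⟩

/-- The relation defining the ray class group of modulus `M`. -/
def rayCon (M : Ideal R) : Con (copIdeals M) where
  r a b := ∃ x y : R, (x ≠ 0 ∧ y ≠ 0) ∧ (x - 1 ∈ M ∧ y - 1 ∈ M) ∧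
    Ideal.span {x} * (a : Ideal R) = Ideal.span {y} * b
  iseqv := by
    refine ⟨fun a ↦ ⟨1, 1, by simp⟩, fun {a b} ⟨x, y, h1, h2, h3⟩ ↦
      ⟨y, x, h1.symm, h2.symm, h3.symm⟩, ?_⟩
    rintro a b c ⟨x, y, ⟨hx, hy⟩, ⟨h1, h2⟩, h3⟩ ⟨z, t, ⟨hz, ht⟩, ⟨h4, h5⟩, h6⟩
    refine ⟨x * z, y * t, ⟨mul_ne_zero hx hz, mul_ne_zero hy ht⟩, ⟨?_, ?_⟩, ?_⟩
    · rw [show x * z - 1 = x * (z - 1) + (x - 1) by ring]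
      exact add_mem (Ideal.mul_mem_left _ _ h4) h1
    · rw [show y * t - 1 = y * (t - 1) + (y - 1) by ring]
      exact add_mem (Ideal.mul_mem_left _ _ h5) h2
    · rw [← Ideal.span_singleton_mul_span_singleton, ← Ideal.span_singleton_mul_span_singleton,
        mul_assoc, mul_assoc, ← h6, mul_left_comm, h3, mul_left_comm]
  mul' := by
    rintro a b c d ⟨x, y, ⟨hx, hy⟩, ⟨h1, h2⟩, h3⟩ ⟨z, t, ⟨hz, ht⟩, ⟨h4, h5⟩, h6⟩
    refine ⟨x * z, y * t, ⟨mul_ne_zero hx hz, mul_ne_zero hy ht⟩, ⟨?_, ?_⟩, ?_⟩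
    · rw [show x * z - 1 = x * (z - 1) + (x - 1) by ring]
      exact add_mem (Ideal.mul_mem_left _ _ h4) h1
    · rw [show y * t - 1 = y * (t - 1) + (y - 1) by ring]
      exact add_mem (Ideal.mul_mem_left _ _ h5) h2
    · rw [← Ideal.span_singleton_mul_span_singleton, ← Ideal.span_singleton_mul_span_singleton,
        Submonoid.coe_mul, Submonoid.coe_mul, mul_mul_mul_comm, h3, h6, mul_mul_mul_comm]

/-- The ray class group of modulus `M`. -/
abbrev RayClass (M : Ideal R) : Type _ := (rayCon M).Quotient

/-- The ray class of an ideal coprime to the modulus. -/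
def rayMk (M : Ideal R) : copIdeals M →* RayClass M := (rayCon M).mk'

theorem rayMk_surjective (M : Ideal R) : Function.Surjective (rayMk M) := Con.mk'_surjective

theorem rayMk_eq_iff {M : Ideal R} {a b : copIdeals M} : rayMk M a = rayMk M b ↔
    ∃ x y : R, (x ≠ 0 ∧ y ≠ 0) ∧ (x - 1 ∈ M ∧ y - 1 ∈ M) ∧
    Ideal.span {x} * (a : Ideal R) = Ideal.span {y} * b := Con.eq (rayCon M)

omit [IsDedekindDomain R] in
theorem isCoprime_span_of_sub_one_mem {M : Ideal R} {γ : R} (h : γ - 1 ∈ M) :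
    IsCoprime (Ideal.span {γ}) M :=
  Ideal.isCoprime_iff_exists.mpr ⟨γ, Ideal.mem_span_singleton_self γ, 1 - γ,
    by rw [← neg_sub]; exact neg_mem h, by ring⟩

theorem rayMk_eq_one_iff {M : Ideal R} {a : copIdeals M} : rayMk M a = 1 ↔
    ∃ γ : R, γ - 1 ∈ M ∧ (a : Ideal R) = Ideal.span {γ} := by
  rw [← map_one (rayMk M), rayMk_eq_iff]
  constructor
  · rintro ⟨x, y, ⟨hx, hy⟩, ⟨h1, h2⟩, h3⟩
    have hy' : y ∈ Ideal.span {x} * (a : Ideal R) := by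
      rw [h3]; simp
    obtain ⟨γ, hγ, hγy⟩ := Ideal.mem_span_singleton_mul.mp hy'
    refine ⟨γ, ?_, ?_⟩
    · rw [show γ - 1 = (x * γ - 1) - γ * (x - 1) by ring, hγy]
      exact sub_mem h2 (Ideal.mul_mem_left _ _ h1)
    · rw [← hγy, ← Ideal.span_singleton_mul_span_singleton, Submonoid.coe_one, mul_one] at h3
      exact mul_left_cancel₀ (by simpa using hx) h3
  · rintro ⟨γ, h1, h2⟩
    refine ⟨1, γ, ⟨?_, ?_⟩, ⟨by simp, h1⟩, by simpa using h2⟩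
    · rintro h0
      have : Subsingleton R := subsingleton_of_zero_eq_one h0.symm
      exact a.2.1 (Subsingleton.elim _ _)
    · rintro rfl
      exact a.2.1 (by simpa using h2)

theorem exists_mul_eq_one_ray {M : Ideal R} (a : copIdeals M) :
    ∃ b : copIdeals M, rayMk M a * rayMk M b = 1 := by
  obtain ⟨i, hi, j, hj, hij⟩ := Ideal.isCoprime_iff_exists.mp a.2.2
  obtain ⟨γ, hγa, hγM, hγ0⟩ : ∃ γ ∈ (a : Ideal R), γ - 1 ∈ M ∧ γ ≠ 0 := by
    have hi1 : i - 1 ∈ M := by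
      rw [← hij, sub_add_cancel_left]; exact neg_mem hj
    by_cases hi0 : i = 0
    · subst hi0
      have h1M : (1 : R) ∈ M := by simpa using neg_mem hi1
      obtain ⟨z, hz, hz0⟩ := Submodule.exists_mem_ne_zero_of_ne_bot a.2.1
      exact ⟨z, hz, by rw [(Ideal.eq_top_iff_one M).mpr h1M]; trivial, hz0⟩
    · exact ⟨i, hi, hi1, hi0⟩
  obtain ⟨b, hb⟩ := Ideal.dvd_span_singleton.mpr hγa
  have hb' : b ∈ copIdeals M := by
    refine ⟨?_, ?_⟩
    · rintro rfl
      rw [Ideal.mul_bot, Ideal.span_singleton_eq_bot] at hb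
      exact hγ0 hb
    · have := isCoprime_span_of_sub_one_mem hγM
      rw [hb] at this
      exact this.of_mul_left_right
  refine ⟨⟨b, hb'⟩, ?_⟩
  rw [← map_mul, rayMk_eq_one_iff]
  exact ⟨γ, hγM, hb.symm⟩

instance (M : Ideal R) : CommGroup (RayClass M) :=
  { (inferInstance : CommMonoid (RayClass M)) with
    inv := fun g ↦ rayMk M (exists_mul_eq_one_ray (rayMk_surjective M g).choose).choose
    inv_mul_cancel := fun g ↦ by
      have h := (exists_mul_eq_one_ray (rayMk_surjective M g).choose).choose_spec
      conv_lhs => rw [mul_comm]; enter [1]; rw [← (rayMk_surjective M g).choose_spec]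
      exact h }

end RayClass

section RayCount2

open Ideal NumberField.InfinitePlace NumberField.mixedEmbedding
  NumberField.mixedEmbedding.fundamentalCone NumberField.Units Topology

variable (K : Type*) [Field K] [NumberField K]

theorem card_ray_eq (M : Ideal (𝓞 K)) (a b : copIdeals M) (hab : rayMk M a * rayMk M b = 1) (s : ℝ) :
    Nat.card {I : copIdeals M // rayMk M I = rayMk M a ∧ (absNorm (I : Ideal (𝓞 K)) : ℝ) ≤ s} =
    Nat.card {I : (Ideal (𝓞 K))⁰ // (b : Ideal (𝓞 K)) ∣ I ∧
      (∃ γ, γ - 1 ∈ M ∧ (I : Ideal (𝓞 K)) = span {γ}) ∧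
      (absNorm (I : Ideal (𝓞 K)) : ℝ) ≤ s * absNorm (b : Ideal (𝓞 K))} := by
  have hb0 : (0 : ℝ) < absNorm (b : Ideal (𝓞 K)) := by
    rw [Nat.cast_pos, Nat.pos_iff_ne_zero, Ne, absNorm_eq_zero_iff]; exact b.2.1
  have hcl : ∀ I : copIdeals M, rayMk M I = rayMk M a ↔
      ∃ γ, γ - 1 ∈ M ∧ ((I * b : copIdeals M) : Ideal (𝓞 K)) = span {γ} := by
    intro I
    rw [← rayMk_eq_one_iff, map_mul, ← hab]
    constructor
    · intro h; rw [h]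
    · intro h
      calc rayMk M I = rayMk M I * (rayMk M a * rayMk M b) := by rw [hab, mul_one]
        _ = (rayMk M I * rayMk M b) * rayMk M a := by rw [mul_comm (rayMk M a), mul_assoc]
        _ = rayMk M a := by rw [h, hab, one_mul]
  refine Nat.card_congr (Equiv.ofBijective (fun I ↦ ⟨⟨((I.1 * b : copIdeals M) : Ideal (𝓞 K)),
    mem_nonZeroDivisors_of_ne_zero (I.1 * b).2.1⟩, ?_, ?_, ?_⟩) ⟨?_, ?_⟩)
  · exact Dvd.intro_left _ rfl
  · exact (hcl _).mp I.2.1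
  · have := I.2.2
    simp only [Submonoid.coe_mul, map_mul, Nat.cast_mul]
    gcongr
  · rintro ⟨I, hI⟩ ⟨J, hJ⟩ h
    simp only [Submonoid.coe_mul, Subtype.mk.injEq] at h
    exact Subtype.ext (Subtype.ext (mul_right_cancel₀ b.2.1 h))
  · rintro ⟨⟨I, hI⟩, ⟨c, hc⟩, ⟨γ, hγ, hIγ⟩, h3⟩
    simp only at hc hIγ h3
    have hcop : c ∈ copIdeals M := by
      refine ⟨?_, ?_⟩
      · rintro rfl
        rw [Ideal.mul_bot] at hc
        exact nonZeroDivisors.ne_zero hI hc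
      · have := isCoprime_span_of_sub_one_mem hγ
        rw [← hIγ, hc] at this
        exact this.of_mul_left_right
    refine ⟨⟨⟨c, hcop⟩, (hcl _).mpr ⟨γ, hγ, ?_⟩, ?_⟩, ?_⟩
    · rw [← hIγ, hc, mul_comm]; rfl
    · rw [hc, map_mul, Nat.cast_mul, mul_comm] at h3
      exact le_of_mul_le_mul_right h3 hb0
    · refine Subtype.ext (Subtype.ext ?_)
      simp only [Submonoid.coe_mul, hc, mul_comm]

open scoped Classical in
theorem card_ray_mul_torsion (M b : Ideal (𝓞 K)) (s : ℝ) :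
    Nat.card {I : (Ideal (𝓞 K))⁰ // b ∣ I ∧
      (∃ γ, γ - 1 ∈ M ∧ (I : Ideal (𝓞 K)) = span {γ}) ∧
      (absNorm (I : Ideal (𝓞 K)) : ℝ) ≤ s} * torsionOrder K =
    Nat.card {γ : 𝓞 K // (mixedEmbedding K γ ∈ fundamentalCone K ∧
        mixedEmbedding.norm (mixedEmbedding K γ) ≤ s) ∧ γ ∈ b ∧ ∃ u : (𝓞 K)ˣ, γ - u ∈ M} := by
  rw [torsionOrder, ← Nat.card_prod]
  refine Nat.card_congr ?_
  let P : {I : (Ideal (𝓞 K))⁰ // Submodule.IsPrincipal (I.1 : Ideal (𝓞 K))} → Prop := fun I ↦ b ∣ I.1 ∧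
      (∃ γ, γ - 1 ∈ M ∧ (I.1 : Ideal (𝓞 K)) = span {γ}) ∧ (absNorm (I.1 : Ideal (𝓞 K)) : ℝ) ≤ s
  let Q : integerSet K → Prop := fun a ↦ P (integerSetEquiv K a).1
  have e1 : {I : (Ideal (𝓞 K))⁰ // b ∣ I ∧ (∃ γ, γ - 1 ∈ M ∧ (I : Ideal (𝓞 K)) = span {γ}) ∧
      (absNorm (I : Ideal (𝓞 K)) : ℝ) ≤ s} ≃ {I // P I} :=
    { toFun := fun I ↦ ⟨⟨I.1, by obtain ⟨γ, -, h⟩ := I.2.2.1; exact ⟨γ, h⟩⟩, I.2⟩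
      invFun := fun I ↦ ⟨I.1.1, I.2⟩
      left_inv := fun _ ↦ rfl
      right_inv := fun _ ↦ rfl }
  have e2 : {I // P I} × torsion K ≃ {a // Q a} :=
    (Equiv.prodSubtypeFstEquivSubtypeProd (p := P)).symm.trans
      (Equiv.subtypeEquiv (integerSetEquiv K) fun _ ↦ Iff.rfl).symm
  have hQ : ∀ a : integerSet K, Q a ↔ ((preimageOfMemIntegerSet a : 𝓞 K) ∈ b ∧
      (∃ u : (𝓞 K)ˣ, (preimageOfMemIntegerSet a : 𝓞 K) - u ∈ M) ∧
      mixedEmbedding.norm (a : mixedSpace K) ≤ s) := by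
    intro a
    simp only [Q, P, integerSetEquiv_apply_fst]
    refine and_congr Ideal.dvd_span_singleton (and_congr ?_ ?_)
    · constructor
      · rintro ⟨γ, hγ, h⟩
        obtain ⟨u, hu⟩ := Ideal.span_singleton_eq_span_singleton.mp h.symm
        refine ⟨u, ?_⟩
        rw [← hu, show γ * (u : 𝓞 K) - u = u * (γ - 1) by ring]
        exact Ideal.mul_mem_left _ _ hγ
      · rintro ⟨u, hu⟩
        refine ⟨↑u⁻¹ * (preimageOfMemIntegerSet a : 𝓞 K), ?_, ?_⟩
        · have := Ideal.mul_mem_left _ ((u⁻¹ : (𝓞 K)ˣ) : 𝓞 K) hu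
          rwa [mul_sub, Units.inv_mul] at this
        · rw [Ideal.span_singleton_eq_span_singleton]
          exact ⟨u⁻¹, mul_comm _ _⟩
    · rw [← intNorm_coe, intNorm, absNorm_span_singleton]
  refine (e1.prodCongr (Equiv.refl _)).trans (e2.trans (Equiv.ofBijective (fun a ↦
    ⟨(preimageOfMemIntegerSet a.1 : 𝓞 K), ?_⟩) ⟨?_, ?_⟩))
  · obtain ⟨h1, h2, h3⟩ := (hQ _).mp a.2
    rw [mixedEmbedding_preimageOfMemIntegerSet]
    exact ⟨⟨a.1.2.1, h3⟩, h1, h2⟩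
  · rintro ⟨a, ha⟩ ⟨a', ha'⟩ h
    simp only [Subtype.mk.injEq] at h
    refine Subtype.ext (Subtype.ext ?_)
    rw [← mixedEmbedding_preimageOfMemIntegerSet, ← mixedEmbedding_preimageOfMemIntegerSet, h]
  · rintro ⟨γ, ⟨h1, h2⟩, h3, h4⟩
    have hγ : mixedEmbedding K (γ : 𝓞 K) ∈ integerSet K := mem_integerSet.mpr ⟨h1, γ, rfl⟩
    have hp := preimageOfMemIntegerSet_mixedEmbedding hγ
    refine ⟨⟨⟨_, hγ⟩, (hQ _).mpr ?_⟩, Subtype.ext hp⟩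
    rw [hp]
    exact ⟨h3, h4, h2⟩

end RayCount2

section RayCount3

open Ideal NumberField.InfinitePlace NumberField.mixedEmbedding
  NumberField.mixedEmbedding.fundamentalCone NumberField.Units Topology

variable (K : Type*) [Field K] [NumberField K]

instance finite_absNorm_le (s : ℝ) : Finite {I : Ideal (𝓞 K) // (absNorm I : ℝ) ≤ s} := by
  refine (Set.Finite.subset (finite_setOfPred_absNorm_le (S := 𝓞 K) ⌊s⌋₊) fun I hI ↦ ?_).to_subtype
  exact Nat.le_floor hI

theorem finite_cone_norm_le (s : ℝ) : Finite {γ : 𝓞 K // mixedEmbedding K γ ∈ fundamentalCone K ∧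
    mixedEmbedding.norm (mixedEmbedding K γ) ≤ s} := by
  have h1 : Finite {a : integerSet K // mixedEmbedding.norm (a : mixedSpace K) ≤ s} := by
    refine Finite.of_injective (β := {I : Ideal (𝓞 K) // (absNorm I : ℝ) ≤ s} × torsion K)
      (fun a ↦ ⟨⟨(integerSetEquiv K a.1).1, ?_⟩, (integerSetEquiv K a.1).2⟩) ?_
    · rw [integerSetEquiv_apply_fst, absNorm_span_singleton]
      exact (intNorm_coe a.1).trans_le a.2
    · rintro a b hab
      simp only [Prod.mk.injEq, Subtype.mk.injEq] at hab
      exact Subtype.ext ((integerSetEquiv K).injective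
        (Prod.ext (Subtype.ext (Subtype.ext hab.1)) hab.2))
  refine Finite.of_injective (β := {a : integerSet K // mixedEmbedding.norm (a : mixedSpace K) ≤ s})
    (fun γ ↦ ⟨⟨mixedEmbedding K γ.1, mem_integerSet.mpr ⟨γ.2.1, γ.1, rfl⟩⟩, γ.2.2⟩) ?_
  intro γ γ' h
  simp only [Subtype.mk.injEq] at h
  exact Subtype.ext (RingOfIntegers.coe_injective (mixedEmbedding_injective K h))

/-- The number of ideals in each ray class is asymptotic to the same multiple of the bound. -/
theorem exists_tendsto_card_ray (M : Ideal (𝓞 K)) (hM : M ≠ ⊥) :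
    ∃ κ : ℝ, 0 < κ ∧ ∀ g : RayClass M, Tendsto (fun s : ℝ ↦ (Nat.card {I : copIdeals M //
      rayMk M I = g ∧ (absNorm (I : Ideal (𝓞 K)) : ℝ) ≤ s} : ℝ) / s) atTop (𝓝 κ) := by
  classical
  obtain ⟨lam, hlam, hlim⟩ := exists_tendsto_card_cone_congr K
  have hMfin : Finite (𝓞 K ⧸ M) := Ideal.finiteQuotientOfFreeOfNeBot M hM
  let H : Set (𝓞 K ⧸ M) := Set.range fun u : (𝓞 K)ˣ ↦ Ideal.Quotient.mk M (u : 𝓞 K)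
  have : Fintype H := Fintype.ofFinite H
  have hHne : Nonempty H := ⟨⟨_, 1, rfl⟩⟩
  have hw : (0 : ℝ) < torsionOrder K := by exact_mod_cast Nat.pos_of_ne_zero (torsionOrder_ne_zero K)
  have hN : (0 : ℝ) < absNorm M := by
    rw [Nat.cast_pos, Nat.pos_iff_ne_zero, Ne, absNorm_eq_zero_iff]; exact hM
  have hHc : (0 : ℝ) < Fintype.card H := by exact_mod_cast Fintype.card_pos
  refine ⟨Fintype.card H * lam / (torsionOrder K * absNorm M), by positivity, fun g ↦ ?_⟩
  obtain ⟨a, rfl⟩ := rayMk_surjective M g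
  obtain ⟨b, hb⟩ := exists_mul_eq_one_ray a
  have hb0 : (0 : ℝ) < absNorm (b : Ideal (𝓞 K)) := by
    rw [Nat.cast_pos, Nat.pos_iff_ne_zero, Ne, absNorm_eq_zero_iff]; exact b.2.1
  have hsplit : ∀ s : ℝ, (Nat.card {γ : 𝓞 K // (mixedEmbedding K γ ∈ fundamentalCone K ∧
        mixedEmbedding.norm (mixedEmbedding K γ) ≤ s) ∧ γ ∈ (b : Ideal (𝓞 K)) ∧
          ∃ u : (𝓞 K)ˣ, γ - u ∈ M}) = ∑ h : H,
      Nat.card {γ : 𝓞 K // (mixedEmbedding K γ ∈ fundamentalCone K ∧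
        mixedEmbedding.norm (mixedEmbedding K γ) ≤ s) ∧ γ ∈ (b : Ideal (𝓞 K)) ∧
          γ - (Quotient.out h.1) ∈ M} := by
    intro s
    have hout : ∀ h : H, ∀ γ : 𝓞 K, γ - Quotient.out h.1 ∈ M ↔ Ideal.Quotient.mk M γ = h.1 := by
      intro h γ
      rw [← Ideal.Quotient.eq]
      conv_rhs => rw [← Ideal.Quotient.mk_out h.1]
    have hfin : ∀ h : H, Finite {γ : 𝓞 K // (mixedEmbedding K γ ∈ fundamentalCone K ∧
        mixedEmbedding.norm (mixedEmbedding K γ) ≤ s) ∧ γ ∈ (b : Ideal (𝓞 K)) ∧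
          γ - (Quotient.out h.1) ∈ M} := by
      intro h
      have := finite_cone_norm_le K s
      exact Finite.of_injective (fun γ ↦ (⟨γ.1, γ.2.1⟩ : {γ : 𝓞 K //
        mixedEmbedding K γ ∈ fundamentalCone K ∧ mixedEmbedding.norm (mixedEmbedding K γ) ≤ s}))
        fun γ γ' h ↦ Subtype.ext (Subtype.mk.inj h)
    rw [← Nat.card_sigma]
    refine Nat.card_congr ?_
    exact
      { toFun := fun γ ↦ ⟨⟨Ideal.Quotient.mk M γ.1, by
          obtain ⟨u, hu⟩ := γ.2.2.2
          exact ⟨u, (Ideal.Quotient.eq.mpr hu).symm⟩⟩, γ.1, γ.2.1, γ.2.2.1, (hout _ _).mpr rfl⟩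
        invFun := fun x ↦ ⟨x.2.1, x.2.2.1, x.2.2.2.1, by
          obtain ⟨u, hu⟩ := x.1.2
          refine ⟨u, Ideal.Quotient.eq.mp ?_⟩
          rw [(hout _ _).mp x.2.2.2.2, ← hu]⟩
        left_inv := fun _ ↦ rfl
        right_inv := by
          rintro ⟨h, γ, h1, h2, h3⟩
          have := (hout _ _).mp h3
          obtain ⟨h, hh⟩ := h
          simp only at this
          subst this
          rfl }
  have key : Tendsto (fun s : ℝ ↦ ∑ h : H,
      (Nat.card {γ : 𝓞 K // (mixedEmbedding K γ ∈ fundamentalCone K ∧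
        mixedEmbedding.norm (mixedEmbedding K γ) ≤ s) ∧ γ ∈ (b : Ideal (𝓞 K)) ∧
          γ - (Quotient.out h.1) ∈ M} : ℝ) / s) atTop
      (𝓝 (∑ _h : H, lam / (absNorm (b : Ideal (𝓞 K)) * absNorm M))) :=
    tendsto_finsetSum _ fun h _ ↦
      hlim ⟨b, mem_nonZeroDivisors_of_ne_zero b.2.1⟩ ⟨M, mem_nonZeroDivisors_of_ne_zero hM⟩
        b.2.2 _
  have key2 := (key.comp (tendsto_id.atTop_mul_const hb0)).mul_const
    ((absNorm (b : Ideal (𝓞 K)) : ℝ) / torsionOrder K)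
  rw [Finset.sum_const, Finset.card_univ, nsmul_eq_mul] at key2
  convert key2 using 1
  · ext s
    rw [card_ray_eq K M a b hb s]
    have h1 := card_ray_mul_torsion K M b (s * absNorm (b : Ideal (𝓞 K)))
    rw [hsplit] at h1
    have h2 := congrArg (Nat.cast (R := ℝ)) h1
    push_cast at h2
    simp only [Function.comp_apply, id]
    rw [← Finset.sum_div, ← h2]
    field_simp
  · congr 1
    field_simp

theorem finite_rayClass (M : Ideal (𝓞 K)) (hM : M ≠ ⊥) : Finite (RayClass M) := by
  classical
  obtain ⟨κ, hκ, hlim⟩ := exists_tendsto_card_ray K M hM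
  obtain ⟨C, hC⟩ : ∃ C : ℝ, Tendsto (fun s : ℝ ↦
      (Nat.card {I : Ideal (𝓞 K) // absNorm I ≤ s} : ℝ) / s) atTop (𝓝 C) :=
    ⟨_, NumberField.Ideal.tendsto_norm_le_div_atTop K⟩
  by_contra hinf
  rw [not_finite_iff_infinite] at hinf
  obtain ⟨n, hn⟩ := exists_nat_gt (C / κ)
  obtain ⟨t, ht⟩ := Infinite.exists_subset_card_eq (RayClass M) n
  have h1 : Tendsto (fun s : ℝ ↦ ∑ g ∈ t, (Nat.card {I : copIdeals M //
      rayMk M I = g ∧ (absNorm (I : Ideal (𝓞 K)) : ℝ) ≤ s} : ℝ) / s) atTop (𝓝 (∑ g ∈ t, κ)) :=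
    tendsto_finsetSum _ fun g _ ↦ hlim g
  rw [Finset.sum_const, ht, nsmul_eq_mul] at h1
  have h2 : (n : ℝ) * κ ≤ C := by
    refine le_of_tendsto_of_tendsto h1 hC ?_
    filter_upwards [eventually_gt_atTop 0] with s hs
    rw [← Finset.sum_div]
    gcongr
    have hf : ∀ g : t, Finite {I : copIdeals M //
        rayMk M I = g ∧ (absNorm (I : Ideal (𝓞 K)) : ℝ) ≤ s} := fun g ↦
      Finite.of_injective (fun I ↦ (⟨I.1.1, I.2.2⟩ : {I : Ideal (𝓞 K) // (absNorm I : ℝ) ≤ s}))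
        fun I J h ↦ Subtype.ext (Subtype.ext (Subtype.mk.inj h))
    rw [← Finset.sum_coe_sort, ← Nat.cast_sum, Nat.cast_le, ← Nat.card_sigma]
    refine Nat.card_le_card_of_injective (fun x ↦ ⟨x.2.1.1, x.2.2.2⟩) ?_
    rintro ⟨⟨g, hg⟩, I, h3, h4⟩ ⟨⟨g', hg'⟩, I', h3', h4'⟩ h
    simp only [Subtype.mk.injEq] at h
    have := Subtype.ext h
    subst this
    simp only at h3 h3'
    subst h3
    subst h3'
    rfl
  rw [div_lt_iff₀ hκ] at hn
  exact absurd h2 hn.not_ge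

end RayCount3

section RaySys

open Topology

/-- A cancellative monoid with norm, class map and primes, modelling the ideals coprime to a
modulus, such that all classes have the same positive density. -/
structure RaySys (D G : Type*) [CancelCommMonoid D] [CommGroup G] where
  N : D →* ℕ
  cl : D →* G
  P : Set D
  dens : ℝ
  N_pos : ∀ a, 0 < N a
  finite_le : ∀ Y : ℝ, {a : D | (N a : ℝ) ≤ Y}.Finite
  dvd_or : ∀ p ∈ P, ∀ a b : D, p ∣ a * b → p ∣ a ∨ p ∣ b
  not_dvd_one : ∀ p ∈ P, ¬ p ∣ 1
  pow_dvd : ∀ p ∈ P, ∀ q ∈ P, p ≠ q → ∀ (i j : ℕ) (a : D), p ^ i ∣ q ^ j * a → p ^ i ∣ a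
  summable : Summable fun p : P ↦ (1 : ℝ) / (N p) ^ 2
  dens_pos : 0 < dens
  tendsto : ∀ g : G, Tendsto (fun Y : ℝ ↦
    (Nat.card {a : D // cl a = g ∧ (N a : ℝ) ≤ Y} : ℝ) / Y) atTop (𝓝 dens)

variable {D G : Type*} [CancelCommMonoid D] [CommGroup G] [Finite G] (s : RaySys D G)

namespace RaySys

omit [Finite G] in
theorem one_le_N (a : D) : (1 : ℝ) ≤ s.N a := by exact_mod_cast s.N_pos a

omit [Finite G] in
theorem N_pos' (a : D) : (0 : ℝ) < s.N a := by exact_mod_cast s.N_pos a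

/-- The elements of norm at most `Y`. -/
def B (Y : ℝ) : Finset D := (s.finite_le Y).toFinset

omit [Finite G] in
@[simp] theorem mem_B {Y : ℝ} {a : D} : a ∈ s.B Y ↔ (s.N a : ℝ) ≤ Y := by simp [B]

omit [Finite G] in
theorem B_mono {Y Z : ℝ} (h : Y ≤ Z) : s.B Y ⊆ s.B Z := fun a ha ↦ by
  rw [mem_B] at *; exact ha.trans h

omit [Finite G] in
theorem B_empty {Y : ℝ} (h : Y < 1) : s.B Y = ∅ := by
  ext a
  simpa using h.trans_le (s.one_le_N a)

open scoped Classical in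
omit [Finite G] in
theorem tendsto_card_class (g : G) : Tendsto (fun Y : ℝ ↦
    (((s.B Y).filter fun a ↦ s.cl a = g).card : ℝ) / Y) atTop (𝓝 s.dens) := by
  refine (s.tendsto g).congr fun Y ↦ ?_
  congr 2
  exact Nat.subtype_card _ fun a ↦ by simp [and_comm]

/-- The total density. -/
def ρ : ℝ := Nat.card G * s.dens

theorem ρ_pos : 0 < s.ρ := by
  have : (0 : ℝ) < Nat.card G := by exact_mod_cast Nat.card_pos
  exact mul_pos this s.dens_pos

theorem tendsto_card : Tendsto (fun Y : ℝ ↦ ((s.B Y).card : ℝ) / Y) atTop (𝓝 s.ρ) := by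
  classical
  have : Fintype G := Fintype.ofFinite G
  have h := tendsto_finsetSum (Finset.univ : Finset G) fun g _ ↦ s.tendsto_card_class g
  rw [Finset.sum_const, Finset.card_univ, nsmul_eq_mul, ← Nat.card_eq_fintype_card] at h
  refine h.congr fun Y ↦ ?_
  rw [← Finset.sum_div, Finset.card_eq_sum_card_fiberwise (f := s.cl) (t := Finset.univ)
    (fun _ _ ↦ Finset.mem_coe.mpr (Finset.mem_univ _))]
  push_cast
  rfl

theorem exists_card_le : ∃ C : ℝ, 0 < C ∧ ∀ Y : ℝ, 0 ≤ Y → ((s.B Y).card : ℝ) ≤ C * Y := by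
  obtain ⟨Y₀, hY₀⟩ := eventually_atTop.mp
    ((s.tendsto_card.eventually_le_const (lt_add_one s.ρ)).and (eventually_ge_atTop 1))
  have hρ := s.ρ_pos
  refine ⟨s.ρ + 1 + (s.B Y₀).card, by positivity, fun Y hY ↦ ?_⟩
  rcases lt_or_ge Y 1 with h1 | h1
  · rw [s.B_empty h1]; simp; positivity
  rcases le_total Y₀ Y with h2 | h2
  · have := (hY₀ Y h2).1
    rw [div_le_iff₀ (by linarith)] at this
    nlinarith [(Nat.cast_nonneg (s.B Y₀).card : (0 : ℝ) ≤ _)]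
  · have h3 : ((s.B Y).card : ℝ) ≤ (s.B Y₀).card := by
      exact_mod_cast Finset.card_le_card (s.B_mono h2)
    nlinarith [(Nat.cast_nonneg (s.B Y₀).card : (0 : ℝ) ≤ _)]

/-- The harmonic sum. -/
def h (Y : ℝ) : ℝ := ∑ a ∈ s.B Y, (1 : ℝ) / s.N a

omit [Finite G] in
theorem h_nonneg (Y : ℝ) : 0 ≤ s.h Y := Finset.sum_nonneg fun _ _ ↦ by positivity

omit [Finite G] in
theorem h_mono {Y Z : ℝ} (hYZ : Y ≤ Z) : s.h Y ≤ s.h Z :=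
  Finset.sum_le_sum_of_subset_of_nonneg (s.B_mono hYZ) fun _ _ _ ↦ by positivity

open scoped Classical in
omit [Finite G] in
theorem h_sub {Y Z : ℝ} (hYZ : Y ≤ Z) :
    s.h Z - s.h Y = ∑ a ∈ s.B Z \ s.B Y, (1 : ℝ) / s.N a := by
  rw [h, h, ← Finset.sum_sdiff (s.B_mono hYZ)]; ring

theorem exists_h_le : ∃ C : ℝ, 0 < C ∧ ∀ Y : ℝ, 2 ≤ Y → s.h Y ≤ C * Real.log Y := by
  classical
  obtain ⟨C, hC, hCY⟩ := s.exists_card_le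
  have hstep : ∀ Y : ℝ, 0 < Y → s.h (2 * Y) ≤ s.h Y + 2 * C := by
    intro Y hY
    have h1 := s.h_sub (show Y ≤ 2 * Y by linarith)
    have h2 : ∑ a ∈ s.B (2 * Y) \ s.B Y, (1 : ℝ) / s.N a ≤
        ∑ a ∈ s.B (2 * Y) \ s.B Y, 1 / Y := by
      refine Finset.sum_le_sum fun a ha ↦ ?_
      simp only [Finset.mem_sdiff, mem_B, not_le] at ha
      exact one_div_le_one_div_of_le hY ha.2.le
    have h3 : ((s.B (2 * Y) \ s.B Y).card : ℝ) ≤ (s.B (2 * Y)).card := by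
      exact_mod_cast Finset.card_le_card Finset.sdiff_subset
    have h4 := hCY (2 * Y) (by linarith)
    rw [Finset.sum_const, nsmul_eq_mul, mul_one_div] at h2
    have h5 : ((s.B (2 * Y) \ s.B Y).card : ℝ) / Y ≤ 2 * C := by
      rw [div_le_iff₀ hY]; linarith
    linarith
  have hpow : ∀ n : ℕ, s.h (2 ^ n) ≤ s.h 1 + 2 * C * n := by
    intro n
    induction n with
    | zero => simp
    | succ n ih =>
      rw [pow_succ, mul_comm]
      refine (hstep _ (by positivity)).trans ?_
      push_cast
      linarith
  have hl2 : 0 < Real.log 2 := Real.log_pos one_lt_two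
  refine ⟨(s.h 1 + 4 * C) / Real.log 2, by have := s.h_nonneg 1; positivity, fun Y hY ↦ ?_⟩
  set n := Nat.clog 2 ⌈Y⌉₊ with hn
  have h1 : Y ≤ 2 ^ n := (Nat.le_ceil Y).trans (by exact_mod_cast Nat.le_pow_clog one_lt_two _)
  have h2 : (n : ℝ) * Real.log 2 ≤ Real.log Y + Real.log 2 := by
    have : (1 : ℕ) < ⌈Y⌉₊ := by
      rw [Nat.lt_ceil]; push_cast; linarith
    have h3 := Nat.pow_pred_clog_lt_self one_lt_two this
    rw [← hn] at h3
    have h4 : ((2 : ℝ) ^ (n - 1)) < Y := by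
      have := Nat.lt_ceil.mp h3
      exact_mod_cast this
    have h5 := Real.log_lt_log (by positivity) h4
    rw [Real.log_pow] at h5
    have h6 : (n : ℝ) ≤ ((n - 1 : ℕ) : ℝ) + 1 := by
      have : n ≤ n - 1 + 1 := by omega
      exact_mod_cast this
    nlinarith
  have hY2 : Real.log 2 ≤ Real.log Y := Real.log_le_log (by norm_num) hY
  refine (s.h_mono h1).trans ((hpow n).trans ?_)
  rw [div_mul_eq_mul_div, le_div_iff₀ hl2]
  have := s.h_nonneg 1
  nlinarith

theorem exists_le_h : ∃ c : ℝ, 0 < c ∧ ∀ᶠ Y : ℝ in atTop, c * Real.log Y ≤ s.h Y := by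
  classical
  obtain ⟨C, hC, hCY⟩ := s.exists_card_le
  have hρ := s.ρ_pos
  obtain ⟨Y₀, hY₀⟩ := eventually_atTop.mp
    ((s.tendsto_card.eventually_const_le (half_lt_self hρ)).and (eventually_ge_atTop 1))
  obtain ⟨m, hm⟩ := exists_nat_gt (4 * C / s.ρ + 1)
  have hm1 : (1 : ℝ) < m := lt_of_le_of_lt (by have : 0 < 4 * C / s.ρ := by positivity
                                               linarith) hm
  have hm4 : 4 * C ≤ m * s.ρ := by
    have : 4 * C / s.ρ < m := by linarith
    rw [div_lt_iff₀ hρ] at this; exact this.le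
  have hY1 : 1 ≤ Y₀ := (hY₀ Y₀ le_rfl).2
  have hstep : ∀ Y : ℝ, Y₀ ≤ Y → s.h Y + s.ρ / 4 ≤ s.h (m * Y) := by
    intro Y hY
    have hY0 : 0 < Y := by linarith
    have hYm : Y ≤ m * Y := by nlinarith
    have h1 := s.h_sub hYm
    have h2 : ∑ a ∈ s.B (m * Y) \ s.B Y, (1 : ℝ) / (m * Y) ≤
        ∑ a ∈ s.B (m * Y) \ s.B Y, 1 / (s.N a : ℝ) := by
      refine Finset.sum_le_sum fun a ha ↦ ?_
      simp only [Finset.mem_sdiff, mem_B, not_le] at ha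
      exact one_div_le_one_div_of_le (s.N_pos' a) ha.1
    have h3 := (hY₀ (m * Y) (hY.trans hYm)).1
    rw [le_div_iff₀ (by positivity)] at h3
    have h4 := hCY Y hY0.le
    rw [Finset.sum_const, nsmul_eq_mul, mul_one_div, Finset.card_sdiff_of_subset (s.B_mono hYm),
      Nat.cast_sub (Finset.card_le_card (s.B_mono hYm))] at h2
    have h5 : s.ρ / 4 ≤ (((s.B (m * Y)).card : ℝ) - (s.B Y).card) / (m * Y) := by
      rw [le_div_iff₀ (by positivity)]
      nlinarith
    linarith
  have hpow : ∀ n : ℕ, s.ρ / 4 * n ≤ s.h (m ^ n * Y₀) := by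
    intro n
    induction n with
    | zero => simpa using s.h_nonneg _
    | succ n ih =>
      have h1 : Y₀ ≤ m ^ n * Y₀ := by
        have : (1 : ℝ) ≤ m ^ n := one_le_pow₀ hm1.le
        nlinarith
      rw [pow_succ, mul_comm ((m : ℝ) ^ n), mul_assoc]
      refine le_trans ?_ (hstep _ h1)
      push_cast
      linarith
  have hlm : 0 < Real.log m := Real.log_pos hm1
  refine ⟨s.ρ / 4 / (2 * Real.log m), by positivity, ?_⟩
  filter_upwards [eventually_ge_atTop Y₀,
    Real.tendsto_log_atTop.eventually_ge_atTop (2 * (Real.log Y₀ + Real.log m))] with Y hY hlY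
  have hYpos : 0 < Y := by linarith
  set n := ⌊(Real.log Y - Real.log Y₀) / Real.log m⌋₊ with hn
  have hY0Y : Real.log Y₀ ≤ Real.log Y := Real.log_le_log (by linarith) hY
  have h1 : (n : ℝ) ≤ (Real.log Y - Real.log Y₀) / Real.log m :=
    Nat.floor_le (div_nonneg (by linarith) hlm.le)
  have h2 : (Real.log Y - Real.log Y₀) / Real.log m < n + 1 := Nat.lt_floor_add_one _
  rw [le_div_iff₀ hlm] at h1
  rw [div_lt_iff₀ hlm] at h2
  have h3 : (m : ℝ) ^ n * Y₀ ≤ Y := by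
    rw [← Real.log_le_log_iff (by positivity) hYpos, Real.log_mul (by positivity) (by positivity),
      Real.log_pow]
    linarith
  refine le_trans ?_ ((hpow n).trans (s.h_mono h3))
  rw [div_mul_eq_mul_div, div_le_iff₀ (by positivity)]
  have : Real.log Y / 2 ≤ n * Real.log m := by nlinarith
  nlinarith

end RaySys
end RaySys

section RaySysTuples

open Topology
open scoped Classical

variable {D G : Type*} [CancelCommMonoid D] [CommGroup G] (s : RaySys D G)
variable (ι : Type*) [Fintype ι]

namespace RaySys

variable {ι} in
theorem N_le_N_prod (a : ι → D) (i : ι) : (s.N (a i) : ℝ) ≤ s.N (∏ j, a j) := by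
  exact_mod_cast Nat.le_of_dvd (s.N_pos _) (map_dvd s.N (Finset.dvd_prod_of_mem a (Finset.mem_univ i)))

theorem finite_tup (Y : ℝ) : {a : ι → D | (s.N (∏ i, a i) : ℝ) ≤ Y}.Finite := by
  refine (Fintype.piFinset fun _ : ι ↦ s.B Y).finite_toSet.subset fun a ha ↦ ?_
  simp only [Finset.mem_coe, Fintype.mem_piFinset, mem_B]
  intro i
  refine le_trans ?_ ha
  exact s.N_le_N_prod a i

/-- Tuples whose product has norm at most `Y`. -/
def Tup (Y : ℝ) : Finset (ι → D) := (s.finite_tup ι Y).toFinset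

@[simp] theorem mem_Tup {Y : ℝ} {a : ι → D} : a ∈ s.Tup ι Y ↔ (s.N (∏ i, a i) : ℝ) ≤ Y := by
  simp [Tup]

theorem Tup_mono {Y Z : ℝ} (h : Y ≤ Z) : s.Tup ι Y ⊆ s.Tup ι Z := fun a ha ↦ by
  rw [mem_Tup] at *; exact ha.trans h

theorem Tup_empty {Y : ℝ} (h : Y < 1) : s.Tup ι Y = ∅ := by
  ext a
  rw [mem_Tup]
  simpa only [Finset.notMem_empty, iff_false, not_le] using h.trans_le (s.one_le_N _)

variable {ι}

/-- Insert a coordinate in a tuple. -/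
def glue (i : ι) (x : D) (b : {j // j ≠ i} → D) : ι → D := (Equiv.funSplitAt i D).symm (x, b)

omit [CancelCommMonoid D] [Fintype ι] in
theorem glue_same (i : ι) (x : D) (b : {j // j ≠ i} → D) : glue i x b i = x := by
  simp [glue, Equiv.funSplitAt, Equiv.piSplitAt]

omit [CancelCommMonoid D] [Fintype ι] in
theorem glue_ne (i : ι) (x : D) (b : {j // j ≠ i} → D) (j : {j // j ≠ i}) :
    glue i x b j = b j := by
  simp [glue, Equiv.funSplitAt, Equiv.piSplitAt, j.2]

theorem prod_glue (i : ι) (x : D) (b : {j // j ≠ i} → D) :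
    ∏ j, glue i x b j = x * ∏ j, b j := by
  rw [Fintype.prod_eq_mul_prod_subtype_ne _ i, glue_same]
  congr 1
  exact Finset.prod_congr rfl fun j _ ↦ glue_ne i x b j

theorem sum_Tup_split (i : ι) (Y : ℝ) (f : (ι → D) → ℝ) :
    ∑ a ∈ s.Tup ι Y, f a = ∑ b ∈ s.Tup {j // j ≠ i} Y,
      ∑ x ∈ s.B (Y / s.N (∏ j, b j)), f (glue i x b) := by
  rw [Finset.sum_sigma']
  refine Finset.sum_bij' (fun a _ ↦ ⟨(Equiv.funSplitAt i D a).2, (Equiv.funSplitAt i D a).1⟩)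
    (fun y _ ↦ glue i y.2 y.1) ?_ ?_ ?_ ?_ ?_
  · intro a ha
    obtain ⟨⟨x, b⟩, rfl⟩ := (Equiv.funSplitAt i D).symm.surjective a
    change glue i x b ∈ _ at ha
    rw [mem_Tup, prod_glue, map_mul, Nat.cast_mul] at ha
    simp only [Equiv.apply_symm_apply, Finset.mem_sigma, mem_Tup, mem_B]
    refine ⟨le_trans ?_ ha, ?_⟩
    · exact le_mul_of_one_le_left (s.N_pos' _).le (s.one_le_N x)
    · rwa [le_div_iff₀ (s.N_pos' _)]
  · rintro ⟨b, x⟩ h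
    simp only [Finset.mem_sigma, mem_Tup, mem_B] at h
    rw [le_div_iff₀ (s.N_pos' _)] at h
    rw [mem_Tup, prod_glue, map_mul, Nat.cast_mul]
    exact h.2
  · intro a _
    exact (Equiv.funSplitAt i D).symm_apply_apply a
  · rintro ⟨b, x⟩ _
    simp [glue]
  · intro a _
    congr 1
    exact ((Equiv.funSplitAt i D).symm_apply_apply a).symm

variable (ι)

/-- The harmonic sum over tuples. -/
def H (Y : ℝ) : ℝ := ∑ a ∈ s.Tup ι Y, (1 : ℝ) / s.N (∏ i, a i)

theorem H_nonneg (Y : ℝ) : 0 ≤ s.H ι Y := Finset.sum_nonneg fun _ _ ↦ by positivity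

theorem H_mono {Y Z : ℝ} (h : Y ≤ Z) : s.H ι Y ≤ s.H ι Z :=
  Finset.sum_le_sum_of_subset_of_nonneg (s.Tup_mono ι h) fun _ _ _ ↦ by positivity

theorem h_pow (Y : ℝ) : s.h Y ^ Fintype.card ι =
    ∑ a ∈ Fintype.piFinset fun _ : ι ↦ s.B Y, (1 : ℝ) / s.N (∏ i, a i) := by
  rw [h, ← Finset.card_univ, ← Finset.prod_const, Finset.prod_univ_sum]
  refine Finset.sum_congr rfl fun a _ ↦ ?_
  rw [map_prod, Nat.cast_prod, Finset.prod_div_distrib, Finset.prod_const_one]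

theorem H_le (Y : ℝ) : s.H ι Y ≤ s.h Y ^ Fintype.card ι := by
  rw [h_pow]
  refine Finset.sum_le_sum_of_subset_of_nonneg (fun a ha ↦ ?_) fun _ _ _ ↦ by positivity
  simp only [Fintype.mem_piFinset, mem_B, mem_Tup] at *
  intro i
  refine le_trans ?_ ha
  exact s.N_le_N_prod a i

theorem le_H (Y : ℝ) : s.h Y ^ Fintype.card ι ≤ s.H ι (Y ^ Fintype.card ι) := by
  rw [h_pow]
  refine Finset.sum_le_sum_of_subset_of_nonneg (fun a ha ↦ ?_) fun _ _ _ ↦ by positivity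
  simp only [Fintype.mem_piFinset, mem_B, mem_Tup] at *
  rw [map_prod, Nat.cast_prod, ← Finset.card_univ, ← Finset.prod_const]
  exact Finset.prod_le_prod (fun i _ ↦ (s.N_pos' _).le) fun i _ ↦ ha i

theorem sum_dvd_le (p : D) (hp : p ∈ s.P) (Y : ℝ) (f : (ι → D) → ℝ) (hf : ∀ a, 0 ≤ f a) :
    ∑ a ∈ (s.Tup ι Y).filter (fun a ↦ p ∣ ∏ i, a i), f a ≤
      ∑ i, ∑ a ∈ s.Tup ι (Y / s.N p), f (a * Pi.mulSingle i p) := by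
  have hprod : ∀ (a : ι → D) (i : ι), ∏ j, (a * Pi.mulSingle i p : ι → D) j = (∏ j, a j) * p := by
    intro a i
    simp only [Pi.mul_apply, Finset.prod_mul_distrib]
    congr 1
    exact Fintype.prod_pi_mulSingle' _ _
  have hdvd : ∀ (t : Finset ι) (a : ι → D), p ∣ ∏ i ∈ t, a i → ∃ i, p ∣ a i := by
    intro t a
    induction t using Finset.induction_on with
    | empty => intro h; simp only [Finset.prod_empty] at h; exact absurd h (s.not_dvd_one p hp)
    | insert i t hi ih =>
      rw [Finset.prod_insert hi]
      intro h
      rcases s.dvd_or p hp _ _ h with h | h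
      · exact ⟨i, h⟩
      · exact ih h
  rw [← Finset.sum_product' Finset.univ (s.Tup ι (Y / s.N p))
    fun i a ↦ f (a * (Pi.mulSingle i p : ι → D))]
  have himg : (s.Tup ι Y).filter (fun a ↦ p ∣ ∏ i, a i) ⊆
      ((Finset.univ : Finset ι) ×ˢ s.Tup ι (Y / s.N p)).image
        (fun y ↦ y.2 * Pi.mulSingle y.1 p) := by
    intro a ha
    rw [Finset.mem_filter] at ha
    obtain ⟨i, c, hc⟩ := hdvd _ _ ha.2
    have : a = (Function.update a i c) * Pi.mulSingle i p := by
      ext j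
      by_cases hj : j = i
      · subst hj; simp [hc, mul_comm]
      · simp [hj]
    rw [Finset.mem_image]
    refine ⟨⟨i, Function.update a i c⟩, ?_, this.symm⟩
    rw [Finset.mem_product]
    refine ⟨Finset.mem_univ _, ?_⟩
    have h1 := ha.1
    rw [this, mem_Tup, hprod, map_mul, Nat.cast_mul] at h1
    rw [mem_Tup, le_div_iff₀ (s.N_pos' _)]
    exact h1
  refine (Finset.sum_le_sum_of_subset_of_nonneg himg fun _ _ _ ↦ hf _).trans ?_
  exact Finset.sum_image_le_of_nonneg fun _ _ ↦ hf _

theorem sum_sq_dvd_le (p : D) (hp : p ∈ s.P) (Y : ℝ) (f : (ι → D) → ℝ) (hf : ∀ a, 0 ≤ f a) :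
    ∑ a ∈ (s.Tup ι Y).filter (fun a ↦ p * p ∣ ∏ i, a i), f a ≤
      ∑ i, ∑ j, ∑ a ∈ s.Tup ι (Y / s.N p / s.N p),
        f (a * Pi.mulSingle j p * Pi.mulSingle i p) := by
  have hprod : ∀ (a : ι → D) (i : ι), ∏ j, (a * Pi.mulSingle i p : ι → D) j = (∏ j, a j) * p := by
    intro a i
    simp only [Pi.mul_apply, Finset.prod_mul_distrib]
    congr 1
    exact Fintype.prod_pi_mulSingle' _ _
  have h1 := s.sum_dvd_le ι p hp Y (fun a ↦ if p * p ∣ ∏ i, a i then f a else 0)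
    (fun a ↦ by split_ifs; exacts [hf a, le_rfl])
  rw [← Finset.sum_filter, Finset.filter_filter] at h1
  have h2 : (s.Tup ι Y).filter (fun a ↦ p ∣ ∏ i, a i ∧ p * p ∣ ∏ i, a i) =
      (s.Tup ι Y).filter (fun a ↦ p * p ∣ ∏ i, a i) :=
    Finset.filter_congr fun a _ ↦ and_iff_right_of_imp fun h ↦ (dvd_mul_right p p).trans h
  rw [h2] at h1
  refine h1.trans (Finset.sum_le_sum fun i _ ↦ ?_)
  rw [← Finset.sum_filter]
  have h3 : (s.Tup ι (Y / s.N p)).filter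
      (fun a ↦ p * p ∣ ∏ j, (a * Pi.mulSingle i p : ι → D) j) =
      (s.Tup ι (Y / s.N p)).filter (fun a ↦ p ∣ ∏ i, a i) := by
    refine Finset.filter_congr fun a _ ↦ ?_
    rw [hprod, mul_comm (∏ j, a j)]
    constructor
    · rintro ⟨c, hc⟩
      exact ⟨c, mul_left_cancel (hc.trans (mul_assoc _ _ _))⟩
    · exact fun h ↦ mul_dvd_mul_left p h
  rw [h3]
  exact s.sum_dvd_le ι p hp _ (fun a ↦ f (a * Pi.mulSingle i p)) fun _ ↦ hf _

theorem card_sq_dvd_le (p : D) (hp : p ∈ s.P) (Y : ℝ) :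
    (((s.Tup ι Y).filter (fun a ↦ p * p ∣ ∏ i, a i)).card : ℝ) ≤
      (Fintype.card ι) ^ 2 * ((s.Tup ι (Y / (s.N p) ^ 2)).card : ℝ) := by
  have := s.sum_sq_dvd_le ι p hp Y (fun _ ↦ 1) (fun _ ↦ zero_le_one)
  simp only [Finset.sum_const, nsmul_eq_mul, mul_one, Finset.card_univ] at this
  rw [sq, sq, ← div_div, mul_assoc]
  exact this

theorem H_dvd_le (p : D) (hp : p ∈ s.P) (Y : ℝ) :
    ∑ a ∈ (s.Tup ι Y).filter (fun a ↦ p ∣ ∏ i, a i), (1 : ℝ) / s.N (∏ i, a i) ≤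
      (Fintype.card ι) / (s.N p) * s.H ι Y := by
  refine (s.sum_dvd_le ι p hp Y _ (fun _ ↦ by positivity)).trans ?_
  have hp1 := s.one_le_N p
  have : ∀ i : ι, ∑ a ∈ s.Tup ι (Y / s.N p), (1 : ℝ) / s.N (∏ j, (a * Pi.mulSingle i p : ι → D) j) ≤
      1 / s.N p * s.H ι Y := by
    intro i
    rcases lt_or_ge Y 0 with hY | hY
    · rw [Tup_empty]
      · simpa using mul_nonneg (by positivity) (s.H_nonneg ι Y)
      · exact (div_nonpos_of_nonpos_of_nonneg hY.le (by positivity)).trans_lt one_pos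
    refine le_trans (le_of_eq ?_) (mul_le_mul_of_nonneg_left
      (s.H_mono ι (div_le_self hY hp1)) (by positivity))
    rw [H, Finset.mul_sum]
    refine Finset.sum_congr rfl fun a _ ↦ ?_
    simp only [Pi.mul_apply, Finset.prod_mul_distrib]
    rw [show ∏ j, (Pi.mulSingle i p : ι → D) j = p from Fintype.prod_pi_mulSingle' _ _, map_mul, Nat.cast_mul]
    field_simp
  refine (Finset.sum_le_sum fun i _ ↦ this i).trans (le_of_eq ?_)
  rw [Finset.sum_const, Finset.card_univ, nsmul_eq_mul]
  ring

theorem H_sq_dvd_le (p : D) (hp : p ∈ s.P) (Y : ℝ) :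
    ∑ a ∈ (s.Tup ι Y).filter (fun a ↦ p * p ∣ ∏ i, a i), (1 : ℝ) / s.N (∏ i, a i) ≤
      (Fintype.card ι) ^ 2 / (s.N p) ^ 2 * s.H ι Y := by
  refine (s.sum_sq_dvd_le ι p hp Y _ (fun _ ↦ by positivity)).trans ?_
  have hp1 := s.one_le_N p
  have : ∀ i j : ι, ∑ a ∈ s.Tup ι (Y / s.N p / s.N p),
      (1 : ℝ) / s.N (∏ k, (a * Pi.mulSingle j p * Pi.mulSingle i p : ι → D) k) ≤
      1 / (s.N p) ^ 2 * s.H ι Y := by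
    intro i j
    rcases lt_or_ge Y 0 with hY | hY
    · rw [Tup_empty]
      · simpa using mul_nonneg (by positivity) (s.H_nonneg ι Y)
      · rw [div_div]
        exact (div_nonpos_of_nonpos_of_nonneg hY.le (by positivity)).trans_lt one_pos
    refine le_trans (le_of_eq ?_) (mul_le_mul_of_nonneg_left
      (s.H_mono ι (Y := Y / s.N p / s.N p) ?_) (by positivity))
    · rw [H, Finset.mul_sum]
      refine Finset.sum_congr rfl fun a _ ↦ ?_
      simp only [Pi.mul_apply, Finset.prod_mul_distrib]
      rw [show ∏ k, (Pi.mulSingle i p : ι → D) k = p from Fintype.prod_pi_mulSingle' _ _,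
        show ∏ k, (Pi.mulSingle j p : ι → D) k = p from Fintype.prod_pi_mulSingle' _ _, map_mul, map_mul, Nat.cast_mul, Nat.cast_mul]
      field_simp
    · exact (div_le_self (div_nonneg hY (by positivity)) hp1).trans (div_le_self hY hp1)
  refine (Finset.sum_le_sum fun i _ ↦ Finset.sum_le_sum fun j _ ↦ this i j).trans (le_of_eq ?_)
  rw [Finset.sum_const, Finset.sum_const, Finset.card_univ, nsmul_eq_mul, nsmul_eq_mul]
  ring

end RaySys
end RaySysTuples

section RaySysDiff

open Topology
open scoped Classical

variable {D G : Type*} [CancelCommMonoid D] [CommGroup G] (s : RaySys D G)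
variable (ι : Type*) [Fintype ι]

namespace RaySys

/-- Squarefreeness with respect to the primes of the system. -/
def Sqf (a : D) : Prop := ∀ p ∈ s.P, ¬ p * p ∣ a

/-- The number of tuples with squarefree product in given classes. -/
def T (g : ι → G) (Y : ℝ) : ℕ :=
  ((s.Tup ι Y).filter fun a ↦ (∀ i, s.cl (a i) = g i) ∧ s.Sqf (∏ i, a i)).card

theorem exists_card_Tup_le [Finite G] [Nonempty ι] : ∃ C : ℝ, 0 < C ∧ ∀ Y : ℝ, 0 ≤ Y →
    ((s.Tup ι Y).card : ℝ) ≤ C * (Y * s.h Y ^ (Fintype.card ι - 1)) := by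
  obtain ⟨C, hC, hCY⟩ := s.exists_card_le
  refine ⟨C, hC, fun Y hY ↦ ?_⟩
  obtain ⟨i⟩ := ‹Nonempty ι›
  have h1 := s.sum_Tup_split i Y (fun _ ↦ 1)
  simp only [Finset.sum_const, nsmul_eq_mul, mul_one] at h1
  rw [h1]
  have h2 : ∀ b ∈ s.Tup {j // j ≠ i} Y, ((s.B (Y / s.N (∏ j, b j))).card : ℝ) ≤
      C * Y * (1 / s.N (∏ j, b j)) := by
    intro b _
    refine (hCY _ (by positivity)).trans (le_of_eq (by ring))
  refine (Finset.sum_le_sum h2).trans ?_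
  rw [← Finset.mul_sum, mul_assoc C Y]
  have h3 := s.H_le {j // j ≠ i} Y
  rw [Fintype.card_subtype_compl, Fintype.card_subtype_eq] at h3
  gcongr
  exact h3

theorem card_Tup_small [Finite G] {ε : ℝ} (hε : 0 < ε) : ∀ᶠ Y : ℝ in atTop,
    ((s.Tup ι Y).card : ℝ) ≤ ε * (Y * Real.log Y ^ Fintype.card ι) := by
  rcases isEmpty_or_nonempty ι with hι | hι
  · filter_upwards [eventually_ge_atTop (1 / ε)] with Y hY
    have h1 : ((s.Tup ι Y).card : ℝ) ≤ 1 := by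
      have : (s.Tup ι Y).card ≤ 1 := Finset.card_le_one_of_subsingleton _
      exact_mod_cast this
    rw [Fintype.card_eq_zero, pow_zero, mul_one]
    rw [div_le_iff₀ hε] at hY
    linarith
  · obtain ⟨C, hC, hCY⟩ := s.exists_card_Tup_le ι
    obtain ⟨C', hC', hh⟩ := s.exists_h_le
    set k := Fintype.card ι with hk
    have hk0 : 0 < k := Fintype.card_pos
    filter_upwards [eventually_ge_atTop 2,
      Real.tendsto_log_atTop.eventually_ge_atTop (C * C' ^ (k - 1) / ε)] with Y hY hl
    rw [div_le_iff₀ hε] at hl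
    have hlog : 0 ≤ Real.log Y := Real.log_nonneg (by linarith)
    refine (hCY Y (by linarith)).trans ?_
    have h1 : s.h Y ^ (k - 1) ≤ (C' * Real.log Y) ^ (k - 1) :=
      pow_le_pow_left₀ (s.h_nonneg Y) (hh Y hY) _
    calc C * (Y * s.h Y ^ (k - 1)) ≤ C * (Y * (C' * Real.log Y) ^ (k - 1)) := by gcongr
      _ = (C * C' ^ (k - 1)) * (Y * Real.log Y ^ (k - 1)) := by rw [mul_pow]; ring
      _ ≤ (Real.log Y * ε) * (Y * Real.log Y ^ (k - 1)) := by gcongr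
      _ = ε * (Y * Real.log Y ^ (k - 1 + 1)) := by rw [pow_succ]; ring
      _ = _ := by rw [Nat.sub_add_cancel hk0]

/-- Elements of a class not divisible by given prime powers. -/
def U (Q : Finset D) (e : D → ℕ) (g : G) (Y : ℝ) : ℕ :=
  ((s.B Y).filter fun a ↦ s.cl a = g ∧ ∀ p ∈ Q, ¬ p ^ e p ∣ a).card

theorem exists_tendsto_U (Q : Finset D) (hQ : ∀ p ∈ Q, p ∈ s.P) (e : D → ℕ) :
    ∃ κ : ℝ, ∀ g : G, Tendsto (fun Y : ℝ ↦ (s.U Q e g Y : ℝ) / Y) atTop (𝓝 κ) := by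
  induction Q using Finset.induction_on with
  | empty =>
    refine ⟨s.dens, fun g ↦ (s.tendsto_card_class g).congr fun Y ↦ ?_⟩
    simp [U]
  | insert q Q hq ih =>
    obtain ⟨κ, hκ⟩ := ih fun p hp ↦ hQ p (Finset.mem_insert_of_mem hp)
    set d := q ^ e q with hd
    have hNd := s.N_pos' d
    refine ⟨κ - κ * (1 / s.N d), fun g ↦ ?_⟩
    have h1 : ∀ Y : ℝ, (s.U (insert q Q) e g Y : ℝ) =
        s.U Q e g Y - s.U Q e (g * (s.cl d)⁻¹) (Y / s.N d) := by
      intro Y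
      rw [eq_sub_iff_add_eq, ← Nat.cast_add, Nat.cast_inj]
      have h2 : s.U Q e g Y = ((s.B Y).filter fun a ↦
          (s.cl a = g ∧ ∀ p ∈ Q, ¬ p ^ e p ∣ a) ∧ ¬ d ∣ a).card +
          ((s.B Y).filter fun a ↦ (s.cl a = g ∧ ∀ p ∈ Q, ¬ p ^ e p ∣ a) ∧ d ∣ a).card := by
        rw [U, ← Finset.card_filter_add_card_filter_not (p := fun a ↦ d ∣ a), Finset.filter_filter,
          Finset.filter_filter, add_comm]
      rw [h2]
      congr 1
      · rw [U]
        congr 1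
        refine Finset.filter_congr fun a _ ↦ ?_
        rw [Finset.forall_mem_insert, and_assoc, and_comm (a := ¬ d ∣ a)]
      · rw [U]
        refine Finset.card_bij (fun a _ ↦ d * a) ?_ (fun a _ b _ h ↦ mul_left_cancel h) ?_
        · intro a ha
          simp only [Finset.mem_filter, mem_B] at ha ⊢
          obtain ⟨h3, h4, h5⟩ := ha
          refine ⟨?_, ⟨?_, ?_⟩, dvd_mul_right _ _⟩
          · rw [le_div_iff₀ hNd] at h3
            rw [map_mul, Nat.cast_mul, mul_comm]; exact h3
          · rw [map_mul, h4, mul_comm, inv_mul_cancel_right]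
          · intro p hp h6
            exact h5 p hp (s.pow_dvd p (hQ p (Finset.mem_insert_of_mem hp)) q
              (hQ q (Finset.mem_insert_self _ _)) (fun h ↦ hq (h ▸ hp)) _ _ _ h6)
        · intro b hb
          simp only [Finset.mem_filter, mem_B] at hb
          obtain ⟨h3, ⟨h4, h5⟩, a, rfl⟩ := hb
          refine ⟨a, ?_, rfl⟩
          simp only [Finset.mem_filter, mem_B]
          refine ⟨?_, ?_, fun p hp h6 ↦ h5 p hp (h6.mul_left _)⟩
          · rw [le_div_iff₀ hNd]
            rw [map_mul, Nat.cast_mul, mul_comm] at h3; exact h3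
          · rw [← h4, map_mul, mul_comm (s.cl d), mul_inv_cancel_right]
    have h3 := (hκ (g * (s.cl d)⁻¹)).comp (tendsto_id.atTop_div_const hNd)
    refine ((hκ g).sub (h3.mul_const (1 / (s.N d : ℝ)))).congr fun Y ↦ ?_
    rw [h1]
    simp only [Function.comp_apply, id]
    field_simp

theorem exists_U_sub_le [Finite G] (Q : Finset D) (hQ : ∀ p ∈ Q, p ∈ s.P) (e : D → ℕ) (g g' : G)
    {ε : ℝ} (hε : 0 < ε) : ∃ C : ℝ, 0 ≤ C ∧ ∀ Z : ℝ, 0 ≤ Z →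
      |(s.U Q e g Z : ℝ) - s.U Q e g' Z| ≤ ε * Z + C := by
  obtain ⟨κ, hκ⟩ := s.exists_tendsto_U Q hQ e
  have h1 := (hκ g).sub (hκ g')
  rw [sub_self] at h1
  obtain ⟨Y₀, hY₀⟩ := eventually_atTop.mp
    (((tendsto_zero_iff_abs_tendsto_zero _).mp h1).eventually_le_const hε)
  refine ⟨(s.B Y₀).card, by positivity, fun Z hZ ↦ ?_⟩
  have hU : ∀ g, (s.U Q e g Z : ℝ) ≤ (s.B Z).card := fun g ↦ by
    exact_mod_cast Finset.card_le_card (Finset.filter_subset _ _)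
  rcases le_total Y₀ Z with h2 | h2
  · have h3 := hY₀ Z h2
    simp only [Function.comp_apply] at h3
    rcases hZ.eq_or_lt with rfl | hZ
    · have h0 : ∀ g, (s.U Q e g 0 : ℝ) = 0 := fun g ↦ by
        have := hU g
        rw [s.B_empty zero_lt_one] at this
        simp only [Finset.card_empty, Nat.cast_zero] at this
        exact le_antisymm this (by positivity)
      rw [h0, h0]; simp
    rw [← sub_div, abs_div, abs_of_pos hZ, div_le_iff₀ hZ] at h3
    exact h3.trans (le_add_of_nonneg_right (by positivity))
  · have h3 : ((s.B Z).card : ℝ) ≤ (s.B Y₀).card := by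
      exact_mod_cast Finset.card_le_card (s.B_mono h2)
    have h4 := hU g
    have h5 := hU g'
    have h6 : (0 : ℝ) ≤ s.U Q e g Z := by positivity
    have h7 : (0 : ℝ) ≤ s.U Q e g' Z := by positivity
    have h8 : 0 ≤ ε * Z := by positivity
    rw [abs_le]
    constructor <;> linarith

theorem card_bad_le [Finite G] [Nonempty ι] {ε : ℝ} (hε : 0 < ε) :
    ∃ Q : Finset D, (∀ p ∈ Q, p ∈ s.P) ∧ ∀ Y : ℝ, 1 ≤ Y →
      (((s.Tup ι Y).filter fun a ↦ ∃ p ∈ s.P, p ∉ Q ∧ p * p ∣ ∏ i, a i).card : ℝ) ≤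
        ε * (Y * s.h Y ^ (Fintype.card ι - 1)) := by
  obtain ⟨C, hC, hCY⟩ := s.exists_card_Tup_le ι
  set k := Fintype.card ι with hk
  have hk0 : (0 : ℝ) < k := by exact_mod_cast Fintype.card_pos
  obtain ⟨Q, hQ⟩ := summable_iff_vanishing_norm.mp s.summable (ε / (k ^ 2 * C)) (by positivity)
  refine ⟨Q.map ⟨Subtype.val, Subtype.val_injective⟩, fun p hp ↦ ?_, fun Y hY ↦ ?_⟩
  · obtain ⟨q, _, rfl⟩ := Finset.mem_map.mp hp
    exact q.2
  set W := (((s.B Y).filter (· ∈ s.P)) \ Q.map ⟨Subtype.val, Subtype.val_injective⟩) with hW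
  have hWP : ∀ p ∈ W, p ∈ s.P := fun p hp ↦ by
    simp only [hW, Finset.mem_sdiff, Finset.mem_filter] at hp
    exact hp.1.2
  have hsub : ((s.Tup ι Y).filter fun a ↦ ∃ p ∈ s.P,
      p ∉ Q.map ⟨Subtype.val, Subtype.val_injective⟩ ∧ p * p ∣ ∏ i, a i) ⊆
      W.biUnion fun p ↦ (s.Tup ι Y).filter fun a ↦ p * p ∣ ∏ i, a i := by
    intro a ha
    rw [Finset.mem_filter] at ha
    obtain ⟨h1, p, hp, hpQ, hpa⟩ := ha
    rw [Finset.mem_biUnion]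
    refine ⟨p, ?_, Finset.mem_filter.mpr ⟨h1, hpa⟩⟩
    rw [hW, Finset.mem_sdiff, Finset.mem_filter, mem_B]
    refine ⟨⟨?_, hp⟩, hpQ⟩
    rw [mem_Tup] at h1
    refine le_trans ?_ h1
    exact_mod_cast Nat.le_of_dvd (s.N_pos _) (map_dvd s.N ((dvd_mul_right p p).trans hpa))
  have hsum : ∑ p ∈ W, (1 : ℝ) / (s.N p) ^ 2 ≤ ε / (k ^ 2 * C) := by
    have h1 := hQ (W.subtype (· ∈ s.P)) (by
      rw [Finset.disjoint_left]
      intro p hp hpQ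
      rw [Finset.mem_subtype, hW, Finset.mem_sdiff] at hp
      exact hp.2 (Finset.mem_map.mpr ⟨p, hpQ, rfl⟩))
    rw [Real.norm_eq_abs] at h1
    refine le_trans (le_of_eq ?_) ((le_abs_self _).trans h1.le)
    rw [Finset.sum_subtype_eq_sum_filter (s := W) (p := (· ∈ s.P)) fun p : D ↦ (1 : ℝ) / (s.N p) ^ 2,
      Finset.filter_true_of_mem hWP]
  have h1 : (((s.Tup ι Y).filter fun a ↦ ∃ p ∈ s.P,
      p ∉ Q.map ⟨Subtype.val, Subtype.val_injective⟩ ∧ p * p ∣ ∏ i, a i).card : ℝ) ≤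
      ∑ p ∈ W, (((s.Tup ι Y).filter fun a ↦ p * p ∣ ∏ i, a i).card : ℝ) := by
    exact_mod_cast (Finset.card_le_card hsub).trans Finset.card_biUnion_le
  refine h1.trans ?_
  have h2 : ∀ p ∈ W, (((s.Tup ι Y).filter fun a ↦ p * p ∣ ∏ i, a i).card : ℝ) ≤
      k ^ 2 * C * (Y * s.h Y ^ (k - 1)) * (1 / (s.N p) ^ 2) := by
    intro p hp
    have hNp := s.one_le_N p
    refine (s.card_sq_dvd_le ι p (hWP p hp) Y).trans ?_
    have h3 := hCY (Y / (s.N p) ^ 2) (by positivity)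
    have h4 : s.h (Y / (s.N p) ^ 2) ^ (k - 1) ≤ s.h Y ^ (k - 1) :=
      pow_le_pow_left₀ (s.h_nonneg _) (s.h_mono (div_le_self (by linarith) (one_le_pow₀ hNp))) _
    calc (k : ℝ) ^ 2 * ((s.Tup ι (Y / (s.N p) ^ 2)).card : ℝ)
        ≤ k ^ 2 * (C * (Y / (s.N p) ^ 2 * s.h Y ^ (k - 1))) := by
          gcongr
          refine h3.trans ?_
          gcongr
      _ = _ := by ring
  refine (Finset.sum_le_sum h2).trans ?_
  rw [← Finset.mul_sum]
  have hh := s.h_nonneg Y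
  calc k ^ 2 * C * (Y * s.h Y ^ (k - 1)) * ∑ p ∈ W, (1 : ℝ) / (s.N p) ^ 2
      ≤ k ^ 2 * C * (Y * s.h Y ^ (k - 1)) * (ε / (k ^ 2 * C)) := by gcongr
    _ = _ := by field_simp

end RaySys
end RaySysDiff

section RaySysEqui

open Topology
open scoped Classical

variable {D G : Type*} [CancelCommMonoid D] [CommGroup G] (s : RaySys D G)
variable {ι : Type*} [Fintype ι]

namespace RaySys

theorem dvd_of_mul_left_dvd_mul_left {M : Type*} [CancelCommMonoid M] {p a b : M}
    (h : p * a ∣ p * b) : a ∣ b := by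
  obtain ⟨c, hc⟩ := h
  exact ⟨c, mul_left_cancel (hc.trans (mul_assoc _ _ _))⟩

theorem sq_dvd_mul_iff {p x b : D} (hp : p ∈ s.P) (hb : ¬ p * p ∣ b) :
    p * p ∣ x * b ↔ p ^ (if p ∣ b then 1 else 2) ∣ x := by
  split_ifs with h
  · rw [pow_one]
    constructor
    · intro h1
      obtain ⟨c, rfl⟩ := h
      rw [mul_left_comm] at h1
      replace h1 := dvd_of_mul_left_dvd_mul_left h1
      rcases s.dvd_or p hp _ _ h1 with h2 | h2
      · exact h2
      · exact absurd (mul_dvd_mul_left p h2) hb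
    · exact fun h1 ↦ mul_dvd_mul h1 h
  · rw [sq]
    constructor
    · intro h1
      obtain ⟨y, rfl⟩ := (s.dvd_or p hp _ _ ((dvd_mul_right p p).trans h1)).resolve_right h
      rw [mul_assoc] at h1
      replace h1 := dvd_of_mul_left_dvd_mul_left h1
      exact mul_dvd_mul_left p ((s.dvd_or p hp _ _ h1).resolve_right h)
    · exact fun h1 ↦ h1.mul_right _

theorem exists_uniform_U_sub_le [Finite G] (Q : Finset D) (hQ : ∀ p ∈ Q, p ∈ s.P) (g g' : G)
    {ε : ℝ} (hε : 0 < ε) : ∃ C : ℝ, 0 ≤ C ∧ ∀ (b : D) (Z : ℝ), 0 ≤ Z →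
      |(s.U Q (fun p ↦ if p ∣ b then 1 else 2) g Z : ℝ) -
        s.U Q (fun p ↦ if p ∣ b then 1 else 2) g' Z| ≤ ε * Z + C := by
  choose C hC hCZ using fun S : Finset D ↦
    s.exists_U_sub_le Q hQ (fun p ↦ if p ∈ S then 1 else 2) g g' hε
  refine ⟨∑ S ∈ Q.powerset, C S, Finset.sum_nonneg fun S _ ↦ hC S, fun b Z hZ ↦ ?_⟩
  have hU : ∀ g, s.U Q (fun p ↦ if p ∣ b then 1 else 2) g Z =
      s.U Q (fun p ↦ if p ∈ Q.filter (· ∣ b) then 1 else 2) g Z := by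
    intro g
    rw [U, U]
    congr 1
    refine Finset.filter_congr fun a _ ↦ and_congr_right fun _ ↦ forall₂_congr fun p hp ↦ ?_
    simp only [Finset.mem_filter, hp, true_and]
  rw [hU, hU]
  refine (hCZ _ Z hZ).trans ?_
  gcongr
  exact Finset.single_le_sum (f := C) (fun S _ ↦ hC S)
    (Finset.mem_powerset.mpr (Finset.filter_subset _ _))

/-- The number of tuples in given classes whose product, with one factor left out, is squarefree,
and whose full product is squarefree at the primes of `Q`. -/
def V (i : ι) (Q : Finset D) (g : ι → G) (Y : ℝ) : ℕ :=
  ((s.Tup ι Y).filter fun a ↦ (∀ j, s.cl (a j) = g j) ∧ s.Sqf (∏ j : {j // j ≠ i}, a j) ∧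
    ∀ p ∈ Q, ¬ p * p ∣ ∏ j, a j).card

theorem T_le_V (i : ι) (Q : Finset D) (hQ : ∀ p ∈ Q, p ∈ s.P) (g : ι → G) (Y : ℝ) :
    s.T ι g Y ≤ s.V i Q g Y := by
  refine Finset.card_le_card fun a ha ↦ ?_
  rw [Finset.mem_filter] at ha ⊢
  obtain ⟨h0, h1, h2⟩ := ha
  refine ⟨h0, ?_⟩
  refine ⟨h1, fun p hp hd ↦ h2 p hp ?_, fun p hp ↦ h2 p (hQ p hp)⟩
  rw [Fintype.prod_eq_mul_prod_subtype_ne _ i]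
  exact hd.mul_left _

theorem V_le (i : ι) (Q : Finset D) (g : ι → G) (Y : ℝ) :
    s.V i Q g Y ≤ s.T ι g Y +
      ((s.Tup ι Y).filter fun a ↦ ∃ p ∈ s.P, p ∉ Q ∧ p * p ∣ ∏ i, a i).card := by
  rw [V, T]
  refine (Finset.card_le_card ?_).trans (Finset.card_union_le _ _)
  intro a ha
  rw [Finset.mem_filter] at ha
  obtain ⟨h1, h2, h3, h4⟩ := ha
  rw [Finset.mem_union, Finset.mem_filter, Finset.mem_filter]
  by_cases h5 : s.Sqf (∏ i, a i)
  · exact Or.inl ⟨h1, h2, h5⟩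
  · rw [Sqf] at h5
    push Not at h5
    obtain ⟨p, hp, hd⟩ := h5
    exact Or.inr ⟨h1, p, hp, fun h ↦ h4 p h hd, hd⟩

theorem V_eq (i : ι) (Q : Finset D) (hQ : ∀ p ∈ Q, p ∈ s.P) (g : ι → G) (Y : ℝ) :
    (s.V i Q g Y : ℝ) = ∑ b ∈ s.Tup {j // j ≠ i} Y,
      if (∀ j, s.cl (b j) = g j) ∧ s.Sqf (∏ j, b j) then
        (s.U Q (fun p ↦ if p ∣ ∏ j, b j then 1 else 2) (g i) (Y / s.N (∏ j, b j)) : ℝ) else 0 := by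
  rw [V, ← Finset.sum_boole, s.sum_Tup_split i]
  refine Finset.sum_congr rfl fun b _ ↦ ?_
  split_ifs with h
  · rw [U, ← Finset.sum_boole]
    refine Finset.sum_congr rfl fun x _ ↦ ?_
    congr 1
    rw [prod_glue]
    simp only [glue_ne]
    refine propext ⟨?_, ?_⟩
    · rintro ⟨h1, h2, h3⟩
      refine ⟨by rw [← h1 i, glue_same], fun p hp ↦ ?_⟩
      rw [← s.sq_dvd_mul_iff (hQ p hp) (h.2 p (hQ p hp))]
      exact h3 p hp
    · rintro ⟨h1, h2⟩
      refine ⟨fun j ↦ ?_, h.2, fun p hp ↦ ?_⟩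
      · by_cases hj : j = i
        · subst hj; rw [glue_same, h1]
        · rw [show j = ((⟨j, hj⟩ : {j // j ≠ i}) : ι) from rfl, glue_ne]
          exact h.1 _
      · rw [s.sq_dvd_mul_iff (hQ p hp) (h.2 p (hQ p hp))]
        exact h2 p hp
  · refine Finset.sum_eq_zero fun x _ ↦ if_neg fun h1 ↦ h ⟨fun j ↦ ?_, ?_⟩
    · rw [← h1.1 j, glue_ne]
    · simpa only [glue_ne] using h1.2.1

theorem abs_T_sub_le_of_eq_off [Finite G] (i : ι) (g g' : ι → G) (hg : ∀ j ≠ i, g j = g' j)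
    {ε : ℝ} (hε : 0 < ε) : ∀ᶠ Y : ℝ in atTop,
      |(s.T ι g Y : ℝ) - s.T ι g' Y| ≤ ε * (Y * Real.log Y ^ (Fintype.card ι - 1)) := by
  have : Nonempty ι := ⟨i⟩
  obtain ⟨c, hc, hch⟩ := s.exists_h_le
  set k := Fintype.card ι with hk
  have hk' : Fintype.card {j // j ≠ i} = k - 1 := by
    rw [Fintype.card_subtype_compl, Fintype.card_subtype_eq]
  set δ := ε / (4 * c ^ (k - 1)) with hδ
  have hδ0 : 0 < δ := by positivity
  obtain ⟨Q, hQ, hbad⟩ := s.card_bad_le ι hδ0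
  obtain ⟨C, hC, hCU⟩ := s.exists_uniform_U_sub_le Q hQ (g i) (g' i) hδ0
  filter_upwards [eventually_ge_atTop 2,
    s.card_Tup_small {j // j ≠ i} (ε := ε / (4 * (C + 1))) (by positivity)] with Y hY hsmall
  rw [hk'] at hsmall
  have hY0 : 0 ≤ Y := by linarith
  set W := Y * Real.log Y ^ (k - 1) with hW
  have hlog : 0 ≤ Real.log Y := Real.log_nonneg (by linarith)
  have hW0 : 0 ≤ W := by positivity
  have hhk : δ * (Y * s.h Y ^ (k - 1)) ≤ ε / 4 * W := by
    calc δ * (Y * s.h Y ^ (k - 1)) ≤ δ * (Y * (c * Real.log Y) ^ (k - 1)) := by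
          gcongr
          · exact s.h_nonneg Y
          · exact hch Y hY
      _ = ε / 4 * W := by rw [mul_pow, hδ, hW]; field_simp
  have hVT : ∀ g : ι → G, |(s.V i Q g Y : ℝ) - s.T ι g Y| ≤ ε / 4 * W := by
    intro g
    have h1 : (s.T ι g Y : ℝ) ≤ s.V i Q g Y := by exact_mod_cast s.T_le_V i Q hQ g Y
    have h2 : (s.V i Q g Y : ℝ) ≤ s.T ι g Y +
      ((s.Tup ι Y).filter fun a ↦ ∃ p ∈ s.P, p ∉ Q ∧ p * p ∣ ∏ i, a i).card := by
      exact_mod_cast s.V_le i Q g Y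
    rw [abs_of_nonneg (by linarith)]
    have h3 := hbad Y (by linarith)
    linarith
  have hVV : |(s.V i Q g Y : ℝ) - s.V i Q g' Y| ≤ ε / 2 * W := by
    rw [s.V_eq i Q hQ, s.V_eq i Q hQ, ← Finset.sum_sub_distrib]
    refine (Finset.abs_sum_le_sum_abs _ _).trans ?_
    have h1 : ∀ b ∈ s.Tup {j // j ≠ i} Y,
      |(if (∀ j, s.cl (b j) = g j) ∧ s.Sqf (∏ j, b j) then
        (s.U Q (fun p ↦ if p ∣ ∏ j, b j then 1 else 2) (g i) (Y / s.N (∏ j, b j)) : ℝ) else 0) -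
       (if (∀ j, s.cl (b j) = g' j) ∧ s.Sqf (∏ j, b j) then
        (s.U Q (fun p ↦ if p ∣ ∏ j, b j then 1 else 2) (g' i) (Y / s.N (∏ j, b j)) : ℝ) else 0)|
      ≤ δ * Y * (1 / s.N (∏ j, b j)) + C := by
      intro b _
      have h2 : (∀ j : {j // j ≠ i}, s.cl (b j) = g j) ↔ (∀ j : {j // j ≠ i}, s.cl (b j) = g' j) :=
        forall_congr' fun j ↦ by rw [hg j j.2]
      simp only [h2]
      split_ifs with h3
      · refine (hCU _ _ (by positivity)).trans (le_of_eq (by ring))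
      · rw [sub_self, abs_zero]; positivity
    refine (Finset.sum_le_sum h1).trans ?_
    rw [Finset.sum_add_distrib, ← Finset.mul_sum, Finset.sum_const, nsmul_eq_mul]
    have h2 := s.H_le {j // j ≠ i} Y
    rw [hk'] at h2
    have h3 : δ * Y * ∑ b ∈ s.Tup {j // j ≠ i} Y, (1 / (s.N (∏ j, b j) : ℝ)) ≤ ε / 4 * W := by
      refine le_trans ?_ hhk
      rw [mul_assoc]
      gcongr
      exact h2
    have h4 : ((s.Tup {j // j ≠ i} Y).card : ℝ) * C ≤ ε / 4 * W := by
      calc ((s.Tup {j // j ≠ i} Y).card : ℝ) * C ≤ (ε / (4 * (C + 1)) * W) * C := by gcongr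
        _ = ε / 4 * W * (C / (C + 1)) := by field_simp
        _ ≤ ε / 4 * W * 1 := by
            gcongr
            rw [div_le_one (by linarith)]; linarith
        _ = _ := mul_one _
    linarith
  have h1 := abs_le.mp (hVT g)
  have h2 := abs_le.mp (hVT g')
  have h3 := abs_le.mp hVV
  rw [abs_le]
  constructor <;> linarith

theorem abs_T_sub_le [Finite G] (g g' : ι → G)
    {ε : ℝ} (hε : 0 < ε) : ∀ᶠ Y : ℝ in atTop,
      |(s.T ι g Y : ℝ) - s.T ι g' Y| ≤ ε * (Y * Real.log Y ^ (Fintype.card ι - 1)) := by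
  have key : ∀ S : Finset ι, ∀ g g' : ι → G, (∀ j ∉ S, g j = g' j) → ∀ ε : ℝ, 0 < ε →
      ∀ᶠ Y : ℝ in atTop,
      |(s.T ι g Y : ℝ) - s.T ι g' Y| ≤ ε * (Y * Real.log Y ^ (Fintype.card ι - 1)) := by
    intro S
    induction S using Finset.induction_on with
    | empty =>
      intro g g' h ε hε
      obtain rfl : g = g' := funext fun j ↦ h j (Finset.notMem_empty _)
      filter_upwards [eventually_ge_atTop 1] with Y hY
      rw [sub_self, abs_zero]
      have := Real.log_nonneg hY
      positivity
    | insert i S hi ih =>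
      intro g g' h ε hε
      have h1 := ih g (Function.update g' i (g i)) (fun j hj ↦ by
        by_cases hji : j = i
        · subst hji; simp
        · rw [Function.update_of_ne hji]
          exact h j (by simp [hji, hj])) (ε / 2) (by positivity)
      have h2 := s.abs_T_sub_le_of_eq_off i (Function.update g' i (g i)) g'
        (fun j hj ↦ Function.update_of_ne hj _ _) (ε := ε / 2) (by positivity)
      filter_upwards [h1, h2] with Y h3 h4
      have := abs_sub_le (s.T ι g Y : ℝ) (s.T ι (Function.update g' i (g i)) Y) (s.T ι g' Y)
      linarith
  exact key Finset.univ g g' (fun j hj ↦ absurd (Finset.mem_univ j) hj) ε hε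

end RaySys
end RaySysEqui

section RaySysLower

open Topology
open scoped Classical

variable {D G : Type*} [CancelCommMonoid D] [CommGroup G] (s : RaySys D G)

namespace RaySys

theorem sum_biUnion_le_of_nonneg {α β : Type*} [DecidableEq α] [DecidableEq β] (A : Finset α) (t : α → Finset β) (f : β → ℝ)
    (hf : ∀ x, 0 ≤ f x) : ∑ x ∈ A.biUnion t, f x ≤ ∑ i ∈ A, ∑ x ∈ t i, f x := by
  induction A using Finset.induction_on with
  | empty => simp
  | insert a A ha ih =>
    rw [Finset.biUnion_insert, Finset.sum_insert ha]
    have h1 := Finset.sum_union_inter (s₁ := t a) (s₂ := A.biUnion t) (f := f)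
    have h2 : 0 ≤ ∑ x ∈ t a ∩ A.biUnion t, f x := Finset.sum_nonneg fun x _ ↦ hf x
    linarith

theorem card_dvd_le (d : D) (Z : ℝ) :
    ((s.B Z).filter (d ∣ ·)).card ≤ (s.B (Z / s.N d)).card := by
  have hNd := s.N_pos' d
  rw [← Finset.card_image_of_injective (s.B (Z / s.N d)) (mul_right_injective d)]
  refine Finset.card_le_card fun x hx ↦ ?_
  rw [Finset.mem_filter, mem_B] at hx
  obtain ⟨h1, y, rfl⟩ := hx
  refine Finset.mem_image.mpr ⟨y, ?_, rfl⟩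
  rw [mem_B, le_div_iff₀ hNd]
  rw [map_mul, Nat.cast_mul, mul_comm] at h1; exact h1

/-- The sum of the inverse squares of the norms of the primes. -/
def σ : ℝ := ∑' p : s.P, (1 : ℝ) / (s.N p) ^ 2

theorem σ_nonneg : 0 ≤ s.σ := tsum_nonneg fun _ ↦ by positivity

theorem sum_le_σ (W : Finset D) (hW : ∀ p ∈ W, p ∈ s.P) :
    ∑ p ∈ W, (1 : ℝ) / (s.N p) ^ 2 ≤ s.σ := by
  refine le_trans (le_of_eq ?_)
    (s.summable.sum_le_tsum (W.subtype (· ∈ s.P)) fun _ _ ↦ by positivity)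
  rw [Finset.sum_subtype_eq_sum_filter (s := W) (p := (· ∈ s.P)) fun p : D ↦ (1 : ℝ) / (s.N p) ^ 2,
      Finset.filter_true_of_mem hW]

theorem exists_finset_tail {δ : ℝ} (hδ : 0 < δ) : ∃ Q : Finset D, (∀ p ∈ Q, p ∈ s.P) ∧
    ∀ W : Finset D, (∀ p ∈ W, p ∈ s.P ∧ p ∉ Q) → ∑ p ∈ W, (1 : ℝ) / (s.N p) ^ 2 ≤ δ := by
  obtain ⟨Q, hQ⟩ := summable_iff_vanishing_norm.mp s.summable δ hδ
  refine ⟨Q.map ⟨Subtype.val, Subtype.val_injective⟩, fun p hp ↦ ?_, fun W hW ↦ ?_⟩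
  · obtain ⟨q, _, rfl⟩ := Finset.mem_map.mp hp
    exact q.2
  · have h1 := hQ (W.subtype (· ∈ s.P)) (by
      rw [Finset.disjoint_left]
      intro p hp hpQ
      rw [Finset.mem_subtype] at hp
      exact (hW _ hp).2 (Finset.mem_map.mpr ⟨p, hpQ, rfl⟩))
    rw [Real.norm_eq_abs] at h1
    refine le_trans (le_of_eq ?_) ((le_abs_self _).trans h1.le)
    rw [Finset.sum_subtype_eq_sum_filter (s := W) (p := (· ∈ s.P)) fun p : D ↦ (1 : ℝ) / (s.N p) ^ 2,
      Finset.filter_true_of_mem fun p hp ↦ (hW p hp).1]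

theorem exists_le_card_sqf [Finite G] (hσ : s.σ ≤ 1 / 16) : ∃ Z₁ : ℝ, 0 < Z₁ ∧
    ∀ (Z : ℝ) (F : Finset D), (∀ p ∈ F, p ∈ s.P) → Z₁ ≤ Z → (∀ p ∈ F, Z₁ ≤ Z / s.N p) →
      ∑ p ∈ F, (1 : ℝ) / s.N p ≤ 1 / 16 →
      s.ρ / 2 * Z ≤ (((s.B Z).filter fun x ↦ s.Sqf x ∧ ∀ p ∈ F, ¬ p ∣ x).card : ℝ) := by
  have hρ := s.ρ_pos
  obtain ⟨C, hC, hCY⟩ := s.exists_card_le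
  obtain ⟨Q, hQ, htail⟩ := s.exists_finset_tail (δ := s.ρ / (8 * C)) (by positivity)
  obtain ⟨Z₀, hZ₀⟩ := eventually_atTop.mp
    ((s.tendsto_card.eventually_le_const (show s.ρ < 2 * s.ρ by linarith)).and
      ((s.tendsto_card.eventually_const_le (show 7 / 8 * s.ρ < s.ρ by linarith)).and
        (eventually_gt_atTop 0)))
  have hZ₀0 : 0 < Z₀ := (hZ₀ Z₀ le_rfl).2.2
  have hup : ∀ Z, Z₀ ≤ Z → ((s.B Z).card : ℝ) ≤ 2 * s.ρ * Z := fun Z hZ ↦ by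
    have := (hZ₀ Z hZ).1
    rwa [div_le_iff₀ (hZ₀ Z hZ).2.2] at this
  have hlow : ∀ Z, Z₀ ≤ Z → 7 / 8 * s.ρ * Z ≤ ((s.B Z).card : ℝ) := fun Z hZ ↦ by
    have := (hZ₀ Z hZ).2.1
    rwa [le_div_iff₀ (hZ₀ Z hZ).2.2] at this
  refine ⟨Z₀ * ∑ p ∈ insert 1 Q, (s.N p : ℝ) ^ 2, ?_, ?_⟩
  · exact mul_pos hZ₀0 (Finset.sum_pos (fun p _ ↦ pow_pos (s.N_pos' p) 2)
      ⟨1, Finset.mem_insert_self _ _⟩)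
  intro Z F hF hZ hFZ hsum
  have hsingle : ∀ p ∈ insert 1 Q, (s.N p : ℝ) ^ 2 ≤ ∑ p ∈ insert 1 Q, (s.N p : ℝ) ^ 2 :=
    fun p hp ↦ Finset.single_le_sum (f := fun p ↦ (s.N p : ℝ) ^ 2) (fun _ _ ↦ by positivity) hp
  have hZ₁ : Z₀ ≤ Z₀ * ∑ p ∈ insert 1 Q, (s.N p : ℝ) ^ 2 := by
    refine le_mul_of_one_le_right hZ₀0.le ?_
    have := hsingle 1 (Finset.mem_insert_self _ _)
    simpa using this
  have hZZ : Z₀ ≤ Z := hZ₁.trans hZ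
  have hZ0 : 0 < Z := hZ₀0.trans_le hZZ
  set W := ((s.B Z).filter (· ∈ s.P)) \ Q with hW
  have hWP : ∀ p ∈ W, p ∈ s.P ∧ p ∉ Q := fun p hp ↦ by
    simp only [hW, Finset.mem_sdiff, Finset.mem_filter] at hp
    exact ⟨hp.1.2, hp.2⟩
  have hsub : s.B Z ⊆ ((s.B Z).filter fun x ↦ s.Sqf x ∧ ∀ p ∈ F, ¬ p ∣ x) ∪
      ((F.biUnion fun p ↦ (s.B Z).filter (p ∣ ·)) ∪
      ((Q.biUnion fun p ↦ (s.B Z).filter (p * p ∣ ·)) ∪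
       (W.biUnion fun p ↦ (s.B Z).filter (p * p ∣ ·)))) := by
    intro x hx
    simp only [Finset.mem_union, Finset.mem_filter, Finset.mem_biUnion, hx, true_and]
    by_cases h1 : ∃ p ∈ F, p ∣ x
    · exact Or.inr (Or.inl h1)
    by_cases h2 : s.Sqf x
    · push Not at h1
      exact Or.inl ⟨h2, h1⟩
    rw [Sqf] at h2
    push Not at h2
    obtain ⟨p, hp, hd⟩ := h2
    by_cases hpQ : p ∈ Q
    · exact Or.inr (Or.inr (Or.inl ⟨p, hpQ, hd⟩))
    refine Or.inr (Or.inr (Or.inr ⟨p, ?_, hd⟩))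
    rw [hW, Finset.mem_sdiff, Finset.mem_filter, mem_B]
    rw [mem_B] at hx
    refine ⟨⟨le_trans ?_ hx, hp⟩, hpQ⟩
    exact_mod_cast Nat.le_of_dvd (s.N_pos _) (map_dvd s.N ((dvd_mul_right p p).trans hd))
  have h1 : ((s.B Z).card : ℝ) ≤
      (((s.B Z).filter fun x ↦ s.Sqf x ∧ ∀ p ∈ F, ¬ p ∣ x).card : ℝ) +
      (∑ p ∈ F, (((s.B Z).filter (p ∣ ·)).card : ℝ) +
      (∑ p ∈ Q, (((s.B Z).filter (p * p ∣ ·)).card : ℝ) +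
       ∑ p ∈ W, (((s.B Z).filter (p * p ∣ ·)).card : ℝ))) := by
    refine le_trans (Nat.cast_le.mpr (Finset.card_le_card hsub)) ?_
    exact_mod_cast (Finset.card_union_le _ _).trans (add_le_add le_rfl
      ((Finset.card_union_le _ _).trans (add_le_add Finset.card_biUnion_le
      ((Finset.card_union_le _ _).trans (add_le_add Finset.card_biUnion_le
        Finset.card_biUnion_le)))))
  have h2 : ∑ p ∈ F, (((s.B Z).filter (p ∣ ·)).card : ℝ) ≤ s.ρ * Z / 8 := by
    calc ∑ p ∈ F, (((s.B Z).filter (p ∣ ·)).card : ℝ) ≤ ∑ p ∈ F, 2 * s.ρ * Z * (1 / s.N p) := by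
          refine Finset.sum_le_sum fun p hp ↦ ?_
          refine (Nat.cast_le.mpr (s.card_dvd_le p Z)).trans ((hup _ ?_).trans (le_of_eq (by ring)))
          exact hZ₁.trans (hFZ p hp)
      _ = 2 * s.ρ * Z * ∑ p ∈ F, (1 : ℝ) / s.N p := by rw [Finset.mul_sum]
      _ ≤ 2 * s.ρ * Z * (1 / 16) := by gcongr
      _ = _ := by ring
  have h3 : ∑ p ∈ Q, (((s.B Z).filter (p * p ∣ ·)).card : ℝ) ≤ s.ρ * Z / 8 := by
    calc ∑ p ∈ Q, (((s.B Z).filter (p * p ∣ ·)).card : ℝ)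
        ≤ ∑ p ∈ Q, 2 * s.ρ * Z * (1 / (s.N p) ^ 2) := by
          refine Finset.sum_le_sum fun p hp ↦ ?_
          refine (Nat.cast_le.mpr (s.card_dvd_le (p * p) Z)).trans ?_
          have hNp := s.N_pos' p
          rw [map_mul, Nat.cast_mul, ← sq]
          refine (hup _ ?_).trans (le_of_eq (by ring))
          rw [le_div_iff₀ (by positivity)]
          refine le_trans ?_ hZ
          gcongr
          exact hsingle p (Finset.mem_insert_of_mem hp)
      _ = 2 * s.ρ * Z * ∑ p ∈ Q, (1 : ℝ) / (s.N p) ^ 2 := by rw [Finset.mul_sum]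
      _ ≤ 2 * s.ρ * Z * (1 / 16) := by
          gcongr
          exact (s.sum_le_σ Q hQ).trans hσ
      _ = _ := by ring
  have h4 : ∑ p ∈ W, (((s.B Z).filter (p * p ∣ ·)).card : ℝ) ≤ s.ρ * Z / 8 := by
    calc ∑ p ∈ W, (((s.B Z).filter (p * p ∣ ·)).card : ℝ)
        ≤ ∑ p ∈ W, C * Z * (1 / (s.N p) ^ 2) := by
          refine Finset.sum_le_sum fun p hp ↦ ?_
          refine (Nat.cast_le.mpr (s.card_dvd_le (p * p) Z)).trans ?_
          rw [map_mul, Nat.cast_mul, ← sq]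
          exact (hCY _ (by positivity)).trans (le_of_eq (by ring))
      _ = C * Z * ∑ p ∈ W, (1 : ℝ) / (s.N p) ^ 2 := by rw [Finset.mul_sum]
      _ ≤ C * Z * (s.ρ / (8 * C)) := by
          gcongr
          exact htail W hWP
      _ = _ := by field_simp
  have h5 := hlow Z hZZ
  linarith

variable (ι : Type*) [Fintype ι]

/-- The primes of norm at most `R` dividing `b`. -/
def primesDvd (R : ℝ) (b : D) : Finset D := (s.B R).filter fun p ↦ p ∈ s.P ∧ p ∣ b

theorem half_H_le (R : ℝ)
    (hσ : ((Fintype.card ι : ℝ) ^ 2 + 16 * Fintype.card ι) * s.σ ≤ 1 / 2) :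
    s.H ι R / 2 ≤ ∑ b ∈ (s.Tup ι R).filter (fun b ↦ s.Sqf (∏ i, b i) ∧
      ∑ p ∈ s.primesDvd R (∏ i, b i), (1 : ℝ) / s.N p ≤ 1 / 16), (1 : ℝ) / s.N (∏ i, b i) := by
  set k := Fintype.card ι with hk
  have hH := s.H_nonneg ι R
  set PB := (s.B R).filter (· ∈ s.P) with hPB
  have hPBP : ∀ p ∈ PB, p ∈ s.P := fun p hp ↦ (Finset.mem_filter.mp hp).2
  have hle : ∀ b ∈ s.Tup ι R, ∀ p ∈ s.P, p ∣ ∏ i, b i → p ∈ PB := by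
    intro b hb p hp hd
    rw [mem_Tup] at hb
    rw [hPB, Finset.mem_filter, mem_B]
    refine ⟨le_trans ?_ hb, hp⟩
    exact_mod_cast Nat.le_of_dvd (s.N_pos _) (map_dvd s.N hd)
  have h1 : ∑ b ∈ (s.Tup ι R).filter (fun b ↦ ¬ s.Sqf (∏ i, b i)), (1 : ℝ) / s.N (∏ i, b i) ≤
      k ^ 2 * s.σ * s.H ι R := by
    calc ∑ b ∈ (s.Tup ι R).filter (fun b ↦ ¬ s.Sqf (∏ i, b i)), (1 : ℝ) / s.N (∏ i, b i)
        ≤ ∑ b ∈ PB.biUnion fun p ↦ (s.Tup ι R).filter (fun b ↦ p * p ∣ ∏ i, b i),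
          (1 : ℝ) / s.N (∏ i, b i) := by
          refine Finset.sum_le_sum_of_subset_of_nonneg (fun b hb ↦ ?_) fun _ _ _ ↦ by positivity
          rw [Finset.mem_filter, Sqf] at hb
          obtain ⟨hb, h⟩ := hb
          push Not at h
          obtain ⟨p, hp, hd⟩ := h
          exact Finset.mem_biUnion.mpr ⟨p, hle b hb p hp ((dvd_mul_right p p).trans hd),
            Finset.mem_filter.mpr ⟨hb, hd⟩⟩
      _ ≤ ∑ p ∈ PB, ∑ b ∈ (s.Tup ι R).filter (fun b ↦ p * p ∣ ∏ i, b i),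
          (1 : ℝ) / s.N (∏ i, b i) :=
          sum_biUnion_le_of_nonneg _ _ _ fun _ ↦ by positivity
      _ ≤ ∑ p ∈ PB, k ^ 2 * s.H ι R * (1 / (s.N p) ^ 2) := by
          refine Finset.sum_le_sum fun p hp ↦ ?_
          exact (s.H_sq_dvd_le ι p (hPBP p hp) R).trans (le_of_eq (by ring))
      _ = k ^ 2 * s.H ι R * ∑ p ∈ PB, (1 : ℝ) / (s.N p) ^ 2 := by rw [Finset.mul_sum]
      _ ≤ k ^ 2 * s.H ι R * s.σ := by
          gcongr
          exact s.sum_le_σ PB hPBP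
      _ = _ := by ring
  have h2 : ∑ b ∈ (s.Tup ι R).filter (fun b ↦
      ¬ ∑ p ∈ s.primesDvd R (∏ i, b i), (1 : ℝ) / s.N p ≤ 1 / 16), (1 : ℝ) / s.N (∏ i, b i) ≤
      16 * k * s.σ * s.H ι R := by
    calc ∑ b ∈ (s.Tup ι R).filter (fun b ↦
          ¬ ∑ p ∈ s.primesDvd R (∏ i, b i), (1 : ℝ) / s.N p ≤ 1 / 16), (1 : ℝ) / s.N (∏ i, b i)
        ≤ ∑ b ∈ (s.Tup ι R).filter (fun b ↦
          ¬ ∑ p ∈ s.primesDvd R (∏ i, b i), (1 : ℝ) / s.N p ≤ 1 / 16),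
          16 * ((1 : ℝ) / s.N (∏ i, b i) * ∑ p ∈ s.primesDvd R (∏ i, b i), (1 : ℝ) / s.N p) := by
          refine Finset.sum_le_sum fun b hb ↦ ?_
          have h3 := (Finset.mem_filter.mp hb).2
          have h4 : (0 : ℝ) ≤ 1 / s.N (∏ i, b i) := by positivity
          nlinarith
      _ ≤ ∑ b ∈ s.Tup ι R,
          16 * ((1 : ℝ) / s.N (∏ i, b i) * ∑ p ∈ s.primesDvd R (∏ i, b i), (1 : ℝ) / s.N p) :=
          Finset.sum_le_sum_of_subset_of_nonneg (Finset.filter_subset _ _) fun _ _ _ ↦ by positivity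
      _ = ∑ p ∈ PB, 16 / s.N p *
          ∑ b ∈ (s.Tup ι R).filter (fun b ↦ p ∣ ∏ i, b i), (1 : ℝ) / s.N (∏ i, b i) := by
          simp only [Finset.mul_sum]
          rw [Finset.sum_comm' (t' := PB)
            (s' := fun p ↦ (s.Tup ι R).filter (fun b ↦ p ∣ ∏ i, b i))]
          · refine Finset.sum_congr rfl fun p _ ↦ Finset.sum_congr rfl fun b _ ↦ by ring
          · intro b p
            simp only [primesDvd, hPB, Finset.mem_filter]
            tauto
      _ ≤ ∑ p ∈ PB, 16 / s.N p * (k / (s.N p) * s.H ι R) := by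
          refine Finset.sum_le_sum fun p hp ↦ ?_
          gcongr
          exact s.H_dvd_le ι p (hPBP p hp) R
      _ = 16 * k * s.H ι R * ∑ p ∈ PB, (1 : ℝ) / (s.N p) ^ 2 := by
          rw [Finset.mul_sum]
          exact Finset.sum_congr rfl fun p _ ↦ by ring
      _ ≤ 16 * k * s.H ι R * s.σ := by
          gcongr
          exact s.sum_le_σ PB hPBP
      _ = _ := by ring
  have h3 : s.H ι R ≤ ∑ b ∈ (s.Tup ι R).filter (fun b ↦ s.Sqf (∏ i, b i) ∧
      ∑ p ∈ s.primesDvd R (∏ i, b i), (1 : ℝ) / s.N p ≤ 1 / 16), (1 : ℝ) / s.N (∏ i, b i) +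
      (∑ b ∈ (s.Tup ι R).filter (fun b ↦ ¬ s.Sqf (∏ i, b i)), (1 : ℝ) / s.N (∏ i, b i) +
       ∑ b ∈ (s.Tup ι R).filter (fun b ↦
      ¬ ∑ p ∈ s.primesDvd R (∏ i, b i), (1 : ℝ) / s.N p ≤ 1 / 16), (1 : ℝ) / s.N (∏ i, b i)) := by
    rw [H, Finset.sum_filter, Finset.sum_filter, Finset.sum_filter, ← Finset.sum_add_distrib,
      ← Finset.sum_add_distrib]
    refine Finset.sum_le_sum fun b _ ↦ ?_
    have h4 : (0 : ℝ) ≤ 1 / s.N (∏ i, b i) := by positivity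
    split_ifs <;> first | linarith | tauto
  have h4 : (k ^ 2 + 16 * k) * s.σ * s.H ι R ≤ 1 / 2 * s.H ι R := by gcongr
  linarith

end RaySys
end RaySysLower

section RaySysMain

open Topology
open scoped Classical

variable {D G : Type*} [CancelCommMonoid D] [CommGroup G] (s : RaySys D G)
variable (ι : Type*) [Fintype ι]

namespace RaySys

theorem sqf_mul {R : ℝ} {x b : D} (hx : s.Sqf x) (hb : s.Sqf b) (hbR : (s.N b : ℝ) ≤ R)
    (h : ∀ p ∈ s.primesDvd R b, ¬ p ∣ x) : s.Sqf (x * b) := by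
  intro p hp hd
  rw [s.sq_dvd_mul_iff hp (hb p hp)] at hd
  split_ifs at hd with hpb
  · rw [pow_one] at hd
    refine h p ?_ hd
    rw [primesDvd, Finset.mem_filter, mem_B]
    refine ⟨le_trans ?_ hbR, hp, hpb⟩
    exact_mod_cast Nat.le_of_dvd (s.N_pos _) (map_dvd s.N hpb)
  · rw [sq] at hd
    exact hx p hp hd

theorem exists_le_card_Tup_sqf [Finite G] [Nonempty ι]
    (hσ : ((Fintype.card ι : ℝ) ^ 2 + 16 * Fintype.card ι) * s.σ ≤ 1 / 2) :
    ∃ c : ℝ, 0 < c ∧ ∀ᶠ Y : ℝ in atTop, c * (Y * Real.log Y ^ (Fintype.card ι - 1)) ≤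
      (((s.Tup ι Y).filter fun a ↦ s.Sqf (∏ i, a i)).card : ℝ) := by
  obtain ⟨i⟩ := ‹Nonempty ι›
  have : Nonempty ι := ⟨i⟩
  set k := Fintype.card ι with hk
  have hk' : Fintype.card {j // j ≠ i} = k - 1 := by
    rw [Fintype.card_subtype_compl, Fintype.card_subtype_eq]
  have hk0 : 0 < k := Fintype.card_pos
  have hk1 : (1 : ℝ) ≤ k := by exact_mod_cast hk0
  have hσ0 := s.σ_nonneg
  have hσ1 : s.σ ≤ 1 / 16 := by nlinarith
  have hσ' : ((Fintype.card {j // j ≠ i} : ℝ) ^ 2 + 16 * Fintype.card {j // j ≠ i}) * s.σ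
      ≤ 1 / 2 := by
    refine le_trans ?_ hσ
    have : (Fintype.card {j // j ≠ i} : ℝ) ≤ k := by
      rw [hk']; exact_mod_cast Nat.sub_le k 1
    gcongr
  have hρ := s.ρ_pos
  obtain ⟨Z₁, hZ₁, hcount⟩ := s.exists_le_card_sqf hσ1
  obtain ⟨c, hc, hch⟩ := s.exists_le_h
  refine ⟨s.ρ / 4 * (c / (4 * k)) ^ (k - 1), by positivity, ?_⟩
  have hW := (tendsto_rpow_atTop (y := 1 / (4 * (k : ℝ))) (by positivity)).eventually hch
  have hR := (tendsto_rpow_atTop (y := 1 / 2) (by norm_num)).eventually_ge_atTop Z₁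
  filter_upwards [eventually_ge_atTop 1, hW, hR] with Y hY hW hR
  have hY0 : 0 < Y := by linarith
  set R := Y ^ (1 / 4 : ℝ) with hRdef
  have hR1 : 1 ≤ R := Real.one_le_rpow hY (by norm_num)
  have hR0 : 0 < R := by linarith
  have hR2 : R ^ 2 = Y ^ (1 / 2 : ℝ) := by
    rw [hRdef, ← Real.rpow_natCast, ← Real.rpow_mul hY0.le]; norm_num
  have hR4 : R ^ 4 = Y := by
    rw [hRdef, ← Real.rpow_natCast, ← Real.rpow_mul hY0.le]; norm_num
  have hRY : R ≤ Y := by rw [← hR4]; exact le_self_pow₀ hR1 (by norm_num)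
  rw [← hR2] at hR
  rw [Real.log_rpow hY0] at hW
  set W := Y ^ (1 / (4 * (k : ℝ))) with hWdef
  have hW1 : 1 ≤ W := Real.one_le_rpow hY (by positivity)
  have hWk : W ^ k = R := by
    rw [hWdef, hRdef, ← Real.rpow_natCast, ← Real.rpow_mul hY0.le]
    congr 1
    field_simp
  have hlog : 0 ≤ Real.log Y := Real.log_nonneg hY
  have hH : (c / (4 * k)) ^ (k - 1) * Real.log Y ^ (k - 1) ≤ s.H {j // j ≠ i} R := by
    calc (c / (4 * k)) ^ (k - 1) * Real.log Y ^ (k - 1)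
        = (c * (1 / (4 * k) * Real.log Y)) ^ (k - 1) := by rw [← mul_pow]; congr 1; ring
      _ ≤ s.h W ^ (k - 1) := by gcongr
      _ ≤ s.H {j // j ≠ i} (W ^ (k - 1)) := by
          have := s.le_H {j // j ≠ i} W
          rwa [hk'] at this
      _ ≤ _ := s.H_mono _ (by rw [← hWk]; exact pow_le_pow_right₀ hW1 (Nat.sub_le _ _))
  set F := (s.Tup {j // j ≠ i} R).filter (fun b ↦ s.Sqf (∏ i, b i) ∧
      ∑ p ∈ s.primesDvd R (∏ i, b i), (1 : ℝ) / s.N p ≤ 1 / 16) with hF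
  calc s.ρ / 4 * (c / (4 * k)) ^ (k - 1) * (Y * Real.log Y ^ (k - 1))
      = s.ρ / 4 * Y * ((c / (4 * k)) ^ (k - 1) * Real.log Y ^ (k - 1)) := by ring
    _ ≤ s.ρ / 4 * Y * s.H {j // j ≠ i} R := by gcongr
    _ = s.ρ / 2 * Y * (s.H {j // j ≠ i} R / 2) := by ring
    _ ≤ s.ρ / 2 * Y * ∑ b ∈ F, (1 : ℝ) / s.N (∏ i, b i) := by
        gcongr
        exact s.half_H_le _ R hσ'
    _ = ∑ b ∈ F, s.ρ / 2 * (Y / s.N (∏ i, b i)) := by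
        rw [Finset.mul_sum]
        exact Finset.sum_congr rfl fun b _ ↦ by ring
    _ ≤ ∑ b ∈ F, ∑ x ∈ s.B (Y / s.N (∏ j, b j)),
          if s.Sqf (∏ j, glue i x b j) then (1 : ℝ) else 0 := by
        refine Finset.sum_le_sum fun b hb ↦ ?_
        rw [hF, Finset.mem_filter, mem_Tup] at hb
        obtain ⟨hbR, hbs, hbg⟩ := hb
        have hNb := s.N_pos' (∏ j, b j)
        rw [Finset.sum_boole]
        refine (hcount _ _ ?_ ?_ ?_ hbg).trans ?_
        · intro p hp
          exact (Finset.mem_filter.mp hp).2.1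
        · rw [le_div_iff₀ hNb]
          calc Z₁ * s.N (∏ j, b j) ≤ R ^ 2 * R ^ 2 := by
                gcongr
                exact hbR.trans (le_self_pow₀ hR1 (by norm_num))
            _ = Y := by rw [← hR4]; ring
        · intro p hp
          have hpR : (s.N p : ℝ) ≤ R := by simpa using (Finset.mem_filter.mp hp).1
          have hNp := s.N_pos' p
          rw [le_div_iff₀ hNp, le_div_iff₀ hNb]
          calc Z₁ * s.N p * s.N (∏ j, b j) ≤ R ^ 2 * R * R := by gcongr
            _ = Y := by rw [← hR4]; ring
        · refine Nat.cast_le.mpr (Finset.card_le_card fun x hx ↦ ?_)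
          rw [Finset.mem_filter] at hx ⊢
          refine ⟨hx.1, ?_⟩
          rw [prod_glue]
          exact s.sqf_mul hx.2.1 hbs hbR hx.2.2
    _ ≤ ∑ b ∈ s.Tup {j // j ≠ i} Y, ∑ x ∈ s.B (Y / s.N (∏ j, b j)),
          if s.Sqf (∏ j, glue i x b j) then (1 : ℝ) else 0 := by
        refine Finset.sum_le_sum_of_subset_of_nonneg ?_ fun _ _ _ ↦
          Finset.sum_nonneg fun _ _ ↦ by positivity
        exact (Finset.filter_subset _ _).trans (s.Tup_mono _ hRY)
    _ = _ := by rw [← s.sum_Tup_split i Y fun a ↦ if s.Sqf (∏ j, a j) then (1 : ℝ) else 0,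
                  Finset.sum_boole]

theorem exists_le_T [Finite G] [Nonempty ι]
    (hσ : ((Fintype.card ι : ℝ) ^ 2 + 16 * Fintype.card ι) * s.σ ≤ 1 / 2) (g : ι → G) :
    ∃ c : ℝ, 0 < c ∧ ∀ᶠ Y : ℝ in atTop, c * (Y * Real.log Y ^ (Fintype.card ι - 1)) ≤
      (s.T ι g Y : ℝ) := by
  have : Fintype G := Fintype.ofFinite G
  obtain ⟨c, hc, hcY⟩ := s.exists_le_card_Tup_sqf ι hσ
  set n : ℝ := (Fintype.card (ι → G) : ℝ) with hn
  have hn0 : 0 < n := by rw [hn]; exact_mod_cast Fintype.card_pos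
  refine ⟨c / (2 * n), by positivity, ?_⟩
  have h1 := Filter.eventually_all.mpr fun g' : ι → G ↦
    s.abs_T_sub_le g' g (ε := c / (2 * n)) (by positivity)
  filter_upwards [hcY, h1] with Y h2 h3
  set W := Y * Real.log Y ^ (Fintype.card ι - 1) with hW
  have h4 : (((s.Tup ι Y).filter fun a ↦ s.Sqf (∏ i, a i)).card : ℝ) =
      ∑ g' : ι → G, (s.T ι g' Y : ℝ) := by
    rw [← Nat.cast_sum, Nat.cast_inj,
      Finset.card_eq_sum_card_fiberwise (f := fun a : ι → D ↦ fun i ↦ s.cl (a i))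
        (t := (Finset.univ : Finset (ι → G))) (fun _ _ ↦ Finset.mem_univ _)]
    refine Finset.sum_congr rfl fun g' _ ↦ ?_
    rw [T, Finset.filter_filter]
    congr 1
    refine Finset.filter_congr fun a _ ↦ ?_
    rw [funext_iff, and_comm]
  have h5 : ∑ g' : ι → G, (s.T ι g' Y : ℝ) ≤ ∑ g' : ι → G, ((s.T ι g Y : ℝ) + c / (2 * n) * W) :=
    Finset.sum_le_sum fun g' _ ↦ by
      have := (abs_le.mp (h3 g')).2
      linarith
  rw [Finset.sum_const, Finset.card_univ, nsmul_eq_mul, ← hn, mul_add] at h5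
  have h6 : n * (c / (2 * n) * W) = c * W / 2 := by field_simp
  rw [h4] at h2
  have h7 : c / (2 * n) * W = (c * W / 2) / n := by field_simp
  rw [h7, div_le_iff₀ hn0]
  linarith

theorem tendsto_T_atTop [Finite G] [Nonempty ι]
    (hσ : ((Fintype.card ι : ℝ) ^ 2 + 16 * Fintype.card ι) * s.σ ≤ 1 / 2) (g : ι → G) :
    Tendsto (fun Y ↦ (s.T ι g Y : ℝ)) atTop atTop := by
  obtain ⟨c, hc, hcY⟩ := s.exists_le_T ι hσ g
  refine tendsto_atTop_mono' _ ?_ (tendsto_id.const_mul_atTop hc)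
  filter_upwards [hcY, Real.tendsto_log_atTop.eventually_ge_atTop 1, eventually_ge_atTop 0]
    with Y h1 h2 h3
  refine le_trans ?_ h1
  rw [id]
  gcongr
  exact le_mul_of_one_le_right h3 (one_le_pow₀ h2)

theorem tendsto_T_div [Finite G] [Nonempty ι]
    (hσ : ((Fintype.card ι : ℝ) ^ 2 + 16 * Fintype.card ι) * s.σ ≤ 1 / 2) (g g' : ι → G) :
    Tendsto (fun Y ↦ (s.T ι g Y : ℝ) / s.T ι g' Y) atTop (𝓝 1) := by
  obtain ⟨c, hc, hcY⟩ := s.exists_le_T ι hσ g'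
  rw [tendsto_iff_norm_sub_tendsto_zero]
  rw [Metric.tendsto_nhds]
  intro ε hε
  filter_upwards [hcY, s.abs_T_sub_le g g' (ε := ε / 2 * c) (by positivity),
    (s.tendsto_T_atTop ι hσ g').eventually_gt_atTop 0] with Y h1 h2 h3
  rw [dist_zero_right, norm_norm, Real.norm_eq_abs, div_sub_one h3.ne', abs_div, abs_of_pos h3,
    div_lt_iff₀ h3]
  calc |(s.T ι g Y : ℝ) - s.T ι g' Y| ≤ ε / 2 * (c * (Y * Real.log Y ^ (Fintype.card ι - 1))) := by
        rw [← mul_assoc]; exact h2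
    _ ≤ ε / 2 * s.T ι g' Y := by gcongr
    _ < ε * s.T ι g' Y := by gcongr; linarith

end RaySys
end RaySysMain

section RayInstance

open Topology Ideal

variable {R : Type*} [CommRing R] [IsDedekindDomain R]

instance (M : Ideal R) : CancelCommMonoid (copIdeals M) where
  mul_left_cancel a b c h := by
    have h1 : (a : Ideal R) * b = a * c := congr_arg Subtype.val h
    exact Subtype.ext (mul_left_cancel₀ a.2.1 h1)

theorem copIdeals_dvd_iff {M : Ideal R} {a b : copIdeals M} : a ∣ b ↔ (a : Ideal R) ∣ b := by
  constructor
  · rintro ⟨c, rfl⟩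
    exact ⟨c, rfl⟩
  · rintro ⟨c, hc⟩
    refine ⟨⟨c, ?_, ?_⟩, Subtype.ext hc⟩
    · rintro rfl
      refine b.2.1 (hc.trans ?_)
      simp
    · have h := b.2.2
      rw [hc] at h
      exact h.of_mul_left_right

variable (K : Type*) [Field K] [NumberField K]

theorem exists_card_absNorm_le : ∃ C : ℝ, 0 < C ∧ ∀ n : ℕ, 1 ≤ n →
    (Nat.card {I : Ideal (𝓞 K) // (absNorm I : ℝ) ≤ n} : ℝ) ≤ C * n := by
  obtain ⟨C, hC⟩ := ((NumberField.Ideal.tendsto_norm_le_div_atTop K).comp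
    tendsto_natCast_atTop_atTop).bddAbove_range
  refine ⟨max C 1, by positivity, fun n hn ↦ ?_⟩
  have hn0 : (0 : ℝ) < n := by exact_mod_cast hn
  rw [← div_le_iff₀ hn0]
  exact (hC ⟨n, rfl⟩).trans (le_max_left _ _)

theorem summable_inv_absNorm_sq :
    Summable fun I : {I : Ideal (𝓞 K) // I ≠ ⊥} ↦ (1 : ℝ) / (absNorm (I : Ideal (𝓞 K))) ^ 2 := by
  classical
  obtain ⟨C, hC, hcard⟩ := exists_card_absNorm_le K
  have hpos : ∀ I : {I : Ideal (𝓞 K) // I ≠ ⊥}, absNorm (I : Ideal (𝓞 K)) ≠ 0 := fun I h ↦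
    I.2 (absNorm_eq_zero_iff.mp h)
  refine summable_of_sum_le (c := 4 * C) (fun _ ↦ by positivity) fun F ↦ ?_
  set f : {I : Ideal (𝓞 K) // I ≠ ⊥} → ℕ := fun I ↦ Nat.log 2 (absNorm (I : Ideal (𝓞 K))) with hf
  rw [← Finset.sum_fiberwise_of_maps_to (t := F.image f) (g := f)
    fun I hI ↦ Finset.mem_image_of_mem f hI]
  have hgeo : ∑ j ∈ F.image f, 2 * C * (1 / 2 : ℝ) ^ j ≤ 4 * C := by
    rw [← Finset.mul_sum]
    have := summable_geometric_two.sum_le_tsum (F.image f) fun _ _ ↦ by positivity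
    rw [tsum_geometric_two] at this
    nlinarith
  refine le_trans (Finset.sum_le_sum fun j _ ↦ ?_) hgeo
  have h1 : ∀ I ∈ F.filter (f · = j), (1 : ℝ) / (absNorm (I : Ideal (𝓞 K))) ^ 2 ≤ 1 / (4 : ℝ) ^ j := by
    intro I hI
    rw [Finset.mem_filter] at hI
    have h2 : 2 ^ j ≤ absNorm (I : Ideal (𝓞 K)) := by
      rw [← hI.2]; exact Nat.pow_log_le_self 2 (hpos I)
    have h3 : (2 : ℝ) ^ j ≤ absNorm (I : Ideal (𝓞 K)) := by exact_mod_cast h2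
    rw [show (4 : ℝ) ^ j = (2 ^ j) ^ 2 by rw [← pow_mul, mul_comm, pow_mul]; norm_num]
    gcongr
  refine (Finset.sum_le_sum h1).trans ?_
  rw [Finset.sum_const, nsmul_eq_mul]
  have h4 : ((F.filter (f · = j)).card : ℝ) ≤ C * (2 ^ (j + 1) : ℕ) := by
    refine le_trans ?_ (hcard (2 ^ (j + 1)) Nat.one_le_two_pow)
    rw [Nat.cast_le, ← Fintype.card_coe, ← Nat.card_eq_fintype_card]
    refine Nat.card_le_card_of_injective (fun I ↦ ⟨(I : {I : Ideal (𝓞 K) // I ≠ ⊥}), ?_⟩) ?_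
    · have hI : Nat.log 2 (absNorm ((I : {I : Ideal (𝓞 K) // I ≠ ⊥}) : Ideal (𝓞 K))) = j :=
        (Finset.mem_filter.mp I.2).2
      have := (Nat.lt_pow_succ_log_self (b := 2) one_lt_two
        (absNorm ((I : {I : Ideal (𝓞 K) // I ≠ ⊥}) : Ideal (𝓞 K)))).le
      rw [hI] at this
      exact_mod_cast this
    · intro I I' h
      exact Subtype.ext (Subtype.ext (Subtype.mk.inj h))
  calc ((F.filter (f · = j)).card : ℝ) * (1 / (4 : ℝ) ^ j)
      ≤ C * (2 ^ (j + 1) : ℕ) * (1 / (4 : ℝ) ^ j) := by gcongr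
    _ = 2 * C * (1 / 2) ^ j := by
      push_cast
      rw [show (4 : ℝ) ^ j = 2 ^ j * 2 ^ j by rw [← mul_pow]; norm_num, pow_succ, one_div_pow]
      field_simp

variable {K}

/-- An ideal coprime to `M` as a nonzero ideal. -/
def toNeBot (M : Ideal R) (a : copIdeals M) : {I : Ideal R // I ≠ ⊥} := ⟨a, a.2.1⟩

theorem toNeBot_injective (M : Ideal R) : Function.Injective (toNeBot M) :=
  fun _ _ h ↦ Subtype.ext (Subtype.mk.inj h)

/-- The norm on the ideals coprime to `M`. -/
def rayNorm (M : Ideal (𝓞 K)) : copIdeals M →* ℕ :=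
  (absNorm : Ideal (𝓞 K) →*₀ ℕ).toMonoidHom.comp (copIdeals M).subtype

theorem rayNorm_apply (M : Ideal (𝓞 K)) (a : copIdeals M) :
    rayNorm M a = absNorm (a : Ideal (𝓞 K)) := rfl

theorem summable_rayNorm (M : Ideal (𝓞 K)) :
    Summable fun p : {p : copIdeals M | (p : Ideal (𝓞 K)).IsPrime} ↦
      (1 : ℝ) / (rayNorm M p) ^ 2 := by
  have h := (summable_inv_absNorm_sq K).comp_injective
    ((toNeBot_injective M).comp (Subtype.val_injective
      (p := fun p : copIdeals M ↦ (p : Ideal (𝓞 K)).IsPrime)))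
  refine h.congr fun p ↦ ?_
  rw [rayNorm_apply, Function.comp_apply, Function.comp_apply, toNeBot]

/-- The system of ideals coprime to the modulus `M`. -/
def raySys (M : Ideal (𝓞 K)) (hM : M ≠ ⊥) : RaySys (copIdeals M) (RayClass M) where
  N := rayNorm M
  cl := rayMk M
  P := {p | (p : Ideal (𝓞 K)).IsPrime}
  dens := (exists_tendsto_card_ray K M hM).choose
  N_pos a := Nat.pos_of_ne_zero fun h ↦ by
    rw [rayNorm_apply] at h
    exact a.2.1 (absNorm_eq_zero_iff.mp h)
  finite_le Y := by
    have h : Finite {a : copIdeals M // (absNorm (a : Ideal (𝓞 K)) : ℝ) ≤ Y} := by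
      refine Finite.of_injective (β := {I : Ideal (𝓞 K) // (absNorm I : ℝ) ≤ Y})
        (fun a ↦ ⟨a.1, a.2⟩) fun a b hab ↦ ?_
      exact Subtype.ext (Subtype.ext (Subtype.mk.inj hab))
    exact Set.finite_coe_iff.mp h
  dvd_or p hp a b h := by
    simp only [copIdeals_dvd_iff] at h ⊢
    exact (Ideal.prime_of_isPrime p.2.1 hp).dvd_or_dvd h
  not_dvd_one p hp h := by
    rw [copIdeals_dvd_iff] at h
    exact (Ideal.prime_of_isPrime p.2.1 hp).not_dvd_one h
  pow_dvd p hp q hq hpq i j a h := by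
    rw [copIdeals_dvd_iff] at h ⊢
    have hp' := Ideal.prime_of_isPrime p.2.1 hp
    refine hp'.pow_dvd_of_dvd_mul_left i (fun h1 ↦ hpq ?_) h
    have h2 := hp'.dvd_of_dvd_pow h1
    rw [Ideal.dvd_iff_le] at h2
    have := (Ideal.IsPrime.isMaximal hq q.2.1).eq_of_le hp.ne_top h2
    exact Subtype.ext this.symm
  summable := summable_rayNorm M
  dens_pos := (exists_tendsto_card_ray K M hM).choose_spec.1
  tendsto := (exists_tendsto_card_ray K M hM).choose_spec.2

theorem raySys_N (M : Ideal (𝓞 K)) (hM : M ≠ ⊥) (a : copIdeals M) :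
    (raySys M hM).N a = absNorm (a : Ideal (𝓞 K)) := rfl

theorem exists_raySys_σ_le {δ : ℝ} (hδ : 0 < δ) : ∃ n : ℕ, ∀ (M : Ideal (𝓞 K)) (hM : M ≠ ⊥),
    (∀ p : Ideal (𝓞 K), p.IsPrime → absNorm p ≤ n → ¬ IsCoprime p M) →
    (raySys M hM).σ ≤ δ := by
  classical
  obtain ⟨Q, hQ⟩ := summable_iff_vanishing_norm.mp (summable_inv_absNorm_sq K) δ hδ
  refine ⟨∑ I ∈ Q, absNorm (I : Ideal (𝓞 K)), fun M hM h ↦ ?_⟩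
  rw [RaySys.σ]
  refine Real.tsum_le_of_sum_le (fun _ ↦ by positivity) fun W ↦ ?_
  have hinj : Function.Injective fun p : (raySys M hM).P ↦ toNeBot M p.1 :=
    (toNeBot_injective M).comp Subtype.val_injective
  have hdisj : Disjoint (W.map ⟨_, hinj⟩) Q := by
    rw [Finset.disjoint_left]
    intro I hI hIQ
    have h3 : absNorm (I : Ideal (𝓞 K)) ≤ ∑ I ∈ Q, absNorm (I : Ideal (𝓞 K)) :=
      Finset.single_le_sum (f := fun I : {I : Ideal (𝓞 K) // I ≠ ⊥} ↦
        absNorm (I : Ideal (𝓞 K))) (fun _ _ ↦ Nat.zero_le _) hIQ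
    obtain ⟨p, _, hp⟩ := Finset.mem_map.mp hI
    have h4 : (I : Ideal (𝓞 K)) = p.1 := by rw [← hp]; rfl
    rw [h4] at h3
    exact h p.1 p.2 h3 p.1.2.2
  have h1 := hQ _ hdisj
  rw [Real.norm_eq_abs, Finset.sum_map] at h1
  refine le_trans (le_of_eq ?_) ((le_abs_self _).trans h1.le)
  refine Finset.sum_congr rfl fun p _ ↦ ?_
  rw [raySys_N, Function.Embedding.coeFn_mk, toNeBot]

end RayInstance

section OrdP

open IsDedekindDomain WithZero

variable {R : Type*} [CommRing R] [IsDedekindDomain R] {K : Type*} [Field K] [Algebra R K]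
  [IsFractionRing R K]

/-- The additive valuation of `K` at a height one prime `p`, with value `0` at `0`. -/
def ordP (p : HeightOneSpectrum R) (x : K) : ℤ := -log (p.valuation K x)

variable (p : HeightOneSpectrum R)

theorem valuation_eq_exp_ordP {x : K} (hx : x ≠ 0) : p.valuation K x = exp (-ordP p x) := by
  rw [ordP, neg_neg, exp_log]
  exact (Valuation.ne_zero_iff _).2 hx

theorem ordP_mul {x y : K} (hx : x ≠ 0) (hy : y ≠ 0) : ordP p (x * y) = ordP p x + ordP p y := by
  have hx' := (Valuation.ne_zero_iff (p.valuation K)).2 hx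
  have hy' := (Valuation.ne_zero_iff (p.valuation K)).2 hy
  rw [ordP, map_mul, log_mul hx' hy', ordP, ordP]
  ring

theorem ordP_pow (x : K) (n : ℕ) : ordP p (x ^ n) = n * ordP p x := by
  simp [ordP, log_pow]

theorem ordP_zpow (x : K) (n : ℤ) : ordP p (x ^ n) = n * ordP p x := by
  simp [ordP]

theorem ordP_inv (x : K) : ordP p x⁻¹ = -ordP p x := by
  simp [ordP]

theorem ordP_div {x y : K} (hx : x ≠ 0) (hy : y ≠ 0) : ordP p (x / y) = ordP p x - ordP p y := by
  rw [div_eq_mul_inv, ordP_mul p hx (inv_ne_zero hy), ordP_inv, sub_eq_add_neg]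

@[simp]
theorem ordP_one : ordP p (1 : K) = 0 := by
  simp [ordP]

@[simp]
theorem ordP_neg (x : K) : ordP p (-x) = ordP p x := by
  simp [ordP]

theorem le_ordP_iff {x : K} (hx : x ≠ 0) {k : ℤ} :
    k ≤ ordP p x ↔ p.valuation K x ≤ exp (-k) := by
  rw [valuation_eq_exp_ordP p hx, exp_le_exp, neg_le_neg_iff]

theorem ordP_algebraMap_nonneg (r : R) : 0 ≤ ordP p (algebraMap R K r) := by
  by_cases hr : algebraMap R K r = 0
  · simp [hr, ordP]
  · rw [le_ordP_iff p hr, neg_zero, exp_zero]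
    exact p.valuation_le_one r

theorem ordP_algebraMap_eq_zero_iff {r : R} (hr : r ≠ 0) :
    ordP p (algebraMap R K r) = 0 ↔ r ∉ p.asIdeal := by
  have h0 : algebraMap R K r ≠ 0 := by simpa using hr
  rw [← p.valuation_eq_one_iff_notMem (K := K), valuation_eq_exp_ordP p h0, exp_eq_one, neg_eq_zero]

theorem exists_ordP_eq_one : ∃ r : R, r ≠ 0 ∧ ordP p (algebraMap R K r) = 1 := by
  obtain ⟨r, hr⟩ := p.intValuation_exists_uniformizer
  have h0 : r ≠ 0 := by
    rintro rfl
    rw [map_zero] at hr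
    exact exp_ne_zero hr.symm
  refine ⟨r, h0, ?_⟩
  rw [ordP, p.valuation_of_algebraMap, hr]
  simp

theorem mem_pow_iff_le_ordP {r : R} (hr : r ≠ 0) (n : ℕ) :
    r ∈ p.asIdeal ^ n ↔ (n : ℤ) ≤ ordP p (algebraMap R K r) := by
  have h0 : algebraMap R K r ≠ 0 := by simpa using hr
  rw [le_ordP_iff p h0, p.valuation_of_algebraMap]
  exact (p.intValuation_le_pow_iff_mem r n).symm

/-- Elements of valuation at least `k` at `p`, including `0`. -/
def ordPGe (k : ℤ) : Submodule R K where
  carrier := {x | p.valuation K x ≤ exp (-k)}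
  add_mem' {x y} hx hy :=
    le_trans (Valuation.map_add (p.valuation K) x y) (max_le hx hy)
  zero_mem' := by simp
  smul_mem' r x hx := by
    rw [Set.mem_ofPred_eq, Algebra.smul_def, map_mul]
    exact mul_le_of_le_one_of_le (p.valuation_le_one r) hx

theorem mem_ordPGe {k : ℤ} {x : K} : x ∈ ordPGe p k ↔ x = 0 ∨ k ≤ ordP p x := by
  by_cases hx : x = 0
  · simp [hx, ordPGe]
  · rw [le_ordP_iff p hx]
    simp [hx, ordPGe]

theorem ordP_add {x y : K} (hxy : x + y ≠ 0) {k : ℤ} (hx : x = 0 ∨ k ≤ ordP p x)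
    (hy : y = 0 ∨ k ≤ ordP p y) : k ≤ ordP p (x + y) := by
  rw [← mem_ordPGe] at hx hy
  exact ((mem_ordPGe p).1 (add_mem hx hy)).resolve_left hxy

theorem ordP_add_eq {x y : K} (hx : x ≠ 0) (hy : y = 0 ∨ ordP p x < ordP p y) :
    x + y ≠ 0 ∧ ordP p (x + y) = ordP p x := by
  rcases hy with rfl | hy
  · simpa
  have hy0 : p.valuation K y < p.valuation K x := by
    by_cases h : y = 0
    · rw [h, map_zero]
      exact zero_lt_iff.2 ((Valuation.ne_zero_iff _).2 hx)
    · rw [valuation_eq_exp_ordP p hx, valuation_eq_exp_ordP p h, exp_lt_exp]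
      omega
  have h := Valuation.map_add_eq_of_lt_left (p.valuation K) hy0
  refine ⟨fun h0 ↦ ?_, ?_⟩
  · rw [h0, map_zero, eq_comm, Valuation.zero_iff] at h
    exact hx h
  · rw [ordP, h, ordP]

theorem ordPGe_mul {k l : ℤ} {x y : K} (hx : x ∈ ordPGe p k) (hy : y ∈ ordPGe p l) :
    x * y ∈ ordPGe p (k + l) := by
  by_cases hx0 : x = 0
  · simp [hx0]
  by_cases hy0 : y = 0
  · simp [hy0]
  rw [mem_ordPGe] at *
  right
  rw [ordP_mul p hx0 hy0]
  have := hx.resolve_left hx0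
  have := hy.resolve_left hy0
  omega

open FractionalIdeal in
theorem count_spanSingleton_algebraMap {r : R} (hr : r ≠ 0) :
    count K p (spanSingleton R⁰ (algebraMap R K r)) = ordP p (algebraMap R K r) := by
  rw [← coeIdeal_span_singleton, count_coe K p (by simpa using hr), ordP, p.valuation_of_algebraMap,
    p.intValuation_if_neg hr, log_exp, neg_neg]

open FractionalIdeal in
theorem count_spanSingleton {x : K} (hx : x ≠ 0) :
    count K p (spanSingleton R⁰ x) = ordP p x := by
  obtain ⟨r, s, hs, rfl⟩ := IsFractionRing.div_surjective (A := R) x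
  have hs0 : s ≠ 0 := nonZeroDivisors.ne_zero hs
  have hr0 : r ≠ 0 := by
    rintro rfl
    simp at hx
  have hs' : algebraMap R K s ≠ 0 := by simpa using hs0
  have hr' : algebraMap R K r ≠ 0 := by simpa using hr0
  rw [ordP_div p hr' hs', ← count_spanSingleton_algebraMap p hr0,
    ← count_spanSingleton_algebraMap p hs0, div_eq_mul_inv, ← spanSingleton_mul_spanSingleton,
    count_mul K p (spanSingleton_ne_zero_iff.2 hr') (spanSingleton_ne_zero_iff.2 (inv_ne_zero hs')), ← spanSingleton_inv,
    count_inv, sub_eq_add_neg]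

open FractionalIdeal in
theorem le_count_of_forall {I : FractionalIdeal R⁰ K} (hI : I ≠ 0) {k : ℤ}
    (h : ∀ x ∈ I, x ∈ ordPGe p k) : k ≤ count K p I := by
  obtain ⟨d, A, hd, rfl⟩ := exists_eq_spanSingleton_mul I
  have hd' : algebraMap R K d ≠ 0 := by simpa using hd
  have hA : A ≠ 0 := by
    rintro rfl
    simp at hI
  rw [count_mul K p (spanSingleton_ne_zero_iff.2 (inv_ne_zero hd')) (by simpa using hA), count_spanSingleton p (inv_ne_zero hd'),
    ordP_inv]
  suffices h' : k + ordP p (algebraMap R K d) ≤ count K p (A : FractionalIdeal R⁰ K) by omega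
  by_cases hneg : k + ordP p (algebraMap R K d) ≤ 0
  · exact hneg.trans (count_coe_nonneg K p A)
  obtain ⟨n, hn⟩ : ∃ n : ℕ, k + ordP p (algebraMap R K d) = n :=
    ⟨_, (Int.toNat_of_nonneg (by omega)).symm⟩
  have hle : A ≤ p.asIdeal ^ n := by
    intro a ha
    by_cases ha0 : a = 0
    · simp [ha0]
    have ha' : algebraMap R K a ≠ 0 := by simpa using ha0
    rw [mem_pow_iff_le_ordP (K := K) p ha0, ← hn]
    have hm := h ((algebraMap R K d)⁻¹ * algebraMap R K a)
      (mul_mem_mul (mem_spanSingleton_self _ _) (mem_coeIdeal_of_mem _ ha))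
    have h1 := ((mem_ordPGe p).1 hm).resolve_left (mul_ne_zero (inv_ne_zero hd') ha')
    rw [ordP_mul p (inv_ne_zero hd') ha', ordP_inv] at h1
    omega
  rw [hn, ← count_pow_self (K := K) (v := p) n, ← coeIdeal_pow]
  exact count_mono K p (by simpa using hA) (coeIdeal_le_coeIdeal' _ le_rfl |>.2 hle)

open FractionalIdeal in
theorem count_le_of_mem {I : FractionalIdeal R⁰ K} {x : K} (hx : x ∈ I) (hx0 : x ≠ 0) :
    count K p I ≤ ordP p x := by
  rw [← count_spanSingleton p hx0]
  exact count_mono K p (spanSingleton_ne_zero_iff.2 hx0) (by simpa using hx)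

open FractionalIdeal in
theorem mem_ordPGe_count {I : FractionalIdeal R⁰ K} {x : K} (hx : x ∈ I) :
    x ∈ ordPGe p (count K p I) := by
  rw [mem_ordPGe]
  by_cases hx0 : x = 0
  · exact .inl hx0
  · exact .inr (count_le_of_mem p hx hx0)

open FractionalIdeal in
theorem le_count_of_span {I : FractionalIdeal R⁰ K} (hI : I ≠ 0) {S : Set K}
    (hS : (I : Submodule R K) = Submodule.span R S) {k : ℤ}
    (h : ∀ x ∈ S, x ∈ ordPGe p k) : k ≤ count K p I := by
  apply le_count_of_forall p hI
  intro x hx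
  rw [← mem_coe, hS] at hx
  exact (Submodule.span_le.2 h) hx

open FractionalIdeal in
theorem exists_ordP_eq_count {I : FractionalIdeal R⁰ K} (hI : I ≠ 0) {S : Set K}
    (hS : (I : Submodule R K) = Submodule.span R S) :
    ∃ x ∈ S, x ≠ 0 ∧ ordP p x = count K p I := by
  by_contra! hcon
  have := le_count_of_span p hI hS (k := count K p I + 1) fun x hx ↦ by
    rw [mem_ordPGe]
    by_cases hx0 : x = 0
    · exact .inl hx0
    have hxI : x ∈ I := by
      rw [← mem_coe, hS]
      exact Submodule.subset_span hx
    have h1 := count_le_of_mem p hxI hx0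
    have h2 := hcon x hx hx0
    right
    omega
  omega

open FractionalIdeal in
theorem fractionalIdeal_ext_count {I J : FractionalIdeal R⁰ K} (hI : I ≠ 0) (hJ : J ≠ 0)
    (h : ∀ p : HeightOneSpectrum R, count K p I = count K p J) : I = J := by
  rw [← finprod_heightOneSpectrum_factorization' K hI,
    ← finprod_heightOneSpectrum_factorization' K hJ]
  simp_rw [h]

open FractionalIdeal in
theorem fractionalIdeal_sq_of_span {I I₂ : FractionalIdeal R⁰ K} (hI : I ≠ 0) {S : Set K}
    (hS : (I : Submodule R K) = Submodule.span R S)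
    (hS₂ : (I₂ : Submodule R K) = Submodule.span R ((fun x ↦ x ^ 2) '' S)) : I₂ = I ^ 2 := by
  have hI₂ : I₂ ≠ 0 := by
    rintro rfl
    apply hI
    rw [← coeToSubmodule_inj, hS, coe_zero, Submodule.span_eq_bot]
    intro x hx
    rw [coe_zero, eq_comm, Submodule.span_eq_bot] at hS₂
    exact pow_eq_zero_iff two_ne_zero |>.1 (hS₂ _ ⟨x, hx, rfl⟩)
  refine fractionalIdeal_ext_count hI₂ (pow_ne_zero 2 hI) fun p ↦ ?_
  rw [count_pow]
  apply le_antisymm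
  · obtain ⟨x, hx, hx0, h⟩ := exists_ordP_eq_count p hI hS
    rw [← h, ← ordP_pow]
    apply count_le_of_mem p _ (pow_ne_zero 2 hx0)
    rw [← mem_coe, hS₂]
    exact Submodule.subset_span ⟨x, hx, rfl⟩
  · apply le_count_of_span p hI₂ hS₂
    rintro _ ⟨x, hx, rfl⟩
    have hxI : x ∈ I := by
      rw [← mem_coe, hS]
      exact Submodule.subset_span hx
    have := ordPGe_mul p (mem_ordPGe_count p hxI) (mem_ordPGe_count p hxI)
    simp only [sq]
    rwa [Nat.cast_two, two_mul]

end OrdP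

section DetIdeal

open Module FractionalIdeal

theorem discr_eq_det_sq_mul {K L : Type*} [Field K] [Field L] [Algebra K L] {n : ℕ}
    (b : Basis (Fin n) K L) (w : Fin n → L) :
    Algebra.discr K w = b.det w ^ 2 * Algebra.discr K b := by
  rw [Basis.det_apply, ← Algebra.discr_of_matrix_vecMul, Basis.toMatrix_map_vecMul]

variable {K : Type*} [Field K] [NumberField K] {L : Type*} [Field L] [NumberField L] [Algebra K L]
  {n : ℕ} (b : Basis (Fin n) K L)

/-- The determinants of tuples of integers of `L` with respect to a `K`-basis of `L`. -/
def detSet : Set K := {d | ∃ w : Fin n → L, (∀ i, IsIntegral ℤ (w i)) ∧ d = b.det w}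

theorem exists_denom : ∃ d : 𝓞 K, d ≠ 0 ∧ ∀ w : 𝓞 L, ∀ i, ∃ r : 𝓞 K,
    algebraMap (𝓞 K) K r = algebraMap (𝓞 K) K d * b.repr (w : L) i := by
  classical
  obtain ⟨S, hS⟩ := (inferInstance : Module.Finite (𝓞 K) (𝓞 L)).fg_top
  obtain ⟨d, hd⟩ := IsLocalization.exist_integer_multiples_of_finset (𝓞 K)⁰
    ((S ×ˢ (Finset.univ : Finset (Fin n))).image fun x ↦ b.repr ((x.1 : 𝓞 L) : L) x.2)
  refine ⟨d, nonZeroDivisors.coe_ne_zero d, fun w ↦ ?_⟩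
  have hw : w ∈ Submodule.span (𝓞 K) (S : Set (𝓞 L)) := hS ▸ Submodule.mem_top
  induction hw using Submodule.span_induction with
  | mem x hx =>
    intro i
    obtain ⟨r, hr⟩ := hd (b.repr ((x : 𝓞 L) : L) i) (Finset.mem_image.2
      ⟨(x, i), by simpa using hx, rfl⟩)
    exact ⟨r, by rw [hr, Algebra.smul_def]⟩
  | zero => exact fun i ↦ ⟨0, by simp⟩
  | add x y _ _ hx hy =>
    intro i
    obtain ⟨r, hr⟩ := hx i
    obtain ⟨s, hs⟩ := hy i
    exact ⟨r + s, by simp [hr, hs, mul_add]⟩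
  | smul c x _ hx =>
    intro i
    obtain ⟨r, hr⟩ := hx i
    refine ⟨c * r, ?_⟩
    have : ((c • x : 𝓞 L) : L) = (algebraMap (𝓞 K) K c) • (x : L) := by
      rw [Algebra.smul_def, Algebra.smul_def]
      rfl
    rw [map_mul, hr, this, map_smul, Finsupp.smul_apply, smul_eq_mul]
    ring

theorem isFractional_span_detSet :
    IsFractional (𝓞 K)⁰ (Submodule.span (𝓞 K) (detSet b)) := by
  obtain ⟨d, hd0, hd⟩ := exists_denom b
  refine ⟨d ^ n, pow_mem (mem_nonZeroDivisors_of_ne_zero hd0) n, fun x hx ↦ ?_⟩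
  induction hx using Submodule.span_induction with
  | mem x hx =>
    obtain ⟨w, hw, rfl⟩ := hx
    have h : ∀ i j, ∃ r : 𝓞 K, algebraMap (𝓞 K) K r = algebraMap (𝓞 K) K d * b.repr (w j) i :=
      fun i j ↦ hd ⟨w j, hw j⟩ i
    choose r hr using h
    refine ⟨(Matrix.of r).det, ?_⟩
    rw [RingHom.map_det, Algebra.smul_def, map_pow, Basis.det_apply]
    have : (algebraMap (𝓞 K) K).mapMatrix (Matrix.of r) =
        algebraMap (𝓞 K) K d • b.toMatrix w := by
      ext i j
      simp [hr, Basis.toMatrix_apply]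
    rw [this, Matrix.det_smul, Fintype.card_fin]
  | zero => exact ⟨0, by simp⟩
  | add x y _ _ hx hy =>
    rw [smul_add]
    exact IsLocalization.isInteger_add hx hy
  | smul c x _ hx =>
    rw [smul_comm]
    exact IsLocalization.isInteger_smul hx

/-- The fractional ideal generated by the determinants of tuples of integers of `L`
with respect to a `K`-basis of `L`. -/
def detIdeal : FractionalIdeal (𝓞 K)⁰ K :=
  ⟨Submodule.span (𝓞 K) (detSet b), isFractional_span_detSet b⟩

theorem coe_detIdeal : (detIdeal b : Submodule (𝓞 K) K) = Submodule.span (𝓞 K) (detSet b) := rfl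

theorem exists_integral_basis (b : Basis (Fin n) K L) : ∃ c : Basis (Fin n) K L, ∀ i, IsIntegral ℤ (c i) := by
  obtain ⟨s, c, hc⟩ := FiniteDimensional.exists_is_basis_integral (𝓞 K) K L
  have e : s ≃ Fin n := c.indexEquiv b
  refine ⟨c.reindex e, fun i ↦ ?_⟩
  rw [Basis.reindex_apply]
  exact isIntegral_trans (A := 𝓞 K) _ (hc _)

theorem detIdeal_ne_zero : detIdeal b ≠ 0 := by
  obtain ⟨c, hc⟩ := exists_integral_basis b
  intro h
  have hm : b.det c ∈ detIdeal b := by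
    rw [← mem_coe, coe_detIdeal]
    exact Submodule.subset_span ⟨c, hc, rfl⟩
  rw [h, mem_zero_iff] at hm
  exact (b.isUnit_det c).ne_zero hm

theorem discr_basis_ne_zero : Algebra.discr K b ≠ 0 :=
  Algebra.discr_not_zero_of_basis K b

theorem coe_relDisc_eq : (relDisc K L : FractionalIdeal (𝓞 K)⁰ K) =
    detIdeal b ^ 2 * spanSingleton (𝓞 K)⁰ (Algebra.discr K b) := by
  obtain rfl : n = finrank K L := by simpa using (finrank_eq_card_basis b).symm
  have hΔ := discr_basis_ne_zero b
  rw [eq_comm, ← eq_div_iff (spanSingleton_ne_zero_iff.2 hΔ)]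
  refine (fractionalIdeal_sq_of_span (detIdeal_ne_zero b) (coe_detIdeal b) ?_).symm
  rw [div_eq_mul_inv, spanSingleton_inv, coe_mul, coe_spanSingleton, coe_coeIdeal, relDisc,
    IsLocalization.coeSubmodule_span, Submodule.span_mul_span]
  apply le_antisymm
  · apply Submodule.span_mono
    rintro _ ⟨_, ⟨d, ⟨c, hc, hd⟩, rfl⟩, _, rfl, rfl⟩
    refine ⟨b.det c, ⟨c, hc, rfl⟩, ?_⟩
    simp only
    rw [hd, discr_eq_det_sq_mul b c, mul_assoc, mul_inv_cancel₀ hΔ, mul_one]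
  · rw [Submodule.span_le]
    rintro _ ⟨_, ⟨w, hw, rfl⟩, rfl⟩
    by_cases h0 : b.det w = 0
    · simp [h0]
    have hu : IsUnit (b.det w) := isUnit_iff_ne_zero.2 h0
    rw [← Basis.is_basis_iff_det] at hu
    let c : Basis (Fin (finrank K L)) K L := Basis.mk hu.1 hu.2.ge
    have hc : ⇑c = w := Basis.coe_mk _ _
    have hdi : IsIntegral ℤ (Algebra.discr K w) := Algebra.discr_isIntegral K hw
    apply Submodule.subset_span
    refine ⟨Algebra.discr K w, ⟨⟨_, hdi⟩, ⟨c, by rwa [hc], by rw [hc]; rfl⟩, rfl⟩,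
      (Algebra.discr K b)⁻¹, rfl, ?_⟩
    simp only
    rw [discr_eq_det_sq_mul b w, mul_assoc, mul_inv_cancel₀ hΔ, mul_one]

end DetIdeal

section Structure

open Module

theorem nonempty_equiv_ker_prod {R A B : Type*} [CommRing R] [AddCommGroup A] [AddCommGroup B]
    [Module R A] [Module R B] [Projective R B] (f : A →ₗ[R] B) (hf : Function.Surjective f) :
    Nonempty (A ≃ₗ[R] f.ker × B) := by
  obtain ⟨s, hs⟩ := projective_lifting_property f LinearMap.id hf
  have hs' : ∀ y, f (s y) = y := fun y ↦ LinearMap.congr_fun hs y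
  refine ⟨LinearEquiv.symm <| LinearEquiv.ofBijective (f.ker.subtype.coprod s) ⟨?_, ?_⟩⟩
  · rw [← LinearMap.ker_eq_bot, LinearMap.ker_eq_bot']
    rintro ⟨⟨x, hx⟩, y⟩ h
    have hx' : f x = 0 := hx
    simp only [LinearMap.coprod_apply, Submodule.subtype_apply] at h
    have hy : y = 0 := by
      have := congrArg f h
      rwa [map_add, hx', hs', zero_add, map_zero] at this
    subst hy
    simp only [map_zero, add_zero] at h
    subst h
    rfl
  · intro a
    refine ⟨(⟨a - s (f a), by simp [hs']⟩, f a), by simp⟩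

variable {R : Type*} [CommRing R] [IsDedekindDomain R]

theorem projective_ideal (I : Ideal R) : Projective R I := by
  have : Flat R I := by
    rw [IsDedekindDomain.flat_iff_torsion_eq_bot, ← Submodule.isTorsionFree_iff_torsion_eq_bot]
    infer_instance
  have : FinitePresentation R I := finitePresentation_of_finite R I
  exact Flat.projective_of_finitePresentation

theorem nonempty_equiv_of_span_mul_eq {I J : Ideal R} {x y : R} (hx : x ≠ 0) (hy : y ≠ 0)
    (h : Ideal.span {x} * I = Ideal.span {y} * J) : Nonempty (I ≃ₗ[R] J) := by
  have key : ∀ (I : Ideal R) {x : R}, x ≠ 0 →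
      Nonempty (I ≃ₗ[R] (Ideal.span {x} * I : Ideal R)) := by
    intro I x hx
    have hinj : Function.Injective (LinearMap.mulLeft R x) := mul_right_injective₀ hx
    have e := Submodule.equivMapOfInjective (LinearMap.mulLeft R x) hinj I
    have h : Submodule.map (LinearMap.mulLeft R x) I = Ideal.span {x} * I := by
      ext z
      simp [Ideal.mem_span_singleton_mul]
    exact ⟨e.trans (LinearEquiv.ofEq _ _ h)⟩
  obtain ⟨e₁⟩ := key I hx
  obtain ⟨e₂⟩ := key J hy
  exact ⟨e₁.trans ((LinearEquiv.ofEq _ _ h).trans e₂.symm)⟩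

theorem exists_equiv_isCoprime {I A : Ideal R} (hI : I ≠ ⊥) (hA : A ≠ ⊥) :
    ∃ I' : Ideal R, I' ≠ ⊥ ∧ IsCoprime I' A ∧ Nonempty (I ≃ₗ[R] I') := by
  obtain ⟨c, hcI, hc0⟩ := Submodule.exists_mem_ne_zero_of_ne_bot hI
  obtain ⟨C, hC⟩ := Ideal.dvd_iff_le.2 ((Ideal.span_singleton_le_iff_mem I).2 hcI)
  have hC0 : C ≠ ⊥ := by
    rintro rfl
    rw [Ideal.mul_bot, Ideal.span_singleton_eq_bot] at hC
    exact hc0 hC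
  obtain ⟨x, hx0, hx⟩ : ∃ x : R, x ≠ 0 ∧ C * A ⊔ Ideal.span {x} = C := by
    obtain ⟨x, hx⟩ := IsDedekindDomain.exists_sup_span_eq
      (Ideal.mul_le_left : C * A ≤ C) (mul_ne_zero hC0 hA)
    by_cases hx0 : x = 0
    · obtain ⟨y, hyC, hy0⟩ := Submodule.exists_mem_ne_zero_of_ne_bot hC0
      refine ⟨y, hy0, ?_⟩
      subst hx0
      rw [Ideal.span_singleton_eq_bot.2 rfl, sup_bot_eq] at hx
      rw [hx, sup_eq_left]
      exact (Ideal.span_singleton_le_iff_mem C).2 hyC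
    · exact ⟨x, hx0, hx⟩
  obtain ⟨I', hI'⟩ := Ideal.dvd_iff_le.2 (hx ▸ le_sup_right : Ideal.span {x} ≤ C)
  refine ⟨I', ?_, ?_, ?_⟩
  · rintro rfl
    rw [Ideal.mul_bot, Ideal.span_singleton_eq_bot] at hI'
    exact hx0 hI'
  · rw [Ideal.isCoprime_iff_sup_eq, sup_comm]
    rw [hI', ← Ideal.mul_sup] at hx
    exact mul_left_cancel₀ hC0 (hx.trans (Ideal.mul_top C).symm)
  · apply nonempty_equiv_of_span_mul_eq hx0 hc0
    rw [hI', hC]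
    ring

theorem exists_ideal_prod_equiv {I A : Ideal R} (hI : I ≠ ⊥) (hA : A ≠ ⊥) :
    ∃ B : Ideal R, B ≠ ⊥ ∧ Nonempty ((I × A) ≃ₗ[R] R × B) := by
  obtain ⟨I', hI'0, hcop, ⟨e⟩⟩ := exists_equiv_isCoprime hI hA
  let f : (I' × A) →ₗ[R] R := I'.subtype.coprod A.subtype
  have hf : Function.Surjective f := by
    intro r
    obtain ⟨i, hi, j, hj, hij⟩ := Ideal.isCoprime_iff_exists.mp hcop
    refine ⟨(⟨r * i, I'.mul_mem_left r hi⟩, ⟨r * j, A.mul_mem_left r hj⟩), ?_⟩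
    simp only [f, LinearMap.coprod_apply, Submodule.subtype_apply]
    rw [← mul_add, hij, mul_one]
  obtain ⟨g⟩ := nonempty_equiv_ker_prod f hf
  have k : (I' ⊓ A : Ideal R) ≃ₗ[R] f.ker :=
    LinearEquiv.ofBijective
      (LinearMap.codRestrict f.ker
        ((Submodule.inclusion (inf_le_left : I' ⊓ A ≤ I')).prod
          (-(Submodule.inclusion (inf_le_right : I' ⊓ A ≤ A)))) (fun x ↦ by simp [f])) (by
      constructor
      · rintro ⟨x, hx⟩ ⟨y, hy⟩ h
        have := congrArg (fun z : f.ker ↦ (z.1.1 : R)) h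
        simpa using this
      · rintro ⟨⟨⟨x, hx⟩, ⟨y, hy⟩⟩, h⟩
        have h' : x + y = 0 := by simpa [f] using h
        obtain rfl : y = -x := by
          rw [eq_neg_iff_add_eq_zero, add_comm]
          exact h'
        refine ⟨⟨x, hx, by simpa using hy⟩, ?_⟩
        rfl)
  refine ⟨I' ⊓ A, ?_, ⟨((e.prodCongr (LinearEquiv.refl R A)).trans g).trans
    (((k.symm).prodCongr (LinearEquiv.refl R R)).trans (LinearEquiv.prodComm R _ _))⟩⟩
  rw [← Ideal.mul_eq_inf_of_coprime (Ideal.isCoprime_iff_sup_eq.1 hcop)]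
  exact mul_ne_zero hI'0 hA

theorem exists_lattice_equiv (k : ℕ) (Λ : Submodule R (Fin (k + 1) → R)) {d : R} (hd : d ≠ 0)
    (hΛ : ∀ x : Fin (k + 1) → R, d • x ∈ Λ) :
    ∃ I : Ideal R, I ≠ ⊥ ∧ Nonempty (Λ ≃ₗ[R] (Fin k → R) × I) := by
  induction k with
  | zero =>
    let e : (Fin 1 → R) ≃ₗ[R] R := LinearEquiv.funUnique (Fin 1) R R
    refine ⟨Submodule.map (e : (Fin 1 → R) →ₗ[R] R) Λ, ?_,
      ⟨(e.submoduleMap Λ).trans (LinearEquiv.uniqueProd).symm⟩⟩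
    intro h
    have : e (d • 1) ∈ Submodule.map (e : (Fin 1 → R) →ₗ[R] R) Λ :=
      ⟨_, hΛ 1, rfl⟩
    rw [h] at this
    exact hd (by simpa [e] using this)
  | succ k ih =>
    let p : (Fin (k + 2) → R) →ₗ[R] R := LinearMap.proj 0
    let A : Ideal R := Submodule.map p Λ
    have hA : A ≠ ⊥ := by
      intro h
      have : p (d • 1) ∈ A := ⟨_, hΛ 1, rfl⟩
      rw [h] at this
      exact hd (by simpa [p] using this)
    let f : Λ →ₗ[R] A := p.submoduleMap Λ
    have hf : Function.Surjective f := LinearMap.submoduleMap_surjective p Λ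
    have := projective_ideal A
    obtain ⟨g⟩ := nonempty_equiv_ker_prod f hf
    let c : (Fin (k + 1) → R) →ₗ[R] (Fin (k + 2) → R) :=
      LinearMap.pi (Fin.cons 0 fun i ↦ LinearMap.proj i)
    have hc0 : ∀ x, c x 0 = 0 := fun x ↦ rfl
    have hcs : ∀ x i, c x (Fin.succ i) = x i := fun x i ↦ rfl
    obtain ⟨I, hI, ⟨u⟩⟩ := ih (Λ.comap c) (fun x ↦ by
      rw [Submodule.mem_comap, map_smul]
      exact hΛ _)
    have kk : Λ.comap c ≃ₗ[R] f.ker :=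
      LinearEquiv.ofBijective
        (LinearMap.codRestrict f.ker (c.restrict (p := Λ.comap c) (q := Λ) fun x hx ↦ hx)
          (fun x ↦ by
            rw [LinearMap.mem_ker]
            exact Subtype.ext (hc0 x))) (by
        constructor
        · rintro ⟨x, hx⟩ ⟨y, hy⟩ h
          have h1 : c x = c y := congrArg (fun z : f.ker ↦ (z.1.1 : Fin (k + 2) → R)) h
          refine Subtype.ext (funext fun i ↦ ?_)
          exact congrFun h1 i.succ
        · rintro ⟨⟨x, hx⟩, h⟩
          have h0 : x 0 = 0 := congrArg Subtype.val (LinearMap.mem_ker.1 h)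
          have hcx : c (fun i ↦ x i.succ) = x := by
            funext i
            refine Fin.cases ?_ (fun j ↦ ?_) i
            · rw [hc0, h0]
            · rw [hcs]
          refine ⟨⟨fun i ↦ x i.succ, ?_⟩, ?_⟩
          · rw [Submodule.mem_comap, hcx]
            exact hx
          · exact Subtype.ext (Subtype.ext hcx))
    obtain ⟨B, hB, ⟨v⟩⟩ := exists_ideal_prod_equiv hI hA
    let e₁ : (((Fin k → R) × I) × A) ≃ₗ[R] (Fin k → R) × (I × A) := LinearEquiv.prodAssoc R _ _ _
    let e₂ : ((Fin k → R) × (I × A)) ≃ₗ[R] (Fin k → R) × (R × B) :=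
      (LinearEquiv.refl R _).prodCongr v
    let e₃ : ((Fin k → R) × (R × B)) ≃ₗ[R] ((Fin k → R) × R) × B :=
      (LinearEquiv.prodAssoc R _ _ _).symm
    let e₄ : ((Fin k → R) × R) ≃ₗ[R] (Fin (k + 1) → R) :=
      (LinearEquiv.prodComm R _ _).trans (Fin.consLinearEquiv R (fun _ ↦ R))
    exact ⟨B, hB, ⟨g.trans (((kk.symm.trans u).prodCongr (LinearEquiv.refl R A)).trans
      (e₁.trans (e₂.trans (e₃.trans (e₄.prodCongr (LinearEquiv.refl R B))))))⟩⟩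

end Structure

section Steinitz

open Module FractionalIdeal

theorem classGroup_mk_spanSingleton_mul {R : Type*} [CommRing R] [IsDomain R] {K : Type*} [Field K]
    [Algebra R K] [IsFractionRing R K] {x : K} (hx : x ≠ 0)
    {U V : (FractionalIdeal R⁰ K)ˣ} (h : (U : FractionalIdeal R⁰ K) = spanSingleton R⁰ x * V) :
    ClassGroup.mk (K := K) U = ClassGroup.mk (K := K) V := by
  have : U = toPrincipalIdeal R K (Units.mk0 x hx) * V := by
    ext1
    rw [h, Units.val_mul, coe_toPrincipalIdeal, Units.val_mk0]
  rw [this, map_mul, mul_eq_right, ClassGroup.mk_eq_one_iff, coe_toPrincipalIdeal,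
    coe_spanSingleton]
  exact ⟨⟨_, rfl⟩⟩

variable {K : Type*} [Field K] [NumberField K] {L : Type*} [Field L] [NumberField L] [Algebra K L]
  {n : ℕ} (b : Basis (Fin n) K L)

/-- The class of the fractional ideal `detIdeal b`. -/
def detClass : ClassGroup (𝓞 K) :=
  ClassGroup.mk (K := K) (Units.mk0 (detIdeal b) (detIdeal_ne_zero b))

theorem detIdeal_eq_of_equiv {k : ℕ} (b : Basis (Fin (k + 1)) K L) {I : Ideal (𝓞 K)} (hI : I ≠ ⊥)
    (φ : (𝓞 L) ≃ₗ[𝓞 K] ((Fin k → 𝓞 K) × I)) :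
    ∃ x : K, x ≠ 0 ∧ detIdeal b = spanSingleton (𝓞 K)⁰ x * (I : FractionalIdeal (𝓞 K)⁰ K) := by
  obtain ⟨x₀, hx₀I, hx₀⟩ := Submodule.exists_mem_ne_zero_of_ne_bot hI
  have hx₀' : algebraMap (𝓞 K) K x₀ ≠ 0 := by simpa using hx₀
  let u : Fin (k + 1) → 𝓞 L :=
    Fin.cons (φ.symm (0, ⟨x₀, hx₀I⟩)) fun i ↦ φ.symm (Pi.single i 1, 0)
  let c : 𝓞 L → Fin (k + 1) → K := fun w ↦
    Fin.cons (algebraMap (𝓞 K) K (φ w).2 / algebraMap (𝓞 K) K x₀)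
      fun i ↦ algebraMap (𝓞 K) K ((φ w).1 i)
  have hsmul : ∀ (r : 𝓞 K) (w : 𝓞 L), ((r • w : 𝓞 L) : L) = algebraMap (𝓞 K) K r • (w : L) := by
    intro r w
    rw [Algebra.smul_def, Algebra.smul_def]
    rfl
  have hc : ∀ w : 𝓞 L, (w : L) = ∑ i, c w i • (u i : L) := by
    intro w
    have h1 : x₀ • w = ((φ w).2 : 𝓞 K) • u 0 + ∑ i : Fin k, (x₀ * (φ w).1 i) • u i.succ := by
      apply φ.injective
      simp only [map_add, map_smul, map_sum, u, Fin.cons_zero, Fin.cons_succ,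
        LinearEquiv.apply_symm_apply]
      refine Prod.ext (funext fun j ↦ ?_) (Subtype.ext ?_)
      · simp [Prod.fst_sum, Finset.sum_apply, Pi.single_apply]
      · simp [Prod.snd_sum, mul_comm]
    have h2 := congrArg (fun z : 𝓞 L ↦ (z : L)) h1
    simp only [map_add, map_sum, hsmul] at h2
    apply smul_right_injective L hx₀'
    simp only
    rw [h2, Fin.sum_univ_succ, smul_add, Finset.smul_sum]
    simp only [c, Fin.cons_zero, Fin.cons_succ, smul_smul, map_mul]
    rw [mul_div_cancel₀ _ hx₀']
  have hspan : ⊤ ≤ Submodule.span K (Set.range fun i ↦ (u i : L)) := by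
    obtain ⟨b', hb'⟩ := exists_integral_basis b
    rw [← b'.span_eq, Submodule.span_le]
    rintro _ ⟨i, rfl⟩
    have := hc ⟨b' i, hb' i⟩
    change b' i = _ at this
    rw [this]
    exact Submodule.sum_mem _ fun j _ ↦ Submodule.smul_mem _ _ (Submodule.subset_span ⟨j, rfl⟩)
  have hcard : Fintype.card (Fin (k + 1)) = finrank K L := (finrank_eq_card_basis b).symm
  let e : Basis (Fin (k + 1)) K L := basisOfTopLeSpanOfCardEqFinrank _ hspan hcard
  have he : ∀ i, e i = u i := fun i ↦ by simp [e]
  have hrepr : ∀ (w : 𝓞 L) i, e.repr (w : L) i = c w i := by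
    intro w i
    conv_lhs => rw [hc w]
    simp_rw [← he]
    rw [e.repr_sum_self]
  have hdet : ∀ w : Fin (k + 1) → L, b.det w = b.det e * e.det w := by
    intro w
    rw [Basis.det_apply, Basis.det_apply, Basis.det_apply, ← Matrix.det_mul,
      Basis.toMatrix_mul_toMatrix]
  have hbe : b.det e ≠ 0 := (b.isUnit_det e).ne_zero
  refine ⟨b.det e / algebraMap (𝓞 K) K x₀, div_ne_zero hbe hx₀', ?_⟩
  rw [← coeToSubmodule_inj, coe_detIdeal, coe_mul, coe_spanSingleton, coe_coeIdeal]
  apply le_antisymm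
  · rw [Submodule.span_le]
    rintro _ ⟨w, hw, rfl⟩
    rw [SetLike.mem_coe, hdet w, Basis.det_apply e w, Matrix.det_succ_row_zero, Finset.mul_sum]
    refine sum_mem fun j _ ↦ ?_
    have hr : ∀ i j, e.repr (w j) i = c ⟨w j, hw j⟩ i := fun i j ↦ hrepr ⟨w j, hw j⟩ i
    have hsub : ((e.toMatrix w).submatrix Fin.succ j.succAbove) =
        (algebraMap (𝓞 K) K).mapMatrix
          (Matrix.of fun i l ↦ (φ ⟨w (j.succAbove l), hw _⟩).1 i) := by
      ext i l
      simp [Basis.toMatrix_apply, hr, c]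
    rw [hsub, ← RingHom.map_det, Basis.toMatrix_apply, hr]
    simp only [c, Fin.cons_zero]
    have : b.det e * ((-1) ^ (j : ℕ) * (algebraMap (𝓞 K) K (φ ⟨w j, hw j⟩).2 /
        algebraMap (𝓞 K) K x₀) * algebraMap (𝓞 K) K (Matrix.of fun i l ↦
          (φ ⟨w (j.succAbove l), hw _⟩).1 i).det) =
        (b.det e / algebraMap (𝓞 K) K x₀) * algebraMap (𝓞 K) K
        (((-1) ^ (j : ℕ) * (Matrix.of fun i l ↦ (φ ⟨w (j.succAbove l), hw _⟩).1 i).det) *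
          (φ ⟨w j, hw j⟩).2) := by
      simp only [map_mul, map_pow, map_neg, map_one]
      ring
    rw [this]
    refine Submodule.mul_mem_mul (Submodule.mem_span_singleton_self _) ?_
    exact ⟨_, Ideal.mul_mem_left _ _ (φ ⟨w j, hw j⟩).2.2, rfl⟩
  · rw [Submodule.mul_le]
    intro m hm _ hy
    obtain ⟨y, hy, rfl⟩ := hy
    obtain ⟨r, rfl⟩ := Submodule.mem_span_singleton.1 hm
    rw [smul_mul_assoc]
    apply Submodule.smul_mem
    apply Submodule.subset_span
    let w : Fin (k + 1) → L := Function.update e 0 ((φ.symm (0, ⟨y, hy⟩) : 𝓞 L) : L)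
    refine ⟨w, fun i ↦ ?_, ?_⟩
    · by_cases hi : i = 0
      · subst hi
        simp only [w, Function.update_self]
        exact RingOfIntegers.isIntegral_coe _
      · simp only [w, Function.update_of_ne hi, he]
        exact RingOfIntegers.isIntegral_coe _
    · rw [hdet w]
      have h2 : e.det w = algebraMap (𝓞 K) K y / algebraMap (𝓞 K) K x₀ := by
        have h3 : ((φ.symm (0, ⟨y, hy⟩) : 𝓞 L) : L) =
            (algebraMap (𝓞 K) K y / algebraMap (𝓞 K) K x₀) • e 0 := by
          conv_lhs => rw [hc]
          rw [Fin.sum_univ_succ]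
          simp [c, he]
        simp only [w]
        rw [h3, e.det.map_update_smul, Function.update_eq_self, e.det_self, smul_eq_mul, mul_one]
      rw [h2]
      simp only [Algebra.linearMap_apply]
      ring

theorem IsSteinitzClass.eq_detClass {C : ClassGroup (𝓞 K)} (h : IsSteinitzClass K L C) :
    C = detClass b := by
  obtain ⟨I, rfl, ⟨φ⟩⟩ := h
  obtain rfl : n = finrank K L := by simpa using (finrank_eq_card_basis b).symm
  obtain ⟨k, hk⟩ : ∃ k, finrank K L = k + 1 := Nat.exists_eq_succ_of_ne_zero finrank_pos.ne'
  have : ∃ x : K, x ≠ 0 ∧ detIdeal b =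
      spanSingleton (𝓞 K)⁰ x * ((I : Ideal (𝓞 K)) : FractionalIdeal (𝓞 K)⁰ K) := by
    generalize finrank K L = N at *
    subst hk
    exact detIdeal_eq_of_equiv b (nonZeroDivisors.coe_ne_zero I) φ
  obtain ⟨x, hx, hxI⟩ := this
  rw [← ClassGroup.mk_mk0 K I, detClass]
  exact (classGroup_mk_spanSingleton_mul hx hxI).symm

theorem exists_isSteinitzClass : ∃ C, IsSteinitzClass K L C := by
  obtain ⟨k, hk⟩ : ∃ k, finrank K L = k + 1 := Nat.exists_eq_succ_of_ne_zero finrank_pos.ne'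
  let b : Basis (Fin (k + 1)) K L := finBasisOfFinrankEq K L hk
  obtain ⟨b', hb'⟩ := exists_integral_basis b
  obtain ⟨d, hd0, hd⟩ := exists_denom b'
  have hd' : algebraMap (𝓞 K) K d ≠ 0 := by simpa using hd0
  have hsmul : ∀ (r : 𝓞 K) (w : 𝓞 L), ((r • w : 𝓞 L) : L) = algebraMap (𝓞 K) K r • (w : L) := by
    intro r w
    rw [Algebra.smul_def, Algebra.smul_def]
    rfl
  choose r hr using hd
  have hinj : Function.Injective (algebraMap (𝓞 K) K) := RingOfIntegers.coe_injective
  let f : 𝓞 L →ₗ[𝓞 K] (Fin (k + 1) → 𝓞 K) :=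
    { toFun := r
      map_add' := fun x y ↦ funext fun i ↦ hinj (by simp [hr, mul_add])
      map_smul' := fun c x ↦ funext fun i ↦ hinj (by
        rw [hr, hsmul, map_smul, Finsupp.smul_apply, RingHom.id_apply, Pi.smul_apply, smul_eq_mul,
          smul_eq_mul, map_mul, hr]
        ring) }
  have hf : Function.Injective f := by
    intro x y hxy
    apply RingOfIntegers.coe_injective
    apply b'.repr.injective
    ext i
    have := congrArg (algebraMap (𝓞 K) K) (congrFun hxy i)
    simp only [f, LinearMap.coe_mk, AddHom.coe_mk, hr] at this
    exact mul_left_cancel₀ hd' this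
  let β : Fin (k + 1) → 𝓞 L := fun i ↦ ⟨b' i, hb' i⟩
  obtain ⟨I, hI, ⟨ψ⟩⟩ := exists_lattice_equiv k (LinearMap.range f) hd0 fun x ↦ by
    refine ⟨∑ i, x i • β i, funext fun j ↦ hinj ?_⟩
    simp only [f, LinearMap.coe_mk, AddHom.coe_mk, hr]
    have hsum : ((∑ i, x i • β i : 𝓞 L) : L) = ∑ i, ((x i • β i : 𝓞 L) : L) :=
      map_sum (algebraMap (𝓞 L) L) _ _
    rw [hsum]
    simp_rw [hsmul]
    change _ * b'.repr (∑ i, algebraMap (𝓞 K) K (x i) • b' i) j = _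
    rw [b'.repr_sum_self]
    simp
  refine ⟨ClassGroup.mk0 ⟨I, mem_nonZeroDivisors_of_ne_zero hI⟩, _, rfl, ⟨?_⟩⟩
  rw [hk]
  exact (LinearEquiv.ofInjective f hf).trans ψ

theorem isSteinitzClass_iff {C : ClassGroup (𝓞 K)} : IsSteinitzClass K L C ↔ C = detClass b := by
  refine ⟨fun h ↦ h.eq_detClass b, ?_⟩
  rintro rfl
  obtain ⟨C, hC⟩ := exists_isSteinitzClass (K := K) (L := L)
  rwa [← hC.eq_detClass b]

end Steinitz

section LiesAbove

open IsDedekindDomain WithZero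

variable {K : Type*} [Field K] [NumberField K] {L : Type*} [Field L] [NumberField L] [Algebra K L]

/-- A valuation subring of `L` whose intersection with `K` is the valuation ring of `p`. -/
def LiesAbove (p : HeightOneSpectrum (𝓞 K)) (V : ValuationSubring L) : Prop :=
  ∀ x : K, algebraMap K L x ∈ V ↔ p.valuation K x ≤ 1

theorem mem_valuationSubring_of_isIntegral (V : ValuationSubring L) {x : L}
    (hx : IsIntegral ℤ x) : x ∈ V := by
  have h : IsIntegral V x := hx.tower_top
  obtain ⟨y, hy⟩ := IsIntegrallyClosed.isIntegral_iff.1 h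
  rw [← hy]
  exact y.2

variable (p : HeightOneSpectrum (𝓞 K))

theorem liesAbove_or_eq_top {V : ValuationSubring L}
    (hV : ∀ x : K, p.valuation K x ≤ 1 → algebraMap K L x ∈ V) :
    LiesAbove p V ∨ ∀ x : L, x ∈ V := by
  by_cases h : LiesAbove p V
  · exact Or.inl h
  right
  have : ∃ x : K, algebraMap K L x ∈ V ∧ 1 < p.valuation K x := by
    by_contra! hc
    exact h fun x ↦ ⟨hc x, hV x⟩
  obtain ⟨x, hxV, hx⟩ := this
  have hx0 : x ≠ 0 := by
    rintro rfl
    simp at hx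
  have hK : ∀ y : K, algebraMap K L y ∈ V := by
    intro y
    by_cases hy : y = 0
    · simp [hy]
    have hx' : ordP p x < 0 := by
      rw [valuation_eq_exp_ordP p hx0, ← exp_zero, exp_lt_exp] at hx
      lia
    have h1 : algebraMap K L (y / x ^ (ordP p y).natAbs) ∈ V := by
      apply hV
      rw [valuation_eq_exp_ordP p (div_ne_zero hy (pow_ne_zero _ hx0)), ← exp_zero, exp_le_exp,
        ordP_div p hy (pow_ne_zero _ hx0), ordP_pow]
      have : -|ordP p y| ≤ ordP p y := neg_abs_le _
      rw [Int.natCast_natAbs]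
      nlinarith [abs_nonneg (ordP p y)]
    have h2 := V.mul_mem _ _ h1 (pow_mem hxV (ordP p y).natAbs)
    rwa [← map_pow, ← map_mul, div_mul_cancel₀ _ (pow_ne_zero _ hx0)] at h2
  intro z
  have hz : IsIntegral K z := Algebra.IsIntegral.isIntegral z
  let f : K →+* V := (algebraMap K L).codRestrict V hK
  have : IsIntegral V z := by
    obtain ⟨P, hP, hPz⟩ := hz
    refine ⟨P.map f, hP.map f, ?_⟩
    rw [Polynomial.eval₂_map]
    exact hPz
  obtain ⟨y, hy⟩ := IsIntegrallyClosed.isIntegral_iff.1 this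
  rw [← hy]
  exact y.2

/-- Elements lying in all valuation rings above `p` are integral up to a factor prime to `p`. -/
theorem exists_mul_isIntegral {x : L} (hx : ∀ V : ValuationSubring L, LiesAbove p V → x ∈ V) :
    ∃ s : 𝓞 K, s ∉ p.asIdeal ∧ IsIntegral ℤ (s • x) := by
  let A := HeightOneSpectrum.valuationSubringAtPrime K p
  let S : Subring L := A.toSubring.map (algebraMap K L)
  have h1 : x ∈ (integralClosure (Subring.closure (S : Set L)) L).toSubring := by
    rw [← iInf_valuationSubring_superset, Subring.mem_iInf]
    rintro ⟨V, hV⟩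
    have hV' : ∀ x : K, p.valuation K x ≤ 1 → algebraMap K L x ∈ V := by
      intro y hy
      apply hV
      refine ⟨y, ?_, rfl⟩
      change y ∈ A
      rw [show A = _ from HeightOneSpectrum.valuationSubringAtPrime_eq_valuationSubring p]
      exact hy
    rcases liesAbove_or_eq_top p hV' with h | h
    · exact hx V h
    · exact h x
  rw [Subring.closure_eq] at h1
  have h2 : IsIntegral S x := h1
  let : Algebra A L := ((algebraMap K L).comp A.subtype).toAlgebra
  have h3 : IsIntegral A x := by
    let g : A →+* S := ((algebraMap K L).comp A.subtype).codRestrict S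
      (fun a ↦ ⟨a, a.2, rfl⟩)
    have hg : Function.Surjective g := by
      rintro ⟨_, a, ha, rfl⟩
      exact ⟨⟨a, ha⟩, rfl⟩
    let : Algebra A S := g.toAlgebra
    have : IsScalarTower A S L := IsScalarTower.of_algebraMap_eq fun _ ↦ rfl
    have : Algebra.IsIntegral A S := ⟨RingHom.isIntegral_of_surjective g hg⟩
    exact isIntegral_trans x h2
  have : IsScalarTower (𝓞 K) A L := IsScalarTower.of_algebraMap_eq fun _ ↦ rfl
  obtain ⟨⟨s, hs⟩, h4⟩ :=
    IsIntegral.exists_multiple_integral_of_isLocalization p.asIdeal.primeCompl x h3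
  exact ⟨s, hs, isIntegral_trans (R := ℤ) (A := 𝓞 K) _ h4⟩

theorem exists_liesAbove : ∃ V : ValuationSubring L, LiesAbove p V := by
  by_contra! h
  obtain ⟨r, hr0, hr⟩ := exists_ordP_eq_one p (K := K)
  have hr0' : algebraMap (𝓞 K) K r ≠ 0 := by simpa using hr0
  obtain ⟨s, hs, hi⟩ := exists_mul_isIntegral p (L := L) (x := algebraMap K L (algebraMap (𝓞 K) K r)⁻¹)
    fun V hV ↦ absurd hV (h V)
  rw [Algebra.smul_def, IsScalarTower.algebraMap_apply (𝓞 K) K L, ← map_mul,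
    isIntegral_algebraMap_iff (algebraMap K L).injective] at hi
  have hs0 : s ≠ 0 := by
    rintro rfl
    exact hs (zero_mem _)
  have hs0' : algebraMap (𝓞 K) K s ≠ 0 := by simpa using hs0
  have h2 := ordP_algebraMap_nonneg (K := K) p (⟨_, hi⟩ : 𝓞 K)
  change 0 ≤ ordP p (algebraMap (𝓞 K) K s * (algebraMap (𝓞 K) K r)⁻¹) at h2
  rw [ordP_mul p hs0' (inv_ne_zero hr0'), ordP_inv, hr,
    (ordP_algebraMap_eq_zero_iff (K := K) p hs0).2 hs] at h2
  lia

end LiesAbove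

section LocalDet

open IsDedekindDomain WithZero Module

variable {K : Type*} [Field K] [NumberField K] {L : Type*} [Field L] [NumberField L] [Algebra K L]

theorem LiesAbove.valuation_le_one_iff {p : HeightOneSpectrum (𝓞 K)} {V : ValuationSubring L}
    (hV : LiesAbove p V) {x : K} (hx : x ≠ 0) :
    V.valuation (algebraMap K L x) ≤ 1 ↔ 0 ≤ ordP p x := by
  rw [ValuationSubring.valuation_le_one_iff, hV, valuation_eq_exp_ordP p hx, ← exp_zero, exp_le_exp]
  lia

theorem LiesAbove.valuation_le_iff {p : HeightOneSpectrum (𝓞 K)} {V : ValuationSubring L}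
    (hV : LiesAbove p V) {x y : K} (hx : x ≠ 0) (hy : y ≠ 0) :
    V.valuation (algebraMap K L x) ≤ V.valuation (algebraMap K L y) ↔ ordP p y ≤ ordP p x := by
  have hy' : 0 < V.valuation (algebraMap K L y) := by
    rw [zero_lt_iff, Valuation.ne_zero_iff]
    simpa using hy
  rw [← div_le_one₀ hy', ← map_div₀, ← map_div₀, hV.valuation_le_one_iff (div_ne_zero hx hy),
    ordP_div p hx hy, sub_nonneg]

theorem LiesAbove.valuation_eq_iff {p : HeightOneSpectrum (𝓞 K)} {V : ValuationSubring L}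
    (hV : LiesAbove p V) {x y : K} (hx : x ≠ 0) (hy : y ≠ 0) :
    V.valuation (algebraMap K L x) = V.valuation (algebraMap K L y) ↔ ordP p x = ordP p y := by
  rw [le_antisymm_iff, hV.valuation_le_iff hx hy, hV.valuation_le_iff hy hx, ← le_antisymm_iff,
    eq_comm]

variable (p : HeightOneSpectrum (𝓞 K)) {n : ℕ} (b : Basis (Fin n) K L)

/-- The exponent of the determinant ideal at `p` can be computed from tuples that are
integral at all places above `p`. -/
theorem count_detIdeal_eq {k : ℤ}
    (h1 : ∀ w : Fin n → L, (∀ i, IsIntegral ℤ (w i)) → b.det w ∈ ordPGe p k)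
    {w : Fin n → L} (hw : ∀ (V : ValuationSubring L), LiesAbove p V → ∀ i, w i ∈ V)
    (hw0 : b.det w ≠ 0) (hwk : ordP p (b.det w) = k) :
    FractionalIdeal.count K p (detIdeal b) = k := by
  apply le_antisymm
  · choose s hs hsi using fun i ↦ exists_mul_isIntegral p (x := w i) fun V hV ↦ hw V hV i
    have hs0 : ∀ i, s i ≠ 0 := fun i h ↦ hs i (h ▸ zero_mem _)
    have hdet : b.det (fun i ↦ s i • w i) = algebraMap (𝓞 K) K (∏ i, s i) * b.det w := by
      have : (fun i ↦ s i • w i) = fun i ↦ algebraMap (𝓞 K) K (s i) • w i := by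
        funext i
        rw [algebraMap_smul]
      rw [this, AlternatingMap.map_smul_univ, map_prod, smul_eq_mul]
    have hmem : b.det (fun i ↦ s i • w i) ∈ detIdeal b := by
      rw [← FractionalIdeal.mem_coe, coe_detIdeal]
      exact Submodule.subset_span ⟨_, hsi, rfl⟩
    have hprod : (∏ i, s i) ≠ 0 := Finset.prod_ne_zero_iff.2 fun i _ ↦ hs0 i
    have hprod' : algebraMap (𝓞 K) K (∏ i, s i) ≠ 0 := by
      rwa [Ne, FaithfulSMul.algebraMap_eq_zero_iff]
    have h2 := count_le_of_mem p hmem (by rw [hdet]; exact mul_ne_zero hprod' hw0)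
    rw [hdet, ordP_mul p hprod' hw0, hwk, (ordP_algebraMap_eq_zero_iff p hprod).2, zero_add] at h2
    · exact h2
    · intro hc
      obtain ⟨i, -, hi⟩ := (p.isPrime.prod_mem_iff).1 hc
      exact hs i hi
  · apply le_count_of_span p (detIdeal_ne_zero b) (coe_detIdeal b)
    rintro _ ⟨w, hw, rfl⟩
    exact h1 w hw

theorem prod_mem_ordPGe {ι : Type*} (s : Finset ι) (f : ι → ℤ) (x : ι → K)
    (h : ∀ i ∈ s, x i ∈ ordPGe p (f i)) : ∏ i ∈ s, x i ∈ ordPGe p (∑ i ∈ s, f i) := by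
  classical
  induction s using Finset.induction_on with
  | empty =>
    rw [Finset.prod_empty, Finset.sum_empty, mem_ordPGe]
    exact Or.inr (by simp)
  | insert a s ha ih =>
    rw [Finset.prod_insert ha, Finset.sum_insert ha]
    exact ordPGe_mul p (h a (Finset.mem_insert_self _ _))
      (ih fun i hi ↦ h i (Finset.mem_insert_of_mem hi))

theorem det_mem_ordPGe (f : Fin n → ℤ) (A : Matrix (Fin n) (Fin n) K)
    (h : ∀ i j, A i j ∈ ordPGe p (f i)) : A.det ∈ ordPGe p (∑ i, f i) := by
  rw [Matrix.det_apply]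
  refine Submodule.sum_mem _ fun σ _ ↦ ?_
  have : ∏ i, A (σ i) i ∈ ordPGe p (∑ i, f i) := by
    rw [← Equiv.sum_comp σ f]
    exact prod_mem_ordPGe p _ _ _ fun i _ ↦ h _ _
  rcases Int.units_eq_one_or (Equiv.Perm.sign σ) with hs | hs
  · rw [hs, one_smul]
    exact this
  · rw [hs, Units.neg_smul, one_smul]
    exact neg_mem this

variable {θ : L} (hb : ∀ i, b i = θ ^ (i : ℕ))

include hb in
theorem det_sub_pow (u : K) : b.det (fun i ↦ (θ - algebraMap K L u) ^ (i : ℕ)) = 1 := by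
  rw [Basis.det_apply, ← Matrix.det_matrixOfPolynomials
    (fun i : Fin n ↦ (Polynomial.X - Polynomial.C u) ^ (i : ℕ))
    (fun i ↦ by rw [Polynomial.natDegree_pow, Polynomial.natDegree_X_sub_C, mul_one])
    (fun i ↦ (Polynomial.monic_X_sub_C u).pow i)]
  congr 1
  ext i j
  rw [Basis.toMatrix_apply, Matrix.of_apply]
  set P := (Polynomial.X - Polynomial.C u) ^ (j : ℕ) with hP
  have hdeg : P.natDegree < n := by
    rw [hP, Polynomial.natDegree_pow, Polynomial.natDegree_X_sub_C, mul_one]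
    exact j.2
  have : (θ - algebraMap K L u) ^ (j : ℕ) = ∑ k : Fin n, P.coeff k • b k := by
    have h1 : (θ - algebraMap K L u) ^ (j : ℕ) = Polynomial.aeval θ P := by simp [hP]
    rw [h1, Polynomial.aeval_eq_sum_range' hdeg, Finset.sum_range]
    simp only [hb]
  rw [this, Basis.repr_sum_self]

include hb in
/-- The basis of powers of `θ - u`. -/
theorem exists_basis_sub_pow (u : K) : ∃ b' : Basis (Fin n) K L,
    (∀ i, b' i = (θ - algebraMap K L u) ^ (i : ℕ)) ∧ ∀ w, b.det w = b'.det w := by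
  have h := det_sub_pow b hb u
  obtain ⟨h1, h2⟩ := (Basis.is_basis_iff_det b (v := fun i : Fin n ↦ (θ - algebraMap K L u) ^ (i : ℕ))).2
    (by rw [h]; exact isUnit_one)
  refine ⟨Basis.mk h1 h2.ge, fun i ↦ by rw [Basis.mk_apply], fun w ↦ ?_⟩
  have := AlternatingMap.eq_smul_basis_det (Basis.mk h1 h2.ge) (b.det)
  rw [this]
  simp [h]

include hb in
theorem discr_kummer {α : K} (hθ : θ ^ n = algebraMap K L α) (hn : n ≠ 0) :
    Algebra.discr K b = n ^ n * α ^ (n - 1) ∨ Algebra.discr K b = -(n ^ n * α ^ (n - 1)) := by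
  let pb : PowerBasis K L := ⟨θ, n, b, hb⟩
  have hmin : minpoly K θ = Polynomial.X ^ n - Polynomial.C α := by
    symm
    apply minpoly.unique_of_degree_le_degree_minpoly K θ (Polynomial.monic_X_pow_sub_C α hn)
    · simp [hθ]
    · rw [Polynomial.degree_X_pow_sub_C (Nat.pos_of_ne_zero hn)]
      exact (pb.degree_minpoly).ge
  have hnorm : Algebra.norm K θ = (-1) ^ n * -α := by
    have := Algebra.PowerBasis.norm_gen_eq_coeff_zero_minpoly pb
    change Algebra.norm K θ = (-1) ^ n * (minpoly K θ).coeff 0 at this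
    rw [this, hmin]
    simp [Polynomial.coeff_X_pow, hn.symm]
  have hfr : Module.finrank K L = n := by
    rw [Module.finrank_eq_card_basis b, Fintype.card_fin]
  have h := Algebra.discr_powerBasis_eq_norm K pb
  change Algebra.discr K b = _ * Algebra.norm K (Polynomial.aeval θ (minpoly K θ).derivative) at h
  have h2 : Polynomial.aeval θ (minpoly K θ).derivative = algebraMap K L n * θ ^ (n - 1) := by
    rw [hmin]
    simp [Polynomial.derivative_X_pow]
  have h3 : ((-1 : K) ^ n * -α) ^ (n - 1) = (-1) ^ ((n + 1) * (n - 1)) * α ^ (n - 1) := by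
    rw [pow_mul, ← mul_pow, pow_succ]
    ring
  rw [h2, map_mul, Algebra.norm_algebraMap, map_pow, hnorm, hfr, h3] at h
  rcases neg_one_pow_eq_or K (n * (n - 1) / 2) with e1 | e1 <;>
  rcases neg_one_pow_eq_or K ((n + 1) * (n - 1)) with e2 | e2 <;>
  · rw [h, e1, e2]
    simp

end LocalDet

section KummerValuation

open IsDedekindDomain WithZero Module

variable {K : Type*} [Field K] [NumberField K]

theorem exists_ordP_eq (p : HeightOneSpectrum (𝓞 K)) (k : ℤ) : ∃ x : K, x ≠ 0 ∧ ordP p x = k := by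
  obtain ⟨r, hr0, hr⟩ := exists_ordP_eq_one p (K := K)
  have h0 : algebraMap (𝓞 K) K r ≠ 0 := by simpa using hr0
  exact ⟨algebraMap (𝓞 K) K r ^ k, zpow_ne_zero _ h0, by rw [ordP_zpow, hr, mul_one]⟩

theorem ordP_nonneg_of_isIntegral (p : HeightOneSpectrum (𝓞 K)) {x : K} (hx : IsIntegral ℤ x) :
    0 ≤ ordP p x :=
  ordP_algebraMap_nonneg p (⟨x, hx⟩ : 𝓞 K)

theorem ordP_natCast_nonneg (p : HeightOneSpectrum (𝓞 K)) (n : ℕ) : 0 ≤ ordP p (n : K) :=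
  ordP_nonneg_of_isIntegral p (by simpa using isIntegral_algebraMap (R := ℤ) (A := K) (x := (n : ℤ)))

theorem ordP_one_sub_le {p : HeightOneSpectrum (𝓞 K)} {ℓ : ℕ} (hℓ : 0 < ℓ) {ζ μ : K}
    (hζ : IsPrimitiveRoot ζ ℓ) (hμ : μ ^ ℓ = 1) (hμ1 : μ ≠ 1) :
    ordP p (1 - ζ) ≤ ordP p (1 - μ) := by
  have : NeZero ℓ := ⟨hℓ.ne'⟩
  obtain ⟨i, -, rfl⟩ := hζ.eq_pow_of_pow_eq_one hμ
  have hζ1 : 1 - ζ ≠ 0 := by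
    intro h
    apply hμ1
    rw [← sub_eq_zero.1 h, one_pow]
  have h := geom_sum_mul ζ i
  have e : 1 - ζ ^ i = (∑ j ∈ Finset.range i, ζ ^ j) * (1 - ζ) := by linear_combination h
  have h2 : (∑ j ∈ Finset.range i, ζ ^ j) ≠ 0 := by
    intro h0
    rw [h0, zero_mul, sub_eq_zero] at e
    exact hμ1 e.symm
  rw [e, ordP_mul p h2 hζ1, le_add_iff_nonneg_left]
  exact ordP_nonneg_of_isIntegral p
    (IsIntegral.sum _ fun j _ ↦ (hζ.isIntegral hℓ).pow j)

theorem ordP_prime_eq (p : HeightOneSpectrum (𝓞 K)) {ℓ : ℕ} (hℓ : ℓ.Prime) {ζ : K}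
    (hζ : IsPrimitiveRoot ζ ℓ) : ordP p (ℓ : K) = (ℓ - 1) * ordP p (1 - ζ) := by
  have : Fact ℓ.Prime := ⟨hℓ⟩
  have h1 : (ℓ : K) = ∏ μ ∈ primitiveRoots ℓ K, (1 - μ) := by
    rw [← Polynomial.eval_one_cyclotomic_prime (R := K) (p := ℓ),
      Polynomial.cyclotomic_eq_prod_X_sub_primitiveRoots hζ, Polynomial.eval_prod]
    simp
  have h2 : ∀ s : Finset K, s ⊆ primitiveRoots ℓ K →
      ordP p (∏ μ ∈ s, (1 - μ)) = s.card * ordP p (1 - ζ) ∧ ∏ μ ∈ s, (1 - μ) ≠ 0 := by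
    classical
    intro s
    induction s using Finset.induction_on with
    | empty => simp
    | insert a s ha ih =>
      intro hs
      obtain ⟨e, e0⟩ := ih ((Finset.subset_insert _ _).trans hs)
      have hap := (mem_primitiveRoots hℓ.pos).1 (hs (Finset.mem_insert_self _ _))
      have ha1 : (1 : K) - a ≠ 0 := sub_ne_zero.2 (hap.ne_one hℓ.one_lt).symm
      have hord : ordP p (1 - a) = ordP p (1 - ζ) :=
        le_antisymm (ordP_one_sub_le hℓ.pos hap hζ.pow_eq_one (hζ.ne_one hℓ.one_lt))
          (ordP_one_sub_le hℓ.pos hζ hap.pow_eq_one (hap.ne_one hℓ.one_lt))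
      rw [Finset.prod_insert ha, ordP_mul p ha1 e0, e, hord, Finset.card_insert_of_notMem ha]
      exact ⟨by push_cast; ring, mul_ne_zero ha1 e0⟩
  have h3 := (h2 _ subset_rfl).1
  rw [← h1, hζ.card_primitiveRoots, Nat.totient_prime hℓ, Nat.cast_sub hℓ.one_le] at h3
  exact_mod_cast h3

theorem ordP_choose_ge (p : HeightOneSpectrum (𝓞 K)) {ℓ : ℕ} (hℓ : ℓ.Prime) {ζ : K}
    (hζ : IsPrimitiveRoot ζ ℓ) {i : ℕ} (hi : i ≠ 0) (hiℓ : i < ℓ) :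
    (ℓ - 1) * ordP p (1 - ζ) ≤ ordP p (ℓ.choose i : K) := by
  obtain ⟨m, hm⟩ := hℓ.dvd_choose_self hi hiℓ
  have hm0 : m ≠ 0 := by
    rintro rfl
    exact (Nat.choose_pos hiℓ.le).ne' hm
  rw [hm, Nat.cast_mul, ordP_mul p (by exact_mod_cast hℓ.ne_zero) (by exact_mod_cast hm0),
    ordP_prime_eq p hℓ hζ]
  linarith [ordP_natCast_nonneg p m]

theorem ordP_one_sub_zeta_nonneg (p : HeightOneSpectrum (𝓞 K)) {ℓ : ℕ} (hℓ : ℓ.Prime) {ζ : K}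
    (hζ : IsPrimitiveRoot ζ ℓ) : 0 ≤ ordP p (1 - ζ) :=
  ordP_nonneg_of_isIntegral p (isIntegral_one.sub (hζ.isIntegral hℓ.pos))

variable {L : Type*} [Field L] [NumberField L] [Algebra K L] {p : HeightOneSpectrum (𝓞 K)}
  {V : ValuationSubring L} (hV : LiesAbove p V) {ℓ : ℕ} (hℓ : ℓ.Prime) {ζ : K}
  (hζ : IsPrimitiveRoot ζ ℓ) {θ : L} {α u : K} (hθ : θ ^ ℓ = algebraMap K L α)

/-- The mixed terms in the binomial expansion of `((θ - u) + u) ^ ℓ`. -/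
def mixedTerms (ℓ : ℕ) (Θ : L) (u : K) : L :=
  ∑ i ∈ Finset.Ico 1 ℓ, Θ ^ i * algebraMap K L u ^ (ℓ - i) * algebraMap K L (ℓ.choose i)

include hℓ hθ in
theorem sub_pow_eq : (θ - algebraMap K L u) ^ ℓ = algebraMap K L (α - u ^ ℓ) -
    mixedTerms ℓ (θ - algebraMap K L u) u := by
  have h := add_pow (θ - algebraMap K L u) (algebraMap K L u) ℓ
  rw [sub_add_cancel, hθ, Finset.sum_range_succ, Finset.range_eq_Ico,
    Finset.sum_eq_sum_Ico_succ_bot hℓ.pos] at h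
  rw [map_sub, map_pow, h, mixedTerms]
  simp only [pow_zero, Nat.sub_zero, Nat.choose_zero_right, Nat.sub_self, Nat.choose_self,
    map_natCast, Nat.cast_one, mul_one, one_mul, zero_add]
  ring

include hV hℓ hζ in
theorem valuation_mixedTerm_le {i : ℕ} (hi : i ∈ Finset.Ico 1 ℓ) (Θ : L) :
    V.valuation (Θ ^ i * algebraMap K L u ^ (ℓ - i) * algebraMap K L (ℓ.choose i)) ≤
      V.valuation Θ ^ i * V.valuation (algebraMap K L ((1 - ζ) * u)) ^ (ℓ - i) := by
  obtain ⟨hi1, hi2⟩ := Finset.mem_Ico.1 hi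
  rw [map_mul (algebraMap K L), map_mul, map_mul, map_mul, mul_pow, map_pow, map_pow, mul_assoc,
    mul_comm (V.valuation (algebraMap K L (1 - ζ)) ^ (ℓ - i))]
  gcongr
  rw [← map_pow, ← map_pow]
  have h1 : (1 : K) - ζ ≠ 0 := sub_ne_zero.2 (hζ.ne_one hℓ.one_lt).symm
  have hc : (ℓ.choose i : K) ≠ 0 := by exact_mod_cast (Nat.choose_pos hi2.le).ne'
  rw [hV.valuation_le_iff hc (pow_ne_zero _ h1), ordP_pow]
  refine le_trans ?_ (ordP_choose_ge p hℓ hζ (by lia) hi2)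
  apply mul_le_mul_of_nonneg_right _ (ordP_one_sub_zeta_nonneg p hℓ hζ)
  rw [Nat.cast_sub hi2.le]
  lia

include hV hℓ hζ hθ in
theorem valuation_sub_pow_of_lt
    (h : V.valuation (algebraMap K L ((1 - ζ) * u)) < V.valuation (θ - algebraMap K L u)) :
    V.valuation (θ - algebraMap K L u) ^ ℓ = V.valuation (algebraMap K L (α - u ^ ℓ)) := by
  set Θ := θ - algebraMap K L u with hΘ
  have hpos : 0 < V.valuation Θ := lt_of_le_of_lt zero_le h
  rw [← map_pow]
  symm
  apply Valuation.map_eq_of_sub_lt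
  have e : algebraMap K L (α - u ^ ℓ) - Θ ^ ℓ = mixedTerms ℓ Θ u := by
    rw [hΘ, sub_pow_eq hℓ hθ]
    ring
  rw [e, mixedTerms]
  apply Valuation.map_sum_lt
  · rw [map_pow]
    exact pow_ne_zero _ hpos.ne'
  · intro i hi
    refine (valuation_mixedTerm_le hV hℓ hζ hi Θ).trans_lt ?_
    obtain ⟨hi1, hi2⟩ := Finset.mem_Ico.1 hi
    calc _ < V.valuation Θ ^ i * V.valuation Θ ^ (ℓ - i) := by
          apply mul_lt_mul_of_pos_left _ (pow_pos hpos _)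
          exact pow_lt_pow_left₀ h zero_le (by lia)
      _ = V.valuation (Θ ^ ℓ) := by rw [← pow_add, map_pow]; congr 1; lia

include hV hℓ hζ hθ in
theorem valuation_sub_pow_of_le
    (h : V.valuation (θ - algebraMap K L u) ≤ V.valuation (algebraMap K L ((1 - ζ) * u))) :
    V.valuation (algebraMap K L (α - u ^ ℓ)) ≤ V.valuation (algebraMap K L (((1 - ζ) * u) ^ ℓ)) := by
  set Θ := θ - algebraMap K L u with hΘ
  have e : algebraMap K L (α - u ^ ℓ) = Θ ^ ℓ + mixedTerms ℓ Θ u := by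
    rw [hΘ, sub_pow_eq hℓ hθ]
    ring
  rw [e, map_pow (algebraMap K L)]
  refine (V.valuation.map_add _ _).trans (max_le ?_ ?_)
  · rw [map_pow, map_pow]
    gcongr
  · apply Valuation.map_sum_le
    intro i hi
    refine (valuation_mixedTerm_le hV hℓ hζ hi Θ).trans ?_
    obtain ⟨hi1, hi2⟩ := Finset.mem_Ico.1 hi
    calc _ ≤ V.valuation (algebraMap K L ((1 - ζ) * u)) ^ i *
          V.valuation (algebraMap K L ((1 - ζ) * u)) ^ (ℓ - i) := by gcongr
      _ = _ := by rw [← pow_add, map_pow]; congr 1; lia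

include hV hℓ hζ hθ in
theorem valuation_sub_of_ramified (h0 : α - u ^ ℓ ≠ 0)
    (hu : u = 0 ∨ ordP p (α - u ^ ℓ) < ℓ * (ordP p (1 - ζ) + ordP p u)) :
    V.valuation (θ - algebraMap K L u) ^ ℓ = V.valuation (algebraMap K L (α - u ^ ℓ)) := by
  by_cases h : V.valuation (algebraMap K L ((1 - ζ) * u)) < V.valuation (θ - algebraMap K L u)
  · exact valuation_sub_pow_of_lt hV hℓ hζ hθ h
  exfalso
  have h2 := valuation_sub_pow_of_le hV hℓ hζ hθ (not_lt.1 h)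
  have h1 : (1 : K) - ζ ≠ 0 := sub_ne_zero.2 (hζ.ne_one hℓ.one_lt).symm
  by_cases hu0 : u = 0
  · subst hu0
    simp only [mul_zero, zero_pow hℓ.ne_zero, map_zero, sub_zero, le_zero_iff,
      Valuation.zero_iff] at h2 h0
    simp at h2
    exact h0 h2
  · rw [hV.valuation_le_iff h0 (pow_ne_zero _ (mul_ne_zero h1 hu0)), ordP_pow,
      ordP_mul p h1 hu0] at h2
    rcases hu with hu | hu
    · exact hu0 hu
    · lia

include hV hℓ hζ hθ in
theorem valuation_sub_of_unramified (hu : u ≠ 0)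
    (h : α - u ^ ℓ ∈ ordPGe p (ℓ * (ordP p (1 - ζ) + ordP p u))) :
    V.valuation (θ - algebraMap K L u) ≤ V.valuation (algebraMap K L ((1 - ζ) * u)) := by
  by_contra! hc
  have h1 : (1 : K) - ζ ≠ 0 := sub_ne_zero.2 (hζ.ne_one hℓ.one_lt).symm
  have h2 := valuation_sub_pow_of_lt hV hℓ hζ hθ hc
  have h3 : V.valuation (algebraMap K L (α - u ^ ℓ)) ≤
      V.valuation (algebraMap K L ((1 - ζ) * u)) ^ ℓ := by
    rcases (mem_ordPGe p).1 h with h | h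
    · rw [h]; simp
    · by_cases h0 : α - u ^ ℓ = 0
      · rw [h0]; simp
      rw [← map_pow, ← map_pow, hV.valuation_le_iff h0 (pow_ne_zero _ (mul_ne_zero h1 hu)),
        ordP_pow, ordP_mul p h1 hu]
      exact h
  rw [← h2] at h3
  exact absurd (pow_lt_pow_left₀ hc zero_le hℓ.ne_zero) (not_lt.2 h3)

end KummerValuation

section KummerCount

open IsDedekindDomain WithZero Module

theorem two_mul_sum_ediv {ℓ : ℕ} (hℓ : ℓ.Prime) {n : ℤ} (hn : ¬ (ℓ : ℤ) ∣ n) :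
    2 * ∑ i : Fin ℓ, ((i : ℕ) * n / ℓ : ℤ) = (ℓ - 1) * (n - 1) := by
  rw [← Finset.sum_range (fun i : ℕ ↦ ((i : ℤ) * n / ℓ : ℤ))]
  obtain ⟨k, rfl⟩ : ∃ k, ℓ = k + 1 := ⟨ℓ - 1, by have := hℓ.pos; lia⟩
  rw [Finset.sum_range_succ', Nat.cast_zero, zero_mul, Int.zero_ediv, add_zero, two_mul]
  nth_rewrite 2 [← Finset.sum_range_reflect]
  rw [← Finset.sum_add_distrib]
  have : ∀ i ∈ Finset.range k, (((i + 1 : ℕ) : ℤ) * n / ((k + 1 : ℕ) : ℤ) +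
      ((k - 1 - i + 1 : ℕ) : ℤ) * n / ((k + 1 : ℕ) : ℤ)) = n - 1 := by
    intro i hi
    have hik := Finset.mem_range.1 hi
    have hpos : (0 : ℤ) < ((k + 1 : ℕ) : ℤ) := by positivity
    have e : ((k - 1 - i + 1 : ℕ) : ℤ) * n = -(((i + 1 : ℕ) : ℤ) * n) + n * ((k + 1 : ℕ) : ℤ) := by
      have : k - 1 - i + 1 = k - i := by lia
      rw [this, Nat.cast_sub hik.le]
      push_cast
      ring
    have hnd : ¬ ((k + 1 : ℕ) : ℤ) ∣ ((i + 1 : ℕ) : ℤ) * n := by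
      intro hd
      rcases Int.Prime.dvd_mul' hℓ hd with h | h
      · rw [Int.natCast_dvd_natCast] at h
        have := Nat.le_of_dvd (by lia) h
        lia
      · exact hn h
    rw [e, Int.add_mul_ediv_right _ _ hpos.ne']
    set a := ((i + 1 : ℕ) : ℤ) * n
    set d := ((k + 1 : ℕ) : ℤ)
    have h1 := Int.emod_add_mul_ediv a d
    have h2 := Int.emod_nonneg a hpos.ne'
    have h3 := Int.emod_lt_of_pos a hpos
    have h4 : a % d ≠ 0 := fun h ↦ hnd (Int.dvd_of_emod_eq_zero h)
    have h5 : -a / d = -(a / d) - 1 := by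
      have h6 : 0 < a % d := lt_of_le_of_ne h2 (Ne.symm h4)
      rw [Int.ediv_eq_iff_of_pos hpos]
      constructor <;> linarith [h1, mul_comm d (a / d)]
    rw [h5]
    ring
  rw [Finset.sum_congr rfl this, Finset.sum_const, Finset.card_range, nsmul_eq_mul]
  push_cast
  ring

variable {K : Type*} [Field K] [NumberField K] {L : Type*} [Field L] [NumberField L] [Algebra K L]
  {p : HeightOneSpectrum (𝓞 K)} {ℓ : ℕ} {Θ : L} {β : K}

theorem valuation_smul_pow_pow {V : ValuationSubring L}
    (hΘ : V.valuation Θ ^ ℓ = V.valuation (algebraMap K L β)) (a : K) (i : ℕ) :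
    V.valuation (algebraMap K L a * Θ ^ i) ^ ℓ = V.valuation (algebraMap K L (a ^ ℓ * β ^ i)) := by
  rw [map_mul, mul_pow, map_pow, ← pow_mul, mul_comm i ℓ, pow_mul, hΘ, map_mul, map_mul, map_pow,
    map_pow, map_pow, map_pow]

theorem ordP_pow_mul_pow {a : K} (ha : a ≠ 0) (hβ : β ≠ 0) (i : ℕ) :
    ordP p (a ^ ℓ * β ^ i) = ℓ * ordP p a + i * ordP p β := by
  rw [ordP_mul p (pow_ne_zero _ ha) (pow_ne_zero _ hβ), ordP_pow, ordP_pow]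

theorem smul_pow_mem_iff (hℓ : ℓ.Prime) {V : ValuationSubring L} (hV : LiesAbove p V)
    (hΘ : V.valuation Θ ^ ℓ = V.valuation (algebraMap K L β)) (hβ : β ≠ 0) {a : K} (ha : a ≠ 0)
    (i : ℕ) : V.valuation (algebraMap K L a * Θ ^ i) ≤ 1 ↔
      -(i * ordP p β / ℓ) ≤ ordP p a := by
  rw [← pow_le_one_iff_of_nonneg zero_le hℓ.ne_zero, valuation_smul_pow_pow hΘ,
    hV.valuation_le_one_iff (mul_ne_zero (pow_ne_zero _ ha) (pow_ne_zero _ hβ)),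
    ordP_pow_mul_pow ha hβ, neg_le, Int.le_ediv_iff_mul_le (by exact_mod_cast hℓ.pos)]
  constructor <;> intro h <;> linarith

/-- If `Θ ^ ℓ` has a valuation prime to `ℓ`, integrality can be read off coordinatewise. -/
theorem smul_pow_mem_of_sum_mem (hℓ : ℓ.Prime) {V : ValuationSubring L} (hV : LiesAbove p V)
    (hΘ : V.valuation Θ ^ ℓ = V.valuation (algebraMap K L β)) (hβ : β ≠ 0)
    (hn : ¬ (ℓ : ℤ) ∣ ordP p β) {a : Fin ℓ → K}
    (ha : V.valuation (∑ i, algebraMap K L (a i) * Θ ^ (i : ℕ)) ≤ 1) (i : Fin ℓ) :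
    V.valuation (algebraMap K L (a i) * Θ ^ (i : ℕ)) ≤ 1 := by
  classical
  have : Nonempty (Fin ℓ) := ⟨i⟩
  obtain ⟨j, -, hj⟩ := Finset.exists_max_image Finset.univ
    (fun i : Fin ℓ ↦ V.valuation (algebraMap K L (a i) * Θ ^ (i : ℕ))) Finset.univ_nonempty
  refine (hj i (Finset.mem_univ _)).trans ?_
  by_cases h0 : a j = 0
  · simp [h0]
  rwa [← Valuation.map_sum_eq_of_lt V.valuation
    (f := fun i : Fin ℓ ↦ algebraMap K L (a i) * Θ ^ (i : ℕ)) (Finset.mem_univ j)]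
  intro k hk
  have hkj : k ≠ j := by simpa using hk
  refine lt_of_le_of_ne (hj k (Finset.mem_univ _)) fun he ↦ hkj ?_
  have he' := congrArg (· ^ ℓ) he
  simp only [valuation_smul_pow_pow hΘ] at he'
  have hk0 : a k ≠ 0 := by
    intro hk0
    rw [hk0, zero_pow hℓ.ne_zero, zero_mul, map_zero, map_zero, eq_comm, Valuation.zero_iff] at he'
    simp only [map_mul, map_pow, mul_eq_zero, pow_eq_zero_iff', map_eq_zero] at he'
    tauto
  rw [hV.valuation_eq_iff (mul_ne_zero (pow_ne_zero _ hk0) (pow_ne_zero _ hβ))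
    (mul_ne_zero (pow_ne_zero _ h0) (pow_ne_zero _ hβ)), ordP_pow_mul_pow hk0 hβ,
    ordP_pow_mul_pow h0 hβ] at he'
  have hd : (ℓ : ℤ) ∣ ((k : ℕ) - (j : ℕ) : ℤ) * ordP p β :=
    ⟨ordP p (a j) - ordP p (a k), by linarith⟩
  rcases Int.Prime.dvd_mul' hℓ hd with h | h
  · have h2 : ((k : ℕ) - (j : ℕ) : ℤ) = 0 := by
      apply Int.eq_zero_of_abs_lt_dvd h
      rw [abs_lt]
      constructor <;> lia
    exact Fin.ext (by lia)
  · exact absurd h hn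

theorem count_detIdeal_of_ramified (hℓ : ℓ.Prime) (b b' : Basis (Fin ℓ) K L)
    (hb' : ∀ i, b' i = Θ ^ (i : ℕ)) (hbb' : ∀ w, b.det w = b'.det w)
    (hΘ : ∀ V : ValuationSubring L, LiesAbove p V →
      V.valuation Θ ^ ℓ = V.valuation (algebraMap K L β))
    (hβ : β ≠ 0) (hn : ¬ (ℓ : ℤ) ∣ ordP p β) :
    2 * FractionalIdeal.count K p (detIdeal b) = -((ℓ - 1) * (ordP p β - 1)) := by
  rw [← two_mul_sum_ediv hℓ hn, ← mul_neg, ← Finset.sum_neg_distrib]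
  congr 1
  choose c hc0 hc using fun i : Fin ℓ ↦ exists_ordP_eq p (-((i : ℕ) * ordP p β / ℓ) : ℤ)
  have hdet : b.det (fun i ↦ c i • b' i) = ∏ i, c i := by
    rw [hbb', AlternatingMap.map_smul_univ]
    simp [Basis.det_self]
  refine count_detIdeal_eq p b ?_ (w := fun i ↦ c i • b' i) ?_ ?_ ?_
  · intro w hw
    rw [hbb', Basis.det_apply]
    apply det_mem_ordPGe
    intro i j
    obtain ⟨V, hV⟩ := exists_liesAbove p (L := L)
    have h1 : V.valuation (w j) ≤ 1 :=
      (V.valuation_le_one_iff _).2 (mem_valuationSubring_of_isIntegral V (hw j))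
    rw [← b'.sum_repr (w j)] at h1
    simp only [hb', Algebra.smul_def] at h1
    have h2 := smul_pow_mem_of_sum_mem hℓ hV (hΘ V hV) hβ hn h1 i
    rw [Basis.toMatrix_apply, mem_ordPGe, or_iff_not_imp_left]
    exact fun h0 ↦ (smul_pow_mem_iff hℓ hV (hΘ V hV) hβ h0 i).1 h2
  · intro V hV i
    rw [← V.valuation_le_one_iff, Algebra.smul_def, hb',
      smul_pow_mem_iff hℓ hV (hΘ V hV) hβ (hc0 i), hc]
  · rw [hdet]
    exact Finset.prod_ne_zero_iff.2 fun i _ ↦ hc0 i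
  · rw [hdet]
    have : ∀ s : Finset (Fin ℓ), ordP p (∏ i ∈ s, c i) = ∑ i ∈ s, ordP p (c i) := by
      intro s
      induction s using Finset.induction_on with
      | empty => simp
      | insert a s ha ih =>
        rw [Finset.prod_insert ha, Finset.sum_insert ha, ordP_mul p (hc0 a)
          (Finset.prod_ne_zero_iff.2 fun i _ ↦ hc0 i), ih]
    rw [this]
    simp only [hc]

theorem count_detIdeal_of_unramified (hℓ : ℓ.Prime) {ζ : K} (hζ : IsPrimitiveRoot ζ ℓ)
    {θ : L} {α u : K} (b : Basis (Fin ℓ) K L) (hb : ∀ i, b i = θ ^ (i : ℕ))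
    (hθ : θ ^ ℓ = algebraMap K L α) (hα : α ≠ 0) (hu : u ≠ 0) (hαu : ordP p α = ℓ * ordP p u)
    (h : α - u ^ ℓ ∈ ordPGe p (ℓ * (ordP p (1 - ζ) + ordP p u))) :
    2 * FractionalIdeal.count K p (detIdeal b) =
      -((ℓ - 1) * (ℓ * (ordP p (1 - ζ) + ordP p u))) := by
  have h1 : (1 : K) - ζ ≠ 0 := sub_ne_zero.2 (hζ.ne_one hℓ.one_lt).symm
  have hlu : (1 - ζ) * u ≠ 0 := mul_ne_zero h1 hu
  have hdiscr : ordP p (Algebra.discr K b) = (ℓ - 1) * (ℓ * (ordP p (1 - ζ) + ordP p u)) := by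
    have hl0 : (ℓ : K) ≠ 0 := by exact_mod_cast hℓ.ne_zero
    have : ordP p ((ℓ : K) ^ ℓ * α ^ (ℓ - 1)) = (ℓ - 1) * (ℓ * (ordP p (1 - ζ) + ordP p u)) := by
      rw [ordP_mul p (pow_ne_zero _ hl0) (pow_ne_zero _ hα), ordP_pow, ordP_pow,
        ordP_prime_eq p hℓ hζ, hαu, Nat.cast_sub hℓ.one_le]
      push_cast
      ring
    rcases discr_kummer b hb hθ hℓ.ne_zero with h | h
    · rw [h, this]
    · rw [h, ordP_neg, this]
  obtain ⟨k, hk⟩ : ∃ k : ℤ, (ℓ - 1) * (ℓ * (ordP p (1 - ζ) + ordP p u)) = 2 * k := by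
    have : Even ((ℓ - 1 : ℤ) * ℓ) := by
      have := Int.even_mul_succ_self (ℓ - 1 : ℤ)
      simpa using this
    obtain ⟨r, hr⟩ := this
    exact ⟨r * (ordP p (1 - ζ) + ordP p u), by rw [← mul_assoc, hr]; ring⟩
  rw [hk, ← mul_neg]
  congr 1
  have hdet : b.det (fun i ↦ ((1 - ζ) * u)⁻¹ ^ (i : ℕ) • (θ - algebraMap K L u) ^ (i : ℕ)) =
      ((1 - ζ) * u)⁻¹ ^ (∑ i : Fin ℓ, (i : ℕ)) := by
    rw [AlternatingMap.map_smul_univ, det_sub_pow b hb, smul_eq_mul, mul_one,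
      Finset.prod_pow_eq_pow_sum]
  refine count_detIdeal_eq p b ?_
    (w := fun i ↦ ((1 - ζ) * u)⁻¹ ^ (i : ℕ) • (θ - algebraMap K L u) ^ (i : ℕ)) ?_ ?_ ?_
  · intro w hw
    rw [mem_ordPGe, or_iff_not_imp_left]
    intro h0
    have h2 : IsIntegral ℤ (Algebra.discr K w) := Algebra.discr_isIntegral K hw
    have h3 := ordP_nonneg_of_isIntegral p h2
    rw [discr_eq_det_sq_mul b, ordP_mul p (pow_ne_zero _ h0) (discr_basis_ne_zero b), ordP_pow,
      hdiscr, hk] at h3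
    push_cast at h3
    lia
  · intro V hV i
    have h2 := valuation_sub_of_unramified hV hℓ hζ hθ hu h
    rw [← V.valuation_le_one_iff, Algebra.smul_def, map_pow, ← mul_pow, map_pow]
    apply pow_le_one₀ zero_le
    have h3 : V.valuation (algebraMap K L ((1 - ζ) * u)) ≠ 0 := by
      rwa [Valuation.ne_zero_iff, Ne, FaithfulSMul.algebraMap_eq_zero_iff]
    rw [map_mul, map_inv₀, map_inv₀]
    exact inv_mul_le_one_of_le₀ h2 zero_le
  · rw [hdet]
    exact pow_ne_zero _ (inv_ne_zero hlu)
  · rw [hdet, ordP_pow, ordP_inv, ordP_mul p h1 hu]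
    have hs : (∑ i : Fin ℓ, (i : ℕ)) * 2 = ℓ * (ℓ - 1) := by
      rw [← Finset.sum_range (fun i ↦ i), Finset.sum_range_id_mul_two]
    have hs' : ((∑ i : Fin ℓ, (i : ℕ) : ℕ) : ℤ) * 2 = ℓ * (ℓ - 1) := by
      have := congrArg (Nat.cast (R := ℤ)) hs
      rwa [Nat.cast_mul, Nat.cast_mul, Nat.cast_sub hℓ.one_le, Nat.cast_one] at this
    have : 2 * (((∑ i : Fin ℓ, (i : ℕ) : ℕ) : ℤ) * (ordP p (1 - ζ) + ordP p u)) = 2 * k := by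
      rw [← hk]
      linear_combination (ordP p (1 - ζ) + ordP p u) * hs'
    lia

end KummerCount

section KummerData

open IsDedekindDomain WithZero Module

variable {K : Type*} [Field K] [NumberField K]

/-- Local data at `p` of the Kummer extension generated by an `ℓ`-th root of `α`;
`c` is twice the exponent of the determinant ideal at `p`. -/
def KummerData (p : HeightOneSpectrum (𝓞 K)) (ℓ : ℕ) (lam α : K) (c : ℤ) : Prop :=
  (∃ u, α - u ^ ℓ ≠ 0 ∧ ¬ (ℓ : ℤ) ∣ ordP p (α - u ^ ℓ) ∧
    (u = 0 ∨ ordP p (α - u ^ ℓ) < ℓ * (ordP p lam + ordP p u)) ∧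
    c = -((ℓ - 1) * (ordP p (α - u ^ ℓ) - 1))) ∨
  ∃ u, u ≠ 0 ∧ ordP p α = ℓ * ordP p u ∧
    α - u ^ ℓ ∈ ordPGe p (ℓ * (ordP p lam + ordP p u)) ∧
    c = -((ℓ - 1) * (ℓ * (ordP p lam + ordP p u)))

variable {p : HeightOneSpectrum (𝓞 K)} {ℓ : ℕ} (hℓ : ℓ.Prime) {ζ : K} (hζ : IsPrimitiveRoot ζ ℓ)

include hℓ hζ in
theorem KummerData.count_detIdeal {L : Type*} [Field L] [NumberField L] [Algebra K L] {θ : L}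
    {α : K} {c : ℤ} (h : KummerData p ℓ (1 - ζ) α c) (b : Basis (Fin ℓ) K L)
    (hb : ∀ i, b i = θ ^ (i : ℕ)) (hθ : θ ^ ℓ = algebraMap K L α) (hα : α ≠ 0) :
    2 * FractionalIdeal.count K p (detIdeal b) = c := by
  rcases h with ⟨u, h0, h1, h2, rfl⟩ | ⟨u, hu, h1, h2, rfl⟩
  · obtain ⟨b', hb', hbb'⟩ := exists_basis_sub_pow b hb u
    exact count_detIdeal_of_ramified hℓ b b' hb' hbb'
      (fun V hV ↦ valuation_sub_of_ramified hV hℓ hζ hθ h0 h2) h0 h1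
  · exact count_detIdeal_of_unramified hℓ hζ b hb hθ hα hu h1 h2

theorem ordP_pow_absNorm_sub {x : K} (hx : x ≠ 0) (hx0 : ordP p x = 0) :
    x ^ (Ideal.absNorm p.asIdeal) - x ∈ ordPGe p 1 := by
  have hv : p.valuation K x ≤ 1 := by
    rw [valuation_eq_exp_ordP p hx, hx0, neg_zero, exp_zero]
  obtain ⟨r, ⟨s, hs⟩, hrs⟩ := p.exists_primeCompl_mul_eq_of_integer x hv
  have hs' : s ∉ p.asIdeal := hs
  have hs0 : s ≠ 0 := by
    rintro rfl
    exact hs' (zero_mem _)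
  have hsK : algebraMap (𝓞 K) K s ≠ 0 := by simpa using hs0
  simp only at hrs
  set q := Ideal.absNorm p.asIdeal with hq
  have hpow : ∀ y : 𝓞 K, y ^ q - y ∈ p.asIdeal := by
    intro y
    have : p.asIdeal.IsMaximal := p.isMaximal
    let : Field (𝓞 K ⧸ p.asIdeal) := Ideal.Quotient.field _
    have : Finite (𝓞 K ⧸ p.asIdeal) := Ideal.finiteQuotientOfFreeOfNeBot _ p.ne_bot
    let := Fintype.ofFinite (𝓞 K ⧸ p.asIdeal)
    have hc : q = Fintype.card (𝓞 K ⧸ p.asIdeal) := by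
      rw [hq, Ideal.absNorm_apply, Submodule.cardQuot_apply, Nat.card_eq_fintype_card]
    rw [← Ideal.Quotient.eq, map_pow, hc, FiniteField.pow_card]
  have hmem : r ^ q * s - r * s ^ q ∈ p.asIdeal := by
    have : r ^ q * s - r * s ^ q = (r ^ q - r) * s - r * (s ^ q - s) := by ring
    rw [this]
    exact sub_mem (Ideal.mul_mem_right _ _ (hpow r)) (Ideal.mul_mem_left _ _ (hpow s))
  have e : x ^ q - x = algebraMap (𝓞 K) K (r ^ q * s - r * s ^ q) *
      (algebraMap (𝓞 K) K s ^ (q + 1))⁻¹ := by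
    rw [eq_mul_inv_iff_mul_eq₀ (pow_ne_zero _ hsK), map_sub, map_mul, map_mul, map_pow, map_pow,
      ← hrs]
    ring
  rw [e]
  by_cases h0 : r ^ q * s - r * s ^ q = 0
  · rw [h0, map_zero, zero_mul]
    exact zero_mem _
  · rw [show (1 : ℤ) = 1 + 0 from rfl]
    apply ordPGe_mul
    · rw [mem_ordPGe]
      have := (mem_pow_iff_le_ordP (K := K) p h0 1).1 (by rwa [pow_one])
      exact Or.inr (by exact_mod_cast this)
    · rw [mem_ordPGe, ordP_inv, ordP_pow, (ordP_algebraMap_eq_zero_iff p hs0).2 hs']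
      simp

include hℓ in
theorem dvd_absNorm (hp : (ℓ : 𝓞 K) ∈ p.asIdeal) : ℓ ∣ Ideal.absNorm p.asIdeal := by
  have : Fact ℓ.Prime := ⟨hℓ⟩
  have h1 : addOrderOf (1 : 𝓞 K ⧸ p.asIdeal) = ℓ := by
    apply addOrderOf_eq_prime
    · rw [nsmul_eq_mul, mul_one]
      have := Ideal.Quotient.eq_zero_iff_mem.2 hp
      rwa [map_natCast] at this
    · have : Nontrivial (𝓞 K ⧸ p.asIdeal) :=
        Ideal.Quotient.nontrivial_iff.2 p.isPrime.ne_top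
      exact one_ne_zero
  rw [← h1, Ideal.absNorm_apply, Submodule.cardQuot_apply]
  exact addOrderOf_dvd_natCard _

include hℓ in
theorem exists_pow_approx (hp : (ℓ : 𝓞 K) ∈ p.asIdeal) {β : K} (hβ : β ≠ 0)
    (hd : (ℓ : ℤ) ∣ ordP p β) :
    ∃ y : K, y ≠ 0 ∧ ordP p β = ℓ * ordP p y ∧ β - y ^ ℓ ∈ ordPGe p (ordP p β + 1) := by
  obtain ⟨k, hk⟩ := hd
  obtain ⟨q, hq⟩ := dvd_absNorm hℓ hp
  obtain ⟨t, ht0, ht⟩ := exists_ordP_eq p k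
  have htl : t ^ ℓ ≠ 0 := pow_ne_zero _ ht0
  set x := β / t ^ ℓ with hx
  have hx0 : x ≠ 0 := div_ne_zero hβ htl
  have hxo : ordP p x = 0 := by
    rw [hx, ordP_div p hβ htl, ordP_pow, hk, ht, sub_self]
  have hyo : ordP p (t * x ^ q) = k := by
    rw [ordP_mul p ht0 (pow_ne_zero _ hx0), ordP_pow, hxo, ht, mul_zero, add_zero]
  refine ⟨t * x ^ q, mul_ne_zero ht0 (pow_ne_zero _ hx0), by rw [hyo, hk], ?_⟩
  have e : β - (t * x ^ q) ^ ℓ = t ^ ℓ * -(x ^ (ℓ * q) - x) := by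
    have : β = t ^ ℓ * x := by rw [hx, mul_div_cancel₀ _ htl]
    rw [this]
    ring
  rw [e]
  apply ordPGe_mul
  · rw [mem_ordPGe, ordP_pow, ht, hk]
    exact Or.inr le_rfl
  · rw [← hq]
    exact neg_mem (ordP_pow_absNorm_sub hx0 hxo)

theorem ordPGe_mono {k l : ℤ} (hkl : k ≤ l) {x : K} (hx : x ∈ ordPGe p l) : x ∈ ordPGe p k := by
  rw [mem_ordPGe] at hx ⊢
  exact hx.imp_right hkl.trans

theorem self_mem_ordPGe (x : K) : x ∈ ordPGe p (ordP p x) := (mem_ordPGe p).2 (Or.inr le_rfl)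

include hℓ hζ in
theorem sub_add_pow_mem {β u y : K} {k : ℤ} (hu : u ≠ 0) (hy : y ≠ 0)
    (h1 : β - u ^ ℓ - y ^ ℓ ∈ ordPGe p k) (huy : ordP p u < ordP p y)
    (hk : k ≤ ordP p y + (ℓ - 1) * (ordP p u + ordP p (1 - ζ))) :
    β - (u + y) ^ ℓ ∈ ordPGe p k := by
  have h := add_pow y u ℓ
  rw [Finset.sum_range_succ, Finset.range_eq_Ico, Finset.sum_eq_sum_Ico_succ_bot hℓ.pos] at h
  simp only [pow_zero, Nat.sub_zero, Nat.choose_zero_right, Nat.sub_self, Nat.choose_self,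
    Nat.cast_one, mul_one, one_mul, zero_add] at h
  have e : β - (u + y) ^ ℓ = (β - u ^ ℓ - y ^ ℓ) -
      ∑ i ∈ Finset.Ico 1 ℓ, y ^ i * u ^ (ℓ - i) * (ℓ.choose i : K) := by
    rw [add_comm u y, h]
    ring
  rw [e]
  refine sub_mem h1 (Submodule.sum_mem _ fun i hi ↦ ?_)
  obtain ⟨hi1, hi2⟩ := Finset.mem_Ico.1 hi
  have hc : (ℓ.choose i : K) ≠ 0 := by exact_mod_cast (Nat.choose_pos hi2.le).ne'
  rw [mem_ordPGe, ordP_mul p (mul_ne_zero (pow_ne_zero _ hy) (pow_ne_zero _ hu)) hc,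
    ordP_mul p (pow_ne_zero _ hy) (pow_ne_zero _ hu), ordP_pow, ordP_pow, Nat.cast_sub hi2.le]
  right
  have h3 := ordP_choose_ge p hℓ hζ (by lia : i ≠ 0) hi2
  have hi3 : (1 : ℤ) ≤ i := by exact_mod_cast hi1
  nlinarith

include hℓ hζ in
theorem exists_kummerData {α : K} (hα : α ≠ 0) : ∃ c, KummerData p ℓ (1 - ζ) α c := by
  by_cases hd : (ℓ : ℤ) ∣ ordP p α
  swap
  · exact ⟨_, Or.inl ⟨0, by simpa [zero_pow hℓ.ne_zero],
      by simpa [zero_pow hℓ.ne_zero], Or.inl rfl, rfl⟩⟩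
  have hlam := ordP_one_sub_zeta_nonneg p hℓ hζ
  have hl2 : (2 : ℤ) ≤ ℓ := by exact_mod_cast hℓ.two_le
  rcases hlam.eq_or_lt with hlam0 | hlam0
  · obtain ⟨k, hk⟩ := hd
    obtain ⟨t, ht0, ht⟩ := exists_ordP_eq p k
    refine ⟨_, Or.inr ⟨t, ht0, by rw [hk, ht], ?_, rfl⟩⟩
    rw [← hlam0, zero_add, ht, ← hk]
    refine sub_mem (self_mem_ordPGe α) ?_
    rw [mem_ordPGe, ordP_pow, ht, hk]
    exact Or.inr le_rfl
  have hp : (ℓ : 𝓞 K) ∈ p.asIdeal := by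
    by_contra hp
    have h1 := (ordP_algebraMap_eq_zero_iff (K := K) p
      (by exact_mod_cast hℓ.ne_zero : (ℓ : 𝓞 K) ≠ 0)).2 hp
    rw [map_natCast, ordP_prime_eq p hℓ hζ] at h1
    nlinarith
  by_contra! hc
  have key : ∀ m : ℕ, ∃ u : K, u ≠ 0 ∧ ordP p α = ℓ * ordP p u ∧
      α - u ^ ℓ ∈ ordPGe p (ordP p α + 1 + m) := by
    intro m
    induction m with
    | zero => simpa using exists_pow_approx hℓ hp hα hd
    | succ m ih =>
      obtain ⟨u, hu0, hu, hum⟩ := ih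
      by_cases h0 : α - u ^ ℓ = 0
      · exact ⟨u, hu0, hu, by rw [h0]; exact zero_mem _⟩
      have h1 := ((mem_ordPGe p).1 hum).resolve_left h0
      by_cases h2 : ordP p α + 1 + (m + 1 : ℕ) ≤ ordP p (α - u ^ ℓ)
      · exact ⟨u, hu0, hu, (mem_ordPGe p).2 (Or.inr h2)⟩
      have h3 : ordP p (α - u ^ ℓ) < ℓ * (ordP p (1 - ζ) + ordP p u) := by
        by_contra! h3
        exact hc _ (Or.inr ⟨u, hu0, hu, (mem_ordPGe p).2 (Or.inr h3), rfl⟩)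
      have h4 : (ℓ : ℤ) ∣ ordP p (α - u ^ ℓ) := by
        by_contra! h4
        exact hc _ (Or.inl ⟨u, h0, h4, Or.inr h3, rfl⟩)
      obtain ⟨y, hy0, hy, hym⟩ := exists_pow_approx hℓ hp h0 h4
      have hm : ordP p α + 1 + (m + 1 : ℕ) = ordP p (α - u ^ ℓ) + 1 := by
        push_cast at h2 ⊢
        lia
      have huy : ordP p u < ordP p y := by
        have : ℓ * ordP p u < ℓ * ordP p y := by
          rw [← hy, ← hu]
          push_cast at hm
          lia
        exact lt_of_mul_lt_mul_left this (by lia)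
      have hyl : ordP p y < ordP p (1 - ζ) + ordP p u := by
        rw [hy] at h3
        exact lt_of_mul_lt_mul_left h3 (by lia)
      refine ⟨u + y, (ordP_add_eq p hu0 (Or.inr huy)).1, ?_, ?_⟩
      · rw [(ordP_add_eq p hu0 (Or.inr huy)).2, hu]
      · rw [hm]
        refine sub_add_pow_mem hℓ hζ hu0 hy0 hym huy ?_
        rw [hy]
        nlinarith
  obtain ⟨u, hu0, hu, hum⟩ := key (ℓ * ordP p (1 - ζ)).toNat
  refine hc _ (Or.inr ⟨u, hu0, hu, ordPGe_mono ?_ hum, rfl⟩)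
  have := Int.self_le_toNat (ℓ * ordP p (1 - ζ))
  rw [hu, mul_add]
  lia

include hℓ hζ in
theorem KummerData.mul {α z : K} {c : ℤ} (h : KummerData p ℓ (1 - ζ) α c) (hα : α ≠ 0)
    (hz : z - 1 ∈ ordPGe p (ℓ * ordP p (1 - ζ) + 1)) :
    KummerData p ℓ (1 - ζ) (α * z) c := by
  have hlam := ordP_one_sub_zeta_nonneg p hℓ hζ
  have hl2 : (2 : ℤ) ≤ ℓ := by exact_mod_cast hℓ.two_le
  have hz1 : z ≠ 0 ∧ ordP p z = 0 := by
    have := ordP_add_eq p (x := (1 : K)) (y := z - 1) one_ne_zero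
      (((mem_ordPGe p).1 hz).imp_right fun h ↦ by
        rw [ordP_one]
        nlinarith)
    rwa [add_sub_cancel, ordP_one] at this
  have hmem : α * (z - 1) ∈ ordPGe p (ordP p α + (ℓ * ordP p (1 - ζ) + 1)) :=
    ordPGe_mul p (self_mem_ordPGe α) hz
  have e : ∀ u : K, α * z - u ^ ℓ = (α - u ^ ℓ) + α * (z - 1) := fun u ↦ by ring
  rcases h with ⟨u, h0, h1, h2, rfl⟩ | ⟨u, hu, h1, h2, rfl⟩
  · left
    have hlt : ordP p (α - u ^ ℓ) < ordP p α + (ℓ * ordP p (1 - ζ) + 1) := by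
      by_cases hu0 : u = 0
      · simp only [hu0, zero_pow hℓ.ne_zero, sub_zero]
        nlinarith
      have h3 := h2.resolve_left hu0
      have h4 := ordP_add p (x := α - u ^ ℓ) (y := u ^ ℓ)
        (k := min (ordP p (α - u ^ ℓ)) (ℓ * ordP p u)) (by simpa)
        (Or.inr (min_le_left _ _)) (Or.inr (by rw [ordP_pow]; exact min_le_right _ _))
      rw [sub_add_cancel] at h4
      rcases min_le_iff.1 h4 with h5 | h5
      · nlinarith
      · lia
    have h3 := ordP_add_eq p h0 (((mem_ordPGe p).1 hmem).imp_right hlt.trans_le)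
    rw [← e] at h3
    exact ⟨u, h3.1, by rwa [h3.2], by rwa [h3.2], by rw [h3.2]⟩
  · right
    refine ⟨u, hu, by rw [ordP_mul p hα hz1.1, hz1.2, add_zero, h1], ?_, rfl⟩
    rw [e]
    refine add_mem h2 (ordPGe_mono ?_ hmem)
    rw [h1]
    lia

include hℓ in
theorem KummerData.eq_of_tame {α lam : K} {c : ℤ} (h : KummerData p ℓ lam α c)
    (hlam : ordP p lam = 0) :
    c = -((ℓ - 1) * (ordP p α - if (ℓ : ℤ) ∣ ordP p α then 0 else 1)) := by
  rcases h with ⟨u, h0, h1, h2, rfl⟩ | ⟨u, hu, h1, h2, rfl⟩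
  · have : ordP p α = ordP p (α - u ^ ℓ) := by
      by_cases hu0 : u = 0
      · simp [hu0, zero_pow hℓ.ne_zero]
      have h3 := h2.resolve_left hu0
      rw [hlam, zero_add, ← ordP_pow] at h3
      have h4 := ordP_add_eq p h0 (Or.inr h3)
      rw [sub_add_cancel] at h4
      exact h4.2
    rw [this, if_neg h1]
  · rw [if_pos ⟨_, h1⟩, hlam, h1, zero_add, sub_zero]

theorem KummerData.dvd {α lam : K} {c : ℤ} (h : KummerData p ℓ lam α c) : (ℓ - 1 : ℤ) ∣ c := by
  rcases h with ⟨u, h0, h1, h2, rfl⟩ | ⟨u, hu, h1, h2, rfl⟩ <;>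
  exact (dvd_mul_right _ _).neg_right

end KummerData

section FibreCount

open Topology

variable {D G : Type*} [CancelCommMonoid D] [CommGroup G] (s : RaySys D G)
  (ι : Type*) [Fintype ι] [DecidableEq ι]

namespace RaySys

open scoped Classical in
/-- The number of tuples with squarefree product in given classes, without the trivial tuple. -/
def T₁ (g : ι → G) (Y : ℝ) : ℕ :=
  Nat.card {a : ι → D // a ≠ 1 ∧ (s.N (∏ i, a i) : ℝ) ≤ Y ∧ (∀ i, s.cl (a i) = g i) ∧
    s.Sqf (∏ i, a i)}

open scoped Classical in
theorem T₁_eq_card_erase (g : ι → G) (Y : ℝ) : s.T₁ ι g Y = (((s.Tup ι Y).filter fun a ↦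
    (∀ i, s.cl (a i) = g i) ∧ s.Sqf (∏ i, a i)).erase 1).card := by
  rw [T₁]
  exact Nat.subtype_card _ fun a ↦ by simp

theorem T₁_le (g : ι → G) (Y : ℝ) : s.T₁ ι g Y ≤ s.T ι g Y := by
  classical
  rw [T₁_eq_card_erase, T]
  convert Finset.card_le_card (Finset.erase_subset _ _)

theorem le_T₁ (g : ι → G) (Y : ℝ) : s.T ι g Y ≤ s.T₁ ι g Y + 1 := by
  classical
  rw [T₁_eq_card_erase, T]
  have h := Finset.pred_card_le_card_erase (s := (s.Tup ι Y).filter fun a ↦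
    (∀ i, s.cl (a i) = g i) ∧ s.Sqf (∏ i, a i)) (a := 1)
  rw [Nat.sub_le_iff_le_add] at h
  convert h

theorem finite_tuples (g : ι → G) (Y : ℝ) : Finite {a : ι → D // a ≠ 1 ∧
    (s.N (∏ i, a i) : ℝ) ≤ Y ∧ (∀ i, s.cl (a i) = g i) ∧ s.Sqf (∏ i, a i)} := by
  have : {a : ι → D | a ≠ 1 ∧ (s.N (∏ i, a i) : ℝ) ≤ Y ∧ (∀ i, s.cl (a i) = g i) ∧
      s.Sqf (∏ i, a i)} ⊆ ↑(s.Tup ι Y) := fun a ha ↦ by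
    have := ha.2.1
    simpa using this
  exact Set.finite_coe_iff.mpr ((s.Tup ι Y).finite_toSet.subset this)

variable [Finite G] [Nonempty ι]
  (hσ : ((Fintype.card ι : ℝ) ^ 2 + 16 * Fintype.card ι) * s.σ ≤ 1 / 2)

include hσ

theorem tendsto_T₁_div_T (g : ι → G) :
    Tendsto (fun Y ↦ (s.T₁ ι g Y : ℝ) / s.T ι g Y) atTop (𝓝 1) := by
  have h := s.tendsto_T_atTop ι hσ g
  have h2 : Tendsto (fun Y ↦ 1 - ((s.T ι g Y : ℝ))⁻¹) atTop (𝓝 1) := by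
    simpa using (tendsto_inv_atTop_zero.comp h).const_sub 1
  refine tendsto_of_tendsto_of_tendsto_of_le_of_le' h2 tendsto_const_nhds ?_ ?_
  · filter_upwards [h.eventually_gt_atTop 0] with Y hY
    rw [le_div_iff₀ hY, sub_mul, inv_mul_cancel₀ hY.ne', one_mul, sub_le_iff_le_add]
    exact_mod_cast s.le_T₁ ι g Y
  · filter_upwards [h.eventually_gt_atTop 0] with Y hY
    rw [div_le_one hY]
    exact_mod_cast s.T₁_le ι g Y

theorem tendsto_T₁_atTop (g : ι → G) : Tendsto (fun Y ↦ (s.T₁ ι g Y : ℝ)) atTop atTop := by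
  refine tendsto_atTop_mono (f := fun Y ↦ (s.T ι g Y : ℝ) - 1) (fun Y ↦ ?_)
    (tendsto_atTop_add_const_right _ _ (s.tendsto_T_atTop ι hσ g))
  rw [sub_le_iff_le_add]
  exact_mod_cast s.le_T₁ ι g Y

theorem tendsto_T₁_div (g g' : ι → G) :
    Tendsto (fun Y ↦ (s.T₁ ι g Y : ℝ) / s.T₁ ι g' Y) atTop (𝓝 1) := by
  have h := ((s.tendsto_T₁_div_T ι hσ g).mul (s.tendsto_T_div ι hσ g g')).mul
    ((s.tendsto_T₁_div_T ι hσ g').inv₀ one_ne_zero)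
  rw [mul_one, inv_one, mul_one] at h
  refine h.congr' ?_
  filter_upwards [(s.tendsto_T_atTop ι hσ g).eventually_gt_atTop 0,
    (s.tendsto_T_atTop ι hσ g').eventually_gt_atTop 0] with Y h1 h2
  rw [inv_div]
  field_simp

theorem exists_tuple (g : ι → G) :
    ∃ a : ι → D, a ≠ 1 ∧ (∀ i, s.cl (a i) = g i) ∧ s.Sqf (∏ i, a i) := by
  obtain ⟨Y, hY⟩ := ((s.tendsto_T₁_atTop ι hσ g).eventually_gt_atTop 0).exists
  have h : 0 < s.T₁ ι g Y := by exact_mod_cast hY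
  obtain ⟨a⟩ := (Nat.card_pos_iff.mp h).1
  exact ⟨a, a.2.1, a.2.2.2⟩

end RaySys

theorem tendsto_sum_div_sum {α ι : Type*} {l : Filter α} (s : Finset ι) (hs : s.Nonempty)
    {f g : ι → α → ℝ} (hg : ∀ i ∈ s, ∀ᶠ x in l, 0 < g i x)
    (h : ∀ i ∈ s, Tendsto (fun x ↦ f i x / g i x) l (𝓝 1)) :
    Tendsto (fun x ↦ (∑ i ∈ s, f i x) / ∑ i ∈ s, g i x) l (𝓝 1) := by
  rw [Metric.tendsto_nhds]
  intro ε hε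
  have h' : ∀ᶠ x in l, ∀ i ∈ s, 0 < g i x ∧ dist (f i x / g i x) 1 < ε :=
    (Finset.eventually_all s).mpr fun i hi ↦
      (hg i hi).and ((Metric.tendsto_nhds.mp (h i hi)) ε hε)
  filter_upwards [h'] with x hx
  have hpos : 0 < ∑ i ∈ s, g i x := Finset.sum_pos (fun i hi ↦ (hx i hi).1) hs
  rw [Real.dist_eq, div_sub_one hpos.ne', abs_div, abs_of_pos hpos, div_lt_iff₀ hpos,
    ← Finset.sum_sub_distrib, Finset.mul_sum]
  refine (Finset.abs_sum_le_sum_abs _ _).trans_lt (Finset.sum_lt_sum_of_nonempty hs fun i hi ↦ ?_)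
  obtain ⟨h1, h2⟩ := hx i hi
  rwa [Real.dist_eq, div_sub_one h1.ne', abs_div, abs_of_pos h1, div_lt_iff₀ h1] at h2

variable {W C : Type*} (τ : W → ι → D) (d : W → ℝ) (St : W → C) (k : ℕ)

/-- `f` transports the fibre of `τ` over `a` to the fibre over `a'`, preserving `d` and changing
`St` by `κ`. -/
def FibreTransport (f : W → W) (a a' : ι → D) (κ : C → C) : Prop :=
  Set.BijOn f {v | τ v = a} {v | τ v = a'} ∧ ∀ v, τ v = a → d (f v) = d v ∧ St (f v) = κ (St v)

/-- The number of points with nontrivial invariant, bounded `d v * N (∏ τ v) ^ k` and given `St`. -/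
def fibreCount (c : C) (X : ℝ) : ℕ :=
  Nat.card {v : W // τ v ≠ 1 ∧ d v * (s.N (∏ i, τ v i) : ℝ) ^ k ≤ X ∧ St v = c}

/-- The points over representative tuples with given `St`. -/
def repPoints (t : (ι → G) → ι → D) (c : C) : Set W :=
  {v | τ v = t (fun i ↦ s.cl (τ v i)) ∧ St v = c}

variable {ι τ d St k} (hk : k ≠ 0)
  (hτ : ∀ v, s.Sqf (∏ i, τ v i)) (hd : ∀ v, 0 < d v)
  (h1 : ∀ a a' : ι → D, a ≠ 1 → a' ≠ 1 → s.Sqf (∏ i, a i) → s.Sqf (∏ i, a' i) →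
    (∀ i, s.cl (a i) = s.cl (a' i)) → ∃ f, FibreTransport ι τ d St f a a' id)
  (t : (ι → G) → ι → D) (ht : ∀ g, t g ≠ 1 ∧ (∀ i, s.cl (t g i) = g i) ∧ s.Sqf (∏ i, t g i))

include hk hd in
theorem mul_pow_le_iff {X : ℝ} (hX : 0 ≤ X) (v : W) (n : ℕ) :
    d v * (n : ℝ) ^ k ≤ X ↔ (n : ℝ) ≤ (X / d v) ^ (1 / (k : ℝ)) := by
  rw [← le_div_iff₀' (hd v), one_div, Real.le_rpow_inv_iff_of_pos (by positivity)
    (div_nonneg hX (hd v).le) (by positivity), Real.rpow_natCast]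

include hk hτ hd h1 ht in
theorem fibreCount_eq_sum (c : C) [Fintype (repPoints s ι τ St t c)] {X : ℝ} (hX : 0 ≤ X) :
    fibreCount s ι τ d St k c X = ∑ ω : repPoints s ι τ St t c,
      s.T₁ ι (fun i ↦ s.cl (τ ω i)) ((X / d ω) ^ (1 / (k : ℝ))) := by
  have : ∀ a : {a : ι → D // a ≠ 1 ∧ s.Sqf (∏ i, a i)},
      ∃ f, FibreTransport ι τ d St f (t fun i ↦ s.cl (a.1 i)) a id := fun a ↦
    h1 _ _ (ht _).1 a.2.1 (ht _).2.2 a.2.2 (ht _).2.1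
  choose f hf using this
  have hfin := fun ω : repPoints s ι τ St t c ↦
    s.finite_tuples ι (fun i ↦ s.cl (τ ω i)) ((X / d ω) ^ (1 / (k : ℝ)))
  simp only [RaySys.T₁]
  rw [← Nat.card_sigma, fibreCount]
  have hω : ∀ (ω : repPoints s ι τ St t c) (a : ι → D), (∀ i, s.cl (a i) = s.cl (τ ω i)) →
      τ ω = t fun i ↦ s.cl (a i) := fun ω a h ↦ by
    rw [funext h]; exact ω.2.1
  symm
  refine Nat.card_congr (Equiv.ofBijective (fun x ↦ ⟨f ⟨x.2.1, x.2.2.1, x.2.2.2.2.2⟩ x.1, ?_⟩) ⟨?_, ?_⟩)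
  · obtain ⟨ω, a, ha1, ha2, ha3, ha4⟩ := x
    obtain ⟨hb, hp⟩ := hf ⟨a, ha1, ha4⟩
    have h2 : τ (f ⟨a, ha1, ha4⟩ ω) = a := hb.mapsTo (hω ω a ha3)
    have h3 := hp ω (hω ω a ha3)
    simp only
    rw [h2, h3.1, h3.2, mul_pow_le_iff hk hd hX]
    exact ⟨ha1, ha2, ω.2.2⟩
  · rintro ⟨ω, a, ha1, ha2, ha3, ha4⟩ ⟨ω', a', ha1', ha2', ha3', ha4'⟩ h
    have h0 := Subtype.mk.inj h
    have h2 : τ (f ⟨a, ha1, ha4⟩ ω) = a := (hf ⟨a, ha1, ha4⟩).1.mapsTo (hω ω a ha3)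
    have h2' : τ (f ⟨a', ha1', ha4'⟩ ω') = a' := (hf ⟨a', ha1', ha4'⟩).1.mapsTo (hω ω' a' ha3')
    have h3 : a = a' := by rw [← h2, ← h2', h0]
    subst h3
    have h4 := (hf ⟨a, ha1, ha4⟩).1.injOn (hω ω a ha3) (hω ω' a ha3') h0
    have h5 : ω = ω' := Subtype.ext h4
    subst h5
    rfl
  · rintro ⟨v, hv1, hv2, hv3⟩
    obtain ⟨w, hw, hwv⟩ := (hf ⟨τ v, hv1, hτ v⟩).1.surjOn (show τ v = τ v from rfl)
    have hp := (hf ⟨τ v, hv1, hτ v⟩).2 w hw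
    rw [hwv] at hp
    have hw' : τ w = t fun i ↦ s.cl (τ v i) := hw
    have hcl : ∀ i, s.cl (τ w i) = s.cl (τ v i) := fun i ↦ by rw [hw']; exact (ht _).2.1 i
    refine ⟨⟨⟨w, ?_, ?_⟩, τ v, hv1, ?_, fun i ↦ (hcl i).symm, hτ v⟩, Subtype.ext hwv⟩
    · rw [funext hcl]; exact hw
    · rw [← hv3, hp.2]; rfl
    · rwa [← mul_pow_le_iff hk hd hX, ← hp.1]

variable [Finite G] [Nonempty ι]
  (hσ : ((Fintype.card ι : ℝ) ^ 2 + 16 * Fintype.card ι) * s.σ ≤ 1 / 2)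
  (hfin : ∀ a, a ≠ 1 → {v | τ v = a}.Finite)

include ht hfin in
theorem finite_repPoints (c : C) : (repPoints s ι τ St t c).Finite := by
  refine (Set.finite_iUnion (fun g ↦ hfin (t g) (ht g).1)).subset fun v hv ↦ ?_
  rw [Set.mem_iUnion]
  exact ⟨_, hv.1⟩

include hk hd hσ in
theorem tendsto_T₁_rpow (v : W) (g g' : ι → G) :
    Tendsto (fun X : ℝ ↦ (s.T₁ ι g ((X / d v) ^ (1 / (k : ℝ))) : ℝ) /
      s.T₁ ι g' ((X / d v) ^ (1 / (k : ℝ)))) atTop (𝓝 1) ∧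
    Tendsto (fun X : ℝ ↦ (s.T₁ ι g ((X / d v) ^ (1 / (k : ℝ))) : ℝ)) atTop atTop := by
  have h : Tendsto (fun X : ℝ ↦ (X / d v) ^ (1 / (k : ℝ))) atTop atTop :=
    (tendsto_rpow_atTop (by positivity)).comp (tendsto_id.atTop_div_const (hd v))
  exact ⟨(s.tendsto_T₁_div ι hσ g g').comp h, (s.tendsto_T₁_atTop ι hσ g).comp h⟩

include hk hτ hd h1 ht hσ hfin in
theorem exists_tendsto_fibreCount_atTop (c : C) (hne : (repPoints s ι τ St t c).Nonempty) :
    Tendsto (fun X ↦ (fibreCount s ι τ d St k c X : ℝ)) atTop atTop := by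
  have := (finite_repPoints (τ := τ) (St := St) s t ht hfin c).fintype
  obtain ⟨ω, hω⟩ := hne
  have h3 := (tendsto_T₁_rpow s hk hd hσ ω (fun i ↦ s.cl (τ ω i)) 1).2
  refine tendsto_atTop_mono' _ ?_ h3
  filter_upwards [eventually_ge_atTop 0] with X hX
  rw [fibreCount_eq_sum s hk hτ hd h1 t ht c hX, Nat.cast_sum]
  have h0 : ∀ ω ∈ (Finset.univ : Finset (repPoints s ι τ St t c)),
      (0 : ℝ) ≤ s.T₁ ι (fun i ↦ s.cl (τ ω i)) ((X / d ω) ^ (1 / (k : ℝ))) :=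
    fun _ _ ↦ Nat.cast_nonneg _
  have h4 := Finset.single_le_sum h0 (Finset.mem_univ (⟨ω, hω⟩ : repPoints s ι τ St t c))
  exact h4

variable (γ : ι → G) {κ : C → C} (hκ : Function.Injective κ)
  (h2 : ∀ a a' : ι → D, a ≠ 1 → a' ≠ 1 → s.Sqf (∏ i, a i) → s.Sqf (∏ i, a' i) →
    (∀ i, s.cl (a' i) = s.cl (a i) * γ i) → ∃ f, FibreTransport ι τ d St f a a' κ)

include ht hκ h2 in
theorem exists_equiv_repPoints (c : C) :
    ∃ e : repPoints s ι τ St t c ≃ repPoints s ι τ St t (κ c), ∀ ω,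
      d (e ω) = d ω ∧ ∀ i, s.cl (τ (e ω) i) = s.cl (τ ω i) * γ i := by
  have : ∀ g : ι → G, ∃ f, FibreTransport ι τ d St f (t g) (t (g * γ)) κ := fun g ↦
    h2 _ _ (ht _).1 (ht _).1 (ht _).2.2 (ht _).2.2 fun i ↦ by
      rw [(ht _).2.1, (ht _).2.1, Pi.mul_apply]
  choose f hf using this
  have hf1 : ∀ ω : repPoints s ι τ St t c, τ (f (fun i ↦ s.cl (τ ω i)) ω) =
      t ((fun i ↦ s.cl (τ ω i)) * γ) := fun ω ↦ (hf _).1.mapsTo ω.2.1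
  have hf2 : ∀ (ω : repPoints s ι τ St t c) i, s.cl (τ (f (fun i ↦ s.cl (τ ω i)) ω) i) =
      s.cl (τ ω i) * γ i := fun ω i ↦ by rw [hf1, (ht _).2.1]; rfl
  refine ⟨Equiv.ofBijective (fun ω ↦ ⟨f (fun i ↦ s.cl (τ ω i)) ω, ?_, ?_⟩) ⟨?_, ?_⟩, fun ω ↦ ⟨?_, ?_⟩⟩
  · rw [funext (hf2 ω)]
    exact hf1 ω
  · rw [((hf _).2 ω ω.2.1).2, ω.2.2]
  · intro ω ω' h
    have h0 := Subtype.mk.inj h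
    have h3 : (fun i ↦ s.cl (τ ω i)) = fun i ↦ s.cl (τ ω' i) := by
      funext i
      have h4 := hf2 ω i
      rw [h0, hf2 ω' i] at h4
      exact (mul_right_cancel h4).symm
    have h5 := hf1 ω'
    rw [← h3] at h5 h0
    refine Subtype.ext ((hf _).1.injOn ω.2.1 ?_ h0)
    have := ω'.2.1
    rwa [← h3] at this
  · rintro ⟨v, hv1, hv2⟩
    set g : ι → G := fun i ↦ s.cl (τ v i) * (γ i)⁻¹ with hg
    have hgγ : g * γ = fun i ↦ s.cl (τ v i) := by
      funext i; simp [hg]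
    have hb := hf g
    rw [hgγ] at hb
    obtain ⟨w, hw, hwv⟩ := hb.1.surjOn (show v ∈ {v' | _} from hv1)
    have hw' : τ w = t g := hw
    have hcl : (fun i ↦ s.cl (τ w i)) = g := by
      funext i; rw [hw', (ht _).2.1]
    refine ⟨⟨w, ?_, ?_⟩, Subtype.ext ?_⟩
    · rw [hcl]; exact hw
    · have := (hb.2 w hw).2
      rw [hwv, hv2] at this
      exact (hκ this).symm
    · simp only
      rw [hcl, hwv]
  · exact ((hf _).2 ω ω.2.1).1
  · exact hf2 ω

include hk hτ hd h1 ht hσ hfin hκ h2 in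
theorem tendsto_fibreCount_div (c : C) (hne : (repPoints s ι τ St t c).Nonempty) :
    Tendsto (fun X ↦ (fibreCount s ι τ d St k (κ c) X : ℝ) / fibreCount s ι τ d St k c X)
      atTop (𝓝 1) := by
  have i1 := (finite_repPoints (τ := τ) (St := St) s t ht hfin c).fintype
  have i2 := (finite_repPoints (τ := τ) (St := St) s t ht hfin (κ c)).fintype
  obtain ⟨e, he⟩ := exists_equiv_repPoints s t ht γ hκ h2 c
  have : Nonempty (repPoints s ι τ St t c) := hne.to_subtype
  have h := tendsto_sum_div_sum (l := atTop) (Finset.univ : Finset (repPoints s ι τ St t c))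
    Finset.univ_nonempty
    (f := fun ω X ↦ (s.T₁ ι (fun i ↦ s.cl (τ (e ω) i)) ((X / d ω) ^ (1 / (k : ℝ))) : ℝ))
    (g := fun ω X ↦ (s.T₁ ι (fun i ↦ s.cl (τ ω i)) ((X / d ω) ^ (1 / (k : ℝ))) : ℝ))
    (fun ω _ ↦ (tendsto_T₁_rpow s hk hd hσ _ _ 1).2.eventually_gt_atTop 0)
    (fun ω _ ↦ (tendsto_T₁_rpow s hk hd hσ _ _ _).1)
  refine h.congr' ?_
  filter_upwards [eventually_ge_atTop 0] with X hX
  rw [fibreCount_eq_sum s hk hτ hd h1 t ht c hX, fibreCount_eq_sum s hk hτ hd h1 t ht (κ c) hX,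
    Nat.cast_sum, Nat.cast_sum]
  congr 1
  refine Fintype.sum_equiv e _ _ fun ω ↦ ?_
  rw [(he ω).1]

end FibreCount

section KummerFields

open Polynomial IntermediateField Module

variable {K A : Type*} [Field K] [Field A] [Algebra K A] {ℓ : ℕ} (hℓ : ℓ.Prime)
  {ζ : K} (hζ : IsPrimitiveRoot ζ ℓ)

include hℓ hζ in
theorem exists_kummer_of_isCyclicExt {L : IntermediateField K A} (hL : IsCyclicExt ℓ K L) :
    ∃ (θ : A) (α : K), (∀ b : K, b ^ ℓ ≠ α) ∧ θ ^ ℓ = algebraMap K A α ∧ L = K⟮θ⟯ := by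
  obtain ⟨hG, ⟨e⟩⟩ := hL
  have : NeZero ℓ := ⟨hℓ.ne_zero⟩
  have : Finite Gal(L/K) := Finite.of_equiv _ e.symm.toEquiv
  have : FiniteDimensional K L := IsGalois.finiteDimensional_of_finite K L
  have : IsCyclic Gal(L/K) := isCyclic_of_surjective _ e.symm.surjective
  have hf : finrank K L = ℓ := by
    rw [← IsGalois.card_aut_eq_finrank, Nat.card_congr (e.toEquiv.trans Multiplicative.toAdd),
      Nat.card_zmod]
  have hr : (primitiveRoots (finrank K L) K).Nonempty :=
    ⟨ζ, by rw [hf]; exact (mem_primitiveRoots hℓ.pos).mpr hζ⟩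
  obtain ⟨θ, ⟨α, hα⟩, hθ⟩ := exists_root_adjoin_eq_top_of_isCyclic K L hr
  have hirr := irreducible_X_pow_sub_C_of_root_adjoin_eq_top hα.symm hθ
  rw [hf] at hirr hα
  refine ⟨θ, α, fun b hb ↦ ?_, congr_arg Subtype.val hα.symm, ?_⟩
  · exact pow_ne_of_irreducible_X_pow_sub_C hirr (dvd_refl ℓ) hℓ.ne_one b hb
  · have h1 := congr_arg (IntermediateField.map L.val) hθ
    rw [adjoin_map, Set.image_singleton, ← AlgHom.fieldRange_eq_map, fieldRange_val] at h1
    exact h1.symm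

variable {α : K} (hα : ∀ b : K, b ^ ℓ ≠ α)

include hℓ hα

theorem minpoly_kummer {θ : A} (hθ : θ ^ ℓ = algebraMap K A α) : minpoly K θ = X ^ ℓ - C α :=
  (minpoly.eq_of_irreducible_of_monic (X_pow_sub_C_irreducible_of_prime hℓ hα)
    (by simp [hθ]) (monic_X_pow_sub_C α hℓ.ne_zero)).symm

theorem isIntegral_kummer {θ : A} (hθ : θ ^ ℓ = algebraMap K A α) : IsIntegral K θ :=
  ⟨X ^ ℓ - C α, monic_X_pow_sub_C α hℓ.ne_zero, by simp [hθ]⟩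

theorem finrank_kummer {θ : A} (hθ : θ ^ ℓ = algebraMap K A α) : finrank K K⟮θ⟯ = ℓ := by
  rw [adjoin.finrank (isIntegral_kummer hℓ hα hθ), minpoly_kummer hℓ hα hθ,
    natDegree_X_pow_sub_C]

theorem exists_basis_kummer {L : IntermediateField K A} (θ : L)
    (hθ : θ ^ ℓ = algebraMap K L α) (hL : L = K⟮(θ : A)⟯) :
    ∃ b : Basis (Fin ℓ) K L, ∀ i, b i = θ ^ (i : ℕ) := by
  obtain ⟨θ, hθL⟩ := θ
  have hL' : L = K⟮θ⟯ := hL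
  clear hL
  subst hL'
  have hθ' : θ ^ ℓ = algebraMap K A α := congr_arg Subtype.val hθ
  have hd : (adjoin.powerBasis (isIntegral_kummer hℓ hα hθ')).dim = ℓ := by
    rw [adjoin.powerBasis_dim, minpoly_kummer hℓ hα hθ', natDegree_X_pow_sub_C]
  refine ⟨(adjoin.powerBasis (isIntegral_kummer hℓ hα hθ')).basis.reindex (finCongr hd),
    fun i ↦ ?_⟩
  rw [Basis.reindex_apply, PowerBasis.basis_eq_pow, adjoin.powerBasis_gen]
  rfl

include hζ

theorem isSplittingField_kummer {θ : A} (hθ : θ ^ ℓ = algebraMap K A α) :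
    IsSplittingField K K⟮θ⟯ (X ^ ℓ - C α) := by
  have : FiniteDimensional K K⟮θ⟯ := adjoin.finiteDimensional (isIntegral_kummer hℓ hα hθ)
  have hf := finrank_kummer hℓ hα hθ
  have := isSplittingField_X_pow_sub_C_of_root_adjoin_eq_top (K := K) (L := K⟮θ⟯)
    ⟨ζ, by rw [hf]; exact (mem_primitiveRoots hℓ.pos).mpr hζ⟩ (a := α)
    (α := AdjoinSimple.gen K θ) (by
      rw [hf]
      exact Subtype.ext hθ) (adjoin_eq_top_of_algebra K _
      (by simpa using (adjoin.powerBasis (isIntegral_kummer hℓ hα hθ)).adjoin_gen_eq_top))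
  rwa [hf] at this

theorem isCyclicExt_kummer {θ : A} (hθ : θ ^ ℓ = algebraMap K A α) : IsCyclicExt ℓ K K⟮θ⟯ := by
  have := isSplittingField_kummer hℓ hζ hα hθ
  have hirr := X_pow_sub_C_irreducible_of_prime hℓ hα
  have : NeZero ℓ := ⟨hℓ.ne_zero⟩
  exact ⟨isGalois_of_isSplittingField_X_pow_sub_C ⟨ζ, (mem_primitiveRoots hℓ.pos).mpr hζ⟩ hirr _,
    ⟨autEquivZmod hirr _ hζ⟩⟩

theorem exists_eq_pow_mul_of_mem {θ η : A} (hθ : θ ^ ℓ = algebraMap K A α) {β : K} (hβ : β ≠ 0)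
    (hη : η ^ ℓ = algebraMap K A β) (hmem : η ∈ K⟮θ⟯) :
    ∃ (j : ℕ) (c : K), β = α ^ j * c ^ ℓ := by
  have := isSplittingField_kummer hℓ hζ hα hθ
  have hirr := X_pow_sub_C_irreducible_of_prime hℓ hα
  have : NeZero ℓ := ⟨hℓ.ne_zero⟩
  set L := K⟮θ⟯
  let Θ : L := AdjoinSimple.gen K θ
  let H : L := ⟨η, hmem⟩
  have hΘ : Θ ^ ℓ = algebraMap K L α := Subtype.ext hθ
  have hH : H ^ ℓ = algebraMap K L β := Subtype.ext hη
  have hβL : algebraMap K L β ≠ 0 := by simpa using hβ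
  have hH0 : H ≠ 0 := by
    intro h
    rw [h, zero_pow hℓ.ne_zero] at hH
    exact hβL hH.symm
  obtain ⟨b, hb⟩ := exists_basis_kummer hℓ hα Θ hΘ rfl
  set σ := (autEquivZmod hirr L hζ).symm (Multiplicative.ofAdd ((1 : ℕ) : ZMod ℓ))
  have hσ : σ Θ = ζ • Θ := by
    rw [autEquivZmod_symm_apply_natCast hirr L hΘ hζ 1, pow_one]
  have hζL : IsPrimitiveRoot (algebraMap K L ζ) ℓ :=
    hζ.map_of_injective (algebraMap K L).injective
  obtain ⟨j, hj, hjH⟩ : ∃ j < ℓ, σ H = ζ ^ j • H := by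
    have h1 : (σ H / H) ^ ℓ = 1 := by
      rw [div_pow, ← map_pow, hH, AlgEquiv.commutes, div_self hβL]
    obtain ⟨j, hj, hj'⟩ := hζL.eq_pow_of_pow_eq_one h1
    refine ⟨j, hj, ?_⟩
    rw [Algebra.smul_def, map_pow, hj', div_mul_cancel₀ _ hH0]
  have hrepr := b.sum_repr H
  have h2 : ∀ i : Fin ℓ, ζ ^ (i : ℕ) * b.repr H i = ζ ^ j * b.repr H i := by
    have h3 : σ H = ∑ i : Fin ℓ, (ζ ^ (i : ℕ) * b.repr H i) • b i := by
      conv_lhs => rw [← hrepr]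
      rw [map_sum]
      refine Finset.sum_congr rfl fun i _ ↦ ?_
      rw [map_smul, hb, map_pow, hσ, _root_.smul_pow, smul_smul, mul_comm]
    have h4 : σ H = ∑ i : Fin ℓ, (ζ ^ j * b.repr H i) • b i := by
      rw [hjH]
      conv_lhs => rw [← hrepr]
      rw [Finset.smul_sum]
      exact Finset.sum_congr rfl fun i _ ↦ by rw [smul_smul]
    intro i
    have h5 := congr_arg (fun x ↦ b.repr x i) (h3.symm.trans h4)
    simpa only [b.repr_sum_self] using h5
  have h6 : ∀ i : Fin ℓ, (i : ℕ) ≠ j → b.repr H i = 0 := fun i hi ↦ by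
    by_contra h0
    exact hi (hζ.pow_inj i.2 hj (mul_right_cancel₀ h0 (h2 i)))
  have h7 : H = b.repr H ⟨j, hj⟩ • Θ ^ j := by
    conv_lhs => rw [← hrepr]
    rw [Finset.sum_eq_single ⟨j, hj⟩ (fun i _ hi ↦ ?_) (by simp), hb]
    rw [h6 i (fun h ↦ hi (Fin.ext h)), zero_smul]
  refine ⟨j, b.repr H ⟨j, hj⟩, (algebraMap K L).injective ?_⟩
  generalize b.repr H ⟨j, hj⟩ = c at h7
  rw [← hH, h7, Algebra.smul_def, mul_pow, ← pow_mul, mul_comm j, pow_mul, hΘ, map_mul, map_pow,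
    map_pow, mul_comm]

end KummerFields

section KummerGroup

open Polynomial IntermediateField Module

/-- The group `Kˣ` modulo `ℓ`-th powers. -/
abbrev KummerGroup (ℓ : ℕ) (K : Type*) [Field K] : Type _ :=
  Kˣ ⧸ (powMonoidHom ℓ : Kˣ →* Kˣ).range

variable {K : Type*} [Field K] {ℓ : ℕ}

theorem KummerGroup.mk_eq_iff {α β : Kˣ} : (α : KummerGroup ℓ K) = β ↔ ∃ t : Kˣ, β = α * t ^ ℓ := by
  rw [QuotientGroup.eq]
  constructor
  · rintro ⟨t, ht⟩
    exact ⟨t, by rw [← powMonoidHom_apply, ht, mul_inv_cancel_left]⟩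
  · rintro ⟨t, rfl⟩
    exact ⟨t, by simp⟩

theorem KummerGroup.mk_ne_one_iff (hℓ : ℓ ≠ 0) {α : Kˣ} :
    (α : KummerGroup ℓ K) ≠ 1 ↔ ∀ b : K, b ^ ℓ ≠ α := by
  rw [ne_eq, not_iff_comm]
  push Not
  rw [eq_comm, ← QuotientGroup.mk_one, KummerGroup.mk_eq_iff]
  constructor
  · rintro ⟨b, hb⟩
    have hb0 : b ≠ 0 := by
      rintro rfl
      rw [zero_pow hℓ] at hb
      exact α.ne_zero hb.symm
    exact ⟨Units.mk0 b hb0, Units.ext (by simpa using hb.symm)⟩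
  · rintro ⟨t, rfl⟩
    exact ⟨t, by simp⟩

theorem KummerGroup.pow_eq_one (v : KummerGroup ℓ K) : v ^ ℓ = 1 := by
  induction v using QuotientGroup.induction_on with
  | H α =>
    rw [← QuotientGroup.mk_pow, QuotientGroup.eq_one_iff]
    exact ⟨α, rfl⟩

variable (A : Type*) [Field A] [Algebra K A] [IsAlgClosed A]

/-- The Kummer extension attached to a class modulo `ℓ`-th powers (for `ℓ > 0`). -/
def kummerField (v : KummerGroup ℓ K) : IntermediateField K A :=
  if h : 0 < ℓ then
    K⟮(IsAlgClosed.exists_pow_nat_eq (algebraMap K A (Quotient.out v : Kˣ)) h).choose⟯ else ⊥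

variable {A} (hℓ : ℓ.Prime) {ζ : K} (hζ : IsPrimitiveRoot ζ ℓ)

include hℓ in
theorem exists_kummerField_eq (v : KummerGroup ℓ K) : ∃ (α : Kˣ) (θ : A),
    (α : KummerGroup ℓ K) = v ∧ θ ^ ℓ = algebraMap K A α ∧ kummerField A v = K⟮θ⟯ := by
  refine ⟨Quotient.out v,
    (IsAlgClosed.exists_pow_nat_eq (algebraMap K A (Quotient.out v : Kˣ)) hℓ.pos).choose,
    QuotientGroup.out_eq' v, ?_, ?_⟩
  · exact (IsAlgClosed.exists_pow_nat_eq (algebraMap K A (Quotient.out v : Kˣ)) hℓ.pos).choose_spec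
  · rw [kummerField, dif_pos hℓ.pos]

include hℓ hζ

theorem mem_adjoin_of_pow_eq {θ η : A} {α : Kˣ} (hθ : θ ^ ℓ = algebraMap K A α) {j : ℕ} {c : Kˣ}
    (hη : η ^ ℓ = algebraMap K A (α ^ j * c ^ ℓ : Kˣ)) : η ∈ K⟮θ⟯ := by
  have : NeZero ℓ := ⟨hℓ.ne_zero⟩
  have hα0 : algebraMap K A α ≠ 0 := by simp
  have hc0 : algebraMap K A c ≠ 0 := by simp
  have hθ0 : θ ≠ 0 := by
    rintro rfl
    rw [zero_pow hℓ.ne_zero] at hθ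
    exact hα0 hθ.symm
  have h1 : (η / (θ ^ j * algebraMap K A c)) ^ ℓ = 1 := by
    rw [div_pow, hη, mul_pow, ← pow_mul, mul_comm j, pow_mul, hθ, Units.val_mul,
      Units.val_pow_eq_pow_val, Units.val_pow_eq_pow_val, map_mul, map_pow, map_pow]
    exact div_self (mul_ne_zero (pow_ne_zero _ hα0) (pow_ne_zero _ hc0))
  obtain ⟨i, -, hi⟩ := (hζ.map_of_injective (algebraMap K A).injective).eq_pow_of_pow_eq_one h1
  rw [eq_div_iff (mul_ne_zero (pow_ne_zero _ hθ0) hc0)] at hi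
  rw [← hi]
  exact mul_mem (pow_mem (IntermediateField.algebraMap_mem _ _) _)
    (mul_mem (pow_mem (mem_adjoin_simple_self K θ) _) (IntermediateField.algebraMap_mem _ _))

theorem kummerField_mk {α : Kˣ} {θ : A} (hθ : θ ^ ℓ = algebraMap K A α) :
    kummerField A (α : KummerGroup ℓ K) = K⟮θ⟯ := by
  obtain ⟨β, η, hβ, hη, h⟩ := exists_kummerField_eq (A := A) hℓ (α : KummerGroup ℓ K)
  rw [h]
  apply le_antisymm
  · rw [adjoin_simple_le_iff]
    obtain ⟨t, rfl⟩ := KummerGroup.mk_eq_iff.mp hβ.symm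
    exact mem_adjoin_of_pow_eq hℓ hζ hθ (j := 1) (c := t) (by rw [hη, pow_one])
  · rw [adjoin_simple_le_iff]
    obtain ⟨t, rfl⟩ := KummerGroup.mk_eq_iff.mp hβ
    exact mem_adjoin_of_pow_eq hℓ hζ hη (j := 1) (c := t) (by rw [hθ, pow_one])

theorem isCyclicExt_kummerField {v : KummerGroup ℓ K} (hv : v ≠ 1) :
    IsCyclicExt ℓ K (kummerField A v) := by
  obtain ⟨α, θ, rfl, hθ, h⟩ := exists_kummerField_eq (A := A) hℓ v
  rw [h]
  exact isCyclicExt_kummer hℓ hζ ((KummerGroup.mk_ne_one_iff hℓ.ne_zero).mp hv) hθ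

theorem exists_kummerField_of_isCyclicExt {L : IntermediateField K A} (hL : IsCyclicExt ℓ K L) :
    ∃ v : KummerGroup ℓ K, v ≠ 1 ∧ kummerField A v = L := by
  obtain ⟨θ, α, hα, hθ, rfl⟩ := exists_kummer_of_isCyclicExt hℓ hζ hL
  have hα0 : α ≠ 0 := by
    rintro rfl
    exact hα 0 (zero_pow hℓ.ne_zero)
  exact ⟨(Units.mk0 α hα0 : Kˣ), (KummerGroup.mk_ne_one_iff hℓ.ne_zero).mpr hα,
    kummerField_mk hℓ hζ hθ⟩

theorem kummerField_le_of_mem_zpowers {v w : KummerGroup ℓ K} (h : w ∈ Subgroup.zpowers v) :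
    kummerField A w ≤ kummerField A v := by
  obtain ⟨α, θ, rfl, hθ, hα⟩ := exists_kummerField_eq (A := A) hℓ v
  obtain ⟨β, η, rfl, hη, hβ⟩ := exists_kummerField_eq (A := A) hℓ w
  have hfin : IsOfFinOrder (α : KummerGroup ℓ K) :=
    isOfFinOrder_iff_pow_eq_one.mpr ⟨ℓ, hℓ.pos, KummerGroup.pow_eq_one _⟩
  obtain ⟨j, hj⟩ := hfin.mem_powers_iff_mem_zpowers.mpr h
  obtain ⟨c, rfl⟩ := KummerGroup.mk_eq_iff.mp
    (show ((α ^ j : Kˣ) : KummerGroup ℓ K) = β from hj)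
  rw [hα, hβ, adjoin_simple_le_iff]
  exact mem_adjoin_of_pow_eq hℓ hζ hθ hη

theorem kummerField_eq_iff {v w : KummerGroup ℓ K} (hv : v ≠ 1) (hw : w ≠ 1) :
    kummerField A w = kummerField A v ↔ w ∈ Subgroup.zpowers v := by
  have : Fact ℓ.Prime := ⟨hℓ⟩
  refine ⟨fun h ↦ ?_, fun h ↦ le_antisymm (kummerField_le_of_mem_zpowers hℓ hζ h)
    (kummerField_le_of_mem_zpowers hℓ hζ ?_)⟩
  · obtain ⟨α, θ, rfl, hθ, hα⟩ := exists_kummerField_eq (A := A) hℓ v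
    obtain ⟨β, η, rfl, hη, hβ⟩ := exists_kummerField_eq (A := A) hℓ w
    have hmem : η ∈ K⟮θ⟯ := by
      rw [← hα, ← h, hβ]
      exact mem_adjoin_simple_self K η
    obtain ⟨j, c, hc⟩ := exists_eq_pow_mul_of_mem hℓ hζ
      ((KummerGroup.mk_ne_one_iff hℓ.ne_zero).mp hv) hθ β.ne_zero hη hmem
    have hc0 : c ≠ 0 := by
      rintro rfl
      rw [zero_pow hℓ.ne_zero, mul_zero] at hc
      exact β.ne_zero hc
    refine ⟨j, ?_⟩
    simp only [zpow_natCast]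
    rw [← QuotientGroup.mk_pow, KummerGroup.mk_eq_iff]
    exact ⟨Units.mk0 c hc0, Units.ext (by simpa using hc)⟩
  · have h1 : Subgroup.zpowers w ≤ Subgroup.zpowers v := by simpa using h
    have hov : Nat.card (Subgroup.zpowers v) = ℓ := by
      rw [Nat.card_zpowers, orderOf_eq_prime (KummerGroup.pow_eq_one v) hv]
    have how : Nat.card (Subgroup.zpowers w) = ℓ := by
      rw [Nat.card_zpowers, orderOf_eq_prime (KummerGroup.pow_eq_one w) hw]
    have : Finite (Subgroup.zpowers v) := Nat.finite_of_card_ne_zero (by rw [hov]; exact hℓ.ne_zero)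
    rw [Subgroup.eq_of_le_of_card_ge h1 (by rw [hov, how])]
    exact Subgroup.mem_zpowers v

theorem card_kummerField_fibre {L : IntermediateField K A} (hL : IsCyclicExt ℓ K L) :
    Nat.card {v : KummerGroup ℓ K // v ≠ 1 ∧ kummerField A v = L} = ℓ - 1 := by
  have : Fact ℓ.Prime := ⟨hℓ⟩
  obtain ⟨v, hv, rfl⟩ := exists_kummerField_of_isCyclicExt hℓ hζ hL
  have h1 : {w : KummerGroup ℓ K | w ≠ 1 ∧ kummerField A w = kummerField A v} =
      (Subgroup.zpowers v : Set (KummerGroup ℓ K)) \ {1} := by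
    ext w
    simp only [Set.mem_ofPred_eq, Set.mem_sdiff, SetLike.mem_coe, Set.mem_singleton_iff]
    constructor
    · rintro ⟨h, h'⟩
      exact ⟨(kummerField_eq_iff hℓ hζ hv h).mp h', h⟩
    · rintro ⟨h, h'⟩
      exact ⟨h', (kummerField_eq_iff hℓ hζ hv h').mpr h⟩
  have h2 := Set.ncard_sdiff_singleton_of_mem (one_mem (Subgroup.zpowers v))
  have h3 : (Subgroup.zpowers v : Set (KummerGroup ℓ K)).ncard = ℓ := by
    rw [← Nat.card_coe_set_eq]
    exact (Nat.card_zpowers v).trans (orderOf_eq_prime (KummerGroup.pow_eq_one v) hv)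
  rw [h3] at h2
  rw [← h2]
  erw [← h1]
  exact Nat.card_coe_set_eq _

theorem card_kummerGroup_eq (P : IntermediateField K A → Prop) :
    Nat.card {v : KummerGroup ℓ K // v ≠ 1 ∧ P (kummerField A v)} =
      Nat.card {L : IntermediateField K A // IsCyclicExt ℓ K L ∧ P L} * (ℓ - 1) := by
  have hk : ℓ - 1 ≠ 0 := Nat.sub_ne_zero_of_lt hℓ.one_lt
  let f : {v : KummerGroup ℓ K // v ≠ 1 ∧ P (kummerField A v)} →
    {L : IntermediateField K A // IsCyclicExt ℓ K L ∧ P L} := fun v ↦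
      ⟨kummerField A v.1, isCyclicExt_kummerField hℓ hζ v.2.1, v.2.2⟩
  have hf : ∀ L, Nat.card {v // f v = L} = ℓ - 1 := fun L ↦ by
    rw [← card_kummerField_fibre hℓ hζ L.2.1]
    refine Nat.card_congr ⟨fun v ↦ ⟨v.1.1, v.1.2.1, congr_arg Subtype.val v.2⟩,
      fun v ↦ ⟨⟨v.1, v.2.1, by rw [v.2.2]; exact L.2.2⟩, Subtype.ext v.2.2⟩,
      fun _ ↦ rfl, fun _ ↦ rfl⟩
  have hfin : ∀ L, Finite {v // f v = L} := fun L ↦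
    Nat.finite_of_card_ne_zero (by rw [hf]; exact hk)
  have e : {v : KummerGroup ℓ K // v ≠ 1 ∧ P (kummerField A v)} ≃
      {L : IntermediateField K A // IsCyclicExt ℓ K L ∧ P L} × Fin (ℓ - 1) :=
    (Equiv.sigmaFiberEquiv f).symm.trans
      ((Equiv.sigmaCongrRight fun L ↦ Finite.equivFinOfCardEq (hf L)).trans
        (Equiv.sigmaEquivProd _ _))
  rw [Nat.card_congr e, Nat.card_prod, Nat.card_fin]

end KummerGroup

section IdealOrder

open IsDedekindDomain FractionalIdeal

variable {K : Type*} [Field K] [NumberField K]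

variable (K) in
/-- The exponent of the prime `p` in the ideal `a`. -/
def ordI (p : HeightOneSpectrum (𝓞 K)) (a : Ideal (𝓞 K)) : ℤ :=
  count K p (a : FractionalIdeal (𝓞 K)⁰ K)

variable (p : HeightOneSpectrum (𝓞 K))

theorem ordI_nonneg (a : Ideal (𝓞 K)) : 0 ≤ ordI K p a := count_coe_nonneg K p a

theorem ordI_one : ordI K p 1 = 0 := by
  rw [ordI, Ideal.one_eq_top, coeIdeal_top, count_one]

theorem ordI_mul {a b : Ideal (𝓞 K)} (ha : a ≠ ⊥) (hb : b ≠ ⊥) :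
    ordI K p (a * b) = ordI K p a + ordI K p b := by
  rw [ordI, coeIdeal_mul, count_mul _ _ (coeIdeal_ne_zero.mpr ha) (coeIdeal_ne_zero.mpr hb)]
  rfl

theorem ordI_pow (a : Ideal (𝓞 K)) (n : ℕ) : ordI K p (a ^ n) = n * ordI K p a := by
  rw [ordI, coeIdeal_pow, count_pow]
  rfl

theorem ordI_span {x : 𝓞 K} (hx : x ≠ 0) : ordI K p (Ideal.span {x}) = ordP p (x : K) := by
  rw [ordI, coeIdeal_span_singleton, count_spanSingleton]
  exact (map_ne_zero_iff _ (FaithfulSMul.algebraMap_injective (𝓞 K) K)).mpr hx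

theorem ordI_prod {ι : Type*} (s : Finset ι) (a : ι → Ideal (𝓞 K)) (ha : ∀ i ∈ s, a i ≠ ⊥) :
    ordI K p (∏ i ∈ s, a i) = ∑ i ∈ s, ordI K p (a i) := by
  have h : ((∏ i ∈ s, a i : Ideal (𝓞 K)) : FractionalIdeal (𝓞 K)⁰ K) =
      ∏ i ∈ s, (a i : FractionalIdeal (𝓞 K)⁰ K) :=
    map_prod (coeIdealHom (𝓞 K)⁰ K) a s
  rw [ordI, h, count_prod]
  · rfl
  · exact fun i hi ↦ coeIdeal_ne_zero.mpr (ha i hi)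

open Classical in
theorem ordI_prime (q : HeightOneSpectrum (𝓞 K)) :
    ordI K p q.asIdeal = if q = p then 1 else 0 := count_maximal K p q

theorem eq_of_ordI_eq {a b : Ideal (𝓞 K)} (ha : a ≠ ⊥) (hb : b ≠ ⊥)
    (h : ∀ p, ordI K p a = ordI K p b) : a = b :=
  coeIdeal_injective (K := K)
    (fractionalIdeal_ext_count (coeIdeal_ne_zero.mpr ha) (coeIdeal_ne_zero.mpr hb) h)

theorem pow_dvd_iff_le_ordI {a : Ideal (𝓞 K)} (ha : a ≠ ⊥) (n : ℕ) :
    p.asIdeal ^ n ∣ a ↔ (n : ℤ) ≤ ordI K p a := by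
  classical
  rw [ordI, count_coe K p ha, Nat.cast_le, ← Associates.mk_dvd_mk, Associates.mk_pow,
    ← Associates.prime_pow_dvd_iff_le (Associates.mk_ne_zero.mpr ha)
      p.associates_irreducible]
  rfl

theorem isCoprime_iff_of_prime {M : Ideal (𝓞 K)} : IsCoprime p.asIdeal M ↔ ¬ M ≤ p.asIdeal := by
  rw [Ideal.isCoprime_iff_sup_eq]
  constructor
  · rintro h hM
    rw [sup_eq_left.mpr hM] at h
    exact p.isPrime.ne_top h
  · intro h
    refine p.isMaximal.out.2 _ (lt_of_le_of_ne le_sup_left fun h' ↦ h ?_)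
    rw [h']
    exact le_sup_right

theorem ordI_eq_zero_of_not_isCoprime {M : Ideal (𝓞 K)} (a : copIdeals M)
    (h : ¬ IsCoprime p.asIdeal M) : ordI K p (a : Ideal (𝓞 K)) = 0 := by
  refine le_antisymm ?_ (ordI_nonneg p _)
  by_contra! h1
  have h2 := (pow_dvd_iff_le_ordI p a.2.1 1).mpr (by push_cast; omega)
  rw [pow_one] at h2
  exact h (a.2.2.of_isCoprime_of_dvd_left h2)

/-- A prime coprime to `M`, as a member of `copIdeals M`. -/
def primeCop {M : Ideal (𝓞 K)} (hp : IsCoprime p.asIdeal M) : copIdeals M :=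
  ⟨p.asIdeal, p.ne_bot, hp⟩

theorem raySys_sqf_iff {M : Ideal (𝓞 K)} (hM : M ≠ ⊥) (a : copIdeals M) :
    (raySys M hM).Sqf a ↔ ∀ p, ordI K p (a : Ideal (𝓞 K)) ≤ 1 := by
  constructor
  · intro h p
    by_cases hp : IsCoprime p.asIdeal M
    · have h1 := h (primeCop p hp) p.isPrime
      rw [copIdeals_dvd_iff] at h1
      have h2 : ¬ p.asIdeal ^ 2 ∣ (a : Ideal (𝓞 K)) := by
        rw [pow_two]
        exact h1
      rw [pow_dvd_iff_le_ordI p a.2.1] at h2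
      push_cast at h2
      omega
    · rw [ordI_eq_zero_of_not_isCoprime p a hp]
      exact zero_le_one
  · intro h q hq hd
    rw [copIdeals_dvd_iff] at hd
    let p : HeightOneSpectrum (𝓞 K) := ⟨q, hq, q.2.1⟩
    have h2 : p.asIdeal ^ 2 ∣ (a : Ideal (𝓞 K)) := by
      rw [pow_two]
      exact hd
    rw [pow_dvd_iff_le_ordI p a.2.1] at h2
    have := h p
    push_cast at h2
    omega

theorem ordI_coe_prod {M : Ideal (𝓞 K)} {ι : Type*} [Fintype ι] (a : ι → copIdeals M) :
    ordI K p ((∏ i, a i : copIdeals M) : Ideal (𝓞 K)) =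
      ∑ i, ordI K p (a i : Ideal (𝓞 K)) := by
  rw [Submonoid.coe_finsetProd]
  exact ordI_prod p _ _ fun i _ ↦ (a i).2.1

end IdealOrder

section Match

open IsDedekindDomain FractionalIdeal

theorem eq_zero_or_single {n : ℕ} {c : Fin n → ℤ} (h0 : ∀ i, 0 ≤ c i) (h1 : ∑ i, c i ≤ 1) :
    c = 0 ∨ ∃ j, c = Pi.single j 1 := by
  by_cases h : ∃ j, c j ≠ 0
  · obtain ⟨j, hj⟩ := h
    refine Or.inr ⟨j, funext fun i ↦ ?_⟩
    have hjpos : 1 ≤ c j := by have := h0 j; omega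
    have hsum := Finset.add_sum_erase Finset.univ c (Finset.mem_univ j)
    by_cases hij : i = j
    · subst hij
      have := Finset.sum_nonneg fun k (_ : k ∈ Finset.univ.erase i) ↦ h0 k
      rw [Pi.single_eq_same]
      omega
    · have := Finset.single_le_sum (fun k (_ : k ∈ Finset.univ.erase j) ↦ h0 k)
        (Finset.mem_erase.mpr ⟨hij, Finset.mem_univ i⟩)
      have := h0 i
      rw [Pi.single_eq_of_ne hij]
      omega
  · push Not at h
    exact Or.inl (funext h)

/-- The sum `∑ (i + 1) c_i`. -/
def wsum {n : ℕ} (c : Fin n → ℤ) : ℤ := ∑ i : Fin n, ((i : ℕ) + 1 : ℤ) * c i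

theorem wsum_zero {n : ℕ} : wsum (0 : Fin n → ℤ) = 0 := by simp [wsum]

theorem wsum_single {n : ℕ} (j : Fin n) : wsum (Pi.single j 1) = (j : ℕ) + 1 := by
  rw [wsum, Finset.sum_eq_single j]
  · simp
  · intro i _ hij
    simp [Pi.single_eq_of_ne hij]
  · simp

theorem wsum_bounds {n : ℕ} {c : Fin n → ℤ} (h0 : ∀ i, 0 ≤ c i) (h1 : ∑ i, c i ≤ 1) :
    0 ≤ wsum c ∧ wsum c ≤ n := by
  obtain rfl | ⟨j, rfl⟩ := eq_zero_or_single h0 h1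
  · simp [wsum_zero]
  · rw [wsum_single]
    omega

theorem eq_of_dvd_wsum_sub {n : ℕ} {c c' : Fin n → ℤ} (h0 : ∀ i, 0 ≤ c i) (h1 : ∑ i, c i ≤ 1)
    (h0' : ∀ i, 0 ≤ c' i) (h1' : ∑ i, c' i ≤ 1) (h : (n + 1 : ℤ) ∣ wsum c - wsum c') :
    c = c' := by
  have hb := wsum_bounds h0 h1
  have hb' := wsum_bounds h0' h1'
  have heq : wsum c = wsum c' := by
    have := Int.eq_zero_of_abs_lt_dvd h (by rw [abs_lt]; constructor <;> omega)
    omega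
  obtain rfl | ⟨j, rfl⟩ := eq_zero_or_single h0 h1 <;>
  obtain rfl | ⟨j', rfl⟩ := eq_zero_or_single h0' h1'
  · rfl
  · rw [wsum_single, wsum_zero] at heq
    omega
  · rw [wsum_single, wsum_zero] at heq
    omega
  · rw [wsum_single, wsum_single] at heq
    have : j = j' := Fin.ext (by omega)
    rw [this]

theorem dvd_wsum_iff {n : ℕ} {c : Fin n → ℤ} (h0 : ∀ i, 0 ≤ c i) (h1 : ∑ i, c i ≤ 1) :
    (n + 1 : ℤ) ∣ wsum c ↔ ∑ i, c i = 0 := by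
  obtain rfl | ⟨j, rfl⟩ := eq_zero_or_single h0 h1
  · simp [wsum_zero]
  · rw [wsum_single, Finset.sum_pi_single']
    simp only [Finset.mem_univ, if_true, one_ne_zero, iff_false]
    intro h
    have := Int.le_of_dvd (by omega) h
    omega

variable {K : Type*} [Field K] [NumberField K] {M : Ideal (𝓞 K)} {ℓ : ℕ}

/-- The exponents of `p` in a tuple of ideals. -/
def ordT (p : HeightOneSpectrum (𝓞 K)) (a : Fin (ℓ - 1) → copIdeals M) (i : Fin (ℓ - 1)) : ℤ :=
  ordI K p (a i : Ideal (𝓞 K))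

theorem ordT_nonneg (p : HeightOneSpectrum (𝓞 K)) (a : Fin (ℓ - 1) → copIdeals M)
    (i : Fin (ℓ - 1)) : 0 ≤ ordT p a i := ordI_nonneg p _

theorem ordT_eq_zero {p : HeightOneSpectrum (𝓞 K)} (hp : ¬ IsCoprime p.asIdeal M)
    (a : Fin (ℓ - 1) → copIdeals M) : ordT p a = 0 :=
  funext fun i ↦ ordI_eq_zero_of_not_isCoprime p (a i) hp

theorem ordT_one (p : HeightOneSpectrum (𝓞 K)) :
    ordT p (1 : Fin (ℓ - 1) → copIdeals M) = 0 :=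
  funext fun _ ↦ ordI_one p

theorem tuple_eq_of_ordT {a a' : Fin (ℓ - 1) → copIdeals M}
    (h : ∀ p : HeightOneSpectrum (𝓞 K), ordT p a = ordT p a') : a = a' :=
  funext fun i ↦ Subtype.ext (eq_of_ordI_eq (a i).2.1 (a' i).2.1 fun p ↦ congrFun (h p) i)

/-- The tuple `a` records the exponents of `α` modulo `ℓ` at the primes coprime to `M`. -/
def KumMatch (α : K) (a : Fin (ℓ - 1) → copIdeals M) : Prop :=
  ∀ p : HeightOneSpectrum (𝓞 K), IsCoprime p.asIdeal M → (ℓ : ℤ) ∣ ordP p α - wsum (ordT p a)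

/-- A tuple of ideals whose product is squarefree. -/
def SqfT (a : Fin (ℓ - 1) → copIdeals M) : Prop :=
  ∀ p : HeightOneSpectrum (𝓞 K), ∑ i, ordT p a i ≤ 1

theorem raySys_sqf_prod_iff (hM : M ≠ ⊥) (a : Fin (ℓ - 1) → copIdeals M) :
    (raySys M hM).Sqf (∏ i, a i) ↔ SqfT a := by
  rw [raySys_sqf_iff]
  exact forall_congr' fun p ↦ by rw [ordI_coe_prod]; rfl

theorem KumMatch.unique (hℓ : 0 < ℓ) {α : K} {a a' : Fin (ℓ - 1) → copIdeals M}
    (h : KumMatch α a) (h' : KumMatch α a') (ha : SqfT a) (ha' : SqfT a') : a = a' := by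
  refine tuple_eq_of_ordT fun p ↦ ?_
  by_cases hp : IsCoprime p.asIdeal M
  · refine eq_of_dvd_wsum_sub (ordT_nonneg p a) (ha p) (ordT_nonneg p a') (ha' p) ?_
    have h1 := dvd_sub (h' p hp) (h p hp)
    rw [sub_sub_sub_cancel_left] at h1
    have h2 : ((ℓ - 1 : ℕ) + 1 : ℤ) = ℓ := by omega
    rwa [h2]
  · rw [ordT_eq_zero hp, ordT_eq_zero hp]

theorem KumMatch.dvd_iff (hℓ : 0 < ℓ) {α : K} {a : Fin (ℓ - 1) → copIdeals M}
    (h : KumMatch α a) (ha : SqfT a) {p : HeightOneSpectrum (𝓞 K)} (hp : IsCoprime p.asIdeal M) :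
    (ℓ : ℤ) ∣ ordP p α ↔ ∑ i, ordT p a i = 0 := by
  have h2 : ((ℓ - 1 : ℕ) + 1 : ℤ) = ℓ := by omega
  rw [← dvd_wsum_iff (ordT_nonneg p a) (ha p), h2]
  exact dvd_iff_dvd_of_dvd_sub (h p hp)

theorem KumMatch.mul_pow {α t : K} (hα : α ≠ 0) (ht : t ≠ 0) {a : Fin (ℓ - 1) → copIdeals M}
    (h : KumMatch α a) : KumMatch (α * t ^ ℓ) a := by
  intro p hp
  rw [ordP_mul p hα (pow_ne_zero _ ht), ordP_pow, add_sub_right_comm]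
  exact dvd_add (h p hp) (dvd_mul_right _ _)

theorem kumMatch_one : KumMatch (1 : K) (1 : Fin (ℓ - 1) → copIdeals M) := by
  intro p _
  rw [ordP_one, ordT_one, wsum_zero]
  simp

theorem sqfT_one : SqfT (1 : Fin (ℓ - 1) → copIdeals M) := by
  intro p
  rw [ordT_one]
  simp

theorem finite_ordP_ne_zero {α : K} (hα : α ≠ 0) :
    {p : HeightOneSpectrum (𝓞 K) | ordP p α ≠ 0}.Finite := by
  have h := FractionalIdeal.finite_factors (K := K) (spanSingleton (𝓞 K)⁰ α)
  rw [Filter.eventually_cofinite] at h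
  refine h.subset fun p hp ↦ ?_
  rwa [Set.mem_ofPred_eq, count_spanSingleton p hα]

theorem exists_kumMatch (hℓ : 0 < ℓ) {α : K} (hα : α ≠ 0) :
    ∃ a : Fin (ℓ - 1) → copIdeals M, KumMatch α a ∧ SqfT a := by
  classical
  set S := (finite_ordP_ne_zero hα).toFinset with hS
  let q : HeightOneSpectrum (𝓞 K) → copIdeals M := fun p ↦
    if hp : IsCoprime p.asIdeal M then primeCop p hp else 1
  let a : Fin (ℓ - 1) → copIdeals M := fun i ↦ ∏ p ∈ S with ordP p α % ℓ = (i : ℕ) + 1, q p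
  have hord : ∀ p, IsCoprime p.asIdeal M → ∀ i, ordT p a i =
      if ordP p α % ℓ = (i : ℕ) + 1 then 1 else 0 := by
    intro p hp i
    have h1 : ordT p a i = ∑ r ∈ S with ordP r α % ℓ = (i : ℕ) + 1,
        ordI K p (q r : Ideal (𝓞 K)) := by
      rw [ordT, Submonoid.coe_finsetProd]
      exact ordI_prod p _ _ fun r _ ↦ (q r).2.1
    have h2 : ∀ r, ordI K p (q r : Ideal (𝓞 K)) = if r = p then 1 else 0 := by
      intro r
      by_cases hr : IsCoprime r.asIdeal M
      · have : q r = primeCop r hr := dif_pos hr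
        rw [this]
        exact ordI_prime p r
      · have : q r = 1 := dif_neg hr
        rw [this, if_neg (by rintro rfl; exact hr hp)]
        exact ordI_one p
    rw [h1, Finset.sum_congr rfl fun r _ ↦ h2 r, Finset.sum_ite_eq']
    refine if_congr ?_ rfl rfl
    rw [Finset.mem_filter, hS, Set.Finite.mem_toFinset]
    refine ⟨And.right, fun h ↦ ⟨fun h0 ↦ ?_, h⟩⟩
    rw [h0] at h
    simp at h
    omega
  have hℓ' : (0 : ℤ) < ℓ := by exact_mod_cast hℓ
  have key : ∀ p, IsCoprime p.asIdeal M → (∃ j, ordT p a = Pi.single j 1 ∧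
      ordP p α % ℓ = (j : ℕ) + 1) ∨ (ordT p a = 0 ∧ ordP p α % ℓ = 0) := by
    intro p hp
    have hb1 := Int.emod_nonneg (ordP p α) hℓ'.ne'
    have hb2 := Int.emod_lt_of_pos (ordP p α) hℓ'
    by_cases h0 : ordP p α % ℓ = 0
    · refine Or.inr ⟨funext fun i ↦ ?_, h0⟩
      rw [hord p hp, if_neg (by omega)]
      rfl
    · refine Or.inl ⟨⟨(ordP p α % ℓ - 1).toNat, by omega⟩, funext fun i ↦ ?_, by simp; omega⟩
      rw [hord p hp, Pi.single_apply]
      refine if_congr ?_ rfl rfl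
      rw [Fin.ext_iff]
      simp only
      omega
  refine ⟨a, fun p hp ↦ ?_, fun p ↦ ?_⟩
  · obtain ⟨j, hj, hm⟩ | ⟨h0, hm⟩ := key p hp
    · rw [hj, wsum_single, ← hm]
      exact Int.dvd_self_sub_emod
    · rw [h0, wsum_zero, sub_zero]
      exact Int.dvd_of_emod_eq_zero hm
  · by_cases hp : IsCoprime p.asIdeal M
    · obtain ⟨j, hj, hm⟩ | ⟨h0, hm⟩ := key p hp
      · rw [hj, Finset.sum_pi_single']
        simp
      · rw [h0]
        simp
    · rw [ordT_eq_zero hp]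
      simp

end Match

section KumIdeal

open IsDedekindDomain FractionalIdeal IntermediateField

variable {K : Type*} [Field K] [NumberField K]

open Classical in
/-- The class of a nonzero fractional ideal. -/
def fracClass (J : FractionalIdeal (𝓞 K)⁰ K) : ClassGroup (𝓞 K) :=
  if h : J ≠ 0 then ClassGroup.mk (K := K) (Units.mk0 J h) else 1

theorem fracClass_of_ne_zero {J : FractionalIdeal (𝓞 K)⁰ K} (h : J ≠ 0) :
    fracClass J = ClassGroup.mk (K := K) (Units.mk0 J h) := dif_pos h

theorem fracClass_mul {I J : FractionalIdeal (𝓞 K)⁰ K} (hI : I ≠ 0) (hJ : J ≠ 0) :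
    fracClass (I * J) = fracClass I * fracClass J := by
  rw [fracClass_of_ne_zero hI, fracClass_of_ne_zero hJ, fracClass_of_ne_zero (mul_ne_zero hI hJ),
    Units.mk0_mul, map_mul]

theorem fracClass_pow {I : FractionalIdeal (𝓞 K)⁰ K} (hI : I ≠ 0) (n : ℕ) :
    fracClass (I ^ n) = fracClass I ^ n := by
  rw [fracClass_of_ne_zero hI, fracClass_of_ne_zero (pow_ne_zero n hI), ← map_pow]
  congr 1
  exact Units.ext (by simp)

theorem fracClass_spanSingleton_mul {x : K} (hx : x ≠ 0) {I : FractionalIdeal (𝓞 K)⁰ K}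
    (hI : I ≠ 0) : fracClass (spanSingleton (𝓞 K)⁰ x * I) = fracClass I := by
  have hx' : spanSingleton (𝓞 K)⁰ x ≠ 0 := spanSingleton_ne_zero_iff.mpr hx
  rw [fracClass_of_ne_zero hI, fracClass_of_ne_zero (mul_ne_zero hx' hI)]
  exact classGroup_mk_spanSingleton_mul hx rfl

theorem fracClass_coeIdeal (I : (Ideal (𝓞 K))⁰) :
    fracClass ((I : Ideal (𝓞 K)) : FractionalIdeal (𝓞 K)⁰ K) = ClassGroup.mk0 I := by
  have h : ((I : Ideal (𝓞 K)) : FractionalIdeal (𝓞 K)⁰ K) ≠ 0 :=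
    coeIdeal_ne_zero.mpr (mem_nonZeroDivisors_iff_ne_zero.mp I.2)
  rw [fracClass_of_ne_zero h, ← ClassGroup.mk_mk0 K]
  rfl

/-- The class of an ideal coprime to `M` in the ideal class group. -/
def copClass (M : Ideal (𝓞 K)) : copIdeals M →* ClassGroup (𝓞 K) :=
  ClassGroup.mk0.comp (Submonoid.inclusion (T := (Ideal (𝓞 K))⁰) fun _ h ↦
    mem_nonZeroDivisors_iff_ne_zero.mpr h.1)

theorem fracClass_copIdeals {M : Ideal (𝓞 K)} (a : copIdeals M) :
    fracClass ((a : Ideal (𝓞 K)) : FractionalIdeal (𝓞 K)⁰ K) = copClass M a :=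
  fracClass_coeIdeal ⟨(a : Ideal (𝓞 K)), mem_nonZeroDivisors_iff_ne_zero.mpr a.2.1⟩

theorem copClass_eq_of_rayMk_eq {M : Ideal (𝓞 K)} {a b : copIdeals M}
    (h : rayMk M a = rayMk M b) : copClass M a = copClass M b := by
  obtain ⟨x, y, ⟨hx, hy⟩, -, h⟩ := rayMk_eq_iff.mp h
  exact (ClassGroup.mk0_eq_mk0_iff (R := 𝓞 K)).mpr ⟨x, y, hx, hy, h⟩

theorem copClass_surjective {M : Ideal (𝓞 K)} (hM : M ≠ ⊥) :
    Function.Surjective (copClass M) := by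
  intro C
  obtain ⟨J, hJ⟩ := ClassGroup.mk0_surjective C⁻¹
  have hJ0 : (J : Ideal (𝓞 K)) ≠ ⊥ := mem_nonZeroDivisors_iff_ne_zero.mp J.2
  have hx : ∃ x : 𝓞 K, (J : Ideal (𝓞 K)) * M ⊔ Ideal.span {x} = J ∧ x ≠ 0 := by
    obtain ⟨x, hx⟩ := IsDedekindDomain.exists_sup_span_eq
      (Ideal.mul_le_left : (J : Ideal (𝓞 K)) * M ≤ J) (mul_ne_zero hJ0 hM)
    by_cases hx0 : x = 0
    · subst hx0
      obtain ⟨y, hy, hy0⟩ := Submodule.exists_mem_ne_zero_of_ne_bot (mul_ne_zero hJ0 hM)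
      refine ⟨y, ?_, hy0⟩
      rw [Ideal.span_singleton_zero, sup_bot_eq] at hx
      rw [sup_eq_left.mpr ((Ideal.span_singleton_le_iff_mem _).mpr hy), hx]
    · exact ⟨x, hx, hx0⟩
  obtain ⟨x, hx, hx0⟩ := hx
  obtain ⟨B, hB⟩ := Ideal.dvd_iff_le.mpr (le_sup_right.trans_eq hx)
  have hB0 : B ≠ ⊥ := by
    rintro rfl
    rw [Ideal.mul_bot, Ideal.span_singleton_eq_bot] at hB
    exact hx0 hB
  have hBM : IsCoprime B M := by
    rw [hB, ← Ideal.mul_sup] at hx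
    rw [Ideal.isCoprime_iff_sup_eq, sup_comm]
    exact mul_left_cancel₀ hJ0 (hx.trans (Ideal.mul_top _).symm)
  refine ⟨⟨B, hB0, hBM⟩, ?_⟩
  rw [← inv_inv C, ← hJ]
  refine (ClassGroup.mk0_eq_mk0_inv_iff).mpr ⟨x, hx0, ?_⟩
  rw [hB, mul_comm]
  rfl

variable {ℓ : ℕ} (hℓ : ℓ.Prime) {ζ : K} (hζ : IsPrimitiveRoot ζ ℓ)

/-- The invariants of the Kummer extension of `K` attached to `α`, in terms of the fractional
ideal `J` of determinants. -/
structure IsKumIdeal (ζ : K) (α : Kˣ) (ℓ : ℕ) (J : FractionalIdeal (𝓞 K)⁰ K) : Prop where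
  ne_zero : J ≠ 0
  count : ∀ (p : HeightOneSpectrum (𝓞 K)) (c : ℤ),
    KummerData p ℓ (1 - ζ) (α : K) c → 2 * FractionalIdeal.count K p J = c
  steinitz : ∀ C, IsSteinitzClass K
    (kummerField (AlgebraicClosure K) (α : KummerGroup ℓ K)) C ↔ C = fracClass J
  disc_ne : relDisc K (kummerField (AlgebraicClosure K) (α : KummerGroup ℓ K)) ≠ ⊥
  disc : ∀ p : HeightOneSpectrum (𝓞 K),
    ordI K p (relDisc K (kummerField (AlgebraicClosure K) (α : KummerGroup ℓ K))) =
      2 * FractionalIdeal.count K p J + (ℓ * ordP p (ℓ : K) + (ℓ - 1) * ordP p (α : K))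

include hℓ hζ in
theorem exists_isKumIdeal {α : Kˣ} (hα : (α : KummerGroup ℓ K) ≠ 1) :
    ∃ J, IsKumIdeal ζ α ℓ J := by
  obtain ⟨θ, hθ⟩ := IsAlgClosed.exists_pow_nat_eq
    (algebraMap K (AlgebraicClosure K) (α : K)) hℓ.pos
  rw [KummerGroup.mk_ne_one_iff hℓ.ne_zero] at hα
  have hL := kummerField_mk hℓ hζ hθ
  set L := kummerField (AlgebraicClosure K) (α : KummerGroup ℓ K) with hLdef
  have hθL : θ ∈ L := by
    rw [hL]
    exact mem_adjoin_simple_self K θ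
  have hθ' : (⟨θ, hθL⟩ : L) ^ ℓ = algebraMap K L α := Subtype.ext hθ
  obtain ⟨b, hb⟩ := exists_basis_kummer hℓ hα (⟨θ, hθL⟩ : L) hθ' hL
  have : Module.Finite K L := Module.Finite.of_basis b
  have : NumberField L := NumberField.of_module_finite K L
  have hdisc := coe_relDisc_eq b
  have hD0 : Algebra.discr K b ≠ 0 := discr_basis_ne_zero b
  have hJ0 := detIdeal_ne_zero b
  have hne : (relDisc K L : FractionalIdeal (𝓞 K)⁰ K) ≠ 0 := by
    rw [hdisc]
    exact mul_ne_zero (pow_ne_zero _ hJ0) (spanSingleton_ne_zero_iff.mpr hD0)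
  refine ⟨detIdeal b, hJ0, fun p c hc ↦ hc.count_detIdeal hℓ hζ b hb hθ' α.ne_zero,
    fun C ↦ ?_, coeIdeal_ne_zero.mp hne, fun p ↦ ?_⟩
  · rw [isSteinitzClass_iff b, fracClass_of_ne_zero hJ0]
    rfl
  · rw [ordI, hdisc, count_mul _ _ (pow_ne_zero _ hJ0) (spanSingleton_ne_zero_iff.mpr hD0),
      count_pow, count_spanSingleton p hD0]
    have hord : ordP p (Algebra.discr K b) = ordP p ((ℓ : K) ^ ℓ * (α : K) ^ (ℓ - 1)) := by
      obtain h | h := discr_kummer b hb hθ' hℓ.ne_zero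
      · rw [h]
      · rw [h, ordP_neg]
    rw [hord, ordP_mul p (pow_ne_zero _ (Nat.cast_ne_zero.mpr hℓ.ne_zero))
      (pow_ne_zero _ α.ne_zero), ordP_pow, ordP_pow, Nat.cast_sub hℓ.one_le]
    push_cast
    ring

end KumIdeal

section Twist

open IsDedekindDomain FractionalIdeal IntermediateField

variable {K : Type*} [Field K] [NumberField K] {M : Ideal (𝓞 K)} {ℓ : ℕ}

/-- The element `z` is close to `1` at the primes dividing `M`, and multiplication by `z` carries
elements matched with `a` to elements matched with `a'`. -/
structure IsTwist (ζ : K) (a a' : Fin (ℓ - 1) → copIdeals M) (k : HeightOneSpectrum (𝓞 K) → ℤ)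
    (z : Kˣ) : Prop where
  ord : ∀ p, ordP p (z : K) = wsum (ordT p a') - wsum (ordT p a) - ℓ * k p
  near : ∀ p : HeightOneSpectrum (𝓞 K), ¬ IsCoprime p.asIdeal M →
    (z : K) - 1 ∈ ordPGe p (ℓ * ordP p (1 - ζ) + 1)
  unit : ∀ p : HeightOneSpectrum (𝓞 K), ¬ IsCoprime p.asIdeal M → ordP p (z : K) = 0

/-- The modulus `M` is divisible by a sufficiently high power of every prime above `ℓ`. -/
structure IsGoodModulus (ℓ : ℕ) (ζ : K) (M : Ideal (𝓞 K)) : Prop where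
  ne_bot : M ≠ ⊥
  near : ∀ p : HeightOneSpectrum (𝓞 K), ¬ IsCoprime p.asIdeal M → ∀ x ∈ M,
    (x : K) ∈ ordPGe p (ℓ * ordP p (1 - ζ) + 1)
  tame : ∀ p : HeightOneSpectrum (𝓞 K), IsCoprime p.asIdeal M → ordP p (1 - ζ) = 0

variable {ζ : K} {a a' : Fin (ℓ - 1) → copIdeals M} {k : HeightOneSpectrum (𝓞 K) → ℤ} {z : Kˣ}

theorem IsTwist.inv (h : IsTwist ζ a a' k z) : IsTwist ζ a' a (fun p ↦ -k p) z⁻¹ where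
  ord p := by
    rw [Units.val_inv_eq_inv_val, ordP_inv, h.ord]
    ring
  near p hp := by
    have h1 : ((z⁻¹ : Kˣ) : K) - 1 = -(z : K)⁻¹ * ((z : K) - 1) := by
      rw [Units.val_inv_eq_inv_val]
      field_simp
      ring
    have h2 : -(z : K)⁻¹ ∈ ordPGe p (0 : ℤ) := by
      rw [mem_ordPGe, ordP_neg, ordP_inv, h.unit p hp]
      simp
    have := ordPGe_mul p h2 (h.near p hp)
    rwa [h1, ← zero_add (_ * _ + 1 : ℤ)]
  unit p hp := by
    rw [Units.val_inv_eq_inv_val, ordP_inv, h.unit p hp, neg_zero]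

theorem IsTwist.match (h : IsTwist ζ a a' k z) {α : Kˣ} (hα : KumMatch (α : K) a) :
    KumMatch ((α * z : Kˣ) : K) a' := by
  intro p hp
  rw [Units.val_mul, ordP_mul p α.ne_zero z.ne_zero, h.ord p]
  have : ordP p (α : K) + (wsum (ordT p a') - wsum (ordT p a) - ℓ * k p) - wsum (ordT p a') =
      (ordP p (α : K) - wsum (ordT p a)) - ℓ * k p := by ring
  rw [this]
  exact dvd_sub (hα p hp) (dvd_mul_right _ _)

theorem copIdeals_ne_bot (a : copIdeals M) : (a : Ideal (𝓞 K)) ≠ ⊥ := a.2.1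

theorem ordI_prod_pow_succ (p : HeightOneSpectrum (𝓞 K)) (a : Fin (ℓ - 1) → copIdeals M) :
    ordI K p ((∏ i, a i ^ ((i : ℕ) + 1) : copIdeals M) : Ideal (𝓞 K)) = wsum (ordT p a) := by
  rw [ordI_coe_prod, wsum]
  refine Finset.sum_congr rfl fun i _ ↦ ?_
  rw [SubmonoidClass.coe_pow, ordI_pow]
  push_cast
  rfl

theorem exists_isTwist (hM : IsGoodModulus ℓ ζ M)
    (a a' : Fin (ℓ - 1) → copIdeals M) (c : copIdeals M)
    (h : rayMk M (∏ i, a' i ^ ((i : ℕ) + 1)) =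
      rayMk M (∏ i, a i ^ ((i : ℕ) + 1)) * rayMk M c ^ ℓ) :
    ∃ z, IsTwist ζ a a' (fun p ↦ ordI K p (c : Ideal (𝓞 K))) z := by
  rw [← map_pow, ← map_mul, eq_comm] at h
  obtain ⟨x, y, ⟨hx, hy⟩, ⟨hxM, hyM⟩, h⟩ := rayMk_eq_iff.mp h
  have hinj := FaithfulSMul.algebraMap_injective (𝓞 K) K
  have hx' : (x : K) ≠ 0 := (map_ne_zero_iff _ hinj).mpr hx
  have hy' : (y : K) ≠ 0 := (map_ne_zero_iff _ hinj).mpr hy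
  have hunit : ∀ (p : HeightOneSpectrum (𝓞 K)), ¬ IsCoprime p.asIdeal M → ∀ w : 𝓞 K, w ≠ 0 →
      w - 1 ∈ M → ordP p (w : K) = 0 := by
    intro p hp w hw hwM
    rw [ordP_algebraMap_eq_zero_iff p hw]
    intro hwp
    rw [isCoprime_iff_of_prime, not_not] at hp
    have : (1 : 𝓞 K) ∈ p.asIdeal := by
      have := p.asIdeal.sub_mem hwp (hp hwM)
      rwa [sub_sub_cancel] at this
    exact p.isPrime.ne_top ((Ideal.eq_top_iff_one _).mpr this)
  refine ⟨Units.mk0 ((x : K) / y) (div_ne_zero hx' hy'), fun p ↦ ?_, fun p hp ↦ ?_, fun p hp ↦ ?_⟩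
  · rw [Units.val_mk0, ordP_div p hx' hy']
    have h1 := congrArg (ordI K p) h
    rw [ordI_mul p (by simpa using hx) (copIdeals_ne_bot _),
      ordI_mul p (by simpa using hy) (copIdeals_ne_bot _), ordI_span p hx, ordI_span p hy,
      ordI_prod_pow_succ, Submonoid.coe_mul, ordI_mul p (copIdeals_ne_bot _) (copIdeals_ne_bot _),
      ordI_prod_pow_succ, SubmonoidClass.coe_pow, ordI_pow] at h1
    linarith
  · have h1 : (x : K) / y - 1 = (y : K)⁻¹ * (((x - y : 𝓞 K)) : K) := by
      push_cast
      field_simp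
    have h2 : (y : K)⁻¹ ∈ ordPGe p (0 : ℤ) := by
      rw [mem_ordPGe, ordP_inv, hunit p hp y hy hyM]
      simp
    have h3 : x - y ∈ M := by
      have := M.sub_mem hxM hyM
      rwa [sub_sub_sub_cancel_right] at this
    have := ordPGe_mul p h2 (hM.near p hp _ h3)
    rwa [Units.val_mk0, h1, ← zero_add (_ * _ + 1 : ℤ)]
  · rw [Units.val_mk0, ordP_div p hx' hy', hunit p hp x hx hxM, hunit p hp y hy hyM, sub_zero]

theorem IsTwist.two_mul_count (hℓ : ℓ.Prime) (hζ : IsPrimitiveRoot ζ ℓ)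
    (hM : IsGoodModulus ℓ ζ M) (h : IsTwist ζ a a' k z) (ha : SqfT a) (ha' : SqfT a') {α : Kˣ}
    (hα : KumMatch (α : K) a) {J J' : FractionalIdeal (𝓞 K)⁰ K} (hJ : IsKumIdeal ζ α ℓ J)
    (hJ' : IsKumIdeal ζ (α * z) ℓ J') (p : HeightOneSpectrum (𝓞 K)) :
    2 * (count K p J' - count K p J) = (ℓ - 1) * (-ordP p (z : K) +
      ordI K p ((∏ i, a' i : copIdeals M) : Ideal (𝓞 K)) -
      ordI K p ((∏ i, a i : copIdeals M) : Ideal (𝓞 K))) := by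
  obtain ⟨c, hc⟩ := exists_kummerData (p := p) hℓ hζ α.ne_zero
  have h1 := hJ.count p c hc
  by_cases hp : IsCoprime p.asIdeal M
  · obtain ⟨c', hc'⟩ := exists_kummerData (p := p) hℓ hζ (α * z).ne_zero
    have h1' := hJ'.count p c' hc'
    have h2 := hc.eq_of_tame hℓ (hM.tame p hp)
    have h2' := hc'.eq_of_tame hℓ (hM.tame p hp)
    have hif : ∀ {β : Kˣ} {b : Fin (ℓ - 1) → copIdeals M}, KumMatch (β : K) b → SqfT b →
        (if (ℓ : ℤ) ∣ ordP p (β : K) then 0 else 1 : ℤ) =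
          ordI K p ((∏ i, b i : copIdeals M) : Ideal (𝓞 K)) := by
      intro β b hβ hb
      have h3 : ordI K p ((∏ i, b i : copIdeals M) : Ideal (𝓞 K)) = ∑ i, ordT p b i :=
        ordI_coe_prod p b
      have h4 := hb p
      have h5 : 0 ≤ ∑ i, ordT p b i := Finset.sum_nonneg fun i _ ↦ ordT_nonneg p b i
      have h6 := hβ.dvd_iff hℓ.pos hb hp
      rw [h3]
      split_ifs with h7
      · exact (h6.mp h7).symm
      · have : ∑ i, ordT p b i ≠ 0 := fun h ↦ h7 (h6.mpr h)
        omega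
    rw [hif hα ha] at h2
    rw [hif (h.match hα) ha', Units.val_mul, ordP_mul p α.ne_zero z.ne_zero] at h2'
    linear_combination h1' - h1 + h2' - h2
  · have hc' := hc.mul hℓ hζ α.ne_zero (h.near p hp)
    rw [← Units.val_mul] at hc'
    have h1' := hJ'.count p c hc'
    rw [h.unit p hp, ordI_eq_zero_of_not_isCoprime p _ hp, ordI_eq_zero_of_not_isCoprime p _ hp]
    linear_combination h1' - h1

section Invariants

variable (hℓ : ℓ.Prime) (hζ : IsPrimitiveRoot ζ ℓ) (hM : IsGoodModulus ℓ ζ M)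
  (h : IsTwist ζ a a' k z) (ha : SqfT a) (ha' : SqfT a') {α : Kˣ} (hα : KumMatch (α : K) a)
  {J J' : FractionalIdeal (𝓞 K)⁰ K} (hJ : IsKumIdeal ζ α ℓ J) (hJ' : IsKumIdeal ζ (α * z) ℓ J')

include hℓ hζ hM h ha ha' hα hJ hJ'

theorem IsTwist.relDisc_mul :
    relDisc K (kummerField (AlgebraicClosure K) ((α * z : Kˣ) : KummerGroup ℓ K)) *
      ((∏ i, a i : copIdeals M) : Ideal (𝓞 K)) ^ (ℓ - 1) =
    relDisc K (kummerField (AlgebraicClosure K) (α : KummerGroup ℓ K)) *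
      ((∏ i, a' i : copIdeals M) : Ideal (𝓞 K)) ^ (ℓ - 1) := by
  have hb := pow_ne_zero (ℓ - 1) (∏ i, a i : copIdeals M).2.1
  have hb' := pow_ne_zero (ℓ - 1) (∏ i, a' i : copIdeals M).2.1
  refine eq_of_ordI_eq (K := K) (mul_ne_zero hJ'.disc_ne hb) (mul_ne_zero hJ.disc_ne hb')
    fun p ↦ ?_
  have h1 := h.two_mul_count hℓ hζ hM ha ha' hα hJ hJ' p
  rw [ordI_mul p hJ'.disc_ne hb, ordI_mul p hJ.disc_ne hb', ordI_pow, ordI_pow, hJ.disc, hJ'.disc,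
    Units.val_mul, ordP_mul p α.ne_zero z.ne_zero, Nat.cast_sub hℓ.one_le,
    Nat.cast_one]
  linear_combination h1

theorem IsTwist.fracClass_odd {m : ℕ} (hm : ℓ - 1 = 2 * m) :
    fracClass J' * copClass M (∏ i, a i) ^ m = fracClass J * copClass M (∏ i, a' i) ^ m := by
  have hz : spanSingleton (𝓞 K)⁰ (z : K) ≠ 0 := spanSingleton_ne_zero_iff.mpr z.ne_zero
  have hb : (((∏ i, a i : copIdeals M) : Ideal (𝓞 K)) : FractionalIdeal (𝓞 K)⁰ K) ≠ 0 :=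
    coeIdeal_ne_zero.mpr (∏ i, a i : copIdeals M).2.1
  have hb' : (((∏ i, a' i : copIdeals M) : Ideal (𝓞 K)) : FractionalIdeal (𝓞 K)⁰ K) ≠ 0 :=
    coeIdeal_ne_zero.mpr (∏ i, a' i : copIdeals M).2.1
  have hzm := pow_ne_zero m hz
  have hbm := pow_ne_zero m hb
  have hbm' := pow_ne_zero m hb'
  have hJ0 := hJ.ne_zero
  have hJ0' := hJ'.ne_zero
  rw [← fracClass_copIdeals, ← fracClass_copIdeals, ← fracClass_pow hb, ← fracClass_pow hb',
    ← fracClass_mul hJ0 hbm', ← fracClass_mul hJ0' hbm,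
    ← fracClass_spanSingleton_mul (pow_ne_zero m z.ne_zero) (mul_ne_zero hJ0' hbm),
    ← spanSingleton_pow]
  congr 1
  refine fractionalIdeal_ext_count (mul_ne_zero hzm (mul_ne_zero hJ0' hbm))
    (mul_ne_zero hJ0 hbm') fun p ↦ ?_
  have h1 := h.two_mul_count hℓ hζ hM ha ha' hα hJ hJ' p
  rw [count_mul _ _ hzm (mul_ne_zero hJ0' hbm), count_mul _ _ hJ0' hbm, count_mul _ _ hJ0 hbm',
    count_pow, count_pow, count_pow, count_spanSingleton p z.ne_zero]
  have h2 : (ℓ : ℤ) - 1 = 2 * m := by have := hℓ.one_le; omega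
  rw [h2, mul_assoc] at h1
  have h3 := mul_left_cancel₀ two_ne_zero h1
  rw [ordI, ordI] at h3
  linear_combination h3

theorem IsTwist.fracClass_two (h2 : ℓ = 2) {c : copIdeals M}
    (hk : ∀ p, k p = ordI K p (c : Ideal (𝓞 K))) :
    fracClass J' = fracClass J * copClass M c := by
  have hc : ((c : Ideal (𝓞 K)) : FractionalIdeal (𝓞 K)⁰ K) ≠ 0 := coeIdeal_ne_zero.mpr c.2.1
  have hJ0 := hJ.ne_zero
  have hJ0' := hJ'.ne_zero
  rw [← fracClass_copIdeals, ← fracClass_mul hJ0 hc]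
  congr 1
  refine fractionalIdeal_ext_count hJ0' (mul_ne_zero hJ0 hc) fun p ↦ ?_
  have h1 := h.two_mul_count hℓ hζ hM ha ha' hα hJ hJ' p
  subst h2
  rw [count_mul _ _ hJ0 hc]
  have hw : ∀ b : Fin (2 - 1) → copIdeals M, wsum (ordT p b) =
      ordI K p ((∏ i, b i : copIdeals M) : Ideal (𝓞 K)) := by
    intro b
    rw [ordI_coe_prod, wsum]
    refine Finset.sum_congr rfl fun i _ ↦ ?_
    have : (i : ℕ) = 0 := by omega
    rw [this]
    simp [ordT]
  rw [h.ord p, hw, hw, hk p, ordI, ordI, ordI] at h1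
  push_cast at h1
  linarith

end Invariants

end Twist

section Transport

open IsDedekindDomain FractionalIdeal

variable {K : Type*} [Field K] [NumberField K] {ℓ : ℕ}

open Classical in
/-- The squarefree tuple of ideals coprime to `M` attached to a class modulo `ℓ`-th powers. -/
def kumTuple (M : Ideal (𝓞 K)) (v : KummerGroup ℓ K) : Fin (ℓ - 1) → copIdeals M :=
  if h : 0 < ℓ then (exists_kumMatch h (Quotient.out v : Kˣ).ne_zero).choose else 1

open Classical in
/-- The Steinitz class of the Kummer extension attached to a class modulo `ℓ`-th powers. -/
def kumSteinitz (v : KummerGroup ℓ K) : ClassGroup (𝓞 K) :=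
  if h : ∃ C, IsSteinitzClass K (kummerField (AlgebraicClosure K) v) C then h.choose else 1

open Classical in
/-- The part of the norm of the discriminant of a Kummer extension that is not accounted for by
the associated tuple of ideals. -/
def kumDisc (M : Ideal (𝓞 K)) (v : KummerGroup ℓ K) : ℝ :=
  if v = 1 then 1 else
    (Ideal.absNorm (relDisc K (kummerField (AlgebraicClosure K) v)) : ℝ) /
      (Ideal.absNorm ((∏ i, kumTuple M v i : copIdeals M) : Ideal (𝓞 K)) : ℝ) ^ (ℓ - 1)

variable {M : Ideal (𝓞 K)} (hℓ : ℓ.Prime) {ζ : K} (hζ : IsPrimitiveRoot ζ ℓ)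

section

include hℓ

theorem sqfT_kumTuple (v : KummerGroup ℓ K) : SqfT (kumTuple M v) := by
  rw [kumTuple, dif_pos hℓ.pos]
  exact (exists_kumMatch hℓ.pos (Quotient.out v : Kˣ).ne_zero).choose_spec.2

theorem kumMatch_kumTuple (α : Kˣ) : KumMatch (α : K) (kumTuple M (α : KummerGroup ℓ K)) := by
  obtain ⟨t, ht⟩ := KummerGroup.mk_eq_iff.mp (QuotientGroup.out_eq' (α : KummerGroup ℓ K))
  have h1 : KumMatch ((Quotient.out (α : KummerGroup ℓ K) : Kˣ) : K)
      (kumTuple M (α : KummerGroup ℓ K)) := by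
    rw [kumTuple, dif_pos hℓ.pos]
    exact (exists_kumMatch hℓ.pos (Quotient.out _ : Kˣ).ne_zero).choose_spec.1
  have h2 := h1.mul_pow (Units.ne_zero _) t.ne_zero
  have h3 := congrArg (Units.val : Kˣ → K) ht
  rw [Units.val_mul, Units.val_pow_eq_pow_val] at h3
  rw [h3]
  exact h2

theorem kumTuple_eq_iff {α : Kˣ} {a : Fin (ℓ - 1) → copIdeals M} (ha : SqfT a) :
    kumTuple M (α : KummerGroup ℓ K) = a ↔ KumMatch (α : K) a := by
  refine ⟨?_, fun h ↦ (kumMatch_kumTuple hℓ α).unique hℓ.pos h (sqfT_kumTuple hℓ _) ha⟩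
  rintro rfl
  exact kumMatch_kumTuple hℓ α

theorem kumTuple_one : kumTuple M (1 : KummerGroup ℓ K) = 1 := by
  rw [← QuotientGroup.mk_one, kumTuple_eq_iff hℓ sqfT_one, Units.val_one]
  exact kumMatch_one

theorem ne_one_of_kumTuple_ne_one {v : KummerGroup ℓ K} (h : kumTuple M v ≠ 1) : v ≠ 1 := by
  rintro rfl
  exact h (kumTuple_one hℓ)

end

theorem IsKumIdeal.kumSteinitz_eq {α : Kˣ} {J : FractionalIdeal (𝓞 K)⁰ K}
    (hJ : IsKumIdeal ζ α ℓ J) : kumSteinitz (α : KummerGroup ℓ K) = fracClass J := by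
  have h : ∃ C, IsSteinitzClass K (kummerField (AlgebraicClosure K) (α : KummerGroup ℓ K)) C :=
    ⟨_, (hJ.steinitz _).mpr rfl⟩
  rw [kumSteinitz, dif_pos h]
  exact (hJ.steinitz _).mp h.choose_spec

include hℓ hζ in
theorem isSteinitzClass_kummerField_iff {v : KummerGroup ℓ K} (hv : v ≠ 1)
    {C : ClassGroup (𝓞 K)} :
    IsSteinitzClass K (kummerField (AlgebraicClosure K) v) C ↔ kumSteinitz v = C := by
  induction v using QuotientGroup.induction_on with
  | H α =>
    obtain ⟨J, hJ⟩ := exists_isKumIdeal hℓ hζ hv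
    rw [hJ.kumSteinitz_eq, hJ.steinitz, eq_comm]

include hℓ hζ in
theorem relDisc_kummerField_ne_bot {v : KummerGroup ℓ K} (hv : v ≠ 1) :
    relDisc K (kummerField (AlgebraicClosure K) v) ≠ ⊥ := by
  induction v using QuotientGroup.induction_on with
  | H α =>
    obtain ⟨J, hJ⟩ := exists_isKumIdeal hℓ hζ hv
    exact hJ.disc_ne

theorem absNorm_copIdeals_pos (a : copIdeals M) :
    (0 : ℝ) < Ideal.absNorm (a : Ideal (𝓞 K)) := by
  have : Ideal.absNorm (a : Ideal (𝓞 K)) ≠ 0 := fun h ↦ a.2.1 (Ideal.absNorm_eq_zero_iff.mp h)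
  positivity

include hℓ hζ in
theorem kumDisc_pos (v : KummerGroup ℓ K) : 0 < kumDisc M v := by
  rw [kumDisc]
  split_ifs with hv
  · exact one_pos
  · have h1 : Ideal.absNorm (relDisc K (kummerField (AlgebraicClosure K) v)) ≠ 0 := fun h ↦
      relDisc_kummerField_ne_bot hℓ hζ hv (Ideal.absNorm_eq_zero_iff.mp h)
    have h2 := absNorm_copIdeals_pos (∏ i, kumTuple M v i : copIdeals M)
    positivity

theorem kumDisc_mul {v : KummerGroup ℓ K} (hv : v ≠ 1) :
    kumDisc M v *
      (Ideal.absNorm ((∏ i, kumTuple M v i : copIdeals M) : Ideal (𝓞 K)) : ℝ) ^ (ℓ - 1) =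
    Ideal.absNorm (relDisc K (kummerField (AlgebraicClosure K) v)) := by
  rw [kumDisc, if_neg hv]
  exact div_mul_cancel₀ _ (pow_ne_zero _ (absNorm_copIdeals_pos _).ne')

include hℓ hζ in
theorem IsTwist.fibreTransport (hM : IsGoodModulus ℓ ζ M) {a a' : Fin (ℓ - 1) → copIdeals M}
    {k : HeightOneSpectrum (𝓞 K) → ℤ} {z : Kˣ} (h : IsTwist ζ a a' k z) (ha : SqfT a)
    (ha' : SqfT a') (ha1 : a ≠ 1) (ha1' : a' ≠ 1) {κ : ClassGroup (𝓞 K) → ClassGroup (𝓞 K)}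
    (hκ : ∀ (α : Kˣ) (J J' : FractionalIdeal (𝓞 K)⁰ K), KumMatch (α : K) a → IsKumIdeal ζ α ℓ J →
      IsKumIdeal ζ (α * z) ℓ J' → fracClass J' = κ (fracClass J)) :
    FibreTransport (Fin (ℓ - 1)) (kumTuple M) (kumDisc M) kumSteinitz
      (fun v : KummerGroup ℓ K ↦ v * (z : KummerGroup ℓ K)) a a' κ := by
  have hmaps : ∀ {b b' : Fin (ℓ - 1) → copIdeals M} {k' : HeightOneSpectrum (𝓞 K) → ℤ} {w : Kˣ},
      IsTwist ζ b b' k' w → SqfT b → SqfT b' → ∀ v : KummerGroup ℓ K, kumTuple M v = b →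
        kumTuple M (v * (w : KummerGroup ℓ K)) = b' := by
    intro b b' k' w hw hb hb' v hv
    induction v using QuotientGroup.induction_on with
    | H α =>
      rw [← QuotientGroup.mk_mul, kumTuple_eq_iff hℓ hb']
      exact hw.match ((kumTuple_eq_iff hℓ hb).mp hv)
  refine ⟨⟨fun v hv ↦ hmaps h ha ha' v hv, fun v _ w _ h' ↦ ?_, fun v hv ↦ ?_⟩,
    fun v hv ↦ ?_⟩
  · rw [eq_mul_inv_of_mul_eq h']
    exact mul_inv_cancel_right w _
  · refine ⟨v * ((z⁻¹ : Kˣ) : KummerGroup ℓ K), hmaps h.inv ha' ha v hv, ?_⟩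
    exact inv_mul_cancel_right v (z : KummerGroup ℓ K)
  · have hv' := hmaps h ha ha' v hv
    have hv1 : v ≠ 1 := ne_one_of_kumTuple_ne_one (M := M) hℓ (hv ▸ ha1)
    have hv1' : v * (z : KummerGroup ℓ K) ≠ 1 :=
      ne_one_of_kumTuple_ne_one (M := M) hℓ (hv' ▸ ha1')
    induction v using QuotientGroup.induction_on with
    | H α =>
      obtain ⟨J, hJ⟩ := exists_isKumIdeal hℓ hζ hv1
      obtain ⟨J', hJ'⟩ := exists_isKumIdeal hℓ hζ (α := α * z) hv1'
      have hα := (kumTuple_eq_iff hℓ ha).mp hv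
      refine ⟨?_, ?_⟩
      · have h1 := congrArg (fun I ↦ (Ideal.absNorm I : ℝ))
          (h.relDisc_mul hℓ hζ hM ha ha' hα hJ hJ')
        simp only [map_mul, map_pow, Nat.cast_mul, Nat.cast_pow] at h1
        rw [kumDisc, kumDisc, if_neg hv1, if_neg hv1', hv, hv',
          div_eq_div_iff (pow_ne_zero _ (absNorm_copIdeals_pos _).ne')
            (pow_ne_zero _ (absNorm_copIdeals_pos _).ne')]
        exact h1
      · refine hJ'.kumSteinitz_eq.trans ?_
        rw [hJ.kumSteinitz_eq]
        exact hκ α J J' hα hJ hJ'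

include hℓ hζ in
theorem exists_fibreTransport_id (hM : IsGoodModulus ℓ ζ M) {a a' : Fin (ℓ - 1) → copIdeals M}
    (ha1 : a ≠ 1) (ha1' : a' ≠ 1) (ha : SqfT a) (ha' : SqfT a')
    (h : ∀ i, rayMk M (a i) = rayMk M (a' i)) :
    ∃ f : KummerGroup ℓ K → KummerGroup ℓ K,
      FibreTransport (Fin (ℓ - 1)) (kumTuple M) (kumDisc M) kumSteinitz f a a' id := by
  obtain ⟨z, hz⟩ := exists_isTwist hM a a' 1 (by
    rw [map_one, one_pow, mul_one, map_prod, map_prod]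
    exact Finset.prod_congr rfl fun i _ ↦ by rw [map_pow, map_pow, h i])
  refine ⟨_, hz.fibreTransport hℓ hζ hM ha ha' ha1 ha1' fun α J J' hα hJ hJ' ↦ ?_⟩
  obtain h2 | hodd := hℓ.eq_two_or_odd'
  · rw [hz.fracClass_two hℓ hζ hM ha ha' hα hJ hJ' h2 (c := 1) (fun _ ↦ rfl), map_one, mul_one,
      id]
  · obtain ⟨m, hm⟩ := hodd
    have h1 := hz.fracClass_odd hℓ hζ hM ha ha' hα hJ hJ' (m := m) (by omega)
    have h2 : copClass M (∏ i, a i) = copClass M (∏ i, a' i) := by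
      rw [map_prod, map_prod]
      exact Finset.prod_congr rfl fun i _ ↦ copClass_eq_of_rayMk_eq (h i)
    rw [h2] at h1
    exact mul_right_cancel h1

theorem exists_prod_pow_eq_one {G : Type*} [CommGroup G] {n : ℕ} (hn : 2 ≤ n) (t : G) :
    ∃ γ : Fin n → G, ∏ i, γ i ^ ((i : ℕ) + 1) = 1 ∧ ∏ i, γ i = t := by
  obtain ⟨k, rfl⟩ := Nat.exists_eq_add_of_le' hn
  refine ⟨Fin.cons (t ^ 2) (Fin.cons t⁻¹ 1), ?_, ?_⟩
  · simp [Fin.prod_univ_succ]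
  · simp [Fin.prod_univ_succ, pow_two]

include hℓ hζ in
theorem exists_fibreTransport_shift (hM : IsGoodModulus ℓ ζ M) {m : ℕ}
    (hm : m = if ℓ = 2 then 1 else (ℓ - 1) / 2) (C : ClassGroup (𝓞 K)) :
    ∃ γ : Fin (ℓ - 1) → RayClass M, ∀ a a' : Fin (ℓ - 1) → copIdeals M, a ≠ 1 → a' ≠ 1 →
      SqfT a → SqfT a' → (∀ i, rayMk M (a' i) = rayMk M (a i) * γ i) →
      ∃ f : KummerGroup ℓ K → KummerGroup ℓ K,
        FibreTransport (Fin (ℓ - 1)) (kumTuple M) (kumDisc M) kumSteinitz f a a' (· * C ^ m) := by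
  obtain ⟨t, rfl⟩ := copClass_surjective hM.ne_bot C
  obtain h2 | hodd := hℓ.eq_two_or_odd'
  · refine ⟨fun _ ↦ rayMk M t ^ 2, fun a a' ha1 ha1' ha ha' h ↦ ?_⟩
    rw [if_pos h2] at hm
    obtain ⟨z, hz⟩ := exists_isTwist hM a a' t (by
      subst h2
      rw [map_prod, map_prod]
      simp [h])
    refine ⟨_, hz.fibreTransport hℓ hζ hM ha ha' ha1 ha1' fun α J J' hα hJ hJ' ↦ ?_⟩
    rw [hz.fracClass_two hℓ hζ hM ha ha' hα hJ hJ' h2 (fun _ ↦ rfl), hm, pow_one]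
  · have hℓ2 : ℓ ≠ 2 := by
      rintro rfl
      exact absurd hodd (by decide)
    have h3 : 2 ≤ ℓ - 1 := by
      have := hℓ.two_le
      omega
    rw [if_neg hℓ2] at hm
    obtain ⟨γ, hγ1, hγt⟩ := exists_prod_pow_eq_one h3 (rayMk M t)
    refine ⟨γ, fun a a' ha1 ha1' ha ha' h ↦ ?_⟩
    obtain ⟨z, hz⟩ := exists_isTwist hM a a' 1 (by
      rw [map_one, one_pow, mul_one, map_prod, map_prod]
      simp only [map_pow, h, mul_pow, Finset.prod_mul_distrib, hγ1, mul_one])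
    refine ⟨_, hz.fibreTransport hℓ hζ hM ha ha' ha1 ha1' fun α J J' hα hJ hJ' ↦ ?_⟩
    have h1 := hz.fracClass_odd hℓ hζ hM ha ha' hα hJ hJ' (m := m) (by
      obtain ⟨r, hr⟩ := hodd
      omega)
    have h2 : copClass M (∏ i, a' i) = copClass M (∏ i, a i) * copClass M t := by
      rw [← map_mul]
      refine copClass_eq_of_rayMk_eq ?_
      rw [map_mul, map_prod, map_prod, ← hγt, ← Finset.prod_mul_distrib]
      exact Finset.prod_congr rfl fun i _ ↦ h i
    rw [h2, mul_pow, ← mul_assoc, mul_right_comm] at h1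
    exact mul_right_cancel h1

theorem exists_fractionalIdeal_count (e : HeightOneSpectrum (𝓞 K) → ℤ)
    (he : {p | e p ≠ 0}.Finite) :
    ∃ I : FractionalIdeal (𝓞 K)⁰ K, I ≠ 0 ∧ ∀ p, count K p I = e p := by
  refine ⟨(Finsupp.mk he.toFinset e fun _ ↦ he.mem_toFinset).prod (HeightOneSpectrum.asIdeal · ^ ·),
    ?_, fun p ↦ count_finsuppProd K p _⟩
  exact Finset.prod_ne_zero_iff.mpr fun v _ ↦ zpow_ne_zero _ (coeIdeal_ne_zero.mpr v.ne_bot)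

theorem IsKumIdeal.fracClass_mem {α : Kˣ} {J : FractionalIdeal (𝓞 K)⁰ K} (hℓ : ℓ.Prime)
    (hζ : IsPrimitiveRoot ζ ℓ) (hJ : IsKumIdeal ζ α ℓ J) {m : ℕ}
    (hm : m = if ℓ = 2 then 1 else (ℓ - 1) / 2) : fracClass J ∈ powClassGroup K m := by
  by_cases h2 : ℓ = 2
  · rw [hm, if_pos h2]
    exact ⟨fracClass J, pow_one _⟩
  · rw [if_neg h2] at hm
    have hm2 : (ℓ : ℤ) - 1 = 2 * m := by
      obtain ⟨r, hr⟩ := hℓ.odd_of_ne_two h2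
      omega
    have hdvd : ∀ p, (m : ℤ) ∣ FractionalIdeal.count K p J := by
      intro p
      obtain ⟨c, hc⟩ := exists_kummerData (p := p) hℓ hζ α.ne_zero
      have h1 := hc.dvd
      rw [← hJ.count p c hc, hm2] at h1
      exact (mul_dvd_mul_iff_left two_ne_zero).mp h1
    have hfin := FractionalIdeal.finite_factors J
    rw [Filter.eventually_cofinite] at hfin
    obtain ⟨I, hI, hIc⟩ := exists_fractionalIdeal_count (fun p ↦ FractionalIdeal.count K p J / m)
      (hfin.subset fun p hp hp0 ↦ hp (by rw [hp0, Int.zero_ediv]))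
    refine ⟨fracClass I, ?_⟩
    rw [powMonoidHom_apply, ← fracClass_pow hI]
    congr 1
    refine fractionalIdeal_ext_count (pow_ne_zero _ hI) hJ.ne_zero fun p ↦ ?_
    rw [count_pow, hIc, Int.mul_ediv_cancel' (hdvd p)]

include hℓ hζ in
theorem kumSteinitz_mem {v : KummerGroup ℓ K} (hv : v ≠ 1) {m : ℕ}
    (hm : m = if ℓ = 2 then 1 else (ℓ - 1) / 2) : kumSteinitz v ∈ powClassGroup K m := by
  induction v using QuotientGroup.induction_on with
  | H α =>
    obtain ⟨J, hJ⟩ := exists_isKumIdeal hℓ hζ hv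
    rw [hJ.kumSteinitz_eq]
    exact hJ.fracClass_mem hℓ hζ hm

end Transport

section Finiteness

open IsDedekindDomain FractionalIdeal

variable {K : Type*} [Field K] [NumberField K] {ℓ : ℕ}

theorem exists_spanSingleton_of_fracClass_eq_one {I : FractionalIdeal (𝓞 K)⁰ K} (hI : I ≠ 0)
    (h : fracClass I = 1) : ∃ x : K, x ≠ 0 ∧ I = spanSingleton (𝓞 K)⁰ x := by
  rw [fracClass_of_ne_zero hI, ClassGroup.mk_eq_one_iff] at h
  have : ((I : FractionalIdeal (𝓞 K)⁰ K) : Submodule (𝓞 K) K).IsPrincipal := h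
  have h2 := eq_spanSingleton_of_principal I
  refine ⟨_, fun h0 ↦ hI ?_, h2⟩
  rw [h2, h0, spanSingleton_zero]

theorem exists_eq_mul_of_fracClass_eq {I J : FractionalIdeal (𝓞 K)⁰ K} (hI : I ≠ 0) (hJ : J ≠ 0)
    (h : fracClass I = fracClass J) :
    ∃ x : K, x ≠ 0 ∧ I = spanSingleton (𝓞 K)⁰ x * J := by
  have h1 : fracClass (I * J⁻¹) = 1 := by
    rw [← mul_left_inj (fracClass J), ← fracClass_mul (mul_ne_zero hI (inv_ne_zero hJ)) hJ,
      inv_mul_cancel_right₀ hJ, one_mul, h]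
  obtain ⟨x, hx, h2⟩ := exists_spanSingleton_of_fracClass_eq_one
    (mul_ne_zero hI (inv_ne_zero hJ)) h1
  exact ⟨x, hx, by rw [← h2, inv_mul_cancel_right₀ hJ]⟩

variable (K ℓ) in
/-- The natural map from the units of the ring of integers to the Kummer group. -/
def unitsToKummer : (𝓞 K)ˣ →* KummerGroup ℓ K :=
  (QuotientGroup.mk' _).comp (Units.map (algebraMap (𝓞 K) K).toMonoidHom)

theorem finite_range_unitsToKummer (hℓ : ℓ ≠ 0) :
    (Set.range (unitsToKummer K ℓ)).Finite := by
  have h2 : Group.FG (𝓞 K)ˣ := Group.fg_iff_monoid_fg.mpr inferInstance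
  have h1 : Group.FG (unitsToKummer K ℓ).range :=
    Group.fg_of_surjective (unitsToKummer K ℓ).rangeRestrict_surjective
  have h3 : IsMulTorsion (unitsToKummer K ℓ).range := by
    rintro ⟨v, hv⟩
    refine isOfFinOrder_iff_pow_eq_one.mpr ⟨ℓ, Nat.pos_of_ne_zero hℓ, Subtype.ext ?_⟩
    exact KummerGroup.pow_eq_one v
  have h4 : Finite (unitsToKummer K ℓ).range := CommGroup.finite_of_fg_isMulTorsion _ h3
  exact h4

theorem exists_kumRoot (v : KummerGroup ℓ K) :
    ∃ I : FractionalIdeal (𝓞 K)⁰ K, I ≠ 0 ∧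
      ∀ p, count K p I = ordP p ((Quotient.out v : Kˣ) : K) / ℓ :=
  exists_fractionalIdeal_count _
    ((finite_ordP_ne_zero (Quotient.out v : Kˣ).ne_zero).subset fun p hp hp0 ↦
      hp (by rw [hp0, Int.zero_ediv]))

theorem exists_unitsToKummer_mul (hℓ : ℓ ≠ 0) {v w : KummerGroup ℓ K}
    (h : ∀ p : HeightOneSpectrum (𝓞 K), (ℓ : ℤ) ∣
      ordP p ((Quotient.out v : Kˣ) : K) - ordP p ((Quotient.out w : Kˣ) : K))
    (hc : fracClass (exists_kumRoot v).choose = fracClass (exists_kumRoot w).choose) :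
    ∃ u, unitsToKummer K ℓ u * w = v := by
  obtain ⟨hI, hIc⟩ := (exists_kumRoot v).choose_spec
  obtain ⟨hJ, hJc⟩ := (exists_kumRoot w).choose_spec
  set I := (exists_kumRoot v).choose
  set J := (exists_kumRoot w).choose
  set α : Kˣ := Quotient.out v with hα
  set β : Kˣ := Quotient.out w with hβ
  obtain ⟨t, ht, hIJ⟩ := exists_eq_mul_of_fracClass_eq hI hJ hc
  have hz : (β : K) * t ^ ℓ ≠ 0 := mul_ne_zero β.ne_zero (pow_ne_zero _ ht)
  have h1 : spanSingleton (𝓞 K)⁰ ((β : K) * t ^ ℓ) = spanSingleton (𝓞 K)⁰ (α : K) := by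
    refine fractionalIdeal_ext_count (spanSingleton_ne_zero_iff.mpr hz)
      (spanSingleton_ne_zero_iff.mpr α.ne_zero) fun p ↦ ?_
    rw [count_spanSingleton p hz, count_spanSingleton p α.ne_zero,
      ordP_mul p β.ne_zero (pow_ne_zero _ ht), ordP_pow]
    have h2 := congrArg (count K p) hIJ
    rw [count_mul K p (spanSingleton_ne_zero_iff.mpr ht) hJ, count_spanSingleton p ht, hIc, hJc]
      at h2
    obtain ⟨r, hr⟩ := h p
    have h3 : ordP p (α : K) = ordP p (β : K) + ℓ * r := by linarith
    rw [h3, Int.add_mul_ediv_left _ _ (by exact_mod_cast hℓ)] at h2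
    have h4 : r = ordP p t := by linarith
    rw [h3, h4]
  obtain ⟨u, hu⟩ := spanSingleton_eq_spanSingleton.mp h1
  refine ⟨u, ?_⟩
  rw [← QuotientGroup.out_eq' w, ← QuotientGroup.out_eq' v]
  refine KummerGroup.mk_eq_iff.mpr ⟨Units.mk0 t ht, Units.ext ?_⟩
  rw [← hα, ← hβ, ← hu]
  simp only [Units.val_mul, Units.val_pow_eq_pow_val, Units.val_mk0, Units.coe_map]
  rw [Units.smul_def, Algebra.smul_def, mul_assoc]
  rfl

theorem finite_kumTuple_fibre (hℓ : ℓ.Prime) {M : Ideal (𝓞 K)} (hM : M ≠ ⊥)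
    (a : Fin (ℓ - 1) → copIdeals M) : {v : KummerGroup ℓ K | kumTuple M v = a}.Finite := by
  have hS : {p : HeightOneSpectrum (𝓞 K) | ¬ IsCoprime p.asIdeal M}.Finite := by
    refine (Ideal.finite_factors hM).subset fun p hp ↦ ?_
    rw [Set.mem_ofPred_eq, isCoprime_iff_of_prime, not_not] at hp
    exact Ideal.dvd_iff_le.mpr hp
  have : Finite {p : HeightOneSpectrum (𝓞 K) // ¬ IsCoprime p.asIdeal M} := hS
  have : NeZero ℓ := ⟨hℓ.ne_zero⟩
  let f : KummerGroup ℓ K → ({p : HeightOneSpectrum (𝓞 K) // ¬ IsCoprime p.asIdeal M} → ZMod ℓ) ×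
      ClassGroup (𝓞 K) := fun v ↦
    (fun p ↦ (ordP p.1 ((Quotient.out v : Kˣ) : K) : ZMod ℓ),
      fracClass (exists_kumRoot v).choose)
  refine Set.Finite.of_finite_fibers f (Set.toFinite _) fun y _ ↦ ?_
  obtain h | ⟨w, hw, hwy⟩ :=
    ({v : KummerGroup ℓ K | kumTuple M v = a} ∩ f ⁻¹' {y}).eq_empty_or_nonempty
  · rw [h]
    exact Set.finite_empty
  refine ((finite_range_unitsToKummer (K := K) hℓ.ne_zero).image (· * w)).subset ?_
  rintro v ⟨hv, hvy⟩
  have hvw : f v = f w := hvy.trans hwy.symm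
  have hdvd : ∀ p : HeightOneSpectrum (𝓞 K), (ℓ : ℤ) ∣
      ordP p ((Quotient.out v : Kˣ) : K) - ordP p ((Quotient.out w : Kˣ) : K) := by
    intro p
    by_cases hp : IsCoprime p.asIdeal M
    · have h1 := kumMatch_kumTuple (M := M) hℓ (Quotient.out v : Kˣ) p hp
      have h2 := kumMatch_kumTuple (M := M) hℓ (Quotient.out w : Kˣ) p hp
      rw [QuotientGroup.out_eq'] at h1 h2
      rw [hv] at h1
      rw [hw] at h2
      have := dvd_sub h1 h2
      rwa [sub_sub_sub_cancel_right] at this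
    · have h1 := congrFun (congrArg Prod.fst hvw) ⟨p, hp⟩
      exact (ZMod.intCast_eq_intCast_iff_dvd_sub _ _ ℓ).mp h1.symm
  obtain ⟨u, hu⟩ := exists_unitsToKummer_mul hℓ.ne_zero hdvd (congrArg Prod.snd hvw)
  exact ⟨_, ⟨u, rfl⟩, hu⟩

end Finiteness

section Modulus

open IsDedekindDomain

variable {K : Type*} [Field K] [NumberField K] {ℓ : ℕ}

theorem exists_isGoodModulus (hℓ : ℓ.Prime) {ζ : K} (hζ : IsPrimitiveRoot ζ ℓ) (n : ℕ) :
    ∃ M : Ideal (𝓞 K), IsGoodModulus ℓ ζ M ∧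
      ∀ p : Ideal (𝓞 K), p.IsPrime → Ideal.absNorm p ≤ n → ¬ IsCoprime p M := by
  set r : 𝓞 K := ((n.factorial * ℓ : ℕ) : 𝓞 K) with hr
  have hr0 : r ≠ 0 := Nat.cast_ne_zero.mpr (mul_ne_zero n.factorial_ne_zero hℓ.ne_zero)
  have hle : ∀ p : Ideal (𝓞 K), p.IsPrime → (r ∈ p ↔ Ideal.span {r ^ (ℓ + 1)} ≤ p) := by
    intro p hp
    rw [Ideal.span_singleton_le_iff_mem, hp.pow_mem_iff_mem _ ℓ.succ_pos]
  have hcop : ∀ p : Ideal (𝓞 K), p.IsPrime → r ∈ p →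
      ¬ IsCoprime p (Ideal.span {r ^ (ℓ + 1)}) := by
    intro p hp hrp hc
    rw [Ideal.isCoprime_iff_sup_eq, sup_eq_left.mpr ((hle p hp).mp hrp)] at hc
    exact hp.ne_top hc
  have hord : ∀ p : HeightOneSpectrum (𝓞 K), ordP p (r : K) = ordP p (n.factorial : K) +
      (ℓ - 1) * ordP p (1 - ζ) := by
    intro p
    rw [← ordP_prime_eq p hℓ hζ, ← ordP_mul p (Nat.cast_ne_zero.mpr n.factorial_ne_zero)
      (Nat.cast_ne_zero.mpr hℓ.ne_zero), hr]
    push_cast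
    rfl
  have hℓ2 : (2 : ℤ) ≤ ℓ := by exact_mod_cast hℓ.two_le
  refine ⟨Ideal.span {r ^ (ℓ + 1)}, ⟨?_, fun p hp x hx ↦ ?_, fun p hp ↦ ?_⟩,
    fun p hp hpn ↦ ?_⟩
  · rw [Ne, Ideal.span_singleton_eq_bot]
    exact pow_ne_zero _ hr0
  · rw [isCoprime_iff_of_prime, not_not, ← hle _ p.isPrime] at hp
    have h1 : 1 ≤ ordP p (r : K) := by
      have := (mem_pow_iff_le_ordP (K := K) p hr0 1).mp (by rwa [pow_one])
      exact_mod_cast this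
    obtain ⟨y, rfl⟩ := Ideal.mem_span_singleton.mp hx
    obtain rfl | hy := eq_or_ne y 0
    · simp
    rw [mem_ordPGe]
    right
    have hy' : (y : K) ≠ 0 := by simpa using hy
    have hr' : (r : K) ≠ 0 := by simpa using hr0
    rw [RingOfIntegers.coe_eq_algebraMap, map_mul, map_pow, ordP_mul p (pow_ne_zero _ hr') hy', ordP_pow]
    have h2 := ordP_algebraMap_nonneg (K := K) p y
    have h3 := ordP_natCast_nonneg (K := K) p n.factorial
    have h4 := ordP_one_sub_zeta_nonneg p hℓ hζ
    have h5 : ordP p (1 - ζ) ≤ ordP p (r : K) := by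
      rw [hord]
      nlinarith
    push_cast
    nlinarith
  · rw [isCoprime_iff_of_prime, ← hle _ p.isPrime] at hp
    have h1 := (ordP_algebraMap_eq_zero_iff (K := K) p hr0).mpr hp
    have h3 := ordP_natCast_nonneg (K := K) p n.factorial
    have h4 := ordP_one_sub_zeta_nonneg p hℓ hζ
    have h2 := (hord p).symm.trans h1
    nlinarith
  · obtain rfl | hp0 := eq_or_ne p ⊥
    · intro h
      rw [Ideal.isCoprime_iff_sup_eq, bot_sup_eq, Ideal.span_singleton_eq_top,
        isUnit_pow_succ_iff, ← Ideal.span_singleton_eq_top, ← Ideal.absNorm_eq_one_iff, hr,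
        Ideal.absNorm_span_natCast, Nat.pow_eq_one] at h
      obtain h | h := h
      · exact hℓ.ne_one (Nat.eq_one_of_mul_eq_one_left h)
      · exact Module.finrank_pos.ne' h
    · have h1 : Ideal.absNorm p ∣ n.factorial :=
        Nat.dvd_factorial (Nat.pos_of_ne_zero fun h ↦ hp0 (Ideal.absNorm_eq_zero_iff.mp h)) hpn
      obtain ⟨c, hc⟩ := h1.mul_right ℓ
      refine hcop p hp ?_
      rw [hr, hc, Nat.cast_mul]
      exact Ideal.mul_mem_right _ _ (Ideal.absNorm_mem p)

end Modulus

section Final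

open Topology

theorem tendsto_div_sum {ι : Type*} [Fintype ι] {F N : ι → ℝ → ℝ} {B : ℝ}
    (hF : ∀ c, Tendsto (F c) atTop atTop)
    (hFF : ∀ c c', Tendsto (fun X ↦ F c X / F c' X) atTop (𝓝 1))
    (hN : ∀ c, ∀ᶠ X in atTop, F c X ≤ N c X ∧ N c X ≤ F c X + B) (c : ι) :
    Tendsto (fun X ↦ N c X / ∑ c', N c' X) atTop (𝓝 (1 / Fintype.card ι)) := by
  have h1 : ∀ c, Tendsto (fun X ↦ N c X / F c X) atTop (𝓝 1) := by
    intro c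
    have h2 : Tendsto (fun X ↦ 1 + B / F c X) atTop (𝓝 1) := by
      simpa using (Tendsto.const_div_atTop (hF c) B).const_add 1
    refine tendsto_of_tendsto_of_tendsto_of_le_of_le' tendsto_const_nhds h2 ?_ ?_
    · filter_upwards [(hF c).eventually_gt_atTop 0, hN c] with X hX hX'
      rw [one_le_div hX]
      exact hX'.1
    · filter_upwards [(hF c).eventually_gt_atTop 0, hN c] with X hX hX'
      rw [div_le_iff₀ hX, add_mul, one_mul, div_mul_cancel₀ _ hX.ne']
      exact hX'.2
  have h2 : ∀ c', Tendsto (fun X ↦ N c' X / N c X) atTop (𝓝 1) := by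
    intro c'
    have h3 := ((h1 c').mul (hFF c' c)).div (h1 c) one_ne_zero
    rw [mul_one, div_one] at h3
    refine h3.congr' ?_
    filter_upwards [(hF c).eventually_gt_atTop 0, (hF c').eventually_gt_atTop 0] with X hX hX'
    rw [Pi.div_apply]
    field_simp
  have h3 := (tendsto_finsetSum Finset.univ fun c' _ ↦ h2 c').inv₀ (by
    simp [(Fintype.card_pos_iff.mpr ⟨c⟩).ne'])
  simp only [Finset.sum_const, Finset.card_univ, nsmul_eq_mul, mul_one] at h3
  rw [one_div]
  refine h3.congr fun X ↦ ?_
  rw [← Finset.sum_div, inv_div]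

variable {K : Type*} [Field K] [NumberField K] {ℓ : ℕ}

/-- The number of nontrivial Kummer classes with bounded discriminant and given Steinitz class. -/
def kumCount (ℓ : ℕ) (X : ℝ) (C : ClassGroup (𝓞 K)) : ℕ :=
  Nat.card {v : KummerGroup ℓ K // v ≠ 1 ∧
    (Ideal.absNorm (relDisc K (kummerField (AlgebraicClosure K) v)) : ℝ) ≤ X ∧ kumSteinitz v = C}

variable (hℓ : ℓ.Prime)

include hℓ

theorem kumCount_bounds {M : Ideal (𝓞 K)} (hM : M ≠ ⊥) {X : ℝ} {C : ClassGroup (𝓞 K)}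
    (h : 0 < fibreCount (raySys M hM) (Fin (ℓ - 1)) (kumTuple M) (kumDisc M)
      (kumSteinitz (ℓ := ℓ)) (ℓ - 1) C X) :
    {v : KummerGroup ℓ K | v ≠ 1 ∧
      (Ideal.absNorm (relDisc K (kummerField (AlgebraicClosure K) v)) : ℝ) ≤ X ∧
        kumSteinitz v = C}.Finite ∧
    fibreCount (raySys M hM) (Fin (ℓ - 1)) (kumTuple M) (kumDisc M)
      (kumSteinitz (ℓ := ℓ)) (ℓ - 1) C X ≤ kumCount ℓ X C ∧
    kumCount ℓ X C ≤ fibreCount (raySys M hM) (Fin (ℓ - 1)) (kumTuple M) (kumDisc M)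
      (kumSteinitz (ℓ := ℓ)) (ℓ - 1) C X + {v : KummerGroup ℓ K | kumTuple M v = 1}.ncard := by
  set S := {v : KummerGroup ℓ K | v ≠ 1 ∧
      (Ideal.absNorm (relDisc K (kummerField (AlgebraicClosure K) v)) : ℝ) ≤ X ∧
        kumSteinitz v = C} with hS
  set T := {v : KummerGroup ℓ K | kumTuple M v ≠ 1 ∧ kumDisc M v *
    ((raySys M hM).N (∏ i, kumTuple M v i) : ℝ) ^ (ℓ - 1) ≤ X ∧ kumSteinitz v = C} with hT
  have hT' : T.Finite := (Nat.card_pos_iff.mp h).2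
  have h0 := finite_kumTuple_fibre hℓ hM (1 : Fin (ℓ - 1) → copIdeals M)
  have hiff : ∀ v : KummerGroup ℓ K, v ≠ 1 → (kumDisc M v *
      ((raySys M hM).N (∏ i, kumTuple M v i) : ℝ) ^ (ℓ - 1) ≤ X ↔
      (Ideal.absNorm (relDisc K (kummerField (AlgebraicClosure K) v)) : ℝ) ≤ X) := by
    intro v hv
    rw [raySys_N, kumDisc_mul hv]
  have hTS : T ⊆ S := by
    rintro v ⟨h1, h2, h3⟩
    have hv := ne_one_of_kumTuple_ne_one (M := M) hℓ h1
    exact ⟨hv, (hiff v hv).mp h2, h3⟩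
  have hST : S ⊆ T ∪ {v : KummerGroup ℓ K | kumTuple M v = 1} := by
    rintro v ⟨h1, h2, h3⟩
    by_cases hv : kumTuple M v = 1
    · exact Or.inr hv
    · exact Or.inl ⟨hv, (hiff v h1).mpr h2, h3⟩
  have hSf : S.Finite := (hT'.union h0).subset hST
  refine ⟨hSf, Set.ncard_le_ncard hTS hSf, ?_⟩
  exact (Set.ncard_le_ncard hST (hT'.union h0)).trans (Set.ncard_union_le _ _)

variable {ζ : K} (hζ : IsPrimitiveRoot ζ ℓ)

include hζ

theorem kumCount_eq (X : ℝ) (C : ClassGroup (𝓞 K)) :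
    kumCount ℓ X C = Nat.card {L : IntermediateField K (AlgebraicClosure K) //
      IsCyclicExt ℓ K L ∧ (Ideal.absNorm (relDisc K L) : ℝ) ≤ X ∧ IsSteinitzClass K L C} *
        (ℓ - 1) := by
  rw [← card_kummerGroup_eq hℓ hζ fun L ↦
    (Ideal.absNorm (relDisc K L) : ℝ) ≤ X ∧ IsSteinitzClass K L C]
  refine Nat.card_congr (Equiv.subtypeEquivRight fun v ↦ and_congr_right fun hv ↦ ?_)
  rw [isSteinitzClass_kummerField_iff hℓ hζ hv]

theorem card_sum_eq {m : ℕ} (hm : m = if ℓ = 2 then 1 else (ℓ - 1) / 2) {X : ℝ}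
    (hfin : ∀ C : powClassGroup K m, {v : KummerGroup ℓ K | v ≠ 1 ∧
      (Ideal.absNorm (relDisc K (kummerField (AlgebraicClosure K) v)) : ℝ) ≤ X ∧
        kumSteinitz v = C}.Finite) [Fintype (powClassGroup K m)] :
    Nat.card {L : IntermediateField K (AlgebraicClosure K) //
      IsCyclicExt ℓ K L ∧ (Ideal.absNorm (relDisc K L) : ℝ) ≤ X} * (ℓ - 1) =
        ∑ C : powClassGroup K m, kumCount ℓ X (C : ClassGroup (𝓞 K)) := by
  rw [← card_kummerGroup_eq hℓ hζ fun L ↦ (Ideal.absNorm (relDisc K L) : ℝ) ≤ X]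
  have (C : powClassGroup K m) : Finite {v : KummerGroup ℓ K // v ≠ 1 ∧
      (Ideal.absNorm (relDisc K (kummerField (AlgebraicClosure K) v)) : ℝ) ≤ X ∧
        kumSteinitz v = C} := hfin C
  unfold kumCount
  rw [← Nat.card_sigma]
  refine Nat.card_congr ⟨fun v ↦ ⟨⟨kumSteinitz v.1, kumSteinitz_mem hℓ hζ v.2.1 hm⟩, v.1, v.2.1,
    v.2.2, rfl⟩, fun v ↦ ⟨v.2.1, v.2.2.1, v.2.2.2.1⟩, fun v ↦ rfl, ?_⟩
  rintro ⟨⟨C, hC⟩, v, hv1, hv2, h⟩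
  obtain rfl : kumSteinitz v = C := h
  rfl

theorem exists_kumTuple_eq {M : Ideal (𝓞 K)} (hM : IsGoodModulus ℓ ζ M)
    {a : Fin (ℓ - 1) → copIdeals M} (ha : SqfT a) (h : ∀ i, rayMk M (a i) = 1) :
    ∃ v : KummerGroup ℓ K, kumTuple M v = a := by
  obtain ⟨z, hz⟩ := exists_isTwist hM 1 a 1 (by
    simp [h])
  refine ⟨((1 * z : Kˣ) : KummerGroup ℓ K), (kumTuple_eq_iff hℓ ha).mpr ?_⟩
  have h1 := hz.match (α := 1) kumMatch_one
  simpa using h1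

theorem tendsto_kumCount_div {m : ℕ} (hm : m = if ℓ = 2 then 1 else (ℓ - 1) / 2)
    {𝒞 : ClassGroup (𝓞 K)} (h𝒞 : 𝒞 ∈ powClassGroup K m) :
    Tendsto (fun X : ℝ ↦ (kumCount ℓ X 𝒞 : ℝ) /
      ((Nat.card {L : IntermediateField K (AlgebraicClosure K) //
        IsCyclicExt ℓ K L ∧ (Ideal.absNorm (relDisc K L) : ℝ) ≤ X} * (ℓ - 1) : ℕ) : ℝ))
      atTop (𝓝 (1 / (Nat.card (powClassGroup K m) : ℝ))) := by
  classical
  have hk : ℓ - 1 ≠ 0 := Nat.sub_ne_zero_of_lt hℓ.one_lt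
  have : Nonempty (Fin (ℓ - 1)) := ⟨⟨0, Nat.pos_of_ne_zero hk⟩⟩
  have hA : (0 : ℝ) < (Fintype.card (Fin (ℓ - 1)) : ℝ) ^ 2 + 16 * Fintype.card (Fin (ℓ - 1)) := by
    have : (0 : ℝ) < Fintype.card (Fin (ℓ - 1)) := Nat.cast_pos.mpr Fintype.card_pos
    positivity
  set A := (Fintype.card (Fin (ℓ - 1)) : ℝ) ^ 2 + 16 * Fintype.card (Fin (ℓ - 1)) with hAdef
  obtain ⟨n, hn⟩ := exists_raySys_σ_le (K := K) (δ := 1 / 2 / A) (by positivity)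
  obtain ⟨M, hM, hMn⟩ := exists_isGoodModulus hℓ hζ n
  have hσ : A * (raySys M hM.ne_bot).σ ≤ 1 / 2 := by
    rw [← le_div_iff₀' hA]
    exact hn M hM.ne_bot hMn
  have := finite_rayClass K M hM.ne_bot
  set s := raySys M hM.ne_bot with hs
  have hsq : ∀ a : Fin (ℓ - 1) → copIdeals M, s.Sqf (∏ i, a i) → SqfT a := fun a ↦
    (raySys_sqf_prod_iff hM.ne_bot a).mp
  choose t ht using fun g ↦ s.exists_tuple (Fin (ℓ - 1)) hσ g
  have hτ : ∀ v : KummerGroup ℓ K, s.Sqf (∏ i, kumTuple M v i) := fun v ↦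
    (raySys_sqf_prod_iff hM.ne_bot _).mpr (sqfT_kumTuple hℓ v)
  have hd : ∀ v : KummerGroup ℓ K, 0 < kumDisc M v := kumDisc_pos hℓ hζ
  have h1 : ∀ a a' : Fin (ℓ - 1) → copIdeals M, a ≠ 1 → a' ≠ 1 → s.Sqf (∏ i, a i) →
      s.Sqf (∏ i, a' i) → (∀ i, s.cl (a i) = s.cl (a' i)) →
      ∃ f : KummerGroup ℓ K → KummerGroup ℓ K,
        FibreTransport (Fin (ℓ - 1)) (kumTuple M) (kumDisc M) kumSteinitz f a a' id :=
    fun a a' ha ha' hq hq' h ↦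
      exists_fibreTransport_id hℓ hζ hM ha ha' (hsq a hq) (hsq a' hq') h
  have hfin : ∀ a : Fin (ℓ - 1) → copIdeals M, a ≠ 1 →
      {v : KummerGroup ℓ K | kumTuple M v = a}.Finite :=
    fun a _ ↦ finite_kumTuple_fibre hℓ hM.ne_bot a
  obtain ⟨v₀, hv₀⟩ := exists_kumTuple_eq hℓ hζ hM (hsq _ (ht 1).2.2) (ht 1).2.1
  obtain ⟨C₀, hC₀⟩ : ∃ C : powClassGroup K m, (C : ClassGroup (𝓞 K)) = kumSteinitz v₀ :=
    ⟨⟨_, kumSteinitz_mem hℓ hζ (ne_one_of_kumTuple_ne_one (M := M) hℓ (hv₀ ▸ (ht 1).1)) hm⟩, rfl⟩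
  have hκ : ∀ D : ClassGroup (𝓞 K), Function.Injective (· * D ^ m) := fun D ↦
    mul_left_injective (D ^ m)
  have hpow : ∀ C C' : powClassGroup K m, ∃ D : ClassGroup (𝓞 K),
      (C' : ClassGroup (𝓞 K)) = C * D ^ m := by
    intro C C'
    obtain ⟨D, hD⟩ := (C⁻¹ * C').2
    refine ⟨D, ?_⟩
    rw [powMonoidHom_apply] at hD
    rw [hD, Subgroup.coe_mul, Subgroup.coe_inv, mul_inv_cancel_left]
  choose γ hγ using exists_fibreTransport_shift (K := K) hℓ hζ hM hm
  have h2 : ∀ (D : ClassGroup (𝓞 K)) (a a' : Fin (ℓ - 1) → copIdeals M), a ≠ 1 → a' ≠ 1 →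
      s.Sqf (∏ i, a i) → s.Sqf (∏ i, a' i) → (∀ i, s.cl (a' i) = s.cl (a i) * γ D i) →
      ∃ f : KummerGroup ℓ K → KummerGroup ℓ K,
        FibreTransport (Fin (ℓ - 1)) (kumTuple M) (kumDisc M) kumSteinitz f a a' (· * D ^ m) :=
    fun D a a' ha ha' hq hq' h ↦ hγ D a a' ha ha' (hsq a hq) (hsq a' hq') h
  have hne₀ : (repPoints s (Fin (ℓ - 1)) (kumTuple M) (kumSteinitz (ℓ := ℓ)) t C₀).Nonempty := by
    refine ⟨v₀, ?_, hC₀.symm⟩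
    rw [hv₀]
    congr 1
    exact (funext (ht 1).2.1).symm
  have hne : ∀ C : powClassGroup K m,
      (repPoints s (Fin (ℓ - 1)) (kumTuple M) (kumSteinitz (ℓ := ℓ)) t C).Nonempty := by
    intro C
    obtain ⟨D, hD⟩ := hpow C₀ C
    obtain ⟨e, -⟩ := exists_equiv_repPoints s t ht (γ D) (hκ D) (h2 D) (C₀ : ClassGroup (𝓞 K))
    obtain ⟨ω, hω⟩ := hne₀
    rw [hD]
    exact ⟨_, (e ⟨ω, hω⟩).2⟩
  have hF : ∀ C : powClassGroup K m, Tendsto (fun X ↦ (fibreCount s (Fin (ℓ - 1)) (kumTuple M)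
      (kumDisc M) (kumSteinitz (ℓ := ℓ)) (ℓ - 1) C X : ℝ)) atTop atTop := fun C ↦
    exists_tendsto_fibreCount_atTop s hk hτ hd h1 t ht hσ hfin _ (hne C)
  have hFF : ∀ C' C : powClassGroup K m, Tendsto (fun X ↦ (fibreCount s (Fin (ℓ - 1))
      (kumTuple M) (kumDisc M) (kumSteinitz (ℓ := ℓ)) (ℓ - 1) C' X : ℝ) / fibreCount s
      (Fin (ℓ - 1)) (kumTuple M) (kumDisc M) (kumSteinitz (ℓ := ℓ)) (ℓ - 1) C X) atTop (𝓝 1) := by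
    intro C' C
    obtain ⟨D, hD⟩ := hpow C C'
    rw [hD]
    exact tendsto_fibreCount_div s hk hτ hd h1 t ht hσ hfin (γ D) (hκ D) (h2 D) _ (hne C)
  have hev : ∀ C : powClassGroup K m, ∀ᶠ X in atTop, 0 < fibreCount s (Fin (ℓ - 1)) (kumTuple M)
      (kumDisc M) (kumSteinitz (ℓ := ℓ)) (ℓ - 1) C X := fun C ↦
    ((hF C).eventually_gt_atTop 0).mono fun X hX ↦ by exact_mod_cast hX
  have : Fintype (powClassGroup K m) := Fintype.ofFinite _
  have h3 := tendsto_div_sum (N := fun (C : powClassGroup K m) X ↦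
      (kumCount ℓ X (C : ClassGroup (𝓞 K)) : ℝ)) hF hFF
    (B := ({v : KummerGroup ℓ K | kumTuple M v = 1}.ncard : ℝ)) (fun C ↦ by
      filter_upwards [hev C] with X hX
      obtain ⟨-, h4, h5⟩ := kumCount_bounds hℓ hM.ne_bot hX
      exact ⟨by exact_mod_cast h4, by exact_mod_cast h5⟩) ⟨𝒞, h𝒞⟩
  rw [Nat.card_eq_fintype_card]
  refine h3.congr' ?_
  filter_upwards [eventually_all.mpr hev] with X hX
  rw [card_sum_eq hℓ hζ hm fun C ↦ (kumCount_bounds hℓ hM.ne_bot (hX C)).1, Nat.cast_sum]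

end Final

/-- **Equidistribution of Steinitz classes of `ℤ/ℓℤ`-extensions.**
Let `ℓ` be a prime and `K` a number field containing the `ℓ`-th roots of unity.  For any
class `𝒞` in the subgroup `Cl(K)^((ℓ-1)/2)` of `(ℓ-1)/2`-th powers of the class group
(which is all of `Cl(K)` when `ℓ = 2`), the proportion of degree-`ℓ` cyclic extensions
`L/K` (counted up to `K`-isomorphism inside a fixed algebraic closure, ordered by the
absolute norm of the relative discriminant) whose Steinitz class is `𝒞` tends to
`1 / #Cl(K)^((ℓ-1)/2)`. -/
theorem steinitz_equidistribution_kummer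
    (ℓ : ℕ) (hℓ : ℓ.Prime) (K : Type*) [Field K] [NumberField K]
    (hζ : ∃ ζ : K, IsPrimitiveRoot ζ ℓ)
    (m : ℕ) (hm : m = if ℓ = 2 then 1 else (ℓ - 1) / 2)
    (𝒞 : ClassGroup (𝓞 K)) (h𝒞 : 𝒞 ∈ powClassGroup K m) :
    Tendsto (fun X : ℝ =>
      (Nat.card {L : IntermediateField K (AlgebraicClosure K) //
          IsCyclicExt ℓ K L ∧ (Ideal.absNorm (relDisc K L) : ℝ) ≤ X ∧
          IsSteinitzClass K L 𝒞} : ℝ) /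
      (Nat.card {L : IntermediateField K (AlgebraicClosure K) //
          IsCyclicExt ℓ K L ∧ (Ideal.absNorm (relDisc K L) : ℝ) ≤ X} : ℝ))
      atTop (nhds (1 / (Nat.card (powClassGroup K m) : ℝ))) := by
  obtain ⟨ζ, hζ⟩ := hζ
  refine (tendsto_kumCount_div hℓ hζ hm h𝒞).congr fun X ↦ ?_
  have hk : ((ℓ - 1 : ℕ) : ℝ) ≠ 0 := Nat.cast_ne_zero.mpr (Nat.sub_ne_zero_of_lt hℓ.one_lt)
  rw [kumCount_eq hℓ hζ, Nat.cast_mul, Nat.cast_mul, mul_div_mul_right _ _ hk]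

end
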